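/- Every planar graph without 4-cycles, without 6-cycles, and without 8-cycles is (I,F)-colorable. -/

import Mathlib

open SimpleGraph

namespace IFPaper

variable {V : Type}

/-- An `(I,F)`-coloring of a graph, encoded as a Boolean coloring where
`true` means color `I` and `false` means color `F`:  the `I`-colored vertices
form an independent set and the `F`-colored vertices induce a forest
(no cycle has all of its vertices colored `F`). -/
def IFColoring (G : SimpleGraph V) (c : V → Bool) : Prop :=
  (∀ ⦃u v : V⦄, G.Adj u v → c u = true → c v = false) ∧
  (∀ (v : V) (w : G.Walk v v), w.IsCycle → ¬ (∀ x ∈ w.support, c x = false))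

/-- A graph is `(I,F)`-colorable if it admits an `(I,F)`-coloring. -/
def IFColorable (G : SimpleGraph V) : Prop := ∃ c : V → Bool, IFColoring G c

/-- An `(I,F)`-coloring of the subgraph of `G` induced on the set `S`. -/
def IFColoringOn (G : SimpleGraph V) (S : Set V) (c : V → Bool) : Prop :=
  (∀ ⦃u v : V⦄, u ∈ S → v ∈ S → G.Adj u v → c u = true → c v = false) ∧
  (∀ (v : V) (w : G.Walk v v), w.IsCycle → (∀ x ∈ w.support, x ∈ S) →
    ¬ (∀ x ∈ w.support, c x = false))

/-- A splitting `F`-path of (the vertex set `Q` of) a cycle: a path all of whose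
vertices get color `F`, whose two endpoints lie on `Q`, and all of whose other
vertices (at least one) do not lie on `Q`. -/
def IsSplittingFPath (G : SimpleGraph V) (Q : Set V) (c : V → Bool)
    {a b : V} (p : G.Walk a b) : Prop :=
  p.IsPath ∧ (∀ x ∈ p.support, c x = false) ∧ a ∈ Q ∧ b ∈ Q ∧ 2 ≤ p.length ∧
  ∀ x ∈ p.support, x ≠ a → x ≠ b → x ∉ Q

/-- A super IF-coloring of `(G, Q)`: an `(I,F)`-coloring of `G` with no
splitting `F`-path of `Q`. -/
def SuperIFColoring (G : SimpleGraph V) (Q : Set V) (c : V → Bool) : Prop :=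
  IFColoring G c ∧ ∀ (a b : V) (p : G.Walk a b), ¬ IsSplittingFPath G Q c p

/-- `d* ≥ 3`: any two distinct cycles of length at most `5` are at distance at
least `3`. -/
def Cycles5Apart (G : SimpleGraph V) : Prop :=
  ∀ ⦃u v : V⦄ (c1 : G.Walk u u) (c2 : G.Walk v v),
    c1.IsCycle → c2.IsCycle → c1.length ≤ 5 → c2.length ≤ 5 →
    {e : Sym2 V | e ∈ c1.edges} ≠ {e : Sym2 V | e ∈ c2.edges} →
    ∀ x ∈ c1.support, ∀ y ∈ c2.support, 3 ≤ G.dist x y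

/-- A claw of the cycle `C`: a vertex not on `C` with three neighbors on `C`. -/
def HasClaw (G : SimpleGraph V) {v : V} (C : G.Walk v v) : Prop :=
  ∃ x : V, x ∉ C.support ∧ ∃ a b c : V, a ∈ C.support ∧ b ∈ C.support ∧ c ∈ C.support ∧
    a ≠ b ∧ a ≠ c ∧ b ≠ c ∧ G.Adj x a ∧ G.Adj x b ∧ G.Adj x c

/-- A triclaw of the cycle `C`: a triangle `x y z` disjoint from `C`, joined by
three edges to three distinct vertices of `C`. -/
def HasTriclaw (G : SimpleGraph V) {v : V} (C : G.Walk v v) : Prop :=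
  ∃ x y z : V, x ∉ C.support ∧ y ∉ C.support ∧ z ∉ C.support ∧
    G.Adj x y ∧ G.Adj y z ∧ G.Adj x z ∧
    ∃ a b c : V, a ∈ C.support ∧ b ∈ C.support ∧ c ∈ C.support ∧
      a ≠ b ∧ a ≠ c ∧ b ≠ c ∧ G.Adj x a ∧ G.Adj y b ∧ G.Adj z c

/-- A bad cycle is a `9`-cycle having a claw or a triclaw. -/
def IsBadCycle (G : SimpleGraph V) {v : V} (C : G.Walk v v) : Prop :=
  C.IsCycle ∧ C.length = 9 ∧ (HasClaw G C ∨ HasTriclaw G C)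

/-- A good cycle is a cycle that is not bad. -/
def IsGoodCycle (G : SimpleGraph V) {v : V} (C : G.Walk v v) : Prop :=
  C.IsCycle ∧ ¬ IsBadCycle G C

/-- The interior of an arc parametrized by `[0,1]`. -/
def ArcInterior (γ : ℝ → ℝ × ℝ) : Set (ℝ × ℝ) := γ '' Set.Ioo 0 1

/-- The image of an arc parametrized by `[0,1]`. -/
def ArcImage (γ : ℝ → ℝ × ℝ) : Set (ℝ × ℝ) := γ '' Set.Icc 0 1

/-- A plane embedding of a simple graph: an injective placement of the vertices
in the plane together with, for every edge, a simple arc joining the images of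
its endpoints, such that arcs meet only at common endpoints and no arc passes
through a vertex. -/
structure IsPlaneEmbedding (G : SimpleGraph V) (vtx : V → ℝ × ℝ)
    (arc : V → V → ℝ → ℝ × ℝ) : Prop where
  vtx_inj : Function.Injective vtx
  arc_cont : ∀ ⦃u v : V⦄, G.Adj u v → ContinuousOn (arc u v) (Set.Icc 0 1)
  arc_injOn : ∀ ⦃u v : V⦄, G.Adj u v → Set.InjOn (arc u v) (Set.Icc 0 1)
  arc_start : ∀ ⦃u v : V⦄, G.Adj u v → arc u v 0 = vtx u
  arc_end : ∀ ⦃u v : V⦄, G.Adj u v → arc u v 1 = vtx v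
  arc_symm : ∀ ⦃u v : V⦄, G.Adj u v → ∀ t : ℝ, arc v u t = arc u v (1 - t)
  arc_avoids_vtx : ∀ ⦃u v : V⦄, G.Adj u v → ∀ w : V, vtx w ∉ ArcInterior (arc u v)
  arc_disjoint : ∀ ⦃u v u' v' : V⦄, G.Adj u v → G.Adj u' v' → s(u, v) ≠ s(u', v') →
    ArcInterior (arc u v) ∩ ArcInterior (arc u' v') = ∅

/-- A graph is planar if it admits a plane embedding. -/
def IsPlanarGraph (G : SimpleGraph V) : Prop :=
  ∃ (vtx : V → ℝ × ℝ) (arc : V → V → ℝ → ℝ × ℝ), IsPlaneEmbedding G vtx arc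

/-- The subset of the plane covered by a plane drawing of `G`. -/
def Drawing (G : SimpleGraph V) (vtx : V → ℝ × ℝ) (arc : V → V → ℝ → ℝ × ℝ) :
    Set (ℝ × ℝ) :=
  Set.range vtx ∪ ⋃ (u : V) (v : V) (_ : G.Adj u v), ArcImage (arc u v)

/-- The subset of the plane covered by the drawing of a walk `w`. -/
def WalkDrawing (G : SimpleGraph V) (arc : V → V → ℝ → ℝ × ℝ)
    {a b : V} (w : G.Walk a b) : Set (ℝ × ℝ) :=
  ⋃ (u : V) (v : V) (_ : G.Adj u v) (_ : s(u, v) ∈ w.edges), ArcImage (arc u v)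

/-- A face of a plane drawing: a connected component of the complement of the
drawing. -/
def IsFace (G : SimpleGraph V) (vtx : V → ℝ × ℝ) (arc : V → V → ℝ → ℝ × ℝ)
    (f : Set (ℝ × ℝ)) : Prop :=
  ∃ p : ℝ × ℝ, p ∉ Drawing G vtx arc ∧
    f = connectedComponentIn (Drawing G vtx arc)ᶜ p

/-- The outer face: the unbounded face. -/
def IsOuterFace (G : SimpleGraph V) (vtx : V → ℝ × ℝ) (arc : V → V → ℝ → ℝ × ℝ)
    (f : Set (ℝ × ℝ)) : Prop :=
  IsFace G vtx arc f ∧ ¬ Bornology.IsBounded f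

/-- A vertex is on a face if its image lies on the boundary of the face. -/
def VertexOnFace (vtx : V → ℝ × ℝ) (f : Set (ℝ × ℝ)) (v : V) : Prop :=
  vtx v ∈ frontier f

/-- The face `f` is bounded by the (closed) walk `w`. -/
def FaceBoundedBy (G : SimpleGraph V) (vtx : V → ℝ × ℝ) (arc : V → V → ℝ → ℝ × ℝ)
    (f : Set (ℝ × ℝ)) {a : V} (w : G.Walk a a) : Prop :=
  IsFace G vtx arc f ∧ frontier f = WalkDrawing G arc w

/-- A vertex lies (strictly) inside the cycle `C` of the plane graph. -/
def VertexInsideCycle (G : SimpleGraph V) (vtx : V → ℝ × ℝ)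
    (arc : V → V → ℝ → ℝ × ℝ) {a : V} (C : G.Walk a a) (v : V) : Prop :=
  vtx v ∉ WalkDrawing G arc C ∧
  Bornology.IsBounded (connectedComponentIn (WalkDrawing G arc C)ᶜ (vtx v))

/-- A vertex lies (strictly) outside the cycle `C` of the plane graph. -/
def VertexOutsideCycle (G : SimpleGraph V) (vtx : V → ℝ × ℝ)
    (arc : V → V → ℝ → ℝ × ℝ) {a : V} (C : G.Walk a a) (v : V) : Prop :=
  vtx v ∉ WalkDrawing G arc C ∧
  ¬ Bornology.IsBounded (connectedComponentIn (WalkDrawing G arc C)ᶜ (vtx v))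

/-- A cycle of a plane graph is separating if its interior and its exterior
each contain a vertex of the graph. -/
def IsSeparatingCycle (G : SimpleGraph V) (vtx : V → ℝ × ℝ)
    (arc : V → V → ℝ → ℝ × ℝ) {a : V} (C : G.Walk a a) : Prop :=
  (∃ v : V, VertexInsideCycle G vtx arc C v) ∧
  (∃ v : V, VertexOutsideCycle G vtx arc C v)

/-- The cycle `C` has no chord in `G`. -/
def Chordless (G : SimpleGraph V) {a : V} (C : G.Walk a a) : Prop :=
  ∀ ⦃u v : V⦄, u ∈ C.support → v ∈ C.support → G.Adj u v → s(u, v) ∈ C.edges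

/-- The precoloring `c0` of the cycle `C0` extends to a super IF-coloring of
`(G, C0)`. -/
def ExtendsToSuper (G : SimpleGraph V) {v0 : V} (C0 : G.Walk v0 v0)
    (c0 : V → Bool) : Prop :=
  ∃ c : V → Bool, SuperIFColoring G {x | x ∈ C0.support} c ∧
    ∀ x ∈ C0.support, c x = c0 x

/-- A counterexample to the extension theorem: a planar graph with `d* ≥ 3`, a
good cycle `C0` of length at most `9`, and an `(I,F)`-coloring of `G[V(C0)]`
which does not extend to a super IF-coloring of `(G, C0)`. -/
def IsCounterexample (G : SimpleGraph V) {v0 : V} (C0 : G.Walk v0 v0)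
    (c0 : V → Bool) : Prop :=
  IsPlanarGraph G ∧ Cycles5Apart G ∧ IsGoodCycle G C0 ∧ C0.length ≤ 9 ∧
  IFColoringOn G {x | x ∈ C0.support} c0 ∧ ¬ ExtendsToSuper G C0 c0

/-- The quantity `|V(G)| + |E(G)|`. -/
noncomputable def graphSize {V : Type} [Fintype V] (G : SimpleGraph V) : ℕ :=
  Fintype.card V + G.edgeSet.ncard

/-- A minimal counterexample to the extension theorem: one minimizing
`|V(G)| + |E(G)|` among all counterexamples. -/
def IsMinimalCounterexample [Fintype V] (G : SimpleGraph V) {v0 : V}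
    (C0 : G.Walk v0 v0) (c0 : V → Bool) : Prop :=
  IsCounterexample G C0 c0 ∧
  ∀ (n : ℕ) (G' : SimpleGraph (Fin n)) (v0' : Fin n) (C0' : G'.Walk v0' v0')
    (c0' : Fin n → Bool), IsCounterexample G' C0' c0' →
      graphSize G ≤ graphSize G'

/-- A chord of the cycle `C` splitting it into two cycles of lengths `l1` and
`l2`: an edge between two non-consecutive vertices of `C` together with two
cycles of lengths `l1` and `l2` which both use the chord, use otherwise only
edges of `C`, and together partition the edges of `C`. -/
def HasChordSplit (G : SimpleGraph V) {a : V} (C : G.Walk a a) (l1 l2 : ℕ) : Prop :=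
  ∃ u v : V, u ∈ C.support ∧ v ∈ C.support ∧ G.Adj u v ∧ s(u, v) ∉ C.edges ∧
    ∃ (c1 c2 : G.Walk u u), c1.IsCycle ∧ c2.IsCycle ∧
      c1.length = l1 ∧ c2.length = l2 ∧
      s(u, v) ∈ c1.edges ∧ s(u, v) ∈ c2.edges ∧
      (∀ e ∈ c1.edges, e ≠ s(u, v) → e ∈ C.edges) ∧
      (∀ e ∈ c2.edges, e ≠ s(u, v) → e ∈ C.edges) ∧
      (∀ e ∈ C.edges, (e ∈ c1.edges ↔ e ∉ c2.edges))

/-- A `(l1, l2, l3)`-claw of the cycle `C`: a claw which together with `C`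
forms three cycles of lengths `l1`, `l2` and `l3`. -/
def HasClawSplit (G : SimpleGraph V) {a : V} (C : G.Walk a a) (l1 l2 l3 : ℕ) : Prop :=
  ∃ x : V, x ∉ C.support ∧ ∃ v1 v2 v3 : V,
    v1 ∈ C.support ∧ v2 ∈ C.support ∧ v3 ∈ C.support ∧
    v1 ≠ v2 ∧ v1 ≠ v3 ∧ v2 ≠ v3 ∧ G.Adj x v1 ∧ G.Adj x v2 ∧ G.Adj x v3 ∧
    ∃ (w1 w2 w3 : G.Walk x x), w1.IsCycle ∧ w2.IsCycle ∧ w3.IsCycle ∧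
      w1.length = l1 ∧ w2.length = l2 ∧ w3.length = l3 ∧
      (∀ e ∈ w1.edges, e ∈ C.edges ∨ e = s(x, v1) ∨ e = s(x, v2) ∨ e = s(x, v3)) ∧
      (∀ e ∈ w2.edges, e ∈ C.edges ∨ e = s(x, v1) ∨ e = s(x, v2) ∨ e = s(x, v3)) ∧
      (∀ e ∈ w3.edges, e ∈ C.edges ∨ e = s(x, v1) ∨ e = s(x, v2) ∨ e = s(x, v3)) ∧
      (∀ e ∈ C.edges, (e ∈ w1.edges ∧ e ∉ w2.edges ∧ e ∉ w3.edges) ∨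
        (e ∉ w1.edges ∧ e ∈ w2.edges ∧ e ∉ w3.edges) ∨
        (e ∉ w1.edges ∧ e ∉ w2.edges ∧ e ∈ w3.edges))

/-- A special `9`-cycle: a `9`-cycle having a `(3,8)`-chord or a
`(5,5,5)`-claw. -/
def IsSpecial9Cycle (G : SimpleGraph V) {a : V} (C : G.Walk a a) : Prop :=
  C.IsCycle ∧ C.length = 9 ∧ (HasChordSplit G C 3 8 ∨ HasClawSplit G C 5 5 5)

/-- Two cycles are normally adjacent if they share exactly one edge and
exactly two vertices. -/
def NormallyAdjacent (G : SimpleGraph V) {a b : V}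
    (c1 : G.Walk a a) (c2 : G.Walk b b) : Prop :=
  (∃ e : Sym2 V, {e' : Sym2 V | e' ∈ c1.edges} ∩ {e' : Sym2 V | e' ∈ c2.edges} = {e}) ∧
  (∃ x y : V, x ≠ y ∧ {z : V | z ∈ c1.support} ∩ {z : V | z ∈ c2.support} = {x, y})

/-- A `3`-fold cover `(H, L)` of `G`. -/
def IsDPCover (G : SimpleGraph V) {W : Type} (H : SimpleGraph W)
    (L : V → Finset W) : Prop :=
  (∀ v : V, (L v).card = 3) ∧
  (∀ ⦃u v : V⦄, u ≠ v → Disjoint (L u) (L v)) ∧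
  (∀ v : V, ∀ a ∈ L v, ∀ b ∈ L v, ¬ H.Adj a b) ∧
  (∀ ⦃a b : W⦄, H.Adj a b → ∃ u v : V, G.Adj u v ∧ a ∈ L u ∧ b ∈ L v) ∧
  (∀ ⦃u v : V⦄, u ≠ v → ∀ a ∈ L u, ∀ b ∈ L v, ∀ b' ∈ L v,
    H.Adj a b → H.Adj a b' → b = b')

/-- `G` is DP-`3`-colorable: for every `3`-fold cover `(H, L)` of `G` there is
an independent transversal picking one vertex from each fiber. -/
def DP3Colorable (G : SimpleGraph V) : Prop :=
  ∀ (W : Type) (H : SimpleGraph W) (L : V → Finset W), IsDPCover G H L →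
    ∃ f : V → W, (∀ v : V, f v ∈ L v) ∧ ∀ u v : V, ¬ H.Adj (f u) (f v)

section
open scoped Classical

/-- `L` is a combinatorial dual of `G`: `L a b` and `L b a` are the two faces at the edge `ab`, and
the even edge sets of `G` are exactly the coboundaries of face labellings modulo two. -/
structure IsDual {V : Type} [Fintype V] (G : SimpleGraph V) {F : Type} (L : V → V → F) : Prop where
  exists_side : ∀ D : V → V → ZMod 2, (∀ a b, D a b = D b a) → (∀ a b, ¬ G.Adj a b → D a b = 0) →
    (∀ a, ∑ b, D a b = 0) → ∃ s : F → ZMod 2, ∀ a b, G.Adj a b → D a b = s (L a b) + s (L b a)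
  even_bdry : ∀ (s : F → ZMod 2) (a : V),
    ∑ b, (if G.Adj a b then s (L a b) + s (L b a) else 0) = 0

/-- A finite graph that has a combinatorial dual. -/
def HasDual {V : Type} [Fintype V] (G : SimpleGraph V) : Prop :=
  ∃ (F : Type) (L : V → V → F), IsDual G L

lemma HasDual.mono {V : Type} [Fintype V] {G H : SimpleGraph V} (hle : H ≤ G) (hG : HasDual G) :
    HasDual H := by
  obtain ⟨F, L, hL⟩ := hG
  let r : F → F → Prop := fun f g => ∃ a b, G.Adj a b ∧ ¬ H.Adj a b ∧ f = L a b ∧ g = L b a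
  refine ⟨Quot r, fun a b => Quot.mk r (L a b), ?_, ?_⟩
  · intro D hs h0 he
    obtain ⟨s, hs'⟩ := hL.exists_side D hs (fun a b hab => h0 a b fun h => hab (hle h)) he
    refine ⟨Quot.lift s ?_, fun a b hab => hs' a b (hle hab)⟩
    rintro _ _ ⟨a, b, hab, hn, rfl, rfl⟩
    have := hs' a b hab
    rw [h0 a b hn] at this
    exact CharTwo.add_eq_zero.1 this.symm
  · intro s a
    refine (Finset.sum_congr rfl fun b _ => ?_).trans
      (hL.even_bdry (fun f => s (Quot.mk r f)) a)
    by_cases h : H.Adj a b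
    · rw [if_pos h, if_pos (hle h)]
    · rw [if_neg h]
      split_ifs with hG
      · have : Quot.mk r (L a b) = Quot.mk r (L b a) := Quot.sound ⟨a, b, hG, h, rfl, rfl⟩
        rw [this, CharTwo.add_self_eq_zero]
      · rfl

/-- The boundary of the edge set of a walk is the sum of its end points. -/
lemma exists_join_of_reachable {W : Type} [Fintype W] {H : SimpleGraph W} {a b : W}
    (h : H.Reachable a b) : ∃ J : W → W → ZMod 2, (∀ x y, J x y = J y x) ∧
      (∀ x y, ¬ H.Adj x y → J x y = 0) ∧
      ∀ x, ∑ y, J x y = (if x = a then 1 else 0) + (if x = b then 1 else 0) := by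
  obtain ⟨p⟩ := h
  induction p with
  | nil =>
    refine ⟨0, fun _ _ => rfl, fun _ _ _ => rfl, fun x => ?_⟩
    simp [CharTwo.add_self_eq_zero]
  | @cons a c b hac p ih =>
    obtain ⟨J, h1, h2, h3⟩ := ih
    refine ⟨fun x y => J x y + ((if x = a ∧ y = c then 1 else 0) + (if x = c ∧ y = a then 1 else 0)),
      fun x y => ?_, fun x y hxy => ?_, fun x => ?_⟩
    · beta_reduce
      rw [h1 x y, add_comm (ite (x = a ∧ y = c) _ _)]
      congr 2 <;> simp only [and_comm]
    · have e1 : ¬ (x = a ∧ y = c) := by rintro ⟨rfl, rfl⟩; exact hxy hac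
      have e2 : ¬ (x = c ∧ y = a) := by rintro ⟨rfl, rfl⟩; exact hxy hac.symm
      simp [h2 x y hxy, e1, e2]
    · rw [Finset.sum_add_distrib, Finset.sum_add_distrib, h3]
      have e1 : ∀ (p q : W), ∑ y, (if x = p ∧ y = q then (1 : ZMod 2) else 0) = if x = p then 1 else 0 := by
        intro p q
        by_cases hx : x = p <;> simp [hx]
      rw [e1, e1]
      have := CharTwo.add_self_eq_zero (if x = c then (1 : ZMod 2) else 0)
      linear_combination this

/-- An edge set with prescribed boundary inside connected fibres. -/
lemma exists_join {W ι : Type} [Fintype W] {H : SimpleGraph W} (f : W → Option ι)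
    (hconn : ∀ a b v, f a = some v → f b = some v → H.Reachable a b) (β : W → ZMod 2)
    (hnone : ∀ a, f a = none → β a = 0) (hsum : ∀ v, ∑ a, (if f a = some v then β a else 0) = 0) :
    ∃ J : W → W → ZMod 2, (∀ x y, J x y = J y x) ∧ (∀ x y, ¬ H.Adj x y → J x y = 0) ∧
      ∀ x, ∑ y, J x y = β x := by
  have hroot : ∃ r : Option ι → Option W, ∀ a v, f a = some v → ∃ b, r (some v) = some b ∧ f b = some v := by
    refine ⟨fun o => if h : ∃ b, f b = o then some h.choose else none, fun a v ha => ?_⟩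
    have h : ∃ b, f b = some v := ⟨a, ha⟩
    exact ⟨h.choose, by simp only [dif_pos h], h.choose_spec⟩
  obtain ⟨r, hr⟩ := hroot
  have hJ : ∀ a : W, ∃ J : W → W → ZMod 2, (∀ x y, J x y = J y x) ∧
      (∀ x y, ¬ H.Adj x y → J x y = 0) ∧
      ∀ x, β a * ∑ y, J x y = β a * ((if x = a then 1 else 0) + (if some x = r (f a) then 1 else 0)) := by
    intro a
    rcases hfa : f a with _ | v
    · exact ⟨0, fun _ _ => rfl, fun _ _ _ => rfl, fun x => by simp [hnone a hfa]⟩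
    · obtain ⟨b, hb, hfb⟩ := hr a v hfa
      obtain ⟨J, h1, h2, h3⟩ := exists_join_of_reachable (hconn a b v hfa hfb)
      exact ⟨J, h1, h2, fun x => by simp [h3, hb]⟩
  choose J h1 h2 h3 using hJ
  refine ⟨fun x y => ∑ a, β a * J a x y, fun x y => by simp only [h1 _ x y], fun x y hxy => ?_, fun x => ?_⟩
  · exact Finset.sum_eq_zero fun a _ => by rw [h2 a x y hxy, mul_zero]
  · rw [Finset.sum_comm]
    simp only [← Finset.mul_sum, h3, mul_add, Finset.sum_add_distrib]
    have e1 : ∑ a, β a * (if x = a then (1 : ZMod 2) else 0) = β x := by simp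
    rw [e1, add_eq_left]
    rcases hx : f x with _ | v
    · refine Finset.sum_eq_zero fun a _ => ?_
      rcases hfa : f a with _ | w
      · simp [hnone a hfa]
      · obtain ⟨b, hb, hfb⟩ := hr a w hfa
        rw [if_neg, mul_zero]
        rw [hb]; intro h; rw [Option.some_inj] at h; subst h; simp [hx] at hfb
    · obtain ⟨b, hb, hfb⟩ := hr x v hx
      by_cases hxb : b = x
      · refine (Finset.sum_congr rfl fun a _ => ?_).trans (hsum v)
        rcases hfa : f a with _ | w
        · simp [hnone a hfa]
        · obtain ⟨b', hb', hfb'⟩ := hr a w hfa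
          by_cases hw : w = v
          · subst hw; simp [hb, hxb]
          · have : some x ≠ r (some w) := by
              rw [hb']; intro h; rw [Option.some_inj] at h; subst h; simp_all
            simp [this, hw]
      · refine Finset.sum_eq_zero fun a _ => ?_
        rcases hfa : f a with _ | w
        · simp [hnone a hfa]
        · obtain ⟨b', hb', hfb'⟩ := hr a w hfa
          have : some x ≠ r (some w) := by
            rw [hb']; intro h; rw [Option.some_inj] at h; subst h
            have : w = v := by simp_all
            subst this; simp_all
          simp [this]

/-- The subgraph of the edges with both ends in the same fibre of `f`. -/
def fibreGraph {W ι : Type} (H : SimpleGraph W) (f : W → ι) : SimpleGraph W where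
  Adj x y := H.Adj x y ∧ f x = f y
  symm := ⟨fun _ _ h => ⟨h.1.symm, h.2.symm⟩⟩
  loopless := ⟨fun _ h => H.loopless.irrefl _ h.1⟩

/-- Minors of a graph with a dual have a dual: `f` sends the vertices of `W` to the branch sets. -/
lemma HasDual.minor {V W : Type} [Fintype V] [Fintype W] {G : SimpleGraph V} {H : SimpleGraph W}
    (hH : HasDual H) (f : W → Option V)
    (hconn : ∀ a b v, f a = some v → f b = some v → (fibreGraph H f).Reachable a b)
    (hex : ∀ u v, G.Adj u v → ∃ a b, f a = some u ∧ f b = some v ∧ H.Adj a b) : HasDual G := by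
  rcases isEmpty_or_nonempty W with hW | hW
  · have hG : ∀ u v, ¬ G.Adj u v := fun u v h => hW.elim (hex u v h).choose
    exact ⟨Unit, fun _ _ => (), fun D _ h0 _ => ⟨0, fun a b h => (hG a b h).elim⟩, fun s a => by
      simp [hG]⟩
  have hx : ∃ x : V → V → W, ∀ u v, G.Adj u v → f (x u v) = some u ∧ f (x v u) = some v ∧
      H.Adj (x u v) (x v u) := by
    have : ∃ y : V → V → W × W, ∀ u v, G.Adj u v →
      f (y u v).1 = some u ∧ f (y u v).2 = some v ∧ H.Adj (y u v).1 (y u v).2 := by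
      choose! a b h using hex
      exact ⟨fun u v => (a u v, b u v), h⟩
    obtain ⟨y, hy⟩ := this
    refine ⟨fun u v => if s(u, v).out.1 = u then (y u v).1 else (y v u).2, fun u v h => ?_⟩
    have hne := h.ne
    have ho : s(v, u) = s(u, v) := Sym2.eq_swap
    beta_reduce
    rw [ho]
    have : s(u, v).out.1 = u ∨ s(u, v).out.1 = v := by
      have := Sym2.out_fst_mem s(u, v)
      simpa using this
    obtain h1 | h1 := this
    · obtain ⟨h3, h4, h5⟩ := hy u v h
      simp [h1, hne, h3, h4, h5]
    · obtain ⟨h3, h4, h5⟩ := hy v u h.symm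
      simp [h1, hne.symm, h3, h4, h5.symm]
  obtain ⟨x, hx⟩ := hx
  -- keep only the edges inside the fibres and one edge for each edge of `G`
  let c : W → W → Prop := fun a b => ∃ u v, G.Adj u v ∧ x u v = a ∧ x v u = b
  have hcH : ∀ a b, c a b → H.Adj a b := by
    rintro a b ⟨u, v, h, rfl, rfl⟩
    exact (hx u v h).2.2
  have hcs : ∀ a b, c a b → c b a := fun a b ⟨u, v, h, h1, h2⟩ => ⟨v, u, h.symm, h2, h1⟩
  let H' : SimpleGraph W :=
    { Adj := fun a b => (fibreGraph H f).Adj a b ∨ c a b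
      symm := ⟨fun a b h => h.imp (fun h => h.symm) (hcs a b)⟩
      loopless := ⟨fun a h => h.elim (fun h => h.1.ne rfl) fun h => (hcH a a h).ne rfl⟩ }
  have hle : H' ≤ H := fun a b h => h.elim (fun h => h.1) (hcH a b)
  obtain ⟨F, L, hL⟩ := hH.mono hle
  have hni : ∀ a b, c a b → ¬ (fibreGraph H f).Adj a b := by
    rintro a b ⟨u, v, h, rfl, rfl⟩ he
    have := he.2
    rw [(hx u v h).1, (hx u v h).2.1, Option.some_inj] at this
    exact h.ne this
  have hinj : ∀ u v u' v', G.Adj u v → G.Adj u' v' → x u v = x u' v' → x v u = x v' u' →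
      u = u' ∧ v = v' := by
    intro u v u' v' h h' e1 e2
    have h1 := (hx u v h).1
    have h2 := (hx u v h).2.1
    rw [e1, (hx u' v' h').1, Option.some_inj] at h1
    rw [e2, (hx u' v' h').2.1, Option.some_inj] at h2
    exact ⟨h1.symm, h2.symm⟩
  -- transport of sums over chosen edges at a fibre
  have hsum : ∀ (E : W → W → ZMod 2) (u : V),
      ∑ a, (if f a = some u then ∑ b, (if c a b then E a b else 0) else 0) =
        ∑ v, (if G.Adj u v then E (x u v) (x v u) else 0) := by
    intro E u
    have h1 : ∀ a b, (if f a = some u then (if c a b then E a b else 0) else 0) =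
        ∑ v, (if G.Adj u v ∧ x u v = a ∧ x v u = b then E a b else 0) := by
      intro a b
      split_ifs with h1 h2
      · obtain ⟨u', v, h, rfl, rfl⟩ := h2
        have : u' = u := by rw [(hx u' v h).1, Option.some_inj] at h1; exact h1
        subst this
        rw [Finset.sum_eq_single v, if_pos ⟨h, rfl, rfl⟩]
        · intro w _ hw
          rw [if_neg]
          rintro ⟨h3, h4, h5⟩
          exact hw (hinj _ _ _ _ h3 h h4 h5).2
        · simp
      · rw [Finset.sum_eq_zero]
        intro v _
        rw [if_neg]
        rintro ⟨h3, h4, h5⟩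
        exact h2 ⟨u, v, h3, h4, h5⟩
      · rw [Finset.sum_eq_zero]
        intro v _
        rw [if_neg]
        rintro ⟨h3, rfl, h5⟩
        exact h1 (hx u v h3).1
    have h2 : ∀ a, (if f a = some u then ∑ b, (if c a b then E a b else 0) else 0) =
        ∑ v, ∑ b, (if G.Adj u v ∧ x u v = a ∧ x v u = b then E a b else 0) := by
      intro a
      rw [Finset.sum_comm]
      simp only [← h1]
      split_ifs <;> simp
    simp only [h2]
    rw [Finset.sum_comm]
    refine Finset.sum_congr rfl fun v _ => ?_
    by_cases h : G.Adj u v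
    · simp [h, ite_and]
    · simp [h]
  refine ⟨F, fun u v => L (x u v) (x v u), ?_, ?_⟩
  · intro D hs h0 he
    let E : W → W → ZMod 2 := fun a b =>
      ∑ u, ∑ v, (if G.Adj u v ∧ x u v = a ∧ x v u = b then D u v else 0)
    have hE : ∀ u v, G.Adj u v → E (x u v) (x v u) = D u v := by
      intro u v h
      change (∑ u', ∑ v', _) = _
      rw [Finset.sum_eq_single u, Finset.sum_eq_single v]
      · simp [h]
      · intro v' _ hv'
        rw [if_neg]
        rintro ⟨h1, h2, h3⟩
        exact hv' (hinj _ _ _ _ h1 h h2 h3).2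
      · simp
      · intro u' _ hu'
        refine Finset.sum_eq_zero fun v' _ => ?_
        rw [if_neg]
        rintro ⟨h1, h2, h3⟩
        exact hu' (hinj _ _ _ _ h1 h h2 h3).1
      · simp
    have hE0 : ∀ a b, ¬ c a b → E a b = 0 := by
      intro a b h
      refine Finset.sum_eq_zero fun u _ => Finset.sum_eq_zero fun v _ => ?_
      rw [if_neg]
      rintro ⟨h1, h2, h3⟩
      exact h ⟨u, v, h1, h2, h3⟩
    have hEs : ∀ a b, E a b = E b a := by
      intro a b
      change (∑ u, ∑ v, _) = ∑ u, ∑ v, _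
      rw [Finset.sum_comm]
      refine Finset.sum_congr rfl fun u _ => Finset.sum_congr rfl fun v _ => ?_
      rw [hs u v]
      congr 1
      simp only [eq_iff_iff]
      exact ⟨fun h => ⟨h.1.symm, h.2.2, h.2.1⟩, fun h => ⟨h.1.symm, h.2.2, h.2.1⟩⟩
    have hfE : ∀ a b, E a b = if c a b then E a b else 0 := by
      intro a b; split_ifs with h
      · rfl
      · exact hE0 a b h
    obtain ⟨J, j1, j2, j3⟩ := exists_join f hconn (fun a => ∑ b, E a b) (by
        intro a ha
        refine Finset.sum_eq_zero fun b _ => hE0 a b ?_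
        rintro ⟨u, v, h, rfl, rfl⟩
        rw [(hx u v h).1] at ha; exact Option.some_ne_none _ ha) (by
        intro v
        simp only [fun a => Finset.sum_congr (rfl : (Finset.univ : Finset W) = _) fun b _ => hfE a b]
        rw [hsum]
        refine (Finset.sum_congr rfl fun w _ => ?_).trans (he v)
        split_ifs with h
        · exact hE v w h
        · exact (h0 v w h).symm)
    obtain ⟨s, hs'⟩ := hL.exists_side (fun a b => E a b + J a b)
      (fun a b => by rw [hEs a b, j1 a b])
      (fun a b h => by rw [hE0 a b fun h' => h (Or.inr h'), j2 a b fun h' => h (Or.inl h'), add_zero])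
      (fun a => by rw [Finset.sum_add_distrib, j3, CharTwo.add_self_eq_zero])
    refine ⟨s, fun u v h => ?_⟩
    have hc : c (x u v) (x v u) := ⟨u, v, h, rfl, rfl⟩
    have := hs' (x u v) (x v u) (Or.inr hc)
    rw [hE u v h, j2 _ _ (hni _ _ hc), add_zero] at this
    exact this
  · intro s u
    rw [← hsum (fun a b => s (L a b) + s (L b a)) u]
    have h1 : ∀ a, (∑ b, (if c a b then s (L a b) + s (L b a) else 0)) =
        ∑ b, (if (fibreGraph H f).Adj a b then s (L a b) + s (L b a) else 0) := by
      intro a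
      rw [← CharTwo.add_eq_zero, ← Finset.sum_add_distrib]
      refine (Finset.sum_congr rfl fun b _ => ?_).trans (hL.even_bdry s a)
      have : H'.Adj a b ↔ (fibreGraph H f).Adj a b ∨ c a b := Iff.rfl
      have := hni a b
      by_cases h1 : c a b <;> by_cases h2 : (fibreGraph H f).Adj a b <;> simp_all
    simp only [h1]
    -- internal edges are counted twice
    have h2 : ∀ a, (if f a = some u then
        ∑ b, (if (fibreGraph H f).Adj a b then s (L a b) + s (L b a) else 0) else 0) =
        ∑ b, (if f a = some u ∧ (fibreGraph H f).Adj a b then s (L a b) else 0) +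
        ∑ b, (if f b = some u ∧ (fibreGraph H f).Adj b a then s (L b a) else 0) := by
      intro a
      rw [← Finset.sum_add_distrib]
      have h3 : ∀ b, (fibreGraph H f).Adj b a ↔ (fibreGraph H f).Adj a b :=
        fun b => ⟨fun h => h.symm, fun h => h.symm⟩
      have h4 : ∀ b, (fibreGraph H f).Adj a b → f b = f a := fun b h => h.2.symm
      split_ifs with h
      · refine Finset.sum_congr rfl fun b _ => ?_
        by_cases h5 : (fibreGraph H f).Adj a b
        · simp [h, h3, h5, h4 b h5]
        · simp [h3, h5]
      · refine (Finset.sum_eq_zero fun b _ => ?_).symm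
        by_cases h5 : (fibreGraph H f).Adj a b
        · simp [h, h3, h4 b h5]
        · simp [h3, h5]
    simp only [h2]
    rw [Finset.sum_add_distrib]
    have h3 := Finset.sum_comm (s := (Finset.univ : Finset W)) (t := (Finset.univ : Finset W))
      (f := fun a b => if f a = some u ∧ (fibreGraph H f).Adj a b then s (L a b) else 0)
    rw [h3]
    exact CharTwo.add_self_eq_zero _
end

section
open scoped Classical

/-- Adjacency of lattice points. -/
def LatticeAdj (p q : ℕ × ℕ) : Prop :=
  (p.2 = q.2 ∧ (p.1 + 1 = q.1 ∨ q.1 + 1 = p.1)) ∨ (p.1 = q.1 ∧ (p.2 + 1 = q.2 ∨ q.2 + 1 = p.2))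

lemma LatticeAdj.symm {p q : ℕ × ℕ} (h : LatticeAdj p q) : LatticeAdj q p := by
  unfold LatticeAdj at *; omega

/-- The `N × N` grid. -/
def gridGraph (N : ℕ) : SimpleGraph (Fin N × Fin N) where
  Adj p q := LatticeAdj (p.1, p.2) (q.1, q.2)
  symm := ⟨fun _ _ h => h.symm⟩
  loopless := ⟨fun p h => by unfold LatticeAdj at h; simp only at h; omega⟩

lemma sum_gridGraph (N : ℕ) (g : ℕ × ℕ → ZMod 2) (p : Fin N × Fin N) :
    ∑ q, (if (gridGraph N).Adj p q then g (q.1, q.2) else 0) =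
      (if (p.1 : ℕ) + 1 < N then g (p.1 + 1, p.2) else 0) + (if 1 ≤ (p.1 : ℕ) then g (p.1 - 1, p.2) else 0) +
      ((if (p.2 : ℕ) + 1 < N then g (p.1, p.2 + 1) else 0) + (if 1 ≤ (p.2 : ℕ) then g (p.1, p.2 - 1) else 0)) := by
  obtain ⟨⟨a, ha⟩, ⟨b, hb⟩⟩ := p
  have h1 : ∀ q : Fin N × Fin N, (if (gridGraph N).Adj (⟨a, ha⟩, ⟨b, hb⟩) q then g (q.1, q.2) else 0) =
      (if (q.1 : ℕ) = a + 1 then if (q.2 : ℕ) = b then g (a + 1, b) else 0 else 0) +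
      (if (q.1 : ℕ) + 1 = a then if (q.2 : ℕ) = b then g (a - 1, b) else 0 else 0) +
      ((if (q.1 : ℕ) = a then if (q.2 : ℕ) = b + 1 then g (a, b + 1) else 0 else 0) +
      (if (q.1 : ℕ) = a then if (q.2 : ℕ) + 1 = b then g (a, b - 1) else 0 else 0)) := by
    rintro ⟨⟨c, hc⟩, ⟨d, hd⟩⟩
    have : (gridGraph N).Adj (⟨a, ha⟩, ⟨b, hb⟩) (⟨c, hc⟩, ⟨d, hd⟩) ↔ LatticeAdj (a, b) (c, d) := Iff.rfl
    rw [this]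
    unfold LatticeAdj
    simp only
    by_cases e1 : c = a + 1
    · subst e1
      have e3 : ¬ (a + 1 + 1 = a) := by omega
      by_cases e4 : d = b
      · subst e4; simp [e3]
      · have : ¬ b = d := fun h => e4 h.symm
        simp [e3, e4, this]
    by_cases e2 : c + 1 = a
    · subst e2
      by_cases e4 : d = b
      · subst e4; simp; omega
      · have : ¬ b = d := fun h => e4 h.symm
        simp [e4, this]
    by_cases e3 : c = a
    · subst e3
      by_cases e4 : d = b + 1
      · subst e4; simp; omega
      by_cases e5 : d + 1 = b
      · subst e5; simp; omega
      · rw [if_neg (by omega)]; simp [e4, e5]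
    · rw [if_neg (by omega)]; simp [e1, e2, e3]
  have h2 : ∀ (P Q : ℕ → Prop) [DecidablePred P] [DecidablePred Q] (x y : ℕ) (z : ZMod 2), (∀ i, i < N → (P i ↔ i = x)) → (∀ i, i < N → (Q i ↔ i = y)) →
      ∑ q : Fin N × Fin N, (if P q.1 then if Q q.2 then z else 0 else 0) = if x < N then if y < N then z else 0 else 0 := by
    intro P Q _ _ x y z hP hQ
    have : ∀ q : Fin N × Fin N, (if P q.1 then if Q q.2 then z else 0 else 0) =
      (fun i j : ℕ => (if i = x then if j = y then z else 0 else 0)) q.1 q.2 := by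
      intro q; simp only [hP _ q.1.2, hQ _ q.2.2]
    simp only [this]
    rw [Fintype.sum_prod_type]
    have h4 : ∀ x₁ : Fin N, ∑ y₁ : Fin N, (if (x₁ : ℕ) = x then if (y₁ : ℕ) = y then z else 0 else 0) =
      ∑ j ∈ Finset.range N, if (x₁ : ℕ) = x then if j = y then z else 0 else 0 := fun x₁ =>
        Fin.sum_univ_eq_sum_range (fun j => if (x₁ : ℕ) = x then if j = y then z else 0 else 0) N
    simp only [h4]
    rw [Fin.sum_univ_eq_sum_range (fun i => ∑ j ∈ Finset.range N, if i = x then if j = y then z else 0 else 0) N]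
    by_cases hx : x < N
    · rw [if_pos hx, Finset.sum_eq_single x]
      · simp [Finset.sum_ite_eq']
      · intro i _ hi; simp [hi]
      · simp [hx]
    · rw [if_neg hx]
      refine Finset.sum_eq_zero fun i hi => ?_
      have : i ≠ x := by rintro rfl; exact hx (Finset.mem_range.1 hi)
      simp [this]
  have h0 : ∀ (P Q : ℕ → Prop) [DecidablePred P] [DecidablePred Q] (z : ZMod 2), (∀ i j, ¬ (P i ∧ Q j)) →
      ∑ q : Fin N × Fin N, (if P q.1 then if Q q.2 then z else 0 else 0) = 0 := by
    intro P Q _ _ z h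
    refine Finset.sum_eq_zero fun q _ => ?_
    have := h q.1 q.2
    split_ifs <;> simp_all
  simp only [h1, Finset.sum_add_distrib]
  rw [h2 (fun i => i = a + 1) (fun j => j = b) (a + 1) b _ (by simp) (by simp),
    h2 (fun i => i = a) (fun j => j = b + 1) a (b + 1) _ (by simp) (by simp)]
  have h3 : ∑ q : Fin N × Fin N, (if (q.1 : ℕ) + 1 = a then if (q.2 : ℕ) = b then g (a - 1, b) else 0 else 0) =
      if 1 ≤ a then g (a - 1, b) else 0 := by
    by_cases h : 1 ≤ a
    · rw [h2 (fun i => i + 1 = a) (fun j => j = b) (a - 1) b _ (by omega) (by simp)]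
      simp [h, hb]; omega
    · rw [h0 (fun i => i + 1 = a) (fun j => j = b) _ (by omega), if_neg h]
  have h3' : ∑ q : Fin N × Fin N, (if (q.1 : ℕ) = a then if (q.2 : ℕ) + 1 = b then g (a, b - 1) else 0 else 0) =
      if 1 ≤ b then g (a, b - 1) else 0 := by
    by_cases h : 1 ≤ b
    · rw [h2 (fun i => i = a) (fun j => j + 1 = b) a (b - 1) _ (by simp) (by omega)]
      simp [h, ha]; omega
    · rw [h0 (fun i => i = a) (fun j => j + 1 = b) _ (by omega), if_neg h]
  rw [h3, h3']
  simp [ha, hb]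

/-- The bounded cells of the grid are indexed by their upper right corner; `none` is the outer
face. -/
def gridCell (N i j : ℕ) : Option (ℕ × ℕ) :=
  if 1 ≤ i ∧ i < N ∧ 1 ≤ j ∧ j < N then some (i, j) else none

/-- The face to the left of a lattice edge. -/
def gridFace (N : ℕ) (p q : ℕ × ℕ) : Option (ℕ × ℕ) :=
  if p.2 = q.2 then (if p.1 < q.1 then gridCell N q.1 (p.2 + 1) else gridCell N p.1 p.2)
  else (if p.2 < q.2 then gridCell N p.1 q.2 else gridCell N (p.1 + 1) p.2)

lemma hasDual_gridGraph (N : ℕ) : HasDual (gridGraph N) := by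
  refine ⟨Option (ℕ × ℕ), fun p q => gridFace N (p.1, p.2) (q.1, q.2), ?_, ?_⟩
  · intro D hs h0 he
    let D' : ℕ × ℕ → ℕ × ℕ → ZMod 2 := fun p q => if h : (p.1 < N ∧ p.2 < N) ∧ q.1 < N ∧ q.2 < N then
      D (⟨p.1, h.1.1⟩, ⟨p.2, h.1.2⟩) (⟨q.1, h.2.1⟩, ⟨q.2, h.2.2⟩) else 0
    have hD' : ∀ p q : Fin N × Fin N, D' (p.1, p.2) (q.1, q.2) = D p q := fun p q => by simp [D']
    have hD's : ∀ p q, D' p q = D' q p := by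
      intro p q
      by_cases h : (p.1 < N ∧ p.2 < N) ∧ q.1 < N ∧ q.2 < N
      · simp only [D', dif_pos h, dif_pos h.symm]; exact hs _ _
      · simp only [D', dif_neg h, dif_neg fun h' => h (And.symm h')]
    let h : ℕ → ℕ → ZMod 2 := fun a b => if 1 ≤ a then D' (a - 1, b) (a, b) else 0
    let v : ℕ → ℕ → ZMod 2 := fun a b => if 1 ≤ b then D' (a, b - 1) (a, b) else 0
    have hev : ∀ a b, a < N → b < N → h (a + 1) b + h a b + (v a (b + 1) + v a b) = 0 := by
      intro a b ha hb
      have h1 := he (⟨a, ha⟩, ⟨b, hb⟩)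
      have h2 : ∀ q, D (⟨a, ha⟩, ⟨b, hb⟩) q =
          if (gridGraph N).Adj (⟨a, ha⟩, ⟨b, hb⟩) q then D' (a, b) (q.1, q.2) else 0 := by
        intro q
        split_ifs with h3
        · rw [← hD']
        · exact h0 _ _ h3
      simp only [h2] at h1
      rw [sum_gridGraph N (fun q => D' (a, b) q)] at h1
      rw [← h1]
      have e1 : h (a + 1) b = if a + 1 < N then D' (a, b) (a + 1, b) else 0 := by
        split_ifs with h5
        · simp [h]
        · simp [h, D', h5]
      have e2 : v a (b + 1) = if b + 1 < N then D' (a, b) (a, b + 1) else 0 := by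
        split_ifs with h5
        · simp [v]
        · simp [v, D', h5]
      have e3 : h a b = if 1 ≤ a then D' (a, b) (a - 1, b) else 0 := by
        simp only [h, hD's (a, b)]
      have e4 : v a b = if 1 ≤ b then D' (a, b) (a, b - 1) else 0 := by
        simp only [v, hD's (a, b)]
      rw [e1, e2, e3, e4]
    let S : ℕ → ℕ → ZMod 2 := fun i j => ∑ b ∈ Finset.range j, h i b
    have hS : ∀ i j, S i (j + 1) = S i j + h i j := fun i j => Finset.sum_range_succ _ _
    have hS0 : ∀ i, S i 0 = 0 := fun i => rfl
    have hv : ∀ a b, a < N → b ≤ N → v a b = S a b + S (a + 1) b := by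
      intro a b ha
      induction b with
      | zero => intro _; simp [v, hS0]
      | succ b ih =>
        intro hb
        rw [hS, hS]
        have h1 := ih (by omega)
        have h2 := hev a b ha (by omega)
        rw [h1] at h2
        have h4 : ∀ x : ZMod 2, x + x = 0 := CharTwo.add_self_eq_zero
        linear_combination h2 - h4 (S a b) - h4 (S (a + 1) b) - h4 (h a b) - h4 (h (a + 1) b)
    have hSl : ∀ j, S 0 j = 0 := fun j => by simp [S, h]
    have hSN : ∀ j, S N j = 0 := by
      intro j
      refine Finset.sum_eq_zero fun b _ => ?_
      simp [h, D']
    have hSt : ∀ a, a ≤ N → S a N = 0 := by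
      intro a
      induction a with
      | zero => intro _; exact hSl N
      | succ a ih =>
        intro ha
        have h1 := hv a N (by omega) le_rfl
        rw [ih (by omega), zero_add] at h1
        rw [← h1]; simp [v, D']
    let s : Option (ℕ × ℕ) → ZMod 2 := fun o => match o with | none => 0 | some p => S p.1 p.2
    have hsS : ∀ i j, i ≤ N → j ≤ N → s (gridCell N i j) = S i j := by
      intro i j hi hj
      unfold gridCell
      split_ifs with h1
      · rfl
      · change 0 = S i j
        rcases (by omega : i = 0 ∨ i = N ∨ j = 0 ∨ j = N) with rfl | rfl | rfl | rfl
        · rw [hSl]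
        · rw [hSN]
        · rw [hS0]
        · rw [hSt i hi]
    refine ⟨s, ?_⟩
    have key : ∀ a b c d, LatticeAdj (a, b) (c, d) → a < N → b < N → c < N → d < N →
        (a < c ∨ b < d) → D' (a, b) (c, d) = s (gridFace N (a, b) (c, d)) + s (gridFace N (c, d) (a, b)) := by
      intro a b c d hadj ha hb hc hd hlt
      unfold LatticeAdj at hadj
      simp only at hadj
      rcases (by omega : (c = a + 1 ∧ d = b) ∨ (c = a ∧ d = b + 1)) with ⟨rfl, rfl⟩ | ⟨rfl, rfl⟩
      · simp only [gridFace, if_true, Nat.lt_succ_self, if_neg (show ¬ (a + 1 < a) by omega)]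
        rw [hsS _ _ (by omega) (by omega), hsS _ _ (by omega) (by omega), hS]
        have : D' (a, d) (a + 1, d) = h (a + 1) d := by simp [h]
        rw [this]
        have h4 : ∀ x : ZMod 2, x + x = 0 := CharTwo.add_self_eq_zero
        linear_combination - h4 (S (a + 1) d)
      · simp only [gridFace, if_neg (show ¬ (b = b + 1) by omega), if_neg (show ¬ (b + 1 = b) by omega),
          Nat.lt_succ_self, if_true, if_neg (show ¬ (b + 1 < b) by omega)]
        rw [hsS _ _ (by omega) (by omega), hsS _ _ (by omega) (by omega), ← hv _ _ (by omega) (by omega)]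
        simp [v]
    rintro p q hpq
    rw [← hD']
    have hpq' : LatticeAdj (p.1, p.2) (q.1, q.2) := hpq
    by_cases hlt : p.1.1 < q.1.1 ∨ p.2.1 < q.2.1
    · exact key _ _ _ _ hpq' p.1.2 p.2.2 q.1.2 q.2.2 hlt
    · rw [hD's, add_comm]
      refine key _ _ _ _ hpq'.symm q.1.2 q.2.2 p.1.2 p.2.2 ?_
      unfold LatticeAdj at hpq'
      simp only at hpq'
      omega
  · intro s p
    rw [sum_gridGraph N (fun q => s (gridFace N (p.1, p.2) q) + s (gridFace N q (p.1, p.2)))]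
    obtain ⟨⟨a, ha⟩, ⟨b, hb⟩⟩ := p
    simp only
    let S : ℕ → ℕ → ZMod 2 := fun i j => s (gridCell N i j)
    have h4 : ∀ x : ZMod 2, x + x = 0 := CharTwo.add_self_eq_zero
    have e1 : (if a + 1 < N then s (gridFace N (a, b) (a + 1, b)) + s (gridFace N (a + 1, b) (a, b)) else 0) =
        S (a + 1) (b + 1) + S (a + 1) b := by
      split_ifs with h
      · simp [gridFace, S]
      · simp [S, gridCell, h, h4]
    have e2 : (if 1 ≤ a then s (gridFace N (a, b) (a - 1, b)) + s (gridFace N (a - 1, b) (a, b)) else 0) =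
        S a b + S a (b + 1) := by
      split_ifs with h
      · simp only [gridFace, if_true, if_neg (show ¬ (a < a - 1) by omega), if_pos (show a - 1 < a by omega)]; rfl
      · simp [S, gridCell, h, h4]
    have e3 : (if b + 1 < N then s (gridFace N (a, b) (a, b + 1)) + s (gridFace N (a, b + 1) (a, b)) else 0) =
        S a (b + 1) + S (a + 1) (b + 1) := by
      split_ifs with h
      · simp [gridFace, S]
      · simp [S, gridCell, h, h4]
    have e4 : (if 1 ≤ b then s (gridFace N (a, b) (a, b - 1)) + s (gridFace N (a, b - 1) (a, b)) else 0) =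
        S (a + 1) b + S a b := by
      split_ifs with h
      · simp only [gridFace, if_neg (show ¬ (b = b - 1) by omega), if_neg (show ¬ (b - 1 = b) by omega),
          if_neg (show ¬ (b < b - 1) by omega), if_pos (show b - 1 < b by omega)]; rfl
      · simp [S, gridCell, h, h4]
    rw [e1, e2, e3, e4]
    linear_combination h4 (S a b) + h4 (S (a + 1) b) + h4 (S a (b + 1)) + h4 (S (a + 1) (b + 1))
end

section
open scoped Classical

/-- A set of lattice points that is connected through lattice edges. -/
def LatticeConnected (S : Set (ℕ × ℕ)) : Prop :=
  ∀ T ⊆ S, T.Nonempty → (∀ p ∈ T, ∀ q ∈ S, LatticeAdj p q → q ∈ T) → S ⊆ T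

/-- A system of lattice blobs for the vertices and the edges of `G` gives a dual of `G`. -/
lemma hasDual_of_lattice {V : Type} [Fintype V] {G : SimpleGraph V} (N : ℕ) (A : V → Set (ℕ × ℕ))
    (M : V → V → Set (ℕ × ℕ)) (hA : ∀ u, LatticeConnected (A u))
    (hM : ∀ u v, G.Adj u v → LatticeConnected (M u v))
    (bA : ∀ u, ∀ p ∈ A u, p.1 < N ∧ p.2 < N) (bM : ∀ u v, G.Adj u v → ∀ p ∈ M u v, p.1 < N ∧ p.2 < N)
    (dA : ∀ u v, u ≠ v → ∀ p ∈ A u, p ∉ A v)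
    (dAM : ∀ u v w, G.Adj u v → w ≠ u → w ≠ v → ∀ p ∈ M u v, p ∉ A w)
    (dM : ∀ u v u' v', G.Adj u v → G.Adj u' v' → s(u, v) ≠ s(u', v') → ∀ p ∈ M u v, p ∉ M u' v')
    (iM : ∀ u v, G.Adj u v → (∃ p ∈ M u v, p ∈ A u) ∧ ∃ p ∈ M u v, p ∈ A v) : HasDual G := by
  let e := Fintype.equivFin V
  let R : V → V → ℕ × ℕ → ℕ × ℕ → Prop := fun u v p q => LatticeAdj p q ∧ q ∈ M u v ∧ q ∉ A v
  let X : V → V → Set (ℕ × ℕ) := fun u v =>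
    {p | G.Adj u v ∧ e u < e v ∧ p ∈ M u v ∧ p ∉ A v ∧ ∃ p₀ ∈ A u, Relation.ReflTransGen (R u v) p₀ p}
  let S : V → Set (ℕ × ℕ) := fun u => {p | p ∈ A u ∨ ∃ v, p ∈ X u v}
  have hSb : ∀ u, ∀ p ∈ S u, p.1 < N ∧ p.2 < N := by
    rintro u p (h | ⟨v, h⟩)
    · exact bA u p h
    · exact bM u v h.1 p h.2.2.1
  have hXA : ∀ u v w, w ≠ u → ∀ p ∈ X u v, p ∉ A w := by
    rintro u v w hw p ⟨h1, h2, h3, h4, -⟩ hp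
    by_cases hv : w = v
    · subst hv; exact h4 hp
    · exact dAM u v w h1 hw hv p h3 hp
  have hSd : ∀ u v, ∀ p ∈ S u, p ∈ S v → u = v := by
    rintro u v p (hu | ⟨u', hu⟩) (hv | ⟨v', hv⟩)
    · by_contra h; exact dA u v h p hu hv
    · by_contra h; exact hXA v v' u h p hv hu
    · by_contra h; exact hXA u u' v (Ne.symm h) p hu hv
    · by_contra h
      by_cases hs : s(u, u') = s(v, v')
      · rw [Sym2.eq_iff] at hs
        rcases hs with ⟨h1, -⟩ | ⟨rfl, rfl⟩
        · exact h h1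
        · exact lt_asymm hu.2.1 hv.2.1
      · exact dM u u' v v' hu.1 hv.1 hs p hu.2.2.1 hv.2.2.1
  let f : Fin N × Fin N → Option V := fun p =>
    if h : ∃ u, ((p.1 : ℕ), (p.2 : ℕ)) ∈ S u then some h.choose else none
  have hf : ∀ p u, f p = some u ↔ ((p.1 : ℕ), (p.2 : ℕ)) ∈ S u := by
    intro p u
    constructor
    · intro h
      simp only [f] at h
      split_ifs at h with h'
      rw [Option.some_inj] at h
      exact h ▸ h'.choose_spec
    · intro h
      have h' : ∃ u, ((p.1 : ℕ), (p.2 : ℕ)) ∈ S u := ⟨u, h⟩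
      simp only [f, dif_pos h', Option.some_inj]
      exact hSd _ _ _ h'.choose_spec h
  let Q : V → ℕ × ℕ → ℕ × ℕ → Prop := fun u p q => LatticeAdj p q ∧ p ∈ S u ∧ q ∈ S u
  have hAA : ∀ u, ∀ p ∈ A u, ∀ q ∈ A u, Relation.ReflTransGen (Q u) p q := by
    intro u p hp q hq
    refine (hA u {q | q ∈ A u ∧ Relation.ReflTransGen (Q u) p q} (fun _ h => h.1)
      ⟨p, hp, .refl⟩ ?_ hq).2
    rintro a ⟨ha, hpa⟩ b hb hab
    exact ⟨hb, hpa.tail ⟨hab, Or.inl ha, Or.inl hb⟩⟩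
  have hAX : ∀ u v, ∀ p ∈ X u v, ∃ p₀ ∈ A u, Relation.ReflTransGen (Q u) p₀ p := by
    rintro u v p ⟨h1, h2, -, -, p₀, hp₀, hr⟩
    refine ⟨p₀, hp₀, ?_⟩
    have : Relation.ReflTransGen (Q u) p₀ p ∧ p ∈ S u := by
      induction hr with
      | refl => exact ⟨.refl, Or.inl hp₀⟩
      | @tail b c hb hbc ih =>
        have hc : c ∈ S u := Or.inr ⟨v, h1, h2, hbc.2.1, hbc.2.2, p₀, hp₀, hb.tail hbc⟩
        exact ⟨ih.1.tail ⟨hbc.1, ih.2, hc⟩, hc⟩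
    exact this.1
  have hQs : ∀ u p q, Relation.ReflTransGen (Q u) p q → Relation.ReflTransGen (Q u) q p := by
    intro u p q h
    induction h with
    | refl => exact .refl
    | tail _ h ih => exact Relation.ReflTransGen.head ⟨h.1.symm, h.2.2, h.2.1⟩ ih
  have hSS : ∀ u, ∀ p ∈ S u, ∀ q ∈ S u, Relation.ReflTransGen (Q u) p q := by
    have : ∀ u, ∀ p ∈ S u, ∃ p₀ ∈ A u, Relation.ReflTransGen (Q u) p₀ p := by
      rintro u p (h | ⟨v, h⟩)
      · exact ⟨p, h, .refl⟩
      · exact hAX u v p h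
    intro u p hp q hq
    obtain ⟨p₀, h1, h2⟩ := this u p hp
    obtain ⟨q₀, h3, h4⟩ := this u q hq
    exact ((hQs _ _ _ h2).trans (hAA u p₀ h1 q₀ h3)).trans h4
  refine (hasDual_gridGraph N).minor f ?_ ?_
  · intro a b u ha hb
    have ha' := (hf a u).1 ha
    have hb' := (hf b u).1 hb
    have h := hSS u _ ha' _ hb'
    have : ∀ q, Relation.ReflTransGen (Q u) ((a.1 : ℕ), (a.2 : ℕ)) q → ∀ c : Fin N × Fin N,
        q = ((c.1 : ℕ), (c.2 : ℕ)) → (fibreGraph (gridGraph N) f).Reachable a c := by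
      intro q hq
      induction hq with
      | refl =>
        intro c hc
        have : a = c := by
          rw [Prod.mk.injEq] at hc
          exact Prod.ext (Fin.ext hc.1) (Fin.ext hc.2)
        rw [this]
      | @tail x y hx hxy ih =>
        rintro c rfl
        have hb := hSb u x hxy.2.1
        refine (ih (⟨x.1, hb.1⟩, ⟨x.2, hb.2⟩) rfl).trans (SimpleGraph.Adj.reachable ⟨hxy.1, ?_⟩)
        rw [(hf _ u).2 hxy.2.1, (hf _ u).2 hxy.2.2]
    exact this _ h b rfl
  · have key : ∀ u v, G.Adj u v → e u < e v → ∃ p ∈ S u, ∃ q ∈ S v, LatticeAdj p q := by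
      intro u v h hlt
      by_contra hcon
      push Not at hcon
      obtain ⟨⟨p, hp, hpA⟩, q, hq, hqA⟩ := iM u v h
      have := hM u v h {x | x ∈ M u v ∧ (x ∈ A u ∨ x ∈ X u v)} (fun _ h => h.1) ⟨p, hp, Or.inl hpA⟩ (by
        rintro a ⟨ha, ha'⟩ b hb hab
        have haS : a ∈ S u := ha'.imp id fun h => ⟨v, h⟩
        have hbv : b ∉ A v := fun hbv => hcon a haS b (Or.inl hbv) hab
        refine ⟨hb, Or.inr ⟨h, hlt, hb, hbv, ?_⟩⟩
        rcases ha' with ha' | ⟨-, -, -, -, p₀, h1, h2⟩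
        · exact ⟨a, ha', .single ⟨hab, hb, hbv⟩⟩
        · exact ⟨p₀, h1, h2.tail ⟨hab, hb, hbv⟩⟩) hq
      rcases this.2 with h' | h'
      · exact dA u v h.ne q h' hqA
      · exact h'.2.2.2.1 hqA
    have key2 : ∀ u v, G.Adj u v → ∃ p ∈ S u, ∃ q ∈ S v, LatticeAdj p q := by
      intro u v h
      rcases lt_trichotomy (e u) (e v) with hlt | heq | hlt
      · exact key u v h hlt
      · exact (h.ne (e.injective heq)).elim
      · obtain ⟨p, hp, q, hq, hpq⟩ := key v u h.symm hlt
        exact ⟨q, hq, p, hp, hpq.symm⟩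
    intro u v h
    obtain ⟨p, hp, q, hq, hpq⟩ := key2 u v h
    have h1 := hSb u p hp
    have h2 := hSb v q hq
    exact ⟨(⟨p.1, h1.1⟩, ⟨p.2, h1.2⟩), (⟨q.1, h2.1⟩, ⟨q.2, h2.2⟩), (hf _ _).2 hp, (hf _ _).2 hq, hpq⟩

/-- The lattice points at sup-distance less than one from a set. -/
def nearLattice (C : Set (ℝ × ℝ)) : Set (ℕ × ℕ) :=
  {p | ∃ x ∈ C, |x.1 - p.1| < 1 ∧ |x.2 - p.2| < 1}

lemma exists_nearLattice {x : ℝ × ℝ} (hx : 0 ≤ x.1 ∧ 0 ≤ x.2) :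
    ∃ p : ℕ × ℕ, |x.1 - p.1| < 1 ∧ |x.2 - p.2| < 1 := by
  refine ⟨(⌊x.1⌋₊, ⌊x.2⌋₊), ?_, ?_⟩
  · have h1 := Nat.floor_le hx.1
    have h2 := Nat.lt_floor_add_one x.1
    rw [abs_lt]; constructor <;> simp only <;> linarith
  · have h1 := Nat.floor_le hx.2
    have h2 := Nat.lt_floor_add_one x.2
    rw [abs_lt]; constructor <;> simp only <;> linarith

lemma latticeConnected_nearLattice {C : Set (ℝ × ℝ)} (hC : IsPreconnected C)
    (hpos : ∀ x ∈ C, 0 ≤ x.1 ∧ 0 ≤ x.2) : LatticeConnected (nearLattice C) := by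
  intro T hT hne hcl
  have hop : ∀ Z : Set (ℕ × ℕ), IsOpen {x : ℝ × ℝ | ∃ p ∈ Z, |x.1 - (p.1 : ℝ)| < 1 ∧ |x.2 - (p.2 : ℝ)| < 1} := by
    intro Z
    have : {x : ℝ × ℝ | ∃ p ∈ Z, |x.1 - (p.1 : ℝ)| < 1 ∧ |x.2 - (p.2 : ℝ)| < 1} =
        ⋃ p ∈ Z, {x : ℝ × ℝ | |x.1 - (p.1 : ℝ)| < 1 ∧ |x.2 - (p.2 : ℝ)| < 1} := by
      ext x; simp only [Set.mem_setOf_eq, Set.mem_iUnion, exists_prop]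
    rw [this]
    refine isOpen_biUnion fun p _ => ?_
    have h1 : Continuous fun x : ℝ × ℝ => |x.1 - (p.1 : ℝ)| := by fun_prop
    have h2 : Continuous fun x : ℝ × ℝ => |x.2 - (p.2 : ℝ)| := by fun_prop
    exact (isOpen_lt h1 continuous_const).inter (isOpen_lt h2 continuous_const)
  intro q hq
  by_contra hqT
  obtain ⟨p, hp⟩ := hne
  obtain ⟨x, hx, hxp⟩ := hT hp
  obtain ⟨y, hy, hyq⟩ := hq
  obtain ⟨z, hz, ⟨a, ha, ha1, ha2⟩, ⟨b, hb, hb1, hb2⟩⟩ := hC _ _ (hop T) (hop (nearLattice C \ T)) (by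
      intro z hz
      obtain ⟨r, hr⟩ := exists_nearLattice (hpos z hz)
      have hrn : r ∈ nearLattice C := ⟨z, hz, hr⟩
      by_cases h : r ∈ T
      · exact Or.inl ⟨r, h, hr⟩
      · exact Or.inr ⟨r, ⟨hrn, h⟩, hr⟩) ⟨x, hx, p, hp, hxp⟩ ⟨y, hy, q, ⟨⟨y, hy, hyq⟩, hqT⟩, hyq⟩
  have hclose : ∀ (t : ℝ) (m n : ℕ), |t - m| < 1 → |t - n| < 1 → m = n ∨ m + 1 = n ∨ n + 1 = m := by
    intro t m n h1 h2
    rw [abs_lt] at h1 h2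
    have h3 : (m : ℝ) < n + 2 := by linarith
    have h4 : (n : ℝ) < m + 2 := by linarith
    norm_cast at h3 h4
    omega
  have hc : (b.1, a.2) ∈ T := by
    rcases hclose z.1 a.1 b.1 ha1 hb1 with h | h
    · rw [← h]; exact ha
    · exact hcl a ha (b.1, a.2) ⟨z, hz, hb1, ha2⟩ (Or.inl ⟨rfl, h⟩)
  refine hb.2 ?_
  rcases hclose z.2 a.2 b.2 ha2 hb2 with h | h
  · rw [h] at hc; exact hc
  · exact hcl _ hc b hb.1 (Or.inr ⟨rfl, h⟩)

lemma exists_pos_separation {ι : Type} [Finite ι] (C : ι → Set (ℝ × ℝ)) (hC : ∀ i, IsCompact (C i)) :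
    ∃ δ > 0, ∀ i j, Disjoint (C i) (C j) → ∀ x ∈ C i, ∀ y ∈ C j, δ ≤ dist x y := by
  have h : ∀ p : ι × ι, ∀ᶠ δ in nhdsWithin (0 : ℝ) (Set.Ioi 0), Disjoint (C p.1) (C p.2) →
      ∀ x ∈ C p.1, ∀ y ∈ C p.2, δ ≤ dist x y := by
    rintro ⟨i, j⟩
    by_cases hd : Disjoint (C i) (C j)
    · obtain ⟨δ, hδ, hs⟩ := Metric.exists_pos_forall_lt_edist (hC i) (hC j).isClosed hd
      filter_upwards [Ioo_mem_nhdsGT (show (0 : ℝ) < δ by exact_mod_cast hδ)] with η hη _ x hx y hy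
      have := hs x hx y hy
      rw [edist_nndist, ENNReal.coe_lt_coe] at this
      have h2 : (δ : ℝ) < dist x y := by rw [dist_nndist]; exact_mod_cast this
      linarith [hη.2]
    · exact Filter.Eventually.of_forall fun δ h => absurd h hd
  obtain ⟨δ, h1, h2⟩ := ((Filter.eventually_all.2 h).and self_mem_nhdsWithin).exists
  exact ⟨δ, h2, fun i j => h1 (i, j)⟩

lemma hasDual_of_isPlanarGraph {V : Type} [Fintype V] {G : SimpleGraph V} (hG : IsPlanarGraph G) :
    HasDual G := by
  obtain ⟨vtx, arc, h⟩ := hG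
  let P : V → V → Set (ℝ × ℝ) := fun u v =>
    if G.Adj u v then arc u v '' Set.Icc 0 (1 / 3) else {vtx u}
  let K : V → Set (ℝ × ℝ) := fun u => ⋃ v, P u v
  let M : V → V → Set (ℝ × ℝ) := fun u v => if G.Adj u v then arc u v '' Set.Icc (1 / 3) (2 / 3) else ∅
  have hsub1 : Set.Icc (0 : ℝ) (1 / 3) ⊆ Set.Icc 0 1 := Set.Icc_subset_Icc le_rfl (by norm_num)
  have hsub2 : Set.Icc (1 / 3 : ℝ) (2 / 3) ⊆ Set.Icc 0 1 := Set.Icc_subset_Icc (by norm_num) (by norm_num)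
  have hPv : ∀ u v, vtx u ∈ P u v := by
    intro u v
    simp only [P]
    split_ifs with hA
    · exact ⟨0, by norm_num, h.arc_start hA⟩
    · rfl
  have hPc : ∀ u v, IsCompact (P u v) ∧ IsPreconnected (P u v) := by
    intro u v
    simp only [P]
    split_ifs with hA
    · exact ⟨isCompact_Icc.image_of_continuousOn ((h.arc_cont hA).mono hsub1),
        isPreconnected_Icc.image _ ((h.arc_cont hA).mono hsub1)⟩
    · exact ⟨isCompact_singleton, isPreconnected_singleton⟩
  have hKc : ∀ u, IsCompact (K u) := fun u => isCompact_iUnion fun v => (hPc u v).1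
  have hKp : ∀ u, IsPreconnected (K u) := fun u =>
    isPreconnected_iUnion ⟨vtx u, Set.mem_iInter.2 fun v => hPv u v⟩ fun v => (hPc u v).2
  have hMc : ∀ u v, IsCompact (M u v) ∧ IsPreconnected (M u v) := by
    intro u v
    simp only [M]
    split_ifs with hA
    · exact ⟨isCompact_Icc.image_of_continuousOn ((h.arc_cont hA).mono hsub2),
        isPreconnected_Icc.image _ ((h.arc_cont hA).mono hsub2)⟩
    · exact ⟨isCompact_empty, isPreconnected_empty⟩
  have hKm : ∀ u, ∀ x ∈ K u, x = vtx u ∨ ∃ v t, G.Adj u v ∧ 0 < t ∧ t ≤ 1 / 3 ∧ arc u v t = x := by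
    intro u x hx
    obtain ⟨v, hv⟩ := Set.mem_iUnion.1 hx
    simp only [P] at hv
    split_ifs at hv with hA
    · obtain ⟨t, ht, rfl⟩ := hv
      rcases ht.1.eq_or_lt with rfl | h0
      · exact Or.inl (h.arc_start hA)
      · exact Or.inr ⟨v, t, hA, h0, ht.2, rfl⟩
    · exact Or.inl hv
  have hMm : ∀ u v, ∀ x ∈ M u v, G.Adj u v ∧ ∃ t, 1 / 3 ≤ t ∧ t ≤ 2 / 3 ∧ arc u v t = x := by
    intro u v x hx
    simp only [M] at hx
    split_ifs at hx with hA
    · obtain ⟨t, ht, rfl⟩ := hx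
      exact ⟨hA, t, ht.1, ht.2, rfl⟩
    · exact hx.elim
  have hinner : ∀ u v t, 0 < t → t < 1 → arc u v t ∈ ArcInterior (arc u v) :=
    fun u v t h0 h1 => ⟨t, ⟨h0, h1⟩, rfl⟩
  have hmeet : ∀ u v u' v' t t', G.Adj u v → G.Adj u' v' → 0 < t → t < 1 → 0 < t' → t' < 1 →
      arc u v t = arc u' v' t' → (u = u' ∧ v = v' ∧ t = t') ∨ (u = v' ∧ v = u' ∧ t = 1 - t') := by
    intro u v u' v' t t' hA hA' h0 h1 h0' h1' heq
    by_cases hs : s(u, v) = s(u', v')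
    · rw [Sym2.eq_iff] at hs
      rcases hs with ⟨rfl, rfl⟩ | ⟨rfl, rfl⟩
      · exact Or.inl ⟨rfl, rfl, h.arc_injOn hA ⟨h0.le, h1.le⟩ ⟨h0'.le, h1'.le⟩ heq⟩
      · rw [h.arc_symm hA] at heq
        exact Or.inr ⟨rfl, rfl, h.arc_injOn hA ⟨h0.le, h1.le⟩ ⟨by linarith, by linarith⟩ heq⟩
    · have := h.arc_disjoint hA hA' hs
      have h2 : arc u v t ∈ ArcInterior (arc u v) ∩ ArcInterior (arc u' v') :=
        ⟨hinner _ _ _ h0 h1, heq ▸ hinner _ _ _ h0' h1'⟩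
      rw [this] at h2
      exact h2.elim
  have hKK : ∀ u v, u ≠ v → Disjoint (K u) (K v) := by
    intro u v huv
    rw [Set.disjoint_left]
    intro x hx hy
    rcases hKm u x hx with rfl | ⟨a, t, hA, h0, h1, rfl⟩
    · rcases hKm v _ hy with h2 | ⟨b, t', hB, h0', h1', h2⟩
      · exact huv (h.vtx_inj h2)
      · exact h.arc_avoids_vtx hB u (h2 ▸ hinner _ _ _ h0' (by linarith))
    · rcases hKm v _ hy with h2 | ⟨b, t', hB, h0', h1', h2⟩
      · exact h.arc_avoids_vtx hA v (h2 ▸ hinner _ _ _ h0 (by linarith))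
      · rcases hmeet _ _ _ _ _ _ hA hB h0 (by linarith) h0' (by linarith) h2.symm with h3 | h3
        · exact huv h3.1
        · linarith [h3.2.2]
  have hMK : ∀ u v w, w ≠ u → w ≠ v → Disjoint (M u v) (K w) := by
    intro u v w hu hv
    rw [Set.disjoint_left]
    intro x hx hy
    obtain ⟨hA, t, h0, h1, rfl⟩ := hMm u v x hx
    rcases hKm w _ hy with h2 | ⟨b, t', hB, h0', h1', h2⟩
    · exact h.arc_avoids_vtx hA w (h2 ▸ hinner _ _ _ (by linarith) (by linarith))
    · rcases hmeet _ _ _ _ _ _ hA hB (by linarith) (by linarith) h0' (by linarith) h2.symm with h3 | h3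
      · exact hu h3.1.symm
      · exact hv h3.2.1.symm
  have hMM : ∀ u v u' v', s(u, v) ≠ s(u', v') → Disjoint (M u v) (M u' v') := by
    intro u v u' v' hs
    rw [Set.disjoint_left]
    intro x hx hy
    obtain ⟨hA, t, h0, h1, rfl⟩ := hMm u v x hx
    obtain ⟨hB, t', h0', h1', h2⟩ := hMm u' v' _ hy
    rcases hmeet _ _ _ _ _ _ hA hB (by linarith) (by linarith) (by linarith) (by linarith) h2.symm with h3 | h3
    · exact hs (by rw [h3.1, h3.2.1])
    · exact hs (by rw [h3.1, h3.2.1, Sym2.eq_swap])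
  let C : V ⊕ (V × V) → Set (ℝ × ℝ) := Sum.elim K fun e => M e.1 e.2
  have hCc : ∀ i, IsCompact (C i) := by
    rintro (u | e)
    · exact hKc u
    · exact (hMc _ _).1
  obtain ⟨δ, hδ, hsep⟩ := exists_pos_separation C hCc
  obtain ⟨R, hR⟩ := (isCompact_iUnion hCc).isBounded.subset_closedBall (0 : ℝ × ℝ)
  have hRb : ∀ i, ∀ x ∈ C i, |x.1| ≤ R ∧ |x.2| ≤ R := by
    intro i x hx
    have := hR (Set.mem_iUnion.2 ⟨i, hx⟩)
    rw [mem_closedBall_zero_iff, Prod.norm_def, max_le_iff] at this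
    exact this
  let φ : ℝ × ℝ → ℝ × ℝ := fun x => ((x.1 + R) * (2 / δ), (x.2 + R) * (2 / δ))
  have hφ : Continuous φ := by fun_prop
  have h2δ : 0 < 2 / δ := by positivity
  have hpos : ∀ i, ∀ x ∈ φ '' C i, 0 ≤ x.1 ∧ 0 ≤ x.2 := by
    rintro i _ ⟨x, hx, rfl⟩
    obtain ⟨h1, h2⟩ := hRb i x hx
    rw [abs_le] at h1 h2
    exact ⟨mul_nonneg (by linarith) h2δ.le, mul_nonneg (by linarith) h2δ.le⟩
  obtain ⟨N, hN⟩ := exists_nat_gt (2 * R * (2 / δ) + 1)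
  have hbd : ∀ i, ∀ p ∈ nearLattice (φ '' C i), p.1 < N ∧ p.2 < N := by
    rintro i p ⟨_, ⟨x, hx, rfl⟩, h1, h2⟩
    obtain ⟨h3, h4⟩ := hRb i x hx
    rw [abs_le] at h3 h4
    rw [abs_lt] at h1 h2
    have h5 : (x.1 + R) * (2 / δ) ≤ 2 * R * (2 / δ) := mul_le_mul_of_nonneg_right (by linarith) h2δ.le
    have h6 : (x.2 + R) * (2 / δ) ≤ 2 * R * (2 / δ) := mul_le_mul_of_nonneg_right (by linarith) h2δ.le
    simp only [φ] at h1 h2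
    constructor
    · have : (p.1 : ℝ) < N := by linarith
      exact_mod_cast this
    · have : (p.2 : ℝ) < N := by linarith
      exact_mod_cast this
  have hdis : ∀ i j, Disjoint (C i) (C j) → ∀ p ∈ nearLattice (φ '' C i), p ∉ nearLattice (φ '' C j) := by
    rintro i j hij p ⟨_, ⟨x, hx, rfl⟩, h1, h2⟩ ⟨_, ⟨y, hy, rfl⟩, h3, h4⟩
    have h5 := hsep i j hij x hx y hy
    rw [Prod.dist_eq, le_max_iff, Real.dist_eq, Real.dist_eq] at h5
    have key : ∀ a b c : ℝ, |(a + R) * (2 / δ) - c| < 1 → |(b + R) * (2 / δ) - c| < 1 → ¬ δ ≤ |a - b| := by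
      intro a b c ha hb hab
      have e1 : |(a - b) * (2 / δ)| < 2 := by
        rw [abs_lt] at ha hb ⊢
        constructor <;> linarith
      rw [abs_mul, abs_of_pos h2δ] at e1
      have e2 : δ * (2 / δ) ≤ |a - b| * (2 / δ) := mul_le_mul_of_nonneg_right hab h2δ.le
      have e3 : δ * (2 / δ) = 2 := by field_simp
      linarith
    rcases h5 with h5 | h5
    · exact key _ _ _ h1 h3 h5
    · exact key _ _ _ h2 h4 h5
  have hmem : ∀ i j, ∀ x ∈ C i, x ∈ C j → ∃ p ∈ nearLattice (φ '' C i), p ∈ nearLattice (φ '' C j) := by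
    intro i j x hi hj
    obtain ⟨p, hp⟩ := exists_nearLattice (hpos i _ ⟨x, hi, rfl⟩)
    exact ⟨p, ⟨_, ⟨x, hi, rfl⟩, hp⟩, ⟨_, ⟨x, hj, rfl⟩, hp⟩⟩
  refine hasDual_of_lattice N (fun u => nearLattice (φ '' C (Sum.inl u)))
    (fun u v => nearLattice (φ '' C (Sum.inr (u, v)))) ?_ ?_ (fun u => hbd _) (fun u v _ => hbd _)
    (fun u v huv => hdis _ _ (hKK u v huv)) (fun u v w _ h1 h2 => hdis _ _ (hMK u v w h1 h2))
    (fun u v u' v' _ _ hs => hdis _ _ (hMM u v u' v' hs)) ?_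
  · exact fun u => latticeConnected_nearLattice ((hKp u).image _ hφ.continuousOn) (hpos (Sum.inl u))
  · exact fun u v _ => latticeConnected_nearLattice (((hMc u v).2).image _ hφ.continuousOn)
      (hpos (Sum.inr (u, v)))
  · intro u v hA
    constructor
    · refine hmem _ _ (arc u v (1 / 3)) ?_ ?_
      · change _ ∈ M u v
        simp only [M, if_pos hA]
        exact ⟨1 / 3, by norm_num, rfl⟩
      · change _ ∈ K u
        refine Set.mem_iUnion.2 ⟨v, ?_⟩
        simp only [P, if_pos hA]
        exact ⟨1 / 3, by norm_num, rfl⟩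
    · refine hmem _ _ (arc u v (2 / 3)) ?_ ?_
      · change _ ∈ M u v
        simp only [M, if_pos hA]
        exact ⟨2 / 3, by norm_num, rfl⟩
      · change _ ∈ K v
        refine Set.mem_iUnion.2 ⟨u, ?_⟩
        simp only [P, if_pos hA.symm]
        refine ⟨1 / 3, by norm_num, ?_⟩
        rw [h.arc_symm hA]; norm_num
end

section
open scoped Classical

variable {V : Type} {G : SimpleGraph V} {S K : Finset V} {c : V → Bool}

/-- The neighbours of `y` in `T` having color `F`. -/
noncomputable def fnb (G : SimpleGraph V) (c : V → Bool) (T : Finset V) (y : V) : Finset V :=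
  T.filter (fun w => c w = false ∧ G.Adj y w)

theorem mem_fnb {T : Finset V} {y w : V} : w ∈ fnb G c T y ↔ w ∈ T ∧ c w = false ∧ G.Adj y w := by
  simp [fnb]

theorem fnb_mono {T T' : Finset V} (h : T ⊆ T') (y : V) : fnb G c T y ⊆ fnb G c T' y :=
  Finset.filter_subset_filter _ h

/-- `Super G S K c`: contracting `K` to a point, the color class `F` in `S` is a forest
(edges inside `K` being ignored). -/
def Super (G : SimpleGraph V) (S K : Finset V) (c : V → Bool) : Prop :=
  ∀ Y ⊆ S, Disjoint Y K → (∀ y ∈ Y, c y = false) → Y.Nonempty →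
    ∃ y ∈ Y, (fnb G c (Y ∪ K) y).card ≤ 1

/-- An `(I,F)`-coloring of `S` which is a forest even after contracting `K`. -/
structure Ok (G : SimpleGraph V) (S K : Finset V) (c : V → Bool) : Prop where
  indep : ∀ a ∈ S, ∀ b ∈ S, G.Adj a b → c a = true → c b = false
  super : Super G S K c

theorem Ok.congr {c' : V → Bool} (h : Ok G S K c) (hK : K ⊆ S) (hc : ∀ v ∈ S, c v = c' v) :
    Ok G S K c' := by
  refine ⟨fun a ha b hb hab h1 => ?_, fun Y hY hd hF hne => ?_⟩
  · rw [← hc b hb]; exact h.indep a ha b hb hab (by rw [hc a ha]; exact h1)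
  · obtain ⟨y, hy, h1⟩ := h.super Y hY hd (fun y hy => by rw [hc y (hY hy)]; exact hF y hy) hne
    refine ⟨y, hy, le_trans (Finset.card_le_card ?_) h1⟩
    intro w hw
    rw [mem_fnb] at hw ⊢
    have : w ∈ S := (Finset.union_subset hY hK) hw.1
    rw [hc w this]; exact hw

theorem Ok.congr_graph {G' : SimpleGraph V} (h : Ok G' S K c)
    (hK : ∀ a ∈ K, ∀ b ∈ K, G.Adj a b → c a = true → c b = false) (hKS : K ⊆ S)
    (hG : ∀ a ∈ S, ∀ b ∈ S, G.Adj a b → (a ∈ K ∧ b ∈ K) ∨ G'.Adj a b) : Ok G S K c := by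
  refine ⟨fun a ha b hb hab h1 => ?_, fun Y hY hd hF hne => ?_⟩
  · rcases hG a ha b hb hab with h2 | h2
    · exact hK a h2.1 b h2.2 hab h1
    · exact h.indep a ha b hb h2 h1
  · obtain ⟨y, hy, h1⟩ := h.super Y hY hd hF hne
    refine ⟨y, hy, le_trans (Finset.card_le_card ?_) h1⟩
    intro w hw
    rw [mem_fnb] at hw ⊢
    refine ⟨hw.1, hw.2.1, ?_⟩
    rcases hG y (hY hy) w (Finset.union_subset hY hKS hw.1) hw.2.2 with h2 | h2
    · exact absurd h2.1 (Finset.disjoint_left.mp hd hy)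
    · exact h2

theorem Ok.insert_I {v : V} (h : Ok G S K c) (hKS : K ⊆ S) (hv : v ∉ S) (hc : c v = true)
    (hn : ∀ w ∈ S, G.Adj v w → c w = false) : Ok G (insert v S) K c := by
  refine ⟨fun a ha b hb hab h1 => ?_, fun Y hY hd hF hne => ?_⟩
  · rcases Finset.mem_insert.mp ha with rfl | ha'
    · rcases Finset.mem_insert.mp hb with rfl | hb'
      · exact absurd rfl hab.ne
      · exact hn b hb' hab
    · rcases Finset.mem_insert.mp hb with rfl | hb'
      · have := hn a ha' hab.symm; rw [this] at h1; cases h1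
      · exact h.indep a ha' b hb' hab h1
  · refine h.super Y (fun y hy => ?_) hd hF hne
    rcases Finset.mem_insert.mp (hY hy) with rfl | h1
    · have := hF _ hy; rw [hc] at this; cases this
    · exact h1

theorem insert_indep_F {v : V}
    (h : ∀ a ∈ S, ∀ b ∈ S, G.Adj a b → c a = true → c b = false) (hc : c v = false) :
    ∀ a ∈ insert v S, ∀ b ∈ insert v S, G.Adj a b → c a = true → c b = false := by
  intro a ha b hb hab h1
  rcases Finset.mem_insert.mp ha with rfl | ha
  · rw [hc] at h1; cases h1
  · rcases Finset.mem_insert.mp hb with rfl | hb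
    · exact hc
    · exact h a ha b hb hab h1

theorem Ok.insert_leaf {v : V} (h : Ok G S K c) (hKS : K ⊆ S) (hv : v ∉ S) (hc : c v = false)
    (p : V) (hn : ∀ w ∈ S, G.Adj v w → c w = false → w = p) : Ok G (insert v S) K c := by
  refine ⟨insert_indep_F h.indep hc, fun Y hY hd hF hne => ?_⟩
  by_cases hvY : v ∈ Y
  · refine ⟨v, hvY, ?_⟩
    rw [Finset.card_le_one]
    have key : ∀ w ∈ fnb G c (Y ∪ K) v, w = p := by
      intro w hw
      rw [mem_fnb, Finset.mem_union] at hw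
      refine hn w ?_ hw.2.2 hw.2.1
      rcases hw.1 with h1 | h1
      · rcases Finset.mem_insert.mp (hY h1) with rfl | h2
        · exact absurd rfl hw.2.2.ne
        · exact h2
      · exact hKS h1
    intro a ha b hb
    rw [key a ha, key b hb]
  · refine h.super Y (fun y hy => ?_) hd hF hne
    rcases Finset.mem_insert.mp (hY hy) with rfl | h1
    · exact absurd hy hvY
    · exact h1

/-- The graph of `F`-edges in `S`, with the `F`-vertices of `K` joined together. -/
def linkGraph (G : SimpleGraph V) (S K : Finset V) (c : V → Bool) : SimpleGraph V where
  Adj a b := a ≠ b ∧ a ∈ S ∧ b ∈ S ∧ c a = false ∧ c b = false ∧ (G.Adj a b ∨ (a ∈ K ∧ b ∈ K))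
  symm := ⟨fun _ _ h => ⟨h.1.symm, h.2.2.1, h.2.1, h.2.2.2.2.1, h.2.2.2.1,
    h.2.2.2.2.2.elim (fun h => Or.inl h.symm) (fun h => Or.inr h.symm)⟩⟩
  loopless := ⟨fun _ h => h.1 rfl⟩

/-- Two vertices are linked if they lie in the same component of the link graph. -/
def Linked (G : SimpleGraph V) (S K : Finset V) (c : V → Bool) (a b : V) : Prop :=
  (linkGraph G S K c).Reachable a b

theorem Linked.symm {a b : V} (h : Linked G S K c a b) : Linked G S K c b a :=
  SimpleGraph.Reachable.symm h

theorem Linked.trans {a b d : V} (h : Linked G S K c a b) (h' : Linked G S K c b d) :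
    Linked G S K c a d := SimpleGraph.Reachable.trans h h'

theorem reachable_map {H H' : SimpleGraph V} (φ : V → V)
    (h : ∀ a b, H.Adj a b → H'.Reachable (φ a) (φ b)) {a b : V} (hab : H.Reachable a b) :
    H'.Reachable (φ a) (φ b) := by
  obtain ⟨w⟩ := hab
  induction w with
  | nil => exact SimpleGraph.Reachable.refl _
  | cons h1 _ ih => exact (h _ _ h1).trans ih

theorem Linked.of_insert {v p a b : V} (hKS : K ⊆ S) (hv : v ∉ S)
    (hn : ∀ w ∈ S, G.Adj v w → c w = false → c v = false → w = p)
    (h : Linked G (insert v S) K c a b) :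
    Linked G S K c (if a = v then p else a) (if b = v then p else b) := by
  refine reachable_map (fun x => if x = v then p else x) ?_ h
  rintro x y ⟨hne, hx, hy, cx, cy, hxy⟩
  have hvK : v ∉ K := fun h => hv (hKS h)
  by_cases h1 : x = v
  · subst h1
    have hy' : y ∈ S := (Finset.mem_insert.mp hy).resolve_left (Ne.symm hne)
    have hy2 : y ≠ x := Ne.symm hne
    rcases hxy with hxy | hxy
    · simp only [if_true, if_neg hy2]
      rw [hn y hy' hxy cy cx]
    · exact absurd hxy.1 hvK
  · by_cases h2 : y = v
    · subst h2
      have hx' : x ∈ S := (Finset.mem_insert.mp hx).resolve_left h1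
      rcases hxy with hxy | hxy
      · simp only [if_true, if_neg h1]
        rw [hn x hx' hxy.symm cx cy]
      · exact absurd hxy.2 hvK
    · simp only [if_neg h1, if_neg h2]
      exact SimpleGraph.Adj.reachable ⟨hne, (Finset.mem_insert.mp hx).resolve_left h1,
        (Finset.mem_insert.mp hy).resolve_left h2, cx, cy, hxy⟩

theorem Super.peel (hs : Super G S K c) : ∀ (n : ℕ) (Y : Finset V), Y.card = n → Y ⊆ S →
    Disjoint Y K → (∀ y ∈ Y, c y = false) →
    (∀ y ∈ Y, ∀ w ∈ K, c w = false → ¬ G.Adj y w) → ∀ p ∈ Y, 1 ≤ (fnb G c Y p).card →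
    (∀ y ∈ Y, y ≠ p → 2 ≤ (fnb G c Y y).card) → False := by
  intro n
  induction n with
  | zero =>
    intro Y h0 _ _ _ _ p hp
    rw [Finset.card_eq_zero] at h0
    simp [h0] at hp
  | succ n ih =>
    intro Y hcard hY hd hF hK p hp h1 h2
    have hU : ∀ y ∈ Y, fnb G c (Y ∪ K) y = fnb G c Y y := by
      intro y hy
      apply Finset.Subset.antisymm
      · intro w hw
        rw [mem_fnb, Finset.mem_union] at hw
        rw [mem_fnb]
        rcases hw.1 with h3 | h3
        · exact ⟨h3, hw.2⟩
        · exact absurd hw.2.2 (hK y hy w h3 hw.2.1)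
      · exact fnb_mono Finset.subset_union_left y
    obtain ⟨y, hy, hy1⟩ := hs Y hY hd hF ⟨p, hp⟩
    rw [hU y hy] at hy1
    have hyp : y = p := by
      by_contra hne
      have := h2 y hy hne
      omega
    subst hyp
    obtain ⟨p', hp'⟩ := Finset.card_eq_one.mp (le_antisymm hy1 h1)
    have hp'm : p' ∈ fnb G c Y y := by rw [hp']; simp
    rw [mem_fnb] at hp'm
    have hne : p' ≠ y := hp'm.2.2.ne.symm
    have hsub : Y.erase y ⊆ Y := Finset.erase_subset _ _
    have hle : ∀ z ∈ Y.erase y, (fnb G c Y z).card ≤ (fnb G c (Y.erase y) z).card + 1 := by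
      intro z _
      have : fnb G c Y z ⊆ insert y (fnb G c (Y.erase y) z) := by
        intro w hw
        rw [mem_fnb] at hw
        rw [Finset.mem_insert, mem_fnb, Finset.mem_erase]
        by_cases h : w = y
        · exact Or.inl h
        · exact Or.inr ⟨⟨h, hw.1⟩, hw.2⟩
      exact (Finset.card_le_card this).trans (Finset.card_insert_le _ _)
    refine ih (Y.erase y) (by rw [Finset.card_erase_of_mem hy, hcard]; rfl) (hsub.trans hY)
      (Finset.disjoint_of_subset_left hsub hd) (fun z hz => hF z (hsub hz))
      (fun z hz => hK z (hsub hz)) p' (Finset.mem_erase.mpr ⟨hne, hp'm.1⟩) ?_ ?_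
    · have := hle p' (Finset.mem_erase.mpr ⟨hne, hp'm.1⟩)
      have := h2 p' hp'm.1 hne
      omega
    · intro z hz hzp
      have hz' := Finset.mem_erase.mp hz
      refine le_trans (h2 z hz'.2 hz'.1) (Finset.card_le_card ?_)
      intro w hw
      rw [mem_fnb] at hw ⊢
      refine ⟨Finset.mem_erase.mpr ⟨?_, hw.1⟩, hw.2⟩
      rintro rfl
      apply hzp
      have : z ∈ fnb G c Y w := by rw [mem_fnb]; exact ⟨hz'.2, hF z hz'.2, hw.2.2.symm⟩
      rw [hp'] at this
      simpa using this

theorem Ok.insert_two_aux {v p q : V} {Y : Finset V} (h : Ok G S K c) (hKS : K ⊆ S) (hv : v ∉ S)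
    (hc : c v = false) (hpq : p ≠ q)
    (hn : ∀ w ∈ S, G.Adj v w → c w = false → w = p ∨ w = q)
    (hl : ¬ Linked G S K c p q) (hY : Y ⊆ insert v S) (hd : Disjoint Y K)
    (hF : ∀ y ∈ Y, c y = false) (hvY : v ∈ Y) (hbad : ∀ y ∈ Y, 2 ≤ (fnb G c (Y ∪ K) y).card)
    (hpK : ∀ k ∈ K, c k = false → ¬ Linked G S K c p k) : False := by
  have hYS : ∀ y ∈ Y, y ≠ v → y ∈ S := fun y hy hne =>
    (Finset.mem_insert.mp (hY hy)).resolve_left hne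
  have hnv : fnb G c (Y ∪ K) v ⊆ {p, q} := by
    intro w hw
    rw [mem_fnb, Finset.mem_union] at hw
    have : w ∈ S := hw.1.elim (fun h1 => hYS w h1 hw.2.2.ne.symm) (fun h1 => hKS h1)
    simpa using hn w this hw.2.2 hw.2.1
  have heq : fnb G c (Y ∪ K) v = {p, q} := by
    apply Finset.eq_of_subset_of_card_le hnv
    rw [Finset.card_pair hpq]; exact hbad v hvY
  have hp : p ∈ fnb G c (Y ∪ K) v := by rw [heq]; simp
  rw [mem_fnb, Finset.mem_union] at hp
  have hpF := hp.2.1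
  have hpY : p ∈ Y := hp.1.resolve_right
    (fun hk => hpK p hk hpF (SimpleGraph.Reachable.refl _))
  have hpv : p ≠ v := hp.2.2.ne.symm
  set Z := Y.filter (fun y => y ≠ v ∧ Linked G S K c p y) with hZ
  have hZY : Z ⊆ Y := Finset.filter_subset _ _
  have hZm : ∀ y, y ∈ Z ↔ y ∈ Y ∧ y ≠ v ∧ Linked G S K c p y := by intro y; simp [hZ]
  have hZS : Z ⊆ S := fun y hy => hYS y (hZY hy) ((hZm y).mp hy).2.1
  have hstep : ∀ y ∈ Z, ∀ w ∈ fnb G c (Y ∪ K) y, w ≠ v → w ∈ fnb G c Z y := by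
    intro y hy w hw hwv
    rw [mem_fnb, Finset.mem_union] at hw
    have hwS : w ∈ S := hw.1.elim (fun h1 => hYS w h1 hwv) (fun h1 => hKS h1)
    have hyz := (hZm y).mp hy
    have hl' : Linked G S K c p w := hyz.2.2.trans
      (SimpleGraph.Adj.reachable ⟨hw.2.2.ne, hZS hy, hwS, hF y hyz.1, hw.2.1, Or.inl hw.2.2⟩)
    have hwY : w ∈ Y := hw.1.resolve_right (fun hk => hpK w hk hw.2.1 hl')
    rw [mem_fnb, hZm]
    exact ⟨⟨hwY, hwv, hl'⟩, hw.2⟩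
  refine h.super.peel Z.card Z rfl hZS (Finset.disjoint_of_subset_left hZY hd)
    (fun y hy => hF y (hZY hy)) ?_ p ((hZm p).mpr ⟨hpY, hpv, SimpleGraph.Reachable.refl _⟩) ?_ ?_
  · intro y hy w hw cw hyw
    have hyz := (hZm y).mp hy
    exact hpK w hw cw (hyz.2.2.trans (SimpleGraph.Adj.reachable
      ⟨hyw.ne, hZS hy, hKS hw, hF y hyz.1, cw, Or.inl hyw⟩))
  · have hpz : p ∈ Z := (hZm p).mpr ⟨hpY, hpv, SimpleGraph.Reachable.refl _⟩
    have h2 := hbad p hpY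
    obtain ⟨w, hw, hwv⟩ := Finset.exists_mem_ne (by omega : 1 < (fnb G c (Y ∪ K) p).card) v
    exact Finset.card_pos.mpr ⟨w, hstep p hpz w hw hwv⟩
  · intro y hy hyp
    refine (hbad y (hZY hy)).trans (Finset.card_le_card fun w hw => hstep y hy w hw ?_)
    rintro rfl
    have hyz := (hZm y).mp hy
    rw [mem_fnb] at hw
    rcases hn y (hZS hy) hw.2.2.symm (hF y hyz.1) with h1 | h1
    · exact hyp h1
    · subst h1; exact hl hyz.2.2

theorem Ok.insert_two {v p q : V} (h : Ok G S K c) (hKS : K ⊆ S) (hv : v ∉ S)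
    (hc : c v = false) (hpq : p ≠ q)
    (hn : ∀ w ∈ S, G.Adj v w → c w = false → w = p ∨ w = q)
    (hl : ¬ Linked G S K c p q) : Ok G (insert v S) K c := by
  refine ⟨insert_indep_F h.indep hc, fun Y hY hd hF hne => ?_⟩
  by_cases hvY : v ∈ Y
  · by_contra hcon
    push Not at hcon
    by_cases hpK : ∀ k ∈ K, c k = false → ¬ Linked G S K c p k
    · exact h.insert_two_aux hKS hv hc hpq hn hl hY hd hF hvY (fun y hy => hcon y hy) hpK
    · push Not at hpK
      obtain ⟨k, hk, ck, hlk⟩ := hpK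
      refine h.insert_two_aux hKS hv hc hpq.symm (fun w h1 h2 h3 => (hn w h1 h2 h3).symm)
        (fun h1 => hl h1.symm) hY hd hF hvY (fun y hy => hcon y hy) ?_
      intro k' hk' ck' hlk'
      apply hl
      refine hlk.trans (Linked.trans ?_ hlk'.symm)
      by_cases h1 : k = k'
      · subst h1; exact SimpleGraph.Reachable.refl _
      · exact SimpleGraph.Adj.reachable ⟨h1, hKS hk, hKS hk', ck, ck', Or.inr ⟨hk, hk'⟩⟩
  · refine h.super Y (fun y hy => ?_) hd hF hne
    rcases Finset.mem_insert.mp (hY hy) with rfl | h1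
    · exact absurd hy hvY
    · exact h1

theorem Ok.glue {A₁ A₂ K₂ : Finset V} {c₁ c₂ : V → Bool} (h₁ : Ok G A₁ K c₁) (h₂ : Ok G A₂ K₂ c₂)
    (hK : K ⊆ A₁) (hK₂ : A₁ ∩ A₂ = K₂) (hc : ∀ v ∈ K₂, c₂ v = c₁ v)
    (hE : ∀ a ∈ A₁, ∀ b ∈ A₂, G.Adj a b → a ∈ A₂ ∨ b ∈ A₁) :
    Ok G (A₁ ∪ A₂) K (fun v => if v ∈ A₁ then c₁ v else c₂ v) := by
  set c : V → Bool := fun v => if v ∈ A₁ then c₁ v else c₂ v with hcdef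
  have e1 : ∀ v ∈ A₁, c₁ v = c v := fun v hv => by simp [hcdef, hv]
  have e2 : ∀ v ∈ A₂, c₂ v = c v := by
    intro v hv
    by_cases h : v ∈ A₁
    · rw [← e1 v h]; exact hc v (by rw [← hK₂]; exact Finset.mem_inter.mpr ⟨h, hv⟩)
    · simp [hcdef, h]
  have hK₂' : K₂ ⊆ A₂ := by rw [← hK₂]; exact Finset.inter_subset_right
  have o1 := h₁.congr hK e1
  have o2 := h₂.congr hK₂' e2
  refine ⟨fun a ha b hb hab h1 => ?_, fun Y hY hd hF hne => ?_⟩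
  · rcases Finset.mem_union.mp ha with ha | ha <;> rcases Finset.mem_union.mp hb with hb | hb
    · exact o1.indep a ha b hb hab h1
    · rcases hE a ha b hb hab with h | h
      · exact o2.indep a h b hb hab h1
      · exact o1.indep a ha b h hab h1
    · rcases hE b hb a ha hab.symm with h | h
      · exact o2.indep a ha b h hab h1
      · exact o1.indep a h b hb hab h1
    · exact o2.indep a ha b hb hab h1
  · by_cases hY2 : ∃ y ∈ Y, y ∉ A₁
    · obtain ⟨y₀, hy₀, hy₀'⟩ := hY2
      have hm : ∀ y ∈ Y.filter (· ∉ A₁), y ∈ A₂ := fun y hy =>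
        (Finset.mem_union.mp (hY (Finset.mem_filter.mp hy).1)).resolve_left
          (Finset.mem_filter.mp hy).2
      obtain ⟨y, hy, hy1⟩ := o2.super (Y.filter (· ∉ A₁)) hm
        (by
          rw [Finset.disjoint_left]
          intro a ha hb
          rw [← hK₂] at hb
          exact (Finset.mem_filter.mp ha).2 (Finset.mem_inter.mp hb).1)
        (fun y hy => hF y (Finset.mem_filter.mp hy).1)
        ⟨y₀, Finset.mem_filter.mpr ⟨hy₀, hy₀'⟩⟩
      refine ⟨y, (Finset.mem_filter.mp hy).1, le_trans (Finset.card_le_card ?_) hy1⟩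
      intro w hw
      rw [mem_fnb, Finset.mem_union] at hw
      rw [mem_fnb, Finset.mem_union]
      refine ⟨?_, hw.2⟩
      by_cases hw1 : w ∈ A₁
      · right
        rw [← hK₂, Finset.mem_inter]
        exact ⟨hw1, (hE w hw1 y (hm y hy) hw.2.2.symm).resolve_right (Finset.mem_filter.mp hy).2⟩
      · left
        exact Finset.mem_filter.mpr ⟨hw.1.resolve_right (fun h => hw1 (hK h)), hw1⟩
    · push Not at hY2
      exact o1.super Y hY2 hd hF hne

end

section
open scoped Classical

variable {V : Type} {G : SimpleGraph V} {S K : Finset V} {c : V → Bool}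

/-- No cycles of length 4, 6 or 8. -/
def NoCyc (G : SimpleGraph V) : Prop :=
  ∀ u v (p : G.Walk u v), p.IsPath → G.Adj u v → p.length ≠ 3 ∧ p.length ≠ 5 ∧ p.length ≠ 7

/-- A cycle of length `k`, presented as a `k`-periodic sequence. -/
structure IsCyc (G : SimpleGraph V) (k : ℕ) (g : ℤ → V) : Prop where
  three_le : 3 ≤ k
  adj : ∀ i, G.Adj (g i) (g (i + 1))
  eq_iff : ∀ i j, g i = g j ↔ (k : ℤ) ∣ i - j

/-- The planar graphs without cycles of length 4, 6 or 8 (with planarity expressed by duality). -/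
def Nice [Fintype V] (G : SimpleGraph V) : Prop := HasDual G ∧ NoCyc G

/-- The vertex sets from which colorings are extended. -/
def Anchor (G : SimpleGraph V) (K : Finset V) : Prop :=
  K.card ≤ 1 ∨ ∃ k g, IsCyc G k g ∧ k ≤ 12 ∧ ∀ v, v ∈ K ↔ ∃ i, g i = v

/-- Every coloring of an anchor extends to `A`. -/
def Solvable (G : SimpleGraph V) (A : Finset V) : Prop :=
  ∀ K ⊆ A, Anchor G K → ∀ c₀ : V → Bool,
    (∀ a ∈ K, ∀ b ∈ K, G.Adj a b → c₀ a = true → c₀ b = false) →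
    ∃ c, (∀ v ∈ K, c v = c₀ v) ∧ Ok G A K c

theorem NoCyc.mono {H : SimpleGraph V} (hle : H ≤ G) (h : NoCyc G) : NoCyc H := by
  intro u v p hp huv
  have := h u v (p.mapLe hle) ((Walk.isPath_mapLe hle).mpr hp) (hle huv)
  simpa using this

theorem Nice.mono [Fintype V] {H : SimpleGraph V} (hle : H ≤ G) (h : Nice G) : Nice H :=
  ⟨h.1.mono hle, h.2.mono hle⟩

theorem noCyc_of_isCycle (h4 : ∀ v (w : G.Walk v v), w.IsCycle → w.length ≠ 4)
    (h6 : ∀ v (w : G.Walk v v), w.IsCycle → w.length ≠ 6)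
    (h8 : ∀ v (w : G.Walk v v), w.IsCycle → w.length ≠ 8) : NoCyc G := by
  intro u v p hp huv
  have key : p.length ≠ 1 → (Walk.cons huv.symm p).IsCycle := by
    intro h1
    rw [Walk.cons_isCycle_iff]
    refine ⟨hp, fun h => h1 (hp.length_eq_one_of_mem_edges (by rwa [Sym2.eq_swap]))⟩
  have l : (Walk.cons huv.symm p).length = p.length + 1 := rfl
  refine ⟨fun h => ?_, fun h => ?_, fun h => ?_⟩
  · exact h4 v _ (key (by omega)) (by omega)
  · exact h6 v _ (key (by omega)) (by omega)
  · exact h8 v _ (key (by omega)) (by omega)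

/-- The graph with `D` deleted and `p` merged into `q`. -/
def idGraph (G : SimpleGraph V) (D : Finset V) (p q : V) : SimpleGraph V where
  Adj a b := a ≠ b ∧ ∃ x y, x ∉ D ∧ y ∉ D ∧ G.Adj x y ∧
    (if x = p then q else x) = a ∧ (if y = p then q else y) = b
  symm := ⟨fun _ _ ⟨h, x, y, hx, hy, hxy, h1, h2⟩ => ⟨h.symm, y, x, hy, hx, hxy.symm, h2, h1⟩⟩
  loopless := ⟨fun _ h => h.1 rfl⟩

/-- The subgraph of edges inside `T`. -/
def res (G : SimpleGraph V) (T : Finset V) : SimpleGraph V where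
  Adj a b := G.Adj a b ∧ a ∈ T ∧ b ∈ T
  symm := ⟨fun _ _ h => ⟨h.1.symm, h.2.2, h.2.1⟩⟩
  loopless := ⟨fun _ h => G.loopless.irrefl _ h.1⟩

theorem res_le (T : Finset V) : res G T ≤ G := fun _ _ h => h.1

theorem idGraph_hasDual [Fintype V] (hG : HasDual G) {D T : Finset V} {p q : V} (hpD : p ∉ D)
    (hT : ∀ x ∈ T, x ∉ D → x = p ∨ x = q) (hpT : p ∈ T) (hqT : q ∈ T)
    (hreach : ∀ x ∈ T, (res G T).Reachable x q) : HasDual (idGraph G D p q) := by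
  have hpf : ∀ x, x ∉ D → (if x ∈ T then some q else if x ∈ D then none else some x) =
      some (if x = p then q else x) := by
    intro x hx
    by_cases h1 : x ∈ T
    · rcases hT x h1 hx with rfl | rfl
      · simp [hpT]
      · simp [hqT]
    · have : x ≠ p := fun h => h1 (h ▸ hpT)
      simp [h1, hx, this]
  refine hG.minor (fun x => if x ∈ T then some q else if x ∈ D then none else some x) ?_ ?_
  · have key : ∀ x v, (if x ∈ T then some q else if x ∈ D then none else some x) = some v →
        (v = q ∧ x ∈ T) ∨ (v ∉ T ∧ x = v) := by
      intro x v h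
      by_cases h1 : x ∈ T
      · simp only [h1, if_true, Option.some.injEq] at h
        exact Or.inl ⟨h.symm, h1⟩
      · by_cases h2 : x ∈ D
        · simp [h1, h2] at h
        · simp only [h1, h2, if_false, Option.some.injEq] at h
          exact Or.inr ⟨h ▸ h1, h⟩
    intro a b v ha hb
    rcases key a v ha with ⟨h1, h2⟩ | ⟨h1, h2⟩ <;> rcases key b v hb with ⟨h3, h4⟩ | ⟨h3, h4⟩
    · have hle : res G T ≤ fibreGraph G
          (fun x => if x ∈ T then some q else if x ∈ D then none else some x) := by
        intro x y hxy
        refine ⟨hxy.1, ?_⟩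
        simp [hxy.2.1, hxy.2.2]
      exact ((hreach a h2).mono hle).trans ((hreach b h4).mono hle).symm
    · exact absurd (h1 ▸ hqT) h3
    · exact absurd (h3 ▸ hqT) h1
    · rw [h2, h4]
  · rintro u v ⟨_, x, y, hx, hy, hxy, rfl, rfl⟩
    exact ⟨x, y, hpf x hx, hpf y hy, hxy⟩

theorem idGraph_adj_iff {D : Finset V} {p q a b : V} (ha : a ≠ q) (hb : b ≠ q)
    (h : (idGraph G D p q).Adj a b) : G.Adj a b ∧ a ∉ D ∧ b ∉ D ∧ a ≠ p ∧ b ≠ p := by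
  obtain ⟨hne, x, y, hx, hy, hxy, h1, h2⟩ := h
  by_cases hxp : x = p
  · simp only [hxp, if_true] at h1; exact absurd h1.symm ha
  · by_cases hyp : y = p
    · simp only [hyp, if_true] at h2; exact absurd h2.symm hb
    · simp only [hxp, hyp, if_false] at h1 h2
      subst h1; subst h2
      exact ⟨hxy, hx, hy, hxp, hyp⟩

theorem idGraph_adj_q {D : Finset V} {p q a : V} (h : (idGraph G D p q).Adj q a) :
    a ∉ D ∧ a ≠ p ∧ ((p ∉ D ∧ G.Adj p a) ∨ (q ∉ D ∧ G.Adj q a)) := by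
  obtain ⟨hne, x, y, hx, hy, hxy, h1, h2⟩ := h
  have hy' : y = a ∧ a ≠ p := by
    by_cases hyp : y = p
    · simp only [hyp, if_true] at h2; exact absurd h2 hne
    · simp only [hyp, if_false] at h2; exact ⟨h2, h2 ▸ hyp⟩
  refine ⟨hy'.1 ▸ hy, hy'.2, ?_⟩
  rw [hy'.1] at hxy
  by_cases hxp : x = p
  · left; exact hxp ▸ ⟨hx, hxy⟩
  · simp only [hxp, if_false] at h1
    right; exact h1 ▸ ⟨hx, hxy⟩

theorem idGraph_lift {D : Finset V} {p q : V} {a b : V} (w : (idGraph G D p q).Walk a b)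
    (hw : q ∉ w.support) (ha : a ∉ D) (hap : a ≠ p) :
    ∃ w' : G.Walk a b, w'.support = w.support ∧ w'.length = w.length ∧
      ∀ x ∈ w'.support, x ∉ D ∧ x ≠ p := by
  induction w with
  | nil => exact ⟨Walk.nil, rfl, rfl, by simp [ha, hap]⟩
  | @cons a e b h w ih =>
    rw [Walk.support_cons, List.mem_cons, not_or] at hw
    have heq : e ≠ q := fun h => hw.2 (h ▸ w.start_mem_support)
    have h1 := idGraph_adj_iff (Ne.symm hw.1) heq h
    obtain ⟨w', h2, h3, h4⟩ := ih hw.2 h1.2.2.1 h1.2.2.2.2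
    refine ⟨Walk.cons h1.1 w', by simp [h2], by simp [h3], ?_⟩
    intro x hx
    rw [Walk.support_cons, List.mem_cons] at hx
    rcases hx with rfl | hx
    · exact ⟨ha, hap⟩
    · exact h4 x hx

theorem idGraph_noCyc (hG : NoCyc G) {D : Finset V} {p q : V} (hpD : p ∉ D) (hqD : q ∉ D)
    (hpq : p ≠ q)
    (hno : ∀ w : G.Walk p q, w.IsPath → (∀ x ∈ w.support, x ∉ D) →
      w.length ≠ 1 ∧ w.length ≠ 2 ∧ w.length ≠ 4 ∧ w.length ≠ 6 ∧ w.length ≠ 8) :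
    NoCyc (idGraph G D p q) := by
  intro u v P hP huv
  by_cases hq : q ∈ P.support
  · have key : P.length = 3 ∨ P.length = 5 ∨ P.length = 7 → False := by
      intro hl
      have hC : (Walk.cons huv.symm P).IsCycle := by
        rw [Walk.cons_isCycle_iff]
        refine ⟨hP, fun h => ?_⟩
        have := hP.length_eq_one_of_mem_edges (by rwa [Sym2.eq_swap])
        omega
      have hqC : q ∈ (Walk.cons huv.symm P).support := by simp [hq]
      have hR := hC.rotate hqC
      have hRl : ((Walk.cons huv.symm P).rotate q hqC).length = P.length + 1 := by
        rw [Walk.length_rotate]; rfl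
      generalize (Walk.cons huv.symm P).rotate q hqC = R at hR hRl
      cases R with
      | nil => simp at hRl
      | @cons _ x _ hqx R₁ =>
        rw [Walk.cons_isCycle_iff] at hR
        have hR1 : R₁.reverse.IsPath := hR.1.reverse
        have hR1l : R₁.reverse.length = P.length := by simpa using hRl
        generalize R₁.reverse = R₂ at hR1 hR1l
        cases R₂ with
        | nil => simp at hR1l; omega
        | @cons _ y _ hqy R₃ =>
          rw [Walk.cons_isPath_iff] at hR1
          have hR3l : R₃.length + 1 = P.length := by simpa using hR1l
          obtain ⟨yD, yp, hy⟩ := idGraph_adj_q hqy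
          obtain ⟨xD, xp, hx⟩ := idGraph_adj_q hqx
          obtain ⟨w, w1, w2, w3⟩ := idGraph_lift R₃ hR1.2 yD yp
          have hwp : w.IsPath := by rw [Walk.isPath_def, w1]; exact hR1.1.support_nodup
          have hqw : q ∉ w.support := by rw [w1]; exact hR1.2
          have hpw : p ∉ w.support := fun h => (w3 p h).2 rfl
          have e1 : ∀ z, z ∉ w.support → G.Adj z y → G.Adj z x → False := by
            intro z hz h1 h2
            have := hG z x (Walk.cons h1 w) (by rw [Walk.cons_isPath_iff]; exact ⟨hwp, hz⟩) h2
            rw [Walk.length_cons] at this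
            omega
          have e2 : ∀ (z : G.Walk p q), z.IsPath → (∀ x ∈ z.support, x ∉ D) →
              z.length = w.length + 2 → False := by
            intro z h1 h2 h3
            have := hno z h1 h2
            omega
          rcases hy with ⟨_, hy⟩ | ⟨_, hy⟩ <;> rcases hx with ⟨_, hx⟩ | ⟨_, hx⟩
          · exact e1 p hpw hy hx
          · have hpath : (w.concat hx.symm).IsPath := by
              rw [Walk.concat_isPath_iff]; exact ⟨hwp, hqw⟩
            refine e2 (Walk.cons hy (w.concat hx.symm)) ?_ ?_ ?_
            · rw [Walk.cons_isPath_iff]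
              refine ⟨hpath, ?_⟩
              rw [Walk.support_concat]
              simp [hpw, hpq]
            · intro z hz
              rw [Walk.support_cons, Walk.support_concat] at hz
              simp only [List.concat_eq_append, List.mem_cons, List.mem_append, List.not_mem_nil,
                or_false] at hz
              rcases hz with rfl | hz | rfl
              · exact hpD
              · exact (w3 z hz).1
              · exact hqD
            · simp
          · have hpath : (w.reverse.concat hy.symm).IsPath := by
              rw [Walk.concat_isPath_iff]; exact ⟨hwp.reverse, by simpa using hqw⟩
            refine e2 (Walk.cons hx (w.reverse.concat hy.symm)) ?_ ?_ ?_
            · rw [Walk.cons_isPath_iff]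
              refine ⟨hpath, ?_⟩
              rw [Walk.support_concat]
              simp [hpw, hpq]
            · intro z hz
              rw [Walk.support_cons, Walk.support_concat] at hz
              simp only [List.concat_eq_append, List.mem_cons, List.mem_append, List.not_mem_nil,
                or_false, Walk.support_reverse, List.mem_reverse] at hz
              rcases hz with rfl | hz | rfl
              · exact hpD
              · exact (w3 z hz).1
              · exact hqD
            · simp
          · exact e1 q hqw hy hx
    refine ⟨fun h => key (Or.inl h), fun h => key (Or.inr (Or.inl h)),
      fun h => key (Or.inr (Or.inr h))⟩
  · have hu : u ≠ q := fun h => hq (h ▸ P.start_mem_support)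
    have hv : v ≠ q := fun h => hq (h ▸ P.end_mem_support)
    have h1 := idGraph_adj_iff hu hv huv
    obtain ⟨w, w1, w2, w3⟩ := idGraph_lift P hq h1.2.1 h1.2.2.2.1
    have := hG u v w (by rw [Walk.isPath_def, w1]; exact hP.support_nodup) h1.1
    rwa [w2] at this

end

section
open scoped Classical

variable {V : Type} {G : SimpleGraph V} {S K : Finset V} {c : V → Bool}

theorem path_inner {H : SimpleGraph V} {a b y : V} (w : H.Walk a b) (hw : w.IsPath)
    (hy : y ∈ w.support) (hya : y ≠ a) (hyb : y ≠ b) :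
    ∃ x z, x ∈ w.support ∧ z ∈ w.support ∧ x ≠ z ∧ H.Adj y x ∧ H.Adj y z := by
  obtain ⟨n, hn, hnl⟩ := Walk.mem_support_iff_exists_getVert.mp hy
  have h0 : n ≠ 0 := by rintro rfl; exact hya (by rw [← hn, Walk.getVert_zero])
  have h1 : n ≠ w.length := by rintro rfl; exact hyb (by rw [← hn, Walk.getVert_length])
  obtain ⟨m, rfl⟩ := Nat.exists_eq_succ_of_ne_zero h0
  have a1 := w.adj_getVert_succ (i := m) (by omega)
  have a2 := w.adj_getVert_succ (i := m + 1) (by omega)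
  rw [Nat.succ_eq_add_one] at hn
  rw [hn] at a1 a2
  refine ⟨w.getVert m, w.getVert (m + 1 + 1), w.getVert_mem_support _, w.getVert_mem_support _,
    fun h => ?_, a1.symm, a2⟩
  have := hw.getVert_injOn (show m ≤ w.length by omega) (show m + 1 + 1 ≤ w.length by omega) h
  omega

theorem path_start {H : SimpleGraph V} {a b : V} (w : H.Walk a b) (hab : a ≠ b) :
    ∃ x ∈ w.support, H.Adj a x := by
  cases w with
  | nil => exact absurd rfl hab
  | @cons _ x _ h w => exact ⟨x, by simp, h⟩

/-- A path in the link graph gives a set without low-degree vertices, except at the ends. -/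
theorem Linked.exists_set {p q : V} (h : Linked G S K c p q) (hpq : p ≠ q) (hpK : p ∉ K) :
    ∃ Y ⊆ S, Disjoint Y K ∧ (∀ y ∈ Y, c y = false) ∧ p ∈ Y ∧
      (∃ w ∈ Y ∪ K, c w = false ∧ G.Adj p w) ∧
      (q ∉ K → ∃ w ∈ Y ∪ K, c w = false ∧ G.Adj q w) ∧
      ∀ y ∈ Y, y ≠ p → y ≠ q → 2 ≤ (fnb G c (Y ∪ K) y).card := by
  obtain ⟨w₀⟩ := h
  obtain ⟨w, hw⟩ : ∃ w : (linkGraph G S K c).Walk p q, w.IsPath :=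
    ⟨w₀.toPath, w₀.toPath.2⟩
  have hU : ∀ x, x ∈ w.support.toFinset \ K ∪ K ↔ x ∈ w.support ∨ x ∈ K := by
    intro x
    by_cases hx : x ∈ K <;> simp [hx]
  have hS : ∀ x ∈ w.support, x ∈ S ∧ c x = false := by
    intro x hx
    by_cases hxq : x = q
    · obtain ⟨y, _, hy⟩ := path_start w.reverse hpq.symm
      rw [hxq]; exact ⟨hy.2.1, hy.2.2.2.1⟩
    · by_cases hxp : x = p
      · obtain ⟨y, _, hy⟩ := path_start w hpq
        rw [hxp]; exact ⟨hy.2.1, hy.2.2.2.1⟩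
      · obtain ⟨y, _, _, _, _, hy, _⟩ := path_inner w hw hx hxp hxq
        exact ⟨hy.2.1, hy.2.2.2.1⟩
  have hadj : ∀ x y, (linkGraph G S K c).Adj x y → x ∉ K → G.Adj x y := fun x y h hx =>
    h.2.2.2.2.2.resolve_right (fun h1 => hx h1.1)
  refine ⟨w.support.toFinset \ K, ?_, Finset.sdiff_disjoint, ?_, ?_, ?_, ?_, ?_⟩
  · intro x hx
    simp only [Finset.mem_sdiff, List.mem_toFinset] at hx
    exact (hS x hx.1).1
  · intro x hx
    simp only [Finset.mem_sdiff, List.mem_toFinset] at hx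
    exact (hS x hx.1).2
  · simp [hpK]
  · obtain ⟨y, hy, hpy⟩ := path_start w hpq
    exact ⟨y, (hU y).mpr (Or.inl hy), (hS y hy).2, hadj _ _ hpy hpK⟩
  · intro hqK
    obtain ⟨y, hy, hqy⟩ := path_start w.reverse hpq.symm
    have hy' : y ∈ w.support := by simpa using hy
    exact ⟨y, (hU y).mpr (Or.inl hy'), (hS y hy').2, hadj _ _ hqy hqK⟩
  · intro y hy hyp hyq
    simp only [Finset.mem_sdiff, List.mem_toFinset] at hy
    obtain ⟨x, z, hx, hz, hxz, h1, h2⟩ := path_inner w hw hy.1 hyp hyq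
    apply Finset.one_lt_card.mpr
    refine ⟨x, ?_, z, ?_, hxz⟩
    · rw [mem_fnb, hU]; exact ⟨Or.inl hx, (hS x hx).2, hadj _ _ h1 hy.2⟩
    · rw [mem_fnb, hU]; exact ⟨Or.inl hz, (hS z hz).2, hadj _ _ h2 hy.2⟩

theorem idGraph_super_aux {A D Y : Finset V} {p q : V} {c' : V → Bool}
    (hs : Super (idGraph G D p q) ((A \ D).erase p) K c')
    (hc : ∀ v, c v = c' (if v = p then q else v))
    (hKS : K ⊆ A \ D) (hpK : p ∉ K) (hp : p ∈ A \ D) (hq : q ∈ A \ D) (hpq : p ≠ q)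
    (hadj : ¬ G.Adj p q) (hcom : ∀ y ∈ A \ D, G.Adj p y → ¬ G.Adj q y)
    (hY : Y ⊆ A \ D) (hF : ∀ y ∈ Y, c y = false)
    (hne : ∃ y ∈ Y, (if y = p then q else y) ∉ K)
    (h1 : ∀ y ∈ Y, y ≠ p → y ≠ q → 2 ≤ (fnb G c (Y ∪ K) y).card)
    (h2 : q ∉ K → p ∈ Y ∨ q ∈ Y → ∃ w ∈ Y ∪ K, ∃ w' ∈ Y ∪ K, w ≠ w' ∧ c w = false ∧ c w' = false ∧
      (G.Adj p w ∨ G.Adj q w) ∧ (G.Adj p w' ∨ G.Adj q w')) : False := by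
  set φ : V → V := fun x => if x = p then q else x with hφ
  have hUS : Y ∪ K ⊆ A \ D := Finset.union_subset hY hKS
  have hnD : ∀ x ∈ A \ D, x ∉ D := fun x hx => (Finset.mem_sdiff.mp hx).2
  have hφU : ∀ x ∈ Y ∪ K, φ x ∈ (Y.image φ \ K) ∪ K := by
    intro x hx
    by_cases h : φ x ∈ K
    · exact Finset.mem_union_right _ h
    · refine Finset.mem_union_left _ (Finset.mem_sdiff.mpr ⟨?_, h⟩)
      rcases Finset.mem_union.mp hx with h3 | h3
      · exact Finset.mem_image_of_mem _ h3
      · exfalso; apply h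
        have : x ≠ p := fun h => hpK (h ▸ h3)
        simpa [hφ, this] using h3
  have hcφ : ∀ x, c' (φ x) = c x := fun x => (hc x).symm
  have hadjφ : ∀ x ∈ A \ D, ∀ y ∈ A \ D, G.Adj x y → φ x ≠ φ y → (idGraph G D p q).Adj (φ x) (φ y) :=
    fun x hx y hy hxy hne => ⟨hne, x, y, hnD x hx, hnD y hy, hxy, rfl, rfl⟩
  have hφp : φ p = q := by simp [hφ]
  have hφn : ∀ x, x ≠ p → φ x = x := fun x hx => by simp [hφ, hx]
  have hφne : ∀ x y, G.Adj x y → φ x ≠ φ y := by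
    intro x y hxy h
    by_cases hx : x = p <;> by_cases hy : y = p
    · subst hx; subst hy; exact hxy.ne rfl
    · rw [hx, hφp, hφn y hy] at h; subst h; subst hx; exact hadj hxy
    · rw [hy, hφp, hφn x hx] at h; subst h; subst hy; exact hadj hxy.symm
    · rw [hφn x hx, hφn y hy] at h; exact hxy.ne h
  obtain ⟨z, hz, hz1⟩ : ∃ z ∈ Y.image φ \ K,
      (fnb (idGraph G D p q) c' (Y.image φ \ K ∪ K) z).card ≤ 1 := by
    refine hs (Y.image φ \ K) ?_ Finset.sdiff_disjoint ?_ ?_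
    · intro z hz
      rw [Finset.mem_sdiff, Finset.mem_image] at hz
      obtain ⟨⟨y, hy, rfl⟩, -⟩ := hz
      by_cases h : y = p
      · rw [h, hφp]; exact Finset.mem_erase.mpr ⟨hpq.symm, hq⟩
      · rw [hφn y h]; exact Finset.mem_erase.mpr ⟨h, hY hy⟩
    · intro z hz
      rw [Finset.mem_sdiff, Finset.mem_image] at hz
      obtain ⟨⟨y, hy, rfl⟩, -⟩ := hz
      rw [hcφ]; exact hF y hy
    · obtain ⟨y, hy, hyK⟩ := hne
      exact ⟨φ y, Finset.mem_sdiff.mpr ⟨Finset.mem_image_of_mem _ hy, hyK⟩⟩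
  rw [Finset.mem_sdiff, Finset.mem_image] at hz
  obtain ⟨⟨y, hy, rfl⟩, hzK⟩ := hz
  have hgoal : ∀ w ∈ Y ∪ K, ∀ w' ∈ Y ∪ K, φ w ≠ φ w' → c w = false → c w' = false →
      (idGraph G D p q).Adj (φ y) (φ w) → (idGraph G D p q).Adj (φ y) (φ w') → False := by
    intro w hw w' hw' hne hcw hcw' ha ha'
    have : 2 ≤ (fnb (idGraph G D p q) c' (Y.image φ \ K ∪ K) (φ y)).card := by
      apply Finset.one_lt_card.mpr
      refine ⟨φ w, ?_, φ w', ?_, hne⟩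
      · rw [mem_fnb]; exact ⟨hφU w hw, by rw [hcφ]; exact hcw, ha⟩
      · rw [mem_fnb]; exact ⟨hφU w' hw', by rw [hcφ]; exact hcw', ha'⟩
    omega
  by_cases hypq : y = p ∨ y = q
  · have hφy : φ y = q := by
      rcases hypq with rfl | rfl
      · exact hφp
      · exact hφn y hpq.symm
    rw [hφy] at hzK
    obtain ⟨w, hw, w', hw', hww', cw, cw', ha, ha'⟩ := h2 hzK
      (by rcases hypq with h | h
          · exact Or.inl (h ▸ hy)
          · exact Or.inr (h ▸ hy))
    have hkey : ∀ w ∈ Y ∪ K, (G.Adj p w ∨ G.Adj q w) → w ≠ p ∧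
        (idGraph G D p q).Adj (φ y) (φ w) := by
      intro w hw h
      have hwp : w ≠ p := by
        rintro rfl
        exact h.elim (fun h => h.ne rfl) (fun h => hadj h.symm)
      refine ⟨hwp, ?_⟩
      rw [hφy]
      rcases h with h | h
      · have := hadjφ p hp w (hUS hw) h (hφne _ _ h)
        rwa [hφp] at this
      · have := hadjφ q hq w (hUS hw) h (hφne _ _ h)
        rwa [hφn q hpq.symm] at this
    have k1 := hkey w hw ha
    have k2 := hkey w' hw' ha'
    exact hgoal w hw w' hw' (by rw [hφn w k1.1, hφn w' k2.1]; exact hww') cw cw' k1.2 k2.2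
  · rw [not_or] at hypq
    obtain ⟨w, hw, w', hw', hww'⟩ := Finset.one_lt_card.mp (h1 y hy hypq.1 hypq.2)
    rw [mem_fnb] at hw hw'
    refine hgoal w hw.1 w' hw'.1 ?_ hw.2.1 hw'.2.1
      (hadjφ y (hY hy) w (hUS hw.1) hw.2.2 (hφne _ _ hw.2.2))
      (hadjφ y (hY hy) w' (hUS hw'.1) hw'.2.2 (hφne _ _ hw'.2.2))
    intro h
    by_cases hx : w = p <;> by_cases hy' : w' = p
    · exact hww' (hx.trans hy'.symm)
    · rw [hx, hφp, hφn w' hy'] at h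
      subst h; subst hx
      exact hcom y (hY hy) hw.2.2.symm hw'.2.2.symm
    · rw [hy', hφp, hφn w hx] at h
      subst h; subst hy'
      exact hcom y (hY hy) hw'.2.2.symm hw.2.2.symm
    · rw [hφn w hx, hφn w' hy'] at h; exact hww' h

theorem Anchor.of_adj {G' : SimpleGraph V} (h : Anchor G K)
    (hadj : ∀ a ∈ K, ∀ b ∈ K, G.Adj a b → G'.Adj a b) : Anchor G' K := by
  rcases h with h | ⟨k, g, hg, hk, hK⟩
  · exact Or.inl h
  · exact Or.inr ⟨k, g, ⟨hg.three_le, fun i => hadj _ ((hK _).mpr ⟨_, rfl⟩) _ ((hK _).mpr ⟨_, rfl⟩)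
      (hg.adj i), hg.eq_iff⟩, hk, hK⟩

/-- Deleting `D` and identifying `p` with `q`. -/
theorem exists_identified [Fintype V] {A D T : Finset V} {p q : V} (hG : Nice G)
    (ih : ∀ G' (A' : Finset V), Nice G' → A'.card < A.card → Solvable G' A')
    (hKA : K ⊆ A \ D) (hanch : Anchor G K) (c₀ : V → Bool)
    (hc₀ : ∀ a ∈ K, ∀ b ∈ K, G.Adj a b → c₀ a = true → c₀ b = false)
    (hp : p ∈ A \ D) (hq : q ∈ A \ D) (hpq : p ≠ q) (hpK : p ∉ K)
    (hqK : q ∈ K → ∀ x ∈ K, ¬ G.Adj p x)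
    (hT : ∀ x ∈ T, x ∉ D → x = p ∨ x = q) (hpT : p ∈ T) (hqT : q ∈ T)
    (hreach : ∀ x ∈ T, (res G T).Reachable x q)
    (hno : ∀ w : G.Walk p q, w.IsPath → (∀ x ∈ w.support, x ∉ D) →
      w.length ≠ 1 ∧ w.length ≠ 2 ∧ w.length ≠ 4 ∧ w.length ≠ 6 ∧ w.length ≠ 8) :
    ∃ c, (∀ v ∈ K, c v = c₀ v) ∧ Ok G (A \ D) K c ∧ c p = c q ∧
      (c p = false → ¬ Linked G (A \ D) K c p q) := by
  have hnD : ∀ x ∈ A \ D, x ∉ D := fun x hx => (Finset.mem_sdiff.mp hx).2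
  have hpD := hnD p hp
  have hqD := hnD q hq
  have hadj : ¬ G.Adj p q := by
    intro h
    have := hno (Walk.cons h Walk.nil) (by simp [hpq]) (by simp [hpD, hqD])
    simp at this
  have hcom : ∀ y ∈ A \ D, G.Adj p y → ¬ G.Adj q y := by
    intro y hy h1 h2
    have := hno (Walk.cons h1 (Walk.cons h2.symm Walk.nil))
      (by simp [hpq, h1.ne, h2.ne.symm]) (by simp [hpD, hqD, hnD y hy])
    simp at this
  have hGn : Nice (idGraph G D p q) :=
    ⟨idGraph_hasDual hG.1 hpD hT hpT hqT hreach, idGraph_noCyc hG.2 hpD hqD hpq hno⟩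
  have hcard : ((A \ D).erase p).card < A.card := by
    rw [Finset.card_erase_of_mem hp]
    have h1 := Finset.card_le_card (Finset.sdiff_subset : A \ D ⊆ A)
    have h2 := Finset.card_pos.mpr ⟨p, hp⟩
    omega
  have hKS : K ⊆ (A \ D).erase p := fun x hx =>
    Finset.mem_erase.mpr ⟨fun h => hpK (h ▸ hx), hKA hx⟩
  have hanch' : Anchor (idGraph G D p q) K := by
    refine hanch.of_adj fun a ha b hb hab => ?_
    have h1 : a ≠ p := fun h => hpK (h ▸ ha)
    have h2 : b ≠ p := fun h => hpK (h ▸ hb)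
    exact ⟨hab.ne, a, b, hnD a (hKA ha), hnD b (hKA hb), hab, by simp [h1], by simp [h2]⟩
  have hc₀' : ∀ a ∈ K, ∀ b ∈ K, (idGraph G D p q).Adj a b → c₀ a = true → c₀ b = false := by
    intro a ha b hb hab h1
    have key : ∀ a ∈ K, ∀ b ∈ K, (idGraph G D p q).Adj a b → G.Adj a b := by
      intro a ha b hb hab
      by_cases haq : a = q
      · subst haq
        obtain ⟨_, _, h3⟩ := idGraph_adj_q hab
        exact (h3.resolve_left (fun h => hqK ha b hb h.2)).2
      · by_cases hbq : b = q
        · subst hbq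
          obtain ⟨_, _, h3⟩ := idGraph_adj_q hab.symm
          exact (h3.resolve_left (fun h => hqK hb a ha h.2)).2.symm
        · exact (idGraph_adj_iff haq hbq hab).1
    exact hc₀ a ha b hb (key a ha b hb hab) h1
  obtain ⟨c', hc'K, hok⟩ := ih _ _ hGn hcard K hKS hanch' c₀ hc₀'
  set c : V → Bool := fun v => c' (if v = p then q else v) with hc
  have hcv : ∀ v, c v = c' (if v = p then q else v) := fun v => rfl
  have hcn : ∀ v, v ≠ p → c v = c' v := fun v hv => by simp [hc, hv]
  have hcp : c p = c q := by simp [hc, hpq.symm]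
  refine ⟨c, ?_, ⟨?_, ?_⟩, hcp, ?_⟩
  · intro v hv
    rw [hcn v (fun h => hpK (h ▸ hv)), hc'K v hv]
  · intro a ha b hb hab h1
    have hm : ∀ a ∈ A \ D, (if a = p then q else a) ∈ (A \ D).erase p := by
      intro a ha
      by_cases h : a = p
      · simp only [h, if_true]; exact Finset.mem_erase.mpr ⟨hpq.symm, hq⟩
      · simp only [h, if_false]; exact Finset.mem_erase.mpr ⟨h, ha⟩
    rw [hcv] at h1 ⊢
    refine hok.indep _ (hm a ha) _ (hm b hb) ⟨?_, a, b, hnD a ha, hnD b hb, hab, rfl, rfl⟩ h1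
    intro h
    by_cases hx : a = p <;> by_cases hy : b = p
    · subst hx; subst hy; exact hab.ne rfl
    · simp only [hx, hy, if_true, if_false] at h; subst h; subst hx; exact hadj hab
    · simp only [hx, hy, if_true, if_false] at h; subst h; subst hy; exact hadj hab.symm
    · simp only [hx, hy, if_false] at h; exact hab.ne h
  · intro Y hY hd hF hne
    by_contra hbad
    push Not at hbad
    have hbad' : ∀ y ∈ Y, 2 ≤ (fnb G c (Y ∪ K) y).card := fun y hy => hbad y hy
    refine idGraph_super_aux hok.super hcv hKA hpK hp hq hpq hadj hcom hY hF ?_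
      (fun y hy _ _ => hbad' y hy) ?_
    · by_contra h
      push Not at h
      have hall : ∀ y ∈ Y, y = p := by
        intro y hy
        by_contra hyp
        have := h y hy
        rw [if_neg hyp] at this
        exact Finset.disjoint_left.mp hd hy this
      obtain ⟨y, hy⟩ := hne
      have hyp := hall y hy
      subst hyp
      have hqK' : q ∈ K := by simpa using h y hy
      obtain ⟨w, hw, -⟩ := Finset.one_lt_card.mp (hbad' y hy)
      rw [mem_fnb, Finset.mem_union] at hw
      rcases hw.1 with h3 | h3
      · exact hw.2.2.ne (hall w h3).symm
      · exact hqK hqK' w h3 hw.2.2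
    · intro hqK' hpqY
      rcases hpqY with h | h
      · obtain ⟨w, hw, w', hw', hne⟩ := Finset.one_lt_card.mp (hbad' p h)
        rw [mem_fnb] at hw hw'
        exact ⟨w, hw.1, w', hw'.1, hne, hw.2.1, hw'.2.1, Or.inl hw.2.2, Or.inl hw'.2.2⟩
      · obtain ⟨w, hw, w', hw', hne⟩ := Finset.one_lt_card.mp (hbad' q h)
        rw [mem_fnb] at hw hw'
        exact ⟨w, hw.1, w', hw'.1, hne, hw.2.1, hw'.2.1, Or.inr hw.2.2, Or.inr hw'.2.2⟩
  · intro _ hl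
    obtain ⟨Y, hY, hd, hF, hpY, ⟨w, hw, cw, hpw⟩, hqw, h2⟩ := hl.exists_set hpq hpK
    refine idGraph_super_aux hok.super hcv hKA hpK hp hq hpq hadj hcom hY hF ?_ h2 ?_
    · by_cases hqK' : q ∈ K
      · have hwK : w ∉ K := fun h => hqK hqK' w h hpw
        refine ⟨w, (Finset.mem_union.mp hw).resolve_right hwK, ?_⟩
        rw [if_neg hpw.ne.symm]; exact hwK
      · exact ⟨p, hpY, by simpa using hqK'⟩
    · intro hqK' _
      obtain ⟨w', hw', cw', hqw'⟩ := hqw hqK'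
      refine ⟨w, hw, w', hw', ?_, cw, cw', Or.inl hpw, Or.inr hqw'⟩
      rintro rfl
      exact hcom w (Finset.union_subset hY hKA hw) hpw hqw'

end

section
open scoped Classical

variable {V : Type} {G : SimpleGraph V} {S K : Finset V} {c : V → Bool}

theorem Linked.congr {c' : V → Bool} (hc : ∀ v ∈ S, c v = c' v) {a b : V}
    (h : Linked G S K c a b) : Linked G S K c' a b := by
  refine SimpleGraph.Reachable.mono ?_ h
  rintro x y ⟨h1, h2, h3, h4, h5, h6⟩
  exact ⟨h1, h2, h3, by rw [← hc x h2]; exact h4, by rw [← hc y h3]; exact h5, h6⟩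

theorem exists_recolor {a b d e : V} (ha : a ∉ S) (hb : b ∉ S) (hd : d ∉ S) (he : e ∉ S)
    (hab : a ≠ b) (had : a ≠ d) (hae : a ≠ e) (hbd : b ≠ d) (hbe : b ≠ e) (hde : d ≠ e)
    (c : V → Bool) (x y z w : Bool) : ∃ c' : V → Bool, (∀ v ∈ S, c v = c' v) ∧
      c' a = x ∧ c' b = y ∧ c' d = z ∧ c' e = w := by
  refine ⟨fun v => if v = a then x else if v = b then y else if v = d then z else
    if v = e then w else c v, ?_, ?_, ?_, ?_, ?_⟩
  · intro v hv
    have h1 : v ≠ a := fun h => ha (h ▸ hv)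
    have h2 : v ≠ b := fun h => hb (h ▸ hv)
    have h3 : v ≠ d := fun h => hd (h ▸ hv)
    have h4 : v ≠ e := fun h => he (h ▸ hv)
    simp [h1, h2, h3, h4]
  all_goals simp [*, Ne.symm hab, Ne.symm had, Ne.symm hae, Ne.symm hbd, Ne.symm hbe, Ne.symm hde]

theorem Ok.cast {S' : Finset V} (h : Ok G S K c) (hS : ∀ v, v ∈ S ↔ v ∈ S') : Ok G S' K c := by
  have : S = S' := Finset.ext hS
  rwa [← this]

set_option maxHeartbeats 4000000 in
/-- Extending a coloring to the four 3-vertices of a tetrad. -/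
theorem tetrad_ext {A : Finset V} {v₀ v₁ v₂ v₃ v₄ v₅ t s : V} {c₁ : V → Bool}
    (hok : Ok G S K c₁) (hKS : K ⊆ S)
    (hA : ∀ v, v ∈ A ↔ v ∈ S ∨ v = v₁ ∨ v = v₂ ∨ v = v₃ ∨ v = v₄)
    (h1 : v₁ ∉ S) (h2 : v₂ ∉ S) (h3 : v₃ ∉ S) (h4 : v₄ ∉ S)
    (h12 : v₁ ≠ v₂) (h13 : v₁ ≠ v₃) (h14 : v₁ ≠ v₄) (h23 : v₂ ≠ v₃) (h24 : v₂ ≠ v₄) (h34 : v₃ ≠ v₄)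
    (s0 : v₀ ∈ S) (s5 : v₅ ∈ S) (st : t ∈ S) (ss : s ∈ S) (h0t : v₀ ≠ t) (hts : t ≠ s)
    (n1 : ∀ w, G.Adj v₁ w → w = v₀ ∨ w = v₂ ∨ w = t)
    (n2 : ∀ w, G.Adj v₂ w → w = v₁ ∨ w = v₃ ∨ w = t)
    (n3 : ∀ w, G.Adj v₃ w → w = v₂ ∨ w = v₄ ∨ w = s)
    (n4 : ∀ w, G.Adj v₄ w → w = v₃ ∨ w = v₅ ∨ w = s)
    (hc : c₁ v₀ = c₁ s) (hl : c₁ v₀ = false → ¬ Linked G S K c₁ v₀ s) :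
    ∃ c, (∀ v ∈ S, c₁ v = c v) ∧ Ok G A K c := by
  have hrec := exists_recolor (S := S) h1 h2 h3 h4 h12 h13 h14 h23 h24 h34 c₁
  have hsub : ∀ (T : Finset V) (v : V), K ⊆ T → K ⊆ insert v T := fun T v h =>
    h.trans (Finset.subset_insert _ _)
  by_cases a0 : c₁ v₀ = true
  · by_cases at' : c₁ t = true
    · obtain ⟨c, hcc, e1, e2, e3, e4⟩ := hrec false false false false
      refine ⟨c, hcc, ?_⟩
      have k0 := hcc _ s0; have k5 := hcc _ s5; have kt := hcc _ st; have ks := hcc _ ss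
      have o := hok.congr hKS hcc
      have o4 := o.insert_leaf (v := v₄) hKS h4 e4 v₅
        (by intro w hw ha hw'; rcases n4 w ha with rfl | rfl | rfl <;> grind)
      have o3 := o4.insert_leaf (v := v₃) (hsub _ _ hKS) (by grind) e3 v₄
        (by intro w hw ha hw'; rcases n3 w ha with rfl | rfl | rfl <;> grind)
      have o2 := o3.insert_leaf (v := v₂) (hsub _ _ (hsub _ _ hKS)) (by grind) e2 v₃
        (by intro w hw ha hw'; rcases n2 w ha with rfl | rfl | rfl <;> grind)
      have o1 := o2.insert_leaf (v := v₁) (hsub _ _ (hsub _ _ (hsub _ _ hKS))) (by grind) e1 v₂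
        (by intro w hw ha hw'; rcases n1 w ha with rfl | rfl | rfl <;> grind)
      exact o1.cast (fun v => by rw [hA]; simp only [Finset.mem_insert]; tauto)
    · obtain ⟨c, hcc, e1, e2, e3, e4⟩ := hrec false true false false
      refine ⟨c, hcc, ?_⟩
      have k0 := hcc _ s0; have k5 := hcc _ s5; have kt := hcc _ st; have ks := hcc _ ss
      have o := hok.congr hKS hcc
      have o4 := o.insert_leaf (v := v₄) hKS h4 e4 v₅
        (by intro w hw ha hw'; rcases n4 w ha with rfl | rfl | rfl <;> grind)
      have o3 := o4.insert_leaf (v := v₃) (hsub _ _ hKS) (by grind) e3 v₄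
        (by intro w hw ha hw'; rcases n3 w ha with rfl | rfl | rfl <;> grind)
      have o1 := o3.insert_leaf (v := v₁) (hsub _ _ (hsub _ _ hKS)) (by grind) e1 t
        (by intro w hw ha hw'; rcases n1 w ha with rfl | rfl | rfl <;> grind)
      have o2 := o1.insert_I (v := v₂) (hsub _ _ (hsub _ _ (hsub _ _ hKS))) (by grind) e2
        (by intro w hw ha; rcases n2 w ha with rfl | rfl | rfl <;> grind)
      exact o2.cast (fun v => by rw [hA]; simp only [Finset.mem_insert]; tauto)
  · have a0' : c₁ v₀ = false := by simpa using a0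
    have hl' := hl a0'
    by_cases at' : c₁ t = true
    · by_cases a5 : c₁ v₅ = true
      · obtain ⟨c, hcc, e1, e2, e3, e4⟩ := hrec false false true false
        refine ⟨c, hcc, ?_⟩
        have k0 := hcc _ s0; have k5 := hcc _ s5; have kt := hcc _ st; have ks := hcc _ ss
        have o := hok.congr hKS hcc
        have o4 := o.insert_leaf (v := v₄) hKS h4 e4 s
          (by intro w hw ha hw'; rcases n4 w ha with rfl | rfl | rfl <;> grind)
        have o1 := o4.insert_leaf (v := v₁) (hsub _ _ hKS) (by grind) e1 v₀
          (by intro w hw ha hw'; rcases n1 w ha with rfl | rfl | rfl <;> grind)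
        have o2 := o1.insert_leaf (v := v₂) (hsub _ _ (hsub _ _ hKS)) (by grind) e2 v₁
          (by intro w hw ha hw'; rcases n2 w ha with rfl | rfl | rfl <;> grind)
        have o3 := o2.insert_I (v := v₃) (hsub _ _ (hsub _ _ (hsub _ _ hKS))) (by grind) e3
          (by intro w hw ha; rcases n3 w ha with rfl | rfl | rfl <;> grind)
        exact o3.cast (fun v => by rw [hA]; simp only [Finset.mem_insert]; tauto)
      · obtain ⟨c, hcc, e1, e2, e3, e4⟩ := hrec false false false true
        refine ⟨c, hcc, ?_⟩
        have k0 := hcc _ s0; have k5 := hcc _ s5; have kt := hcc _ st; have ks := hcc _ ss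
        have o := hok.congr hKS hcc
        have o1 := o.insert_leaf (v := v₁) hKS (by grind) e1 v₀
          (by intro w hw ha hw'; rcases n1 w ha with rfl | rfl | rfl <;> grind)
        have o2 := o1.insert_leaf (v := v₂) (hsub _ _ hKS) (by grind) e2 v₁
          (by intro w hw ha hw'; rcases n2 w ha with rfl | rfl | rfl <;> grind)
        have hnl : ¬ Linked G (insert v₂ (insert v₁ S)) K c v₂ s := by
          intro h
          have l1 := h.of_insert (p := v₁) (hsub _ _ hKS) (by grind)
            (by intro w hw ha hw'; rcases n2 w ha with rfl | rfl | rfl <;> grind)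
          rw [if_pos rfl, if_neg (by grind)] at l1
          have l2 := l1.of_insert (p := v₀) hKS h1
            (by intro w hw ha hw'; rcases n1 w ha with rfl | rfl | rfl <;> grind)
          rw [if_pos rfl, if_neg (by grind)] at l2
          exact hl' (l2.congr (fun v hv => (hcc v hv).symm))
        have o3 := o2.insert_two (v := v₃) (p := v₂) (q := s) (hsub _ _ (hsub _ _ hKS)) (by grind) e3
          (by grind)
          (by intro w hw ha hw'; rcases n3 w ha with rfl | rfl | rfl <;> grind) hnl
        have o4 := o3.insert_I (v := v₄) (hsub _ _ (hsub _ _ (hsub _ _ hKS))) (by grind) e4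
          (by intro w hw ha; rcases n4 w ha with rfl | rfl | rfl <;> grind)
        exact o4.cast (fun v => by rw [hA]; simp only [Finset.mem_insert]; tauto)
    · by_cases a5 : c₁ v₅ = true
      · obtain ⟨c, hcc, e1, e2, e3, e4⟩ := hrec true false true false
        refine ⟨c, hcc, ?_⟩
        have k0 := hcc _ s0; have k5 := hcc _ s5; have kt := hcc _ st; have ks := hcc _ ss
        have o := hok.congr hKS hcc
        have o4 := o.insert_leaf (v := v₄) hKS h4 e4 s
          (by intro w hw ha hw'; rcases n4 w ha with rfl | rfl | rfl <;> grind)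
        have o2 := o4.insert_leaf (v := v₂) (hsub _ _ hKS) (by grind) e2 t
          (by intro w hw ha hw'; rcases n2 w ha with rfl | rfl | rfl <;> grind)
        have o3 := o2.insert_I (v := v₃) (hsub _ _ (hsub _ _ hKS)) (by grind) e3
          (by intro w hw ha; rcases n3 w ha with rfl | rfl | rfl <;> grind)
        have o1 := o3.insert_I (v := v₁) (hsub _ _ (hsub _ _ (hsub _ _ hKS))) (by grind) e1
          (by intro w hw ha; rcases n1 w ha with rfl | rfl | rfl <;> grind)
        exact o1.cast (fun v => by rw [hA]; simp only [Finset.mem_insert]; tauto)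
      · by_cases hlts : Linked G S K c₁ t s
        · obtain ⟨c, hcc, e1, e2, e3, e4⟩ := hrec false true false true
          refine ⟨c, hcc, ?_⟩
          have k0 := hcc _ s0; have k5 := hcc _ s5; have kt := hcc _ st; have ks := hcc _ ss
          have o := hok.congr hKS hcc
          have hnl : ¬ Linked G S K c v₀ t := fun h =>
            hl' ((h.congr (fun v hv => (hcc v hv).symm)).trans hlts)
          have o1 := o.insert_two (v := v₁) (p := v₀) (q := t) hKS h1 e1 h0t
            (by intro w hw ha hw'; rcases n1 w ha with rfl | rfl | rfl <;> grind) hnl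
          have o3 := o1.insert_leaf (v := v₃) (hsub _ _ hKS) (by grind) e3 s
            (by intro w hw ha hw'; rcases n3 w ha with rfl | rfl | rfl <;> grind)
          have o2 := o3.insert_I (v := v₂) (hsub _ _ (hsub _ _ hKS)) (by grind) e2
            (by intro w hw ha; rcases n2 w ha with rfl | rfl | rfl <;> grind)
          have o4 := o2.insert_I (v := v₄) (hsub _ _ (hsub _ _ (hsub _ _ hKS))) (by grind) e4
            (by intro w hw ha; rcases n4 w ha with rfl | rfl | rfl <;> grind)
          exact o4.cast (fun v => by rw [hA]; simp only [Finset.mem_insert]; tauto)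
        · obtain ⟨c, hcc, e1, e2, e3, e4⟩ := hrec true false false true
          refine ⟨c, hcc, ?_⟩
          have k0 := hcc _ s0; have k5 := hcc _ s5; have kt := hcc _ st; have ks := hcc _ ss
          have o := hok.congr hKS hcc
          have o3 := o.insert_leaf (v := v₃) hKS h3 e3 s
            (by intro w hw ha hw'; rcases n3 w ha with rfl | rfl | rfl <;> grind)
          have hnl : ¬ Linked G (insert v₃ S) K c v₃ t := by
            intro h
            have l1 := h.of_insert (p := s) hKS h3
              (by intro w hw ha hw'; rcases n3 w ha with rfl | rfl | rfl <;> grind)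
            rw [if_pos rfl, if_neg (by grind)] at l1
            exact hlts (l1.congr (fun v hv => (hcc v hv).symm)).symm
          have o2 := o3.insert_two (v := v₂) (p := v₃) (q := t) (hsub _ _ hKS) (by grind) e2
            (by grind) (by intro w hw ha hw'; rcases n2 w ha with rfl | rfl | rfl <;> grind) hnl
          have o1 := o2.insert_I (v := v₁) (hsub _ _ (hsub _ _ hKS)) (by grind) e1
            (by intro w hw ha; rcases n1 w ha with rfl | rfl | rfl <;> grind)
          have o4 := o1.insert_I (v := v₄) (hsub _ _ (hsub _ _ (hsub _ _ hKS))) (by grind) e4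
            (by intro w hw ha; rcases n4 w ha with rfl | rfl | rfl <;> grind)
          exact o4.cast (fun v => by rw [hA]; simp only [Finset.mem_insert]; tauto)

set_option maxHeartbeats 4000000 in
/-- Extending a coloring to a 3-vertex `u` and an adjacent triangle `s a b` of 3-vertices. -/
theorem config_ext {A : Finset V} {u u₁ u₃ s a b a₁ b₁ : V} {c₁ : V → Bool}
    (hok : Ok G S K c₁) (hKS : K ⊆ S)
    (hA : ∀ v, v ∈ A ↔ v ∈ S ∨ v = u ∨ v = s ∨ v = a ∨ v = b)
    (h1 : u ∉ S) (h2 : s ∉ S) (h3 : a ∉ S) (h4 : b ∉ S)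
    (h12 : u ≠ s) (h13 : u ≠ a) (h14 : u ≠ b) (h23 : s ≠ a) (h24 : s ≠ b) (h34 : a ≠ b)
    (su1 : u₁ ∈ S) (su3 : u₃ ∈ S) (sa : a₁ ∈ S) (sb : b₁ ∈ S) (h0t : u₁ ≠ u₃)
    (nu : ∀ w, G.Adj u w → w = u₁ ∨ w = u₃ ∨ w = s)
    (ns : ∀ w, G.Adj s w → w = u ∨ w = a ∨ w = b)
    (na : ∀ w, G.Adj a w → w = s ∨ w = b ∨ w = a₁)
    (nb : ∀ w, G.Adj b w → w = s ∨ w = a ∨ w = b₁)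
    (hc : c₁ u₁ = c₁ u₃) (hl : c₁ u₁ = false → ¬ Linked G S K c₁ u₁ u₃) :
    ∃ c, (∀ v ∈ S, c₁ v = c v) ∧ Ok G A K c := by
  have hrec := exists_recolor (S := S) h1 h2 h3 h4 h12 h13 h14 h23 h24 h34 c₁
  have hsub : ∀ (T : Finset V) (v : V), K ⊆ T → K ⊆ insert v T := fun T v h =>
    h.trans (Finset.subset_insert _ _)
  by_cases ca : c₁ a₁ = false
  · obtain ⟨c, hcc, e1, e2, e3, e4⟩ := hrec (!c₁ u₁) false true false
    refine ⟨c, hcc, ?_⟩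
    have k1 := hcc _ su1; have k3 := hcc _ su3; have ka := hcc _ sa; have kb := hcc _ sb
    have o := hok.congr hKS hcc
    have o4 := o.insert_leaf (v := b) hKS h4 e4 b₁
      (by intro w hw ha hw'; rcases nb w ha with rfl | rfl | rfl <;> grind)
    have o2 := o4.insert_leaf (v := s) (hsub _ _ hKS) (by grind) e2 b
      (by intro w hw ha hw'; rcases ns w ha with rfl | rfl | rfl <;> grind)
    have o3 := o2.insert_I (v := a) (hsub _ _ (hsub _ _ hKS)) (by grind) e3
      (by intro w hw ha; rcases na w ha with rfl | rfl | rfl <;> grind)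
    have o1 : Ok G (insert u (insert a (insert s (insert b S)))) K c := by
      by_cases cu : c u = true
      · exact o3.insert_I (v := u) (hsub _ _ (hsub _ _ (hsub _ _ hKS))) (by grind) cu
          (by intro w hw ha; rcases nu w ha with rfl | rfl | rfl <;> grind)
      · exact o3.insert_leaf (v := u) (hsub _ _ (hsub _ _ (hsub _ _ hKS))) (by grind)
          (by simpa using cu) s
          (by intro w hw ha hw'; rcases nu w ha with rfl | rfl | rfl <;> grind)
    exact o1.cast (fun v => by rw [hA]; simp only [Finset.mem_insert]; tauto)
  · by_cases cb : c₁ b₁ = false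
    · obtain ⟨c, hcc, e1, e2, e3, e4⟩ := hrec (!c₁ u₁) false false true
      refine ⟨c, hcc, ?_⟩
      have k1 := hcc _ su1; have k3 := hcc _ su3; have ka := hcc _ sa; have kb := hcc _ sb
      have o := hok.congr hKS hcc
      have o3 := o.insert_leaf (v := a) hKS h3 e3 a₁
        (by intro w hw ha hw'; rcases na w ha with rfl | rfl | rfl <;> grind)
      have o2 := o3.insert_leaf (v := s) (hsub _ _ hKS) (by grind) e2 a
        (by intro w hw ha hw'; rcases ns w ha with rfl | rfl | rfl <;> grind)
      have o4 := o2.insert_I (v := b) (hsub _ _ (hsub _ _ hKS)) (by grind) e4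
        (by intro w hw ha; rcases nb w ha with rfl | rfl | rfl <;> grind)
      have o1 : Ok G (insert u (insert b (insert s (insert a S)))) K c := by
        by_cases cu : c u = true
        · exact o4.insert_I (v := u) (hsub _ _ (hsub _ _ (hsub _ _ hKS))) (by grind) cu
            (by intro w hw ha; rcases nu w ha with rfl | rfl | rfl <;> grind)
        · exact o4.insert_leaf (v := u) (hsub _ _ (hsub _ _ (hsub _ _ hKS))) (by grind)
            (by simpa using cu) s
            (by intro w hw ha hw'; rcases nu w ha with rfl | rfl | rfl <;> grind)
      exact o1.cast (fun v => by rw [hA]; simp only [Finset.mem_insert]; tauto)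
    · obtain ⟨c, hcc, e1, e2, e3, e4⟩ := hrec false true false false
      refine ⟨c, hcc, ?_⟩
      have k1 := hcc _ su1; have k3 := hcc _ su3; have ka := hcc _ sa; have kb := hcc _ sb
      have o := hok.congr hKS hcc
      have o1 : Ok G (insert u S) K c := by
        by_cases cu : c₁ u₁ = true
        · exact o.insert_leaf (v := u) hKS h1 e1 u₁
            (by intro w hw ha hw'; rcases nu w ha with rfl | rfl | rfl <;> grind)
        · exact o.insert_two (v := u) (p := u₁) (q := u₃) hKS h1 e1 h0t
            (by intro w hw ha hw'; rcases nu w ha with rfl | rfl | rfl <;> grind)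
            (fun h => hl (by simpa using cu) (h.congr (fun v hv => (hcc v hv).symm)))
      have o3 := o1.insert_leaf (v := a) (hsub _ _ hKS) (by grind) e3 a₁
        (by intro w hw ha hw'; rcases na w ha with rfl | rfl | rfl <;> grind)
      have o4 := o3.insert_leaf (v := b) (hsub _ _ (hsub _ _ hKS)) (by grind) e4 a
        (by intro w hw ha hw'; rcases nb w ha with rfl | rfl | rfl <;> grind)
      have o2 := o4.insert_I (v := s) (hsub _ _ (hsub _ _ (hsub _ _ hKS))) (by grind) e2
        (by intro w hw ha; rcases ns w ha with rfl | rfl | rfl <;> grind)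
      exact o2.cast (fun v => by rw [hA]; simp only [Finset.mem_insert]; tauto)

end

section
open scoped Classical

variable {V : Type} {G : SimpleGraph V}

/-- The pair `x y` is an edge of the cycle `g`. -/
def CEdge (g : ℤ → V) (x y : V) : Prop :=
  ∃ i : ℤ, (x = g i ∧ y = g (i + 1)) ∨ (y = g i ∧ x = g (i + 1))

theorem CEdge.symm {g : ℤ → V} {x y : V} (h : CEdge g x y) : CEdge g y x := by
  obtain ⟨i, h⟩ := h
  exact ⟨i, h.symm⟩

theorem CEdge.comm {g : ℤ → V} {x y : V} : CEdge g x y ↔ CEdge g y x := ⟨.symm, .symm⟩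

namespace IsCyc

variable {k : ℕ} {g : ℤ → V}

theorem cedge_adj (hg : IsCyc G k g) {x y : V} (h : CEdge g x y) : G.Adj x y := by
  obtain ⟨i, ⟨rfl, rfl⟩ | ⟨rfl, rfl⟩⟩ := h
  · exact hg.adj i
  · exact (hg.adj i).symm

theorem ne_of (hg : IsCyc G k g) {i j : ℤ} (h1 : i < j) (h2 : j < i + k) : g i ≠ g j := by
  rw [Ne, hg.eq_iff]
  intro h
  have := Int.le_of_dvd (by omega) (dvd_sub_comm.mp h)
  omega

theorem period (hg : IsCyc G k g) (i : ℤ) : g (i + k) = g i := by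
  rw [hg.eq_iff]; simp

theorem eq_add (hg : IsCyc G k g) {i j : ℤ} (h : g i = g j) (m : ℤ) : g (i + m) = g (j + m) := by
  rw [hg.eq_iff] at h ⊢
  simpa using h

theorem cedge_iff (hg : IsCyc G k g) {i : ℤ} {y : V} :
    CEdge g (g i) y ↔ y = g (i + 1) ∨ y = g (i - 1) := by
  constructor
  · rintro ⟨j, ⟨h1, rfl⟩ | ⟨rfl, h2⟩⟩
    · exact Or.inl (hg.eq_add h1.symm 1)
    · right
      have := hg.eq_add h2.symm (-1)
      simpa [sub_eq_add_neg] using this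
  · rintro (rfl | rfl)
    · exact ⟨i, Or.inl ⟨rfl, rfl⟩⟩
    · exact ⟨i - 1, Or.inr ⟨rfl, by ring_nf⟩⟩

theorem cedge_mem (_hg : IsCyc G k g) {x y : V} (h : CEdge g x y) : ∃ i, g i = x := by
  obtain ⟨i, ⟨rfl, rfl⟩ | ⟨rfl, rfl⟩⟩ := h
  · exact ⟨_, rfl⟩
  · exact ⟨_, rfl⟩

theorem sum_cedge [Fintype V] (hg : IsCyc G k g) (x : V) :
    ∑ y, (if CEdge g x y then (1 : ZMod 2) else 0) = 0 := by
  by_cases hx : ∃ i, g i = x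
  · obtain ⟨i, rfl⟩ := hx
    have h3 := hg.three_le
    have hne : g (i + 1) ≠ g (i - 1) := (hg.ne_of (by omega) (by omega)).symm
    have : ∀ y, (if CEdge g (g i) y then (1 : ZMod 2) else 0) =
        (if y = g (i + 1) then 1 else 0) + (if y = g (i - 1) then 1 else 0) := by
      intro y
      by_cases h1 : y = g (i + 1)
      · subst h1; simp [hg.cedge_iff, hne]
      · simp [hg.cedge_iff, h1]
    rw [Finset.sum_congr rfl (fun y _ => this y), Finset.sum_add_distrib]
    simp only [Finset.sum_ite_eq', Finset.mem_univ, if_true]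
    decide
  · apply Finset.sum_eq_zero
    intro y _
    rw [if_neg]
    intro h
    exact hx (hg.cedge_mem h)

theorem shift (hg : IsCyc G k g) (m : ℤ) : IsCyc G k (fun i => g (m + i)) := by
  refine ⟨hg.three_le, fun i => ?_, fun i j => ?_⟩
  · have := hg.adj (m + i); rwa [add_assoc] at this
  · rw [hg.eq_iff]; congr! 1; ring

theorem rev (hg : IsCyc G k g) (m : ℤ) : IsCyc G k (fun i => g (m - i)) := by
  refine ⟨hg.three_le, fun i => ?_, fun i j => ?_⟩
  · have := (hg.adj (m - (i + 1))).symm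
    rwa [show m - (i + 1) + 1 = m - i by ring] at this
  · rw [hg.eq_iff, dvd_sub_comm]; congr! 1; ring

end IsCyc

theorem cedge_shift {g : ℤ → V} (m : ℤ) {x y : V} : CEdge (fun i => g (m + i)) x y ↔ CEdge g x y := by
  constructor
  · rintro ⟨i, h⟩; refine ⟨m + i, ?_⟩
    dsimp only at h
    rwa [← add_assoc] at h
  · rintro ⟨i, h⟩; refine ⟨i - m, ?_⟩
    dsimp only
    rwa [show m + (i - m) = i by ring, show m + (i - m + 1) = i + 1 by ring]

theorem cedge_rev {g : ℤ → V} (m : ℤ) {x y : V} : CEdge (fun i => g (m - i)) x y ↔ CEdge g x y := by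
  constructor
  · rintro ⟨i, h⟩; refine ⟨m - (i + 1), ?_⟩
    rw [show m - (i + 1) + 1 = m - i by ring]; tauto
  · rintro ⟨i, h⟩; refine ⟨m - (i + 1), ?_⟩
    dsimp only
    rw [show m - (m - (i + 1)) = i + 1 by ring, show m - (m - (i + 1) + 1) = i by ring]; tauto

theorem mem_edges_iff_getVert {a b : V} (p : G.Walk a b) (e : Sym2 V) :
    e ∈ p.edges ↔ ∃ j < p.length, e = s(p.getVert j, p.getVert (j + 1)) := by
  induction p with
  | nil => simp
  | cons h q ih =>
    rw [Walk.edges_cons, List.mem_cons, ih]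
    constructor
    · rintro (rfl | ⟨j, hj, rfl⟩)
      · exact ⟨0, by simp, by simp⟩
      · exact ⟨j + 1, by simpa using hj, by simp⟩
    · rintro ⟨j, hj, rfl⟩
      cases j with
      | zero => left; simp
      | succ j => right; exact ⟨j, by simpa using hj, by simp⟩

/-- A path together with an edge joining its ends is a cycle. -/
theorem exists_isCyc_of_path {a b : V} (p : G.Walk b a) (hp : p.IsPath) (hab : G.Adj a b)
    (hl : 2 ≤ p.length) : ∃ g, IsCyc G (p.length + 1) g ∧
      (∀ i : ℕ, i ≤ p.length → g i = p.getVert i) ∧ (∀ v, v ∈ p.support ↔ ∃ i, g i = v) ∧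
      ∀ x y, CEdge g x y ↔ (s(x, y) = s(a, b) ∨ s(x, y) ∈ p.edges) := by
  set k : ℕ := p.length + 1 with hk
  have hk0 : (0 : ℤ) < (k : ℤ) := by omega
  let g : ℤ → V := fun i => p.getVert ((i % (k : ℤ)).toNat)
  have hgl : ∀ i : ℕ, i ≤ p.length → g i = p.getVert i := by
    intro i hi
    simp only [g]
    congr 1
    rw [Int.emod_eq_of_lt (by omega) (by omega)]; simp
  have hmod : ∀ i : ℤ, ∃ j : ℕ, j ≤ p.length ∧ i % (k : ℤ) = j ∧ g i = p.getVert j := by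
    intro i
    have h1 := Int.emod_nonneg i hk0.ne'
    have h2 := Int.emod_lt_of_pos i hk0
    exact ⟨(i % (k : ℤ)).toNat, by omega, by omega, rfl⟩
  have hsucc : ∀ i : ℤ, (∃ j : ℕ, j < p.length ∧ g i = p.getVert j ∧ g (i + 1) = p.getVert (j + 1)) ∨
      (g i = a ∧ g (i + 1) = b) := by
    intro i
    obtain ⟨j, hj, hij, hgj⟩ := hmod i
    have e1 : (i + 1) % (k : ℤ) = (j + 1 : ℤ) % (k : ℤ) := by
      rw [Int.add_emod, hij, Int.add_emod (j : ℤ) 1]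
      congr 2
      rw [Int.emod_eq_of_lt (by omega) (by omega)]
    by_cases hj' : j < p.length
    · left
      refine ⟨j, hj', hgj, ?_⟩
      simp only [g]
      congr 1
      rw [e1, Int.emod_eq_of_lt (by omega) (by omega)]; omega
    · right
      have : j = p.length := by omega
      subst this
      refine ⟨by rw [hgj, p.getVert_length], ?_⟩
      simp only [g]
      rw [e1, show ((p.length : ℤ) + 1) = (k : ℤ) by omega, Int.emod_self]
      simp
  have hcyc : IsCyc G k g := by
    refine ⟨by omega, fun i => ?_, fun i j => ?_⟩
    · rcases hsucc i with ⟨j, hj, h1, h2⟩ | ⟨h1, h2⟩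
      · rw [h1, h2]; exact p.adj_getVert_succ hj
      · rw [h1, h2]; exact hab
    · rw [Int.dvd_iff_emod_eq_zero, ← Int.emod_eq_emod_iff_emod_sub_eq_zero]
      obtain ⟨m, hm, him, hgm⟩ := hmod i
      obtain ⟨n, hn, hjn, hgn⟩ := hmod j
      rw [hgm, hgn, him, hjn]
      constructor
      · intro h; exact_mod_cast hp.getVert_injOn hm hn h
      · intro h; rw [Int.ofNat_inj.mp h]
  refine ⟨g, hcyc, hgl, fun v => ?_, fun x y => ?_⟩
  · rw [Walk.mem_support_iff_exists_getVert]
    constructor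
    · rintro ⟨n, hn, hle⟩; exact ⟨n, by rw [hgl n hle, hn]⟩
    · rintro ⟨i, hi⟩
      obtain ⟨j, hj, _, hgj⟩ := hmod i
      exact ⟨j, by rw [← hgj, hi], hj⟩
  · have hmem : ∀ e : Sym2 V, e ∈ p.edges ↔ ∃ j < p.length, e = s(p.getVert j, p.getVert (j + 1)) := by
      intro e
      exact mem_edges_iff_getVert p e
    rw [hmem]
    constructor
    · rintro ⟨i, hi⟩
      rcases hsucc i with ⟨j, hj, h1, h2⟩ | ⟨h1, h2⟩
      · right; refine ⟨j, hj, ?_⟩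
        rw [h1, h2] at hi
        rcases hi with ⟨rfl, rfl⟩ | ⟨rfl, rfl⟩
        · rfl
        · exact Sym2.eq_swap
      · left
        rw [h1, h2] at hi
        rcases hi with ⟨rfl, rfl⟩ | ⟨rfl, rfl⟩
        · rfl
        · exact Sym2.eq_swap
    · rintro (h | ⟨j, hj, h⟩)
      · rw [Sym2.eq_iff] at h
        refine ⟨p.length, ?_⟩
        have e1 : g (p.length : ℤ) = a := by rw [hgl _ le_rfl, p.getVert_length]
        have e2 : g ((p.length : ℤ) + 1) = b := by
          have := hcyc.period 0
          rw [zero_add, show ((k : ℕ) : ℤ) = (p.length : ℤ) + 1 by omega] at this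
          rw [this]
          have := hgl 0 (by omega)
          simpa using this
        rw [e1, e2]; tauto
      · rw [Sym2.eq_iff] at h
        refine ⟨j, ?_⟩
        have e2 : g ((j : ℤ) + 1) = p.getVert (j + 1) := by
          have := hgl (j + 1) (by omega)
          push_cast at this; exact this
        rw [hgl j hj.le, e2]; tauto

end

section
open scoped Classical

variable {V : Type} {G : SimpleGraph V}

theorem zmod_two_cases (x : ZMod 2) : x = 0 ∨ x = 1 := by
  revert x; decide

/-- `G` lives on `A` and is 2-connected. -/
structure TwoConn (G : SimpleGraph V) (A : Finset V) : Prop where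
  three_le : 3 ≤ A.card
  mem : ∀ a b, G.Adj a b → a ∈ A
  conn : ∀ x, ∀ a ∈ A, ∀ b ∈ A, a ≠ x → b ≠ x → ∃ p : G.Walk a b, p.IsPath ∧ x ∉ p.support

namespace TwoConn

variable {A : Finset V}

theorem cyc_through (hT : TwoConn G A) {x b b' : V} (hb : G.Adj x b) (hb' : G.Adj x b')
    (hbb : b ≠ b') : ∃ k g, IsCyc G k g ∧ ∀ y, CEdge g x y ↔ y = b ∨ y = b' := by
  obtain ⟨p, hp, hx⟩ := hT.conn x b (hT.mem _ _ hb.symm) b' (hT.mem _ _ hb'.symm) hb.ne' hb'.ne'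
  have hp' : (Walk.cons hb p).IsPath := by rw [Walk.cons_isPath_iff]; exact ⟨hp, hx⟩
  have hl : 2 ≤ (Walk.cons hb p).length := by
    rw [Walk.length_cons]
    have : p.length ≠ 0 := fun h => hbb (Walk.eq_of_length_eq_zero h)
    omega
  obtain ⟨g, hg, -, -, hE⟩ := exists_isCyc_of_path _ hp' hb'.symm hl
  refine ⟨_, g, hg, fun y => ?_⟩
  rw [hE, Walk.edges_cons, List.mem_cons]
  constructor
  · rintro (h | h | h)
    · rw [Sym2.eq_iff] at h
      rcases h with ⟨h1, rfl⟩ | ⟨-, rfl⟩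
      · exact absurd h1 hb'.ne
      · exact Or.inr rfl
    · rw [Sym2.eq_iff] at h
      rcases h with ⟨-, rfl⟩ | ⟨h1, rfl⟩
      · exact Or.inl rfl
      · exact absurd h1 hb.ne
    · exact absurd (p.fst_mem_support_of_mem_edges h) hx
  · rintro (rfl | rfl)
    · exact Or.inr (Or.inl rfl)
    · exact Or.inl Sym2.eq_swap

theorem exists_other (hT : TwoConn G A) {a : V} (ha : a ∈ A) (b : V) : ∃ b', G.Adj a b' ∧ b' ≠ b := by
  by_cases hab : a = b
  · have h2 : 1 < A.card := by have := hT.three_le; omega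
    obtain ⟨c, hc, hca⟩ := Finset.exists_mem_ne h2 a
    obtain ⟨x, hx, hxa⟩ : ∃ x ∈ A, x ≠ a ∧ x ≠ c := by
      by_contra hcon
      push Not at hcon
      have : A ⊆ {a, c} := fun x hx => by
        by_cases h : x = a
        · simp [h]
        · simp [hcon x hx h]
      have := (Finset.card_le_card this).trans Finset.card_le_two
      have := hT.three_le; omega
    obtain ⟨p, -, -⟩ := hT.conn x a ha c hc hxa.1.symm hxa.2.symm
    cases p with
    | nil => exact absurd rfl hca
    | cons h q => exact ⟨_, h, fun h' => h.ne (hab.trans h'.symm)⟩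
  · obtain ⟨c, hc, hca⟩ : ∃ c ∈ A, c ≠ a ∧ c ≠ b := by
      by_contra hcon
      push Not at hcon
      have : A ⊆ {a, b} := fun x hx => by
        by_cases h : x = a
        · simp [h]
        · simp [hcon x hx h]
      have := (Finset.card_le_card this).trans Finset.card_le_two
      have := hT.three_le; omega
    obtain ⟨p, -, hp⟩ := hT.conn b a ha c hc hab hca.2
    cases p with
    | nil => exact absurd rfl hca.1
    | cons h q =>
      refine ⟨_, h, fun h' => hp ?_⟩
      rw [Walk.support_cons, ← h']
      exact List.mem_cons_of_mem _ q.start_mem_support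

theorem walk (hT : TwoConn G A) {a b : V} (ha : a ∈ A) (hb : b ∈ A) : Nonempty (G.Walk a b) := by
  obtain ⟨x, hx, hxa⟩ : ∃ x ∈ A, x ≠ a ∧ x ≠ b := by
    by_contra hcon
    push Not at hcon
    have : A ⊆ {a, b} := fun x hx => by
      by_cases h : x = a
      · simp [h]
      · simp [hcon x hx h]
    have := (Finset.card_le_card this).trans Finset.card_le_two
    have := hT.three_le; omega
  obtain ⟨p, -, -⟩ := hT.conn x a ha b hb hxa.1.symm hxa.2.symm
  exact ⟨p⟩

end TwoConn

/-- The edge `x y` is on the face `f`. -/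
def Inc {F : Type} (L : V → V → F) (f : F) (x y : V) : Prop := L x y = f ∨ L y x = f

variable {F : Type} {L : V → V → F} {A : Finset V}

theorem Inc.symm {f : F} {x y : V} (h : Inc L f x y) : Inc L f y x := Or.symm h

namespace IsDual

variable [Fintype V]

theorem side (hD : IsDual G L) {k : ℕ} {g : ℤ → V} (hg : IsCyc G k g) :
    ∃ s : F → ZMod 2, ∀ a b, G.Adj a b →
      s (L a b) + s (L b a) = if CEdge g a b then 1 else 0 := by
  obtain ⟨s, hs⟩ := hD.exists_side (fun a b => if CEdge g a b then 1 else 0)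
    (fun a b => by simp only [CEdge.comm (x := a)]) 
    (fun a b hab => if_neg (fun h => hab (hg.cedge_adj h))) (fun a => hg.sum_cedge a)
  exact ⟨s, fun a b hab => (hs a b hab).symm⟩

theorem bond (hD : IsDual G L) (hT : TwoConn G A) (x : V) (S : V → ZMod 2)
    (h : ∀ f, ∑ b, (if G.Adj x b then
      S b * ((if L x b = f then 1 else 0) + (if L b x = f then 1 else 0)) else 0) = 0)
    {b b' : V} (hb : G.Adj x b) (hb' : G.Adj x b') : S b = S b' := by
  by_cases hbb : b = b'
  · rw [hbb]
  obtain ⟨k, g, hg, hE⟩ := hT.cyc_through hb hb' hbb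
  obtain ⟨s, hs⟩ := hD.side hg
  have h1 : ∑ y, (if G.Adj x y then S y * (s (L x y) + s (L y x)) else 0) = 0 := by
    let Fs : Finset F := Finset.univ.image (fun p : V × V => L p.1 p.2)
    have hFs : ∀ a b, L a b ∈ Fs := fun a b => Finset.mem_image.mpr ⟨(a, b), by simp, rfl⟩
    have e : ∀ y, (if G.Adj x y then S y * (s (L x y) + s (L y x)) else 0) =
        ∑ f ∈ Fs, s f * (if G.Adj x y then
          S y * ((if L x y = f then 1 else 0) + (if L y x = f then 1 else 0)) else 0) := by
      intro y
      split_ifs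
      · have e1 : ∀ f, s f * (S y * ((if L x y = f then 1 else 0) + (if L y x = f then 1 else 0))) =
          (if L x y = f then S y * s f else 0) + (if L y x = f then S y * s f else 0) := by
          intro f; split_ifs <;> ring
        rw [Finset.sum_congr rfl (fun f _ => e1 f), Finset.sum_add_distrib, Finset.sum_ite_eq,
          Finset.sum_ite_eq, if_pos (hFs _ _), if_pos (hFs _ _), mul_add]
      · simp
    rw [Finset.sum_congr rfl (fun y _ => e y), Finset.sum_comm]
    apply Finset.sum_eq_zero
    intro f _
    rw [← Finset.mul_sum, h f, mul_zero]
  have h2 : ∀ y, (if G.Adj x y then S y * (s (L x y) + s (L y x)) else 0) =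
      (if y = b then S y else 0) + (if y = b' then S y else 0) := by
    intro y
    by_cases hxy : G.Adj x y
    · rw [if_pos hxy, hs x y hxy]
      simp only [hE]
      by_cases e1 : y = b
      · subst e1; simp [hbb]
      · by_cases e2 : y = b'
        · subst e2; simp [e1]
        · simp [e1, e2]
    · have e1 : y ≠ b := fun h => hxy (h ▸ hb)
      have e2 : y ≠ b' := fun h => hxy (h ▸ hb')
      simp [hxy, e1, e2]
  rw [Finset.sum_congr rfl (fun y _ => h2 y), Finset.sum_add_distrib] at h1
  simp only [Finset.sum_ite_eq', Finset.mem_univ, if_true] at h1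
  rw [← CharTwo.sub_eq_add] at h1
  exact sub_eq_zero.mp h1

theorem ne (hD : IsDual G L) (hT : TwoConn G A) {a b : V} (hab : G.Adj a b) : L a b ≠ L b a := by
  obtain ⟨b', hb', hne⟩ := hT.exists_other (hT.mem _ _ hab) b
  obtain ⟨k, g, hg, hE⟩ := hT.cyc_through hab hb' hne.symm
  obtain ⟨s, hs⟩ := hD.side hg
  have := hs a b hab
  rw [if_pos ((hE b).mpr (Or.inl rfl))] at this
  intro h
  rw [h, CharTwo.add_self_eq_zero] at this
  exact absurd this (by decide)

theorem inc_eq (hD : IsDual G L) (hT : TwoConn G A) {a b : V} (hab : G.Adj a b) (f : F) :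
    ((if L a b = f then 1 else 0) + (if L b a = f then 1 else 0) : ZMod 2) =
      if Inc L f a b then 1 else 0 := by
  have := hD.ne hT hab
  unfold Inc
  by_cases h1 : L a b = f <;> by_cases h2 : L b a = f <;> simp [h1, h2]
  exact absurd (h1.trans h2.symm) this

theorem sum_inc (hD : IsDual G L) (hT : TwoConn G A) (f : F) (x : V) :
    ∑ b, (if G.Adj x b ∧ Inc L f x b then (1 : ZMod 2) else 0) = 0 := by
  refine (Finset.sum_congr rfl ?_).trans (hD.even_bdry (fun g => if g = f then 1 else 0) x)
  intro b _
  by_cases hab : G.Adj x b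
  · simp only [hab, true_and, if_true]
    exact (hD.inc_eq hT hab f).symm
  · simp [hab]

theorem bond' (hD : IsDual G L) (hT : TwoConn G A) (x : V) (S : V → ZMod 2)
    (h : ∀ f, ∑ b, (if G.Adj x b ∧ Inc L f x b then S b else 0) = 0)
    {b b' : V} (hb : G.Adj x b) (hb' : G.Adj x b') : S b = S b' := by
  refine hD.bond hT x S (fun f => ?_) hb hb'
  refine (Finset.sum_congr rfl ?_).trans (h f)
  intro b _
  by_cases hab : G.Adj x b
  · rw [if_pos hab, hD.inc_eq hT hab]; simp [hab]
  · simp [hab]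

theorem block (hD : IsDual G L) (hT : TwoConn G A) (B : V → V → ZMod 2)
    (hB : ∀ a b, B a b = B b a)
    (h : ∀ x f, ∑ b, (if G.Adj x b ∧ Inc L f x b then B x b else 0) = 0)
    {a b a' b' : V} (hab : G.Adj a b) (hab' : G.Adj a' b') : B a b = B a' b' := by
  have key : ∀ x y, G.Walk x y → ∀ b b', G.Adj x b → G.Adj y b' → B x b = B y b' := by
    intro x y p
    induction p with
    | nil => intro b b' hb hb'; exact hD.bond' hT _ _ (h _) hb hb'
    | cons hxz q ih =>
      intro b b' hb hb'
      rw [hD.bond' hT _ _ (h _) hb hxz, hB]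
      exact ih _ _ hxz.symm hb'
  obtain ⟨p⟩ := hT.walk (hT.mem _ _ hab) (hT.mem _ _ hab')
  exact key _ _ p _ _ hab hab'

/-- The boundary of a face is a minimal even set of edges. -/
theorem face_min (hD : IsDual G L) (hT : TwoConn G A) {f : F} (D : V → V → ZMod 2)
    (hsym : ∀ a b, D a b = D b a) (hsup : ∀ a b, D a b ≠ 0 → G.Adj a b ∧ Inc L f a b)
    (heven : ∀ a, ∑ b, D a b = 0) {a b : V} (hab : D a b ≠ 0) :
    ∀ x y, G.Adj x y → Inc L f x y → D x y ≠ 0 := by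
  obtain ⟨s, hs⟩ := hD.exists_side D hsym
    (fun x y hxy => by by_contra h0; exact hxy (hsup x y h0).1) heven
  let X : F → Prop := fun g => s g ≠ s f
  have hXf : ¬ X f := fun h => h rfl
  have hDX : ∀ x y, G.Adj x y → L x y = f → (D x y ≠ 0 ↔ X (L y x)) := by
    intro x y hxy e
    rw [hs x y hxy, e]
    simp only [X]
    rcases zmod_two_cases (s f) with h1 | h1 <;> rcases zmod_two_cases (s (L y x)) with h2 | h2 <;>
      rw [h1, h2] <;> decide
  have hDX' : ∀ x y, G.Adj x y → Inc L f x y → (D x y ≠ 0 ↔ (X (L x y) ∨ X (L y x))) := by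
    intro x y hxy hi
    rcases hi with e | e
    · rw [hDX x y hxy e]
      constructor
      · exact Or.inr
      · rintro (h | h)
        · rw [e] at h; exact absurd h hXf
        · exact h
    · rw [hsym, hDX y x hxy.symm e]
      constructor
      · exact Or.inl
      · rintro (h | h)
        · exact h
        · rw [e] at h; exact absurd h hXf
  have hno : ∀ x y, G.Adj x y → X (L x y) → ¬ X (L y x) → L y x = f := by
    intro x y hxy h1 h2
    have : D x y ≠ 0 := by
      rw [hs x y hxy]
      simp only [X, not_not] at h1 h2
      rw [h2]
      rcases zmod_two_cases (s f) with h3 | h3 <;> rcases zmod_two_cases (s (L x y)) with h4 | h4 <;>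
        first | (rw [h3, h4]; decide) | exact absurd (h4.trans h3.symm) h1
    rcases (hsup x y this).2 with e | e
    · rw [e] at h1; exact absurd h1 hXf
    · exact e
  let B : V → V → ZMod 2 := fun x y => if X (L x y) ∨ X (L y x) then 1 else 0
  have hBs : ∀ x y, B x y = B y x := fun x y => by simp only [B, or_comm]
  have hBe : ∀ x g, ∑ y, (if G.Adj x y ∧ Inc L g x y then B x y else 0) = 0 := by
    intro x g
    by_cases hg : X g
    · refine (Finset.sum_congr rfl ?_).trans (hD.sum_inc hT g x)
      intro y _
      by_cases h1 : G.Adj x y ∧ Inc L g x y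
      · rw [if_pos h1, if_pos h1]
        apply if_pos
        rcases h1.2 with e | e
        · left; rwa [e]
        · right; rwa [e]
      · rw [if_neg h1, if_neg h1]
    · by_cases hgf : g = f
      · refine (Finset.sum_congr rfl ?_).trans (heven x)
        intro y _
        by_cases h1 : G.Adj x y ∧ Inc L g x y
        · rw [if_pos h1]
          subst hgf
          have := hDX' x y h1.1 h1.2
          simp only [B]
          rcases zmod_two_cases (D x y) with h2 | h2
          · rw [h2] at this ⊢; rw [if_neg]; tauto
          · rw [h2] at this ⊢; rw [if_pos]; exact this.mp (by decide)
        · rw [if_neg h1]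
          by_contra h0
          have := hsup x y (Ne.symm h0)
          rw [← hgf] at this; exact h1 this
      · apply Finset.sum_eq_zero
        intro y _
        by_cases h1 : G.Adj x y ∧ Inc L g x y
        · rw [if_pos h1]
          apply if_neg
          rintro (h2 | h2)
          · rcases h1.2 with e | e
            · rw [e] at h2; exact hg h2
            · exact hgf (e ▸ hno x y h1.1 h2 (by rwa [e]))
          · rcases h1.2 with e | e
            · exact hgf (e ▸ hno y x h1.1.symm h2 (by rwa [e]))
            · rw [e] at h2; exact hg h2
        · rw [if_neg h1]
  intro x y hxy hi
  rw [hDX' x y hxy hi]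
  have h1 := (hDX' a b (hsup a b hab).1 (hsup a b hab).2).mp hab
  have h2 := hD.block hT B hBs hBe (hsup a b hab).1 hxy
  simp only [B] at h2
  rw [if_pos h1] at h2
  by_contra h3
  rw [if_neg h3] at h2
  exact absurd h2 (by decide)

end IsDual

theorem sum_sym_eq_zero (D : V → V → ZMod 2) (hs : ∀ a b, D a b = D b a) (hd : ∀ a, D a a = 0)
    (C : Finset V) : ∑ v ∈ C, ∑ w ∈ C, D v w = 0 := by
  rw [← Finset.sum_product']
  refine Finset.sum_involution (fun p _ => (p.2, p.1)) ?_ ?_ ?_ ?_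
  · intro p _
    dsimp only
    rw [hs p.2 p.1, CharTwo.add_self_eq_zero]
  · rintro ⟨x, y⟩ _ h0 h1
    simp only [Prod.mk.injEq] at h1
    dsimp only at h0
    rw [h1.1, hd] at h0
    exact h0 rfl
  · rintro ⟨x, y⟩ h
    simp only [Finset.mem_product] at h ⊢
    exact h.symm
  · rintro ⟨x, y⟩ _; rfl

/-- The boundary of the face `f` is the cycle `g`. -/
structure FCyc (G : SimpleGraph V) (L : V → V → F) (f : F) (k : ℕ) (g : ℤ → V) : Prop where
  cyc : IsCyc G k g
  edge : ∀ x y, CEdge g x y ↔ G.Adj x y ∧ Inc L f x y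

theorem IsDual.exists_fcyc [Fintype V] (hD : IsDual G L) (hT : TwoConn G A) {f : F} {a b : V}
    (hab : G.Adj a b) (hf : Inc L f a b) : ∃ k g, FCyc G L f k g ∧ g 0 = a ∧ g 1 = b := by
  let H : SimpleGraph V :=
    { Adj := fun x y => (G.Adj x y ∧ Inc L f x y) ∧ s(x, y) ≠ s(a, b)
      symm := ⟨fun _ _ h => ⟨⟨h.1.1.symm, h.1.2.symm⟩, by rw [Sym2.eq_swap]; exact h.2⟩⟩
      loopless := ⟨fun _ h => G.loopless.irrefl _ h.1.1⟩ }
  have hHG : H ≤ G := fun _ _ h => h.1.1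
  have hreach : H.Reachable b a := by
    by_contra hcon
    let D : V → V → ZMod 2 := fun x y => if G.Adj x y ∧ Inc L f x y then 1 else 0
    have hDs : ∀ x y, D x y = D y x := fun x y => by
      simp only [D]
      congr 1
      exact propext ⟨fun h => ⟨h.1.symm, h.2.symm⟩, fun h => ⟨h.1.symm, h.2.symm⟩⟩
    let C : Finset V := Finset.univ.filter (fun v => H.Reachable b v)
    have hC : ∀ v, v ∈ C ↔ H.Reachable b v := fun v => by simp [C]
    have h1 := sum_sym_eq_zero D hDs (fun x => if_neg (fun h => G.loopless.irrefl _ h.1)) C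
    have h2 : ∑ v ∈ C, ∑ w, D v w = 0 := Finset.sum_eq_zero (fun v _ => hD.sum_inc hT f v)
    have h3 : ∀ v ∈ C, ∑ w, D v w = ∑ w ∈ C, D v w + (if v = b then 1 else 0) := by
      intro v hv
      rw [← Finset.sum_add_sum_compl C]
      congr 1
      have : ∀ w ∈ Cᶜ, D v w = if w = a then (if v = b then 1 else 0) else 0 := by
        intro w hw
        rw [Finset.mem_compl, hC] at hw
        rw [hC] at hv
        by_cases hvw : G.Adj v w ∧ Inc L f v w
        · have : s(v, w) = s(a, b) := by
            by_contra hne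
            exact hw (hv.trans (SimpleGraph.Adj.reachable (G := H) ⟨hvw, hne⟩))
          rw [Sym2.eq_iff] at this
          rcases this with ⟨rfl, rfl⟩ | ⟨rfl, rfl⟩
          · exact absurd hv hcon
          · simp [D, hvw]
        · simp only [D, if_neg hvw]
          by_cases e1 : w = a
          · by_cases e2 : v = b
            · subst e1 e2; exact absurd ⟨hab.symm, hf.symm⟩ hvw
            · simp [e2]
          · simp [e1]
      rw [Finset.sum_congr rfl this, Finset.sum_ite_eq', if_pos]
      rw [Finset.mem_compl, hC]; exact hcon
    rw [Finset.sum_congr rfl h3, Finset.sum_add_distrib, h1, Finset.sum_ite_eq',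
      if_pos ((hC b).mpr (Reachable.refl _))] at h2
    exact absurd h2 (by decide)
  obtain ⟨q, hq⟩ := hreach.exists_isPath
  have hl : 2 ≤ q.length := by
    by_contra hlt
    have : q.length = 0 ∨ q.length = 1 := by omega
    rcases this with h | h
    · exact hab.ne' (Walk.eq_of_length_eq_zero h)
    · have := Walk.adj_of_length_eq_one h
      exact this.2 Sym2.eq_swap
  obtain ⟨g, hg, hgl, -, hE⟩ := exists_isCyc_of_path (q.mapLe hHG) ((Walk.isPath_mapLe hHG).mpr hq)
    hab (by simpa using hl)
  have hsup : ∀ x y, CEdge g x y → G.Adj x y ∧ Inc L f x y := by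
    intro x y h
    rw [hE] at h
    rcases h with h | h
    · rw [Sym2.eq_iff] at h
      rcases h with ⟨rfl, rfl⟩ | ⟨rfl, rfl⟩
      · exact ⟨hab, hf⟩
      · exact ⟨hab.symm, hf.symm⟩
    · rw [Walk.edges_mapLe_eq_edges] at h
      exact (Walk.adj_of_mem_edges q h).1
  have hmin := hD.face_min hT (f := f) (fun x y => if CEdge g x y then 1 else 0)
    (fun a b => by simp only [CEdge.comm (x := a)])
    (fun x y h => hsup x y (by by_contra h0; exact h (if_neg h0))) (fun x => hg.sum_cedge x)
    (a := a) (b := b) (by rw [if_pos ((hE a b).mpr (Or.inl rfl))]; decide)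
  have g0 : g 0 = b := by have := hgl 0 (by omega); simpa using this
  have g1 : g (-1) = a := by
    have h1 := hgl _ le_rfl
    rw [Walk.getVert_length] at h1
    rw [← hg.period (-1)]
    refine Eq.trans ?_ h1
    congr 1; push_cast; ring
  refine ⟨_, _, ⟨hg.shift (-1), fun x y => ?_⟩, by simpa using g1, by simpa using g0⟩
  rw [cedge_shift]
  refine ⟨hsup x y, fun h => ?_⟩
  by_contra h0
  exact hmin x y h.1 h.2 (if_neg h0)

end

section
open scoped Classical

variable {V : Type} {G : SimpleGraph V} {F : Type} {L : V → V → F} {A : Finset V} [Fintype V]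

/-- The ordered pairs of adjacent vertices. -/
noncomputable def dts (G : SimpleGraph V) : Finset (V × V) :=
  Finset.univ.filter (fun p => G.Adj p.1 p.2)

theorem mem_dts {p : V × V} : p ∈ dts G ↔ G.Adj p.1 p.2 := by simp [dts]

/-- The faces. -/
noncomputable def fcs (G : SimpleGraph V) (L : V → V → F) : Finset F :=
  (dts G).image (fun p => L p.1 p.2)

theorem mem_fcs {f : F} : f ∈ fcs G L ↔ ∃ a b, G.Adj a b ∧ L a b = f := by
  simp [fcs, mem_dts]

theorem mem_fcs_of_inc {f : F} {a b : V} (h : G.Adj a b) (hi : Inc L f a b) : f ∈ fcs G L := by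
  rcases hi with e | e
  · exact mem_fcs.mpr ⟨_, _, h, e⟩
  · exact mem_fcs.mpr ⟨_, _, h.symm, e⟩

theorem IsDual.euler (hD : IsDual G L) (hT : TwoConn G A) :
    (dts G).card + 4 ≤ 2 * A.card + 2 * (fcs G L).card := by
  obtain ⟨a₀, ha₀⟩ : A.Nonempty := Finset.card_pos.mp (by have := hT.three_le; omega)
  obtain ⟨b₀, hb₀, -⟩ := hT.exists_other ha₀ a₀
  set f₀ := L a₀ b₀ with hf₀
  have hf₀m : f₀ ∈ fcs G L := mem_fcs.mpr ⟨_, _, hb₀, rfl⟩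
  let ev : (G.edgeSet → ZMod 2) → V → V → ZMod 2 :=
    fun x a b => if h : G.Adj a b then x ⟨s(a, b), h⟩ else 0
  have evs : ∀ x a b, ev x a b = ev x b a := by
    intro x a b
    simp only [ev]
    by_cases h : G.Adj a b
    · rw [dif_pos h, dif_pos h.symm]; congr 1; exact Subtype.ext Sym2.eq_swap
    · rw [dif_neg h, dif_neg (fun h' => h h'.symm)]
  let bd : (G.edgeSet → ZMod 2) →ₗ[ZMod 2] ({v // v ∈ A.erase a₀} → ZMod 2) :=
    { toFun := fun x a => ∑ b, ev x a b
      map_add' := fun x y => by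
        ext a
        rw [Pi.add_apply, ← Finset.sum_add_distrib]
        apply Finset.sum_congr rfl
        intro b _
        simp only [ev]; split_ifs <;> simp
      map_smul' := fun r x => by
        ext a
        rw [Pi.smul_apply, smul_eq_mul, Finset.mul_sum]
        apply Finset.sum_congr rfl
        intro b _
        simp only [ev]; split_ifs <;> simp }
  let ex : ({f // f ∈ (fcs G L).erase f₀} → ZMod 2) → F → ZMod 2 :=
    fun s f => if h : f ∈ (fcs G L).erase f₀ then s ⟨f, h⟩ else 0
  have exa : ∀ s t f, ex (s + t) f = ex s f + ex t f := by
    intro s t f; simp only [ex]; split_ifs <;> simp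
  have exm : ∀ (r : ZMod 2) s f, ex (r • s) f = r * ex s f := by
    intro s t f; simp only [ex]; split_ifs <;> simp
  let dl : ({f // f ∈ (fcs G L).erase f₀} → ZMod 2) →ₗ[ZMod 2] (G.edgeSet → ZMod 2) :=
    { toFun := fun s e => Sym2.lift ⟨fun a b => ex s (L a b) + ex s (L b a),
        fun a b => add_comm _ _⟩ e.1
      map_add' := fun s t => by
        ext ⟨e, he⟩
        induction e with
        | h a b => simp only [Pi.add_apply, Sym2.lift_mk, exa]; ring
      map_smul' := fun r s => by
        ext ⟨e, he⟩
        induction e with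
        | h a b => simp only [Pi.smul_apply, Sym2.lift_mk, exm, RingHom.id_apply, smul_eq_mul]; ring }
  have hle : LinearMap.ker bd ≤ LinearMap.range dl := by
    intro x hx
    rw [LinearMap.mem_ker] at hx
    have h0 : ∀ a, a ≠ a₀ → ∑ b, ev x a b = 0 := by
      intro a ha
      by_cases haA : a ∈ A
      · exact congrFun hx ⟨a, Finset.mem_erase.mpr ⟨ha, haA⟩⟩
      · exact Finset.sum_eq_zero (fun b _ => dif_neg (fun h => haA (hT.mem _ _ h)))
    have h1 : ∀ a, ∑ b, ev x a b = 0 := by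
      intro a
      by_cases ha : a = a₀
      · have h2 := sum_sym_eq_zero (ev x) (evs x) (fun a => dif_neg (G.loopless.irrefl a))
          Finset.univ
        rw [← Finset.add_sum_erase _ _ (Finset.mem_univ a₀), Finset.sum_eq_zero (s :=
          Finset.univ.erase a₀) (fun a ha => h0 a (Finset.ne_of_mem_erase ha)), add_zero] at h2
        rw [ha, h2]
      · exact h0 a ha
    obtain ⟨s, hs⟩ := hD.exists_side (ev x) (evs x) (fun a b h => dif_neg h) h1
    rw [LinearMap.mem_range]
    refine ⟨fun f => s f + s f₀, ?_⟩
    ext ⟨e, he⟩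
    induction e with
    | h a b =>
      have hab : G.Adj a b := he
      have h3 := hs a b hab
      simp only [ev] at h3
      rw [dif_pos hab] at h3
      have h4 : ∀ f ∈ fcs G L, ex (fun f => s f + s f₀) f = s f + s f₀ := by
        intro f hf
        simp only [ex]
        split_ifs with h5
        · rfl
        · have : f = f₀ := by
            by_contra h6
            exact h5 (Finset.mem_erase.mpr ⟨h6, hf⟩)
          rw [this, CharTwo.add_self_eq_zero]
      rw [h3]
      change ex (fun f => s f + s f₀) (L a b) + ex (fun f => s f + s f₀) (L b a) = _
      rw [h4 _ (mem_fcs.mpr ⟨_, _, hab, rfl⟩), h4 _ (mem_fcs.mpr ⟨_, _, hab.symm, rfl⟩)]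
      have := CharTwo.add_self_eq_zero (s f₀)
      linear_combination this
  have r1 := LinearMap.finrank_range_add_finrank_ker bd
  have r2 : Module.finrank (ZMod 2) (LinearMap.range bd) ≤ (A.erase a₀).card := by
    refine (Submodule.finrank_le _).trans ?_
    rw [Module.finrank_fintype_fun_eq_card, Fintype.card_coe]
  have r3 := Submodule.finrank_mono hle
  have r4 : Module.finrank (ZMod 2) (LinearMap.range dl) ≤ ((fcs G L).erase f₀).card := by
    refine (LinearMap.finrank_range_le _).trans ?_
    rw [Module.finrank_fintype_fun_eq_card, Fintype.card_coe]
  rw [Module.finrank_fintype_fun_eq_card] at r1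
  rw [Finset.card_erase_of_mem ha₀] at r2
  rw [Finset.card_erase_of_mem hf₀m] at r4
  have p1 := Finset.card_pos.mpr ⟨_, ha₀⟩
  have p2 := Finset.card_pos.mpr ⟨_, hf₀m⟩
  have r5 : (dts G).card = 2 * Fintype.card G.edgeSet := by
    have := G.dart_card_eq_twice_card_edges
    rw [← SimpleGraph.edgeFinset_card] 
    rw [← this, ← Finset.card_univ]
    refine (Finset.card_bij (fun d _ => d.toProd) ?_ ?_ ?_).symm
    · intro d _; exact mem_dts.mpr d.adj
    · intro d _ e _ h; exact Dart.ext _ _ h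
    · intro p hp; exact ⟨⟨p, mem_dts.mp hp⟩, Finset.mem_univ _, rfl⟩
  omega

end

section
open scoped Classical

variable {V : Type} {G : SimpleGraph V}

theorem IsCyc.arc_const {k : ℕ} {g : ℤ → V} (hg : IsCyc G k g) (P : V → Prop) (x : V)
    (h : ∀ u v, CEdge g u v → u ≠ x → v ≠ x → P u → P v) {i j : ℤ} (hi : g i ≠ x) (hj : g j ≠ x)
    (hP : P (g i)) : P (g j) := by
  have h3 := hg.three_le
  by_cases hx : ∃ m, g m = x
  · obtain ⟨m, rfl⟩ := hx
    have key : ∀ r : ℕ, (1 ≤ r → r + 1 < k → (P (g (m + r)) ↔ P (g (m + r + 1)))) := by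
      intro r h1 h2
      have n1 : g (m + r) ≠ g m := (hg.ne_of (by omega) (by omega)).symm
      have n2 : g (m + r + 1) ≠ g m := (hg.ne_of (by omega) (by omega)).symm
      have e : CEdge g (g (m + r)) (g (m + r + 1)) := ⟨_, Or.inl ⟨rfl, rfl⟩⟩
      exact ⟨h _ _ e n1 n2, h _ _ e.symm n2 n1⟩
    have key2 : ∀ r : ℕ, 1 ≤ r → r < k → (P (g (m + 1)) ↔ P (g (m + r))) := by
      intro r h1
      induction r, h1 using Nat.le_induction with
      | base => intro _; simp
      | succ r hr ih =>
        intro h2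
        rw [ih (by omega), key r hr h2]
        push_cast; rw [add_assoc]
    have key3 : ∀ i, g i ≠ g m → (P (g (m + 1)) ↔ P (g i)) := by
      intro i hi
      have hk : (0 : ℤ) < k := by omega
      have h1 := Int.emod_nonneg (i - m) hk.ne'
      have h2 := Int.emod_lt_of_pos (i - m) hk
      obtain ⟨r, hr⟩ := Int.eq_ofNat_of_zero_le h1
      have e : g i = g (m + r) := by
        rw [hg.eq_iff, ← hr]
        have := Int.dvd_self_sub_emod (x := i - m) (m := k)
        rwa [sub_sub] at this
      have r0 : r ≠ 0 := by
        rintro rfl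
        apply hi; rw [e]; simp
      rw [e]; exact key2 r (by omega) (by omega)
    exact (key3 j hj).mp ((key3 i hi).mpr hP)
  · push Not at hx
    have key : ∀ i, P (g i) ↔ P (g (i + 1)) := fun i =>
      have e : CEdge g (g i) (g (i + 1)) := ⟨_, Or.inl ⟨rfl, rfl⟩⟩
      ⟨h _ _ e (hx _) (hx _), h _ _ e.symm (hx _) (hx _)⟩
    have key2 : ∀ i, P (g i) ↔ P (g 0) := by
      intro i
      induction i using Int.induction_on with
      | zero => rfl
      | succ i ih => rw [← key, ih]
      | pred i ih => rw [key, sub_add_cancel, ih]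
    exact (key2 j).mpr ((key2 i).mp hP)

variable [Fintype V]

/-- A smallest configuration in which a coloring of an anchor does not extend. -/
structure Bad (G : SimpleGraph V) (A K : Finset V) (c₀ : V → Bool) : Prop where
  nice : Nice G
  ih : ∀ G' (A' : Finset V), Nice G' → A'.card < A.card → Solvable G' A'
  sub : K ⊆ A
  mem : ∀ a b, G.Adj a b → a ∈ A
  proper : ∀ a ∈ K, ∀ b ∈ K, G.Adj a b → c₀ a = true → c₀ b = false
  anch : (∃ x, K = {x}) ∨ ∃ k g, IsCyc G k g ∧ k ≤ 12 ∧ (∀ v, v ∈ K ↔ ∃ i, g i = v) ∧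
    ∀ a ∈ K, ∀ b ∈ K, G.Adj a b → CEdge g a b
  bad : ¬ ∃ c, (∀ v ∈ K, c v = c₀ v) ∧ Ok G A K c

namespace Bad

variable {A K : Finset V} {c₀ : V → Bool}

theorem anchor (h : Bad G A K c₀) : Anchor G K := by
  rcases h.anch with ⟨x, rfl⟩ | ⟨k, g, h1, h2, h3, -⟩
  · exact Or.inl (by simp)
  · exact Or.inr ⟨k, g, h1, h2, h3⟩

theorem split (h : Bad G A K c₀) {A₁ A₂ : Finset V} (hA : A₁ ∪ A₂ = A) (h1 : A₁.card < A.card)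
    (h2 : A₂.card < A.card) (hK : K ⊆ A₁) (hK₂ : Anchor G (A₁ ∩ A₂))
    (hE : ∀ a ∈ A₁, ∀ b ∈ A₂, G.Adj a b → a ∈ A₂ ∨ b ∈ A₁) : False := by
  obtain ⟨c₁, hc₁, ok₁⟩ := h.ih G A₁ h.nice h1 K hK h.anchor c₀ h.proper
  obtain ⟨c₂, hc₂, ok₂⟩ := h.ih G A₂ h.nice h2 (A₁ ∩ A₂) Finset.inter_subset_right hK₂ c₁
    (fun a ha b hb => ok₁.indep a (Finset.inter_subset_left ha) b (Finset.inter_subset_left hb))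
  refine h.bad ⟨_, ?_, hA ▸ ok₁.glue ok₂ hK rfl hc₂ hE⟩
  intro v hv
  rw [if_pos (hK hv), hc₁ v hv]

theorem exists_internal (h : Bad G A K c₀) : ∃ v ∈ A, v ∉ K := by
  by_contra hcon
  push Not at hcon
  refine h.bad ⟨c₀, fun _ _ => rfl, fun a ha b hb => h.proper a (hcon a ha) b (hcon b hb), ?_⟩
  rintro Y hY hd - ⟨y, hy⟩
  exact absurd (hcon y (hY hy)) (Finset.disjoint_left.mp hd hy)

theorem exists_third (h : Bad G A K c₀) {v : V} (hv : v ∈ A) (hvK : v ∉ K) (p q : V) :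
    ∃ w, G.Adj v w ∧ w ≠ p ∧ w ≠ q := by
  by_contra hcon
  push Not at hcon
  have hcon' : ∀ w, G.Adj v w → w = p ∨ w = q := fun w hw => by
    by_cases h1 : w = p
    · exact Or.inl h1
    · exact Or.inr (hcon w hw h1)
  have hKe : K ⊆ A.erase v := fun x hx => Finset.mem_erase.mpr ⟨fun h => hvK (h ▸ hx), h.sub hx⟩
  obtain ⟨c, hc, ok⟩ := h.ih G (A.erase v) h.nice (Finset.card_erase_lt_of_mem hv) K hKe h.anchor c₀
    h.proper
  have hupd : ∀ (b : Bool), ∀ w ∈ A.erase v, c w = Function.update c v b w := fun b w hw => by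
    rw [Function.update_of_ne (Finset.ne_of_mem_erase hw)]
  have fin : ∀ b : Bool, Ok G (insert v (A.erase v)) K (Function.update c v b) → False := by
    intro b hb
    rw [Finset.insert_erase hv] at hb
    exact h.bad ⟨_, fun w hw => by rw [← hupd b w (hKe hw), hc w hw], hb⟩
  by_cases hI : ∀ w ∈ A.erase v, G.Adj v w → c w = false
  · refine fin true ((ok.congr hKe (hupd true)).insert_I hKe (by simp) (by simp) ?_)
    intro w hw hvw
    rw [← hupd true w hw]; exact hI w hw hvw
  · push Not at hI
    obtain ⟨w₀, hw₀, hadj, hcw⟩ := hI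
    have : ∃ r, ∀ w, G.Adj v w → w ≠ w₀ → w = r := by
      rcases hcon' w₀ hadj with rfl | rfl
      · exact ⟨q, fun w hw hne => (hcon' w hw).resolve_left hne⟩
      · exact ⟨p, fun w hw hne => (hcon' w hw).resolve_right hne⟩
    obtain ⟨r, hr⟩ := this
    refine fin false ((ok.congr hKe (hupd false)).insert_leaf hKe (by simp) (by simp) r ?_)
    intro w hw hvw hcw'
    refine hr w hvw ?_
    rintro rfl
    rw [← hupd false w hw] at hcw'
    exact hcw hcw'

theorem twoConn (h : Bad G A K c₀) : TwoConn G A := by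
  obtain ⟨v, hv, hvK⟩ := h.exists_internal
  refine ⟨?_, h.mem, ?_⟩
  · obtain ⟨a, ha, -, -⟩ := h.exists_third hv hvK v v
    obtain ⟨b, hb, hba, -⟩ := h.exists_third hv hvK a a
    have : ({v, a, b} : Finset V) ⊆ A := by
      intro x hx
      simp only [Finset.mem_insert, Finset.mem_singleton] at hx
      rcases hx with rfl | rfl | rfl
      · exact hv
      · exact h.mem _ _ ha.symm
      · exact h.mem _ _ hb.symm
    refine le_trans (le_of_eq ?_) (Finset.card_le_card this)
    rw [Finset.card_eq_three.mpr ⟨v, a, b, ha.ne, hb.ne, hba.symm, rfl⟩]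
  · intro x a ha b hb hax hbx
    by_contra hcon
    let C : Finset V := A.filter (fun v => ∃ p : G.Walk a v, p.IsPath ∧ x ∉ p.support)
    have haC : a ∈ C := Finset.mem_filter.mpr ⟨ha, Walk.nil, by simp, by simpa using hax.symm⟩
    have hbC : b ∉ C := fun h => hcon (Finset.mem_filter.mp h).2
    have hxC : x ∉ C := fun h => by
      obtain ⟨p, -, hp⟩ := (Finset.mem_filter.mp h).2
      exact hp p.end_mem_support
    have hCs : ∀ u v, u ∈ C → G.Adj u v → v ≠ x → v ∈ C := by
      intro u v hu huv hvx
      obtain ⟨p, -, hpx⟩ := (Finset.mem_filter.mp hu).2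
      refine Finset.mem_filter.mpr ⟨h.mem _ _ huv.symm, (p.concat huv).bypass,
        Walk.bypass_isPath _, fun hx => ?_⟩
      have := Walk.support_bypass_subset _ hx
      rw [Walk.support_concat] at this
      simp only [List.concat_eq_append, List.mem_append, List.mem_singleton] at this
      rcases this with h1 | h1
      · exact hpx h1
      · exact hvx h1.symm
    let A₁ := A.filter (fun v => v ∈ C ∨ v = x)
    let A₂ := A.filter (fun v => v ∉ C)
    have m1 : ∀ v, v ∈ A₁ ↔ v ∈ A ∧ (v ∈ C ∨ v = x) := fun v => by simp [A₁]
    have m2 : ∀ v, v ∈ A₂ ↔ v ∈ A ∧ v ∉ C := fun v => by simp [A₂]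
    have hU : A₁ ∪ A₂ = A := by
      ext v
      rw [Finset.mem_union, m1, m2]; tauto
    have c1 : A₁.card < A.card := Finset.card_lt_card ⟨fun v hv => ((m1 v).mp hv).1, fun hs => by
      have := (m1 b).mp (hs hb); tauto⟩
    have c2 : A₂.card < A.card := Finset.card_lt_card ⟨fun v hv => ((m2 v).mp hv).1, fun hs => by
      have := (m2 a).mp (hs ha); tauto⟩
    have hI : (A₁ ∩ A₂).card ≤ 1 := by
      rw [Finset.card_le_one]
      intro u hu v hv
      rw [Finset.mem_inter, m1, m2] at hu hv
      have e1 : u = x := by tauto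
      have e2 : v = x := by tauto
      rw [e1, e2]
    have hE : ∀ u ∈ A₁, ∀ v ∈ A₂, G.Adj u v → u ∈ A₂ ∨ v ∈ A₁ := by
      intro u hu v hv huv
      rw [m1] at hu ⊢
      rw [m2] at hv ⊢
      have := hCs u v
      rcases hu.2 with h1 | h1
      · right
        exact ⟨hv.1, Or.inr (by by_contra h2; exact hv.2 (this h1 huv h2))⟩
      · left; exact ⟨hu.1, by rw [h1]; exact hxC⟩
    have hK : K ⊆ A₁ ∨ K ⊆ A₂ := by
      rcases h.anch with ⟨y, rfl⟩ | ⟨k, g, hg, -, hgK, -⟩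
      · have hy : y ∈ A := h.sub (Finset.mem_singleton_self y)
        simp only [Finset.singleton_subset_iff, m1, m2]
        tauto
      · by_cases hm : ∃ i, g i ∈ C
        · obtain ⟨i, hi⟩ := hm
          left
          intro v hv
          obtain ⟨j, rfl⟩ := (hgK _).mp hv
          rw [m1]
          refine ⟨h.sub hv, ?_⟩
          by_cases hj : g j = x
          · exact Or.inr hj
          · left
            exact hg.arc_const (· ∈ C) x (fun u v e _ hvx hu => hCs u v hu (hg.cedge_adj e) hvx)
              (fun h => hxC (h ▸ hi)) hj hi
        · push Not at hm
          right
          intro v hv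
          obtain ⟨j, rfl⟩ := (hgK _).mp hv
          exact (m2 _).mpr ⟨h.sub hv, hm j⟩
    rcases hK with hK | hK
    · exact h.split hU c1 c2 hK (Or.inl hI) hE
    · rw [Finset.union_comm] at hU
      rw [Finset.inter_comm] at hI
      refine h.split hU c2 c1 hK (Or.inl hI) (fun u hu v hv huv => (hE v hv u hu huv.symm).symm)

end Bad

end

section
open scoped Classical

variable {V : Type} {G : SimpleGraph V} {F : Type} {L : V → V → F} {A K : Finset V} {c₀ : V → Bool}
  [Fintype V]

theorem IsDual.off_const (hD : IsDual G L) (hT : TwoConn G A) {n : ℕ} {g : ℤ → V} {s : F → ZMod 2}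
    (hs : ∀ a b, G.Adj a b → s (L a b) + s (L b a) = if CEdge g a b then 1 else 0)
    (hg : IsCyc G n g) {x : V} (hx : ∀ i, g i ≠ x) {b b' : V} (hb : G.Adj x b) (hb' : G.Adj x b') :
    s (L x b) = s (L x b') ∧ s (L b x) = s (L x b) := by
  have h1 : ∀ y, G.Adj x y → s (L y x) = s (L x y) := by
    intro y hy
    have := hs x y hy
    rw [if_neg (fun h => by obtain ⟨i, hi⟩ := hg.cedge_mem h; exact hx i hi)] at this
    exact (CharTwo.add_eq_zero.1 this).symm
  refine ⟨hD.bond' hT x (fun b => s (L x b)) (fun f => ?_) hb hb', h1 b hb⟩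
  have := congrArg (s f * ·) (hD.sum_inc hT f x)
  simp only [Finset.mul_sum, mul_zero] at this
  refine (Finset.sum_congr rfl ?_).trans this
  intro y _
  split_ifs with h
  · rcases h.2 with e | e
    · rw [e, mul_one]
    · rw [← h1 y h.1, e, mul_one]
  · rw [mul_zero]

theorem IsDual.off_face (hD : IsDual G L) (hT : TwoConn G A) {n : ℕ} {g : ℤ → V} {s : F → ZMod 2}
    (hs : ∀ a b, G.Adj a b → s (L a b) + s (L b a) = if CEdge g a b then 1 else 0)
    (hg : IsCyc G n g) {x : V} (hx : ∀ i, g i ≠ x) {b b' : V} (hb : G.Adj x b) (hb' : G.Adj x b')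
    {f : F} (hf : Inc L f x b') : s (L x b) = s f := by
  obtain ⟨h1, h2⟩ := hD.off_const hT hs hg hx hb' hb
  rcases hf with rfl | rfl
  · exact h1.symm
  · rw [← h1, h2]

namespace Bad

theorem split_cycle (h : Bad G A K c₀) (hD : IsDual G L) {n : ℕ} {g : ℤ → V} {s : F → ZMod 2}
    (hg : IsCyc G n g) (hn : n ≤ 12)
    (hs : ∀ a b, G.Adj a b → s (L a b) + s (L b a) = if CEdge g a b then 1 else 0)
    (hK : ∃ e, ∀ v ∈ K, (∃ i, g i = v) ∨ ∃ b, G.Adj v b ∧ s (L v b) = e)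
    {x y b d : V} (hx : ∀ i, g i ≠ x) (hy : ∀ i, g i ≠ y) (hb : G.Adj x b) (hd : G.Adj y d) :
    s (L x b) = s (L y d) := by
  by_contra hne
  have hT := h.twoConn
  let B : ZMod 2 → Finset V := fun e => A.filter (fun v => (∃ i, g i = v) ∨ ∃ b, G.Adj v b ∧ s (L v b) = e)
  have mB : ∀ e v, v ∈ B e ↔ v ∈ A ∧ ((∃ i, g i = v) ∨ ∃ b, G.Adj v b ∧ s (L v b) = e) :=
    fun e v => by simp [B]
  have off : ∀ v e b, (∀ i, g i ≠ v) → G.Adj v b → v ∈ B e → s (L v b) = e := by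
    intro v e b hv hb hvB
    rcases ((mB e v).mp hvB).2 with ⟨i, hi⟩ | ⟨b', hb', rfl⟩
    · exact absurd hi (hv i)
    · exact (hD.off_const hT hs hg hv hb hb').1
  have hcard : ∀ e, (B e).card < A.card := by
    intro e
    have hor : s (L x b) ≠ e ∨ s (L y d) ≠ e := by
      by_contra hc; push Not at hc; exact hne (hc.1.trans hc.2.symm)
    rcases hor with h1 | h1
    · exact Finset.card_lt_card ⟨Finset.filter_subset _ _, fun hsub => h1 (off x e b hx hb (hsub (h.mem _ _ hb)))⟩
    · exact Finset.card_lt_card ⟨Finset.filter_subset _ _, fun hsub => h1 (off y e d hy hd (hsub (h.mem _ _ hd)))⟩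
  obtain ⟨e, hKe⟩ := hK
  refine h.split (A₁ := B e) (A₂ := B (e + 1)) ?_ (hcard e) (hcard _) ?_ (Or.inr ⟨n, g, hg, hn, ?_⟩) ?_
  · ext v
    rw [Finset.mem_union, mB, mB]
    constructor
    · tauto
    · intro hv
      obtain ⟨w, hw, -⟩ := hT.exists_other hv v
      rcases zmod_two_cases (s (L v w) - e) with h1 | h1
      · exact Or.inl ⟨hv, Or.inr ⟨w, hw, sub_eq_zero.mp h1⟩⟩
      · exact Or.inr ⟨hv, Or.inr ⟨w, hw, by rw [← h1]; ring⟩⟩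
  · intro v hv
    exact (mB e v).mpr ⟨h.sub hv, hKe v hv⟩
  · intro v
    rw [Finset.mem_inter]
    constructor
    · rintro ⟨h1, h2⟩
      by_contra hv
      push Not at hv
      obtain ⟨w, hw, -⟩ := hT.exists_other ((mB _ _).mp h1).1 v
      have := (off v _ w hv hw h1).symm.trans (off v _ w hv hw h2)
      simp at this
    · rintro ⟨i, rfl⟩
      have := h.mem _ _ (hg.adj i)
      exact ⟨(mB _ _).mpr ⟨this, Or.inl ⟨i, rfl⟩⟩, (mB _ _).mpr ⟨this, Or.inl ⟨i, rfl⟩⟩⟩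
  · intro u hu v hv huv
    by_cases h1 : ∃ i, g i = u
    · exact Or.inl ((mB _ _).mpr ⟨h.mem _ _ huv, Or.inl h1⟩)
    · by_cases h2 : ∃ i, g i = v
      · exact Or.inr ((mB _ _).mpr ⟨h.mem _ _ huv.symm, Or.inl h2⟩)
      · push Not at h1 h2
        have e1 := off u _ v h1 huv hu
        refine Or.inr ((mB _ _).mpr ⟨h.mem _ _ huv.symm, Or.inr ⟨u, huv.symm, ?_⟩⟩)
        rw [← e1]; exact (hD.off_const hT hs hg h1 huv huv).2

/-- An anchoring cycle bounds a face. -/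
theorem fcyc_anchor (h : Bad G A K c₀) (hD : IsDual G L) {k : ℕ} {g : ℤ → V} (hg : IsCyc G k g)
    (hk : k ≤ 12) (hK : ∀ v, v ∈ K ↔ ∃ i, g i = v)
    (hch : ∀ a ∈ K, ∀ b ∈ K, G.Adj a b → CEdge g a b) : ∃ f, FCyc G L f k g := by
  have hT := h.twoConn
  obtain ⟨s, hs⟩ := hD.side hg
  obtain ⟨x, hxA, hxK⟩ := h.exists_internal
  obtain ⟨b, hb, -⟩ := hT.exists_other hxA x
  have hx : ∀ i, g i ≠ x := fun i hi => hxK ((hK x).mpr ⟨i, hi⟩)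
  have key : ∀ y d, y ∉ K → G.Adj y d → s (L x b) = s (L y d) := fun y d hy hd =>
    h.split_cycle hD hg hk hs ⟨0, fun v hv => Or.inl ((hK v).mp hv)⟩ hx
      (fun i hi => hy ((hK y).mpr ⟨i, hi⟩)) hb hd
  have e01 := hs _ _ (hg.adj 0)
  rw [if_pos ⟨0, Or.inl ⟨rfl, rfl⟩⟩] at e01
  obtain ⟨f, hf, hsf⟩ : ∃ f, Inc L f (g 0) (g (0 + 1)) ∧ s f ≠ s (L x b) := by
    by_contra hcon
    push Not at hcon
    rw [hcon _ (Or.inl rfl), hcon _ (Or.inr rfl), CharTwo.add_self_eq_zero] at e01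
    exact absurd e01 (by decide)
  have honK : ∀ u v, G.Adj u v → Inc L f u v → u ∈ K := by
    intro u v huv hi
    by_contra hu
    apply hsf
    rw [key u v hu huv]
    exact (hD.off_face hT hs hg (fun i hi => hu ((hK u).mpr ⟨i, hi⟩)) huv huv hi).symm
  have hin : ∀ u v, G.Adj u v → Inc L f u v → CEdge g u v := fun u v huv hi =>
    hch u (honK u v huv hi) v (honK v u huv.symm hi.symm) huv
  have nxt : ∀ i, Inc L f (g i) (g (i + 1)) ↔ Inc L f (g (i + 1)) (g (i + 1 + 1)) := by
    have aux : ∀ j b' b'', G.Adj (g j) b' → Inc L f (g j) b' → (∀ y, CEdge g (g j) y → y = b' ∨ y = b'') →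
        Inc L f (g j) b'' := by
      intro j b' b'' hb' hi hy
      obtain ⟨m, q, hq, q0, q1⟩ := hD.exists_fcyc hT hb' hi
      have hc : CEdge q (q 0) (q (0 - 1)) := hq.cyc.cedge_iff.mpr (Or.inr rfl)
      have hc2 := (hq.edge _ _).mp hc
      have hm := hq.cyc.three_le
      have hne : q (0 - 1) ≠ q 1 := hq.cyc.ne_of (by omega) (by omega)
      rw [q0] at hc2
      rcases hy _ (hin _ _ hc2.1 hc2.2) with e | e
      · exact absurd (e.trans q1.symm) hne
      · rw [← e]; exact hc2.2
    intro i
    constructor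
    · intro hi
      refine aux (i + 1) (g i) _ (hg.adj i).symm hi.symm (fun y hy => ?_)
      rcases hg.cedge_iff.mp hy with e | e
      · exact Or.inr e
      · left; rw [e]; congr 1; ring
    · intro hi
      refine (aux (i + 1) (g (i + 1 + 1)) _ (hg.adj _) hi (fun y hy => ?_)).symm
      rcases hg.cedge_iff.mp hy with e | e
      · exact Or.inl e
      · right; rw [e]; congr 1; ring
  have all : ∀ i, Inc L f (g i) (g (i + 1)) := by
    intro i
    induction i using Int.induction_on with
    | zero => exact hf
    | succ i ih => exact (nxt _).mp ih
    | pred i ih =>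
      have := nxt (-(i : ℤ) - 1)
      rw [sub_add_cancel] at this
      rw [sub_add_cancel]
      exact this.mpr ih
  refine ⟨f, hg, fun u v => ⟨fun hc => ⟨hg.cedge_adj hc, ?_⟩, fun hh => hin u v hh.1 hh.2⟩⟩
  obtain ⟨i, ⟨rfl, rfl⟩ | ⟨rfl, rfl⟩⟩ := hc
  · exact all i
  · exact (all i).symm

theorem anch_face (h : Bad G A K c₀) (hD : IsDual G L) : (∃ x, K = {x}) ∨
    ∃ f k g, FCyc G L f k g ∧ k ≤ 12 ∧ (∀ v, v ∈ K ↔ ∃ i, g i = v) ∧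
      ∀ a ∈ K, ∀ b ∈ K, G.Adj a b → CEdge g a b := by
  rcases h.anch with h1 | ⟨k, g, h1, h2, h3, h4⟩
  · exact Or.inl h1
  · obtain ⟨f, hf⟩ := h.fcyc_anchor hD h1 h2 h3 h4
    exact Or.inr ⟨f, k, g, hf, h2, h3, h4⟩

/-- A cycle of length at most twelve has all vertices off it on one side. -/
theorem one_side (h : Bad G A K c₀) (hD : IsDual G L) {n : ℕ} {g : ℤ → V} {s : F → ZMod 2}
    (hg : IsCyc G n g) (hn : n ≤ 12)
    (hs : ∀ a b, G.Adj a b → s (L a b) + s (L b a) = if CEdge g a b then 1 else 0)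
    {x y b d : V} (hx : ∀ i, g i ≠ x) (hy : ∀ i, g i ≠ y) (hb : G.Adj x b) (hd : G.Adj y d) :
    s (L x b) = s (L y d) := by
  have hT := h.twoConn
  refine h.split_cycle hD hg hn hs ?_ hx hy hb hd
  rcases h.anch_face hD with ⟨z, rfl⟩ | ⟨f, k, q, hq, -, hK, -⟩
  · obtain ⟨w, hw, -⟩ := hT.exists_other (h.sub (Finset.mem_singleton_self z)) z
    refine ⟨s (L z w), fun v hv => Or.inr ⟨w, ?_⟩⟩
    rw [Finset.mem_singleton.mp hv]
    exact ⟨hw, rfl⟩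
  · refine ⟨s f, fun v hv => ?_⟩
    by_cases hv' : ∃ i, g i = v
    · exact Or.inl hv'
    · push Not at hv'
      obtain ⟨i, rfl⟩ := (hK v).mp hv
      have hi := (hq.edge _ _).mp ⟨i, Or.inl ⟨rfl, rfl⟩⟩
      exact Or.inr ⟨_, hi.1, hD.off_face hT hs hg hv' hi.1 hi.1 hi.2⟩

end Bad

end

section
open scoped Classical

variable {V : Type} {G : SimpleGraph V} {F : Type} {L : V → V → F} {A K : Finset V} {c₀ : V → Bool}

theorem IsCyc.arc {k : ℕ} {g : ℤ → V} (hg : IsCyc G k g) (i : ℤ) (m : ℕ) (hm : m < k) :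
    ∃ p : G.Walk (g i) (g (i + m)), p.IsPath ∧ p.length = m ∧
      (∀ v, v ∈ p.support ↔ ∃ j : ℕ, j ≤ m ∧ v = g (i + j)) ∧ ∀ j : ℕ, j ≤ m → p.getVert j = g (i + j) := by
  induction m with
  | zero =>
    refine ⟨Walk.nil.copy rfl (by simp), by simp, by simp, ?_, ?_⟩
    · intro v; simp
    · intro j hj; obtain rfl : j = 0 := by omega
      simp
  | succ m ih =>
    obtain ⟨p, hp, hl, hs, hv⟩ := ih (by omega)
    have ha : G.Adj (g (i + m)) (g (i + (m + 1 : ℕ))) := by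
      have := hg.adj (i + m)
      push_cast; rwa [← add_assoc]
    have hsup : ∀ v, v ∈ (p.concat ha).support ↔ ∃ j : ℕ, j ≤ m + 1 ∧ v = g (i + j) := by
      intro v
      rw [Walk.support_concat, List.mem_append, List.mem_singleton, hs]
      constructor
      · rintro (⟨j, hj, rfl⟩ | rfl)
        · exact ⟨j, by omega, rfl⟩
        · exact ⟨m + 1, le_rfl, rfl⟩
      · rintro ⟨j, hj, rfl⟩
        rcases Nat.lt_or_ge m j with h | h
        · right; obtain rfl : j = m + 1 := by omega
          rfl
        · exact Or.inl ⟨j, h, rfl⟩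
    refine ⟨p.concat ha, ?_, by simp [hl], hsup, ?_⟩
    · rw [Walk.concat_isPath_iff]
      refine ⟨hp, fun h => ?_⟩
      obtain ⟨j, hj, e⟩ := (hs _).mp h
      exact hg.ne_of (i := i + j) (j := i + (m + 1 : ℕ)) (by omega) (by omega) e.symm
    · intro j hj
      rw [Walk.concat_eq_append, Walk.getVert_append]
      split_ifs with h
      · rw [hl] at h
        exact hv j (le_of_lt h)
      · rw [hl] at h
        obtain hj' | hj' : j = m ∨ j = m + 1 := by omega
        · subst hj'; simp [hl]
        · subst hj'; simp [hl]

theorem NoCyc.arc (hN : NoCyc G) {k : ℕ} {g : ℤ → V} (hg : IsCyc G k g) {i : ℤ} {m : ℕ} (hm : m < k)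
    (h : G.Adj (g i) (g (i + m))) : m ≠ 3 ∧ m ≠ 5 ∧ m ≠ 7 := by
  obtain ⟨p, hp, hl, -⟩ := hg.arc i m hm
  rw [← hl]
  exact hN _ _ p hp h

theorem NoCyc.len (hN : NoCyc G) {k : ℕ} {g : ℤ → V} (hg : IsCyc G k g) : k ≠ 4 ∧ k ≠ 6 ∧ k ≠ 8 := by
  have h3 := hg.three_le
  have := hN.arc hg (i := 0) (m := k - 1) (by omega) (by
    have h := (hg.adj (-1)).symm
    rwa [neg_add_cancel, ← hg.period (-1), show (-1 + k : ℤ) = 0 + (k - 1 : ℕ) by omega] at h)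
  omega

theorem IsCyc.exists_lt {k : ℕ} {g : ℤ → V} (hg : IsCyc G k g) (i j : ℤ) :
    ∃ m : ℕ, m < k ∧ g j = g (i + m) := by
  have h3 := hg.three_le
  have hk : (0 : ℤ) < k := by omega
  have h1 := Int.emod_nonneg (j - i) hk.ne'
  have h2 := Int.emod_lt_of_pos (j - i) hk
  obtain ⟨r, hr⟩ := Int.eq_ofNat_of_zero_le h1
  refine ⟨r, by omega, ?_⟩
  rw [hg.eq_iff, ← hr]
  have := Int.dvd_self_sub_emod (x := j - i) (m := k)
  rwa [sub_sub] at this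

theorem NoCyc.chord (hN : NoCyc G) {k : ℕ} {g : ℤ → V} (hg : IsCyc G k g)
    (hk : k = 3 ∨ k = 5 ∨ k = 7 ∨ k = 9) {i j : ℤ} (h : G.Adj (g i) (g j)) : CEdge g (g i) (g j) := by
  obtain ⟨m, hm, e⟩ := hg.exists_lt i j
  rw [e] at h ⊢
  have h1 := hN.arc hg hm h
  have h0 : m ≠ 0 := by rintro rfl; simp at h
  have h2 := hN.arc hg (i := i + m) (m := k - m) (by omega) (by
    rw [show i + (m : ℤ) + (k - m : ℕ) = i + k by omega, hg.period]; exact h.symm)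
  rw [hg.cedge_iff]
  have : m = 1 ∨ m = k - 1 := by omega
  rcases this with rfl | hm1
  · left; simp
  · right; rw [← hg.period (i - 1)]; congr 1; omega

theorem NoCyc.no4 (hN : NoCyc G) {a b c d : V} (h1 : G.Adj a b) (h2 : G.Adj b c) (h3 : G.Adj c d)
    (h4 : G.Adj d a) (hac : a ≠ c) (hbd : b ≠ d) : False := by
  have := hN _ _ (Walk.cons h1 (Walk.cons h2 (Walk.cons h3 Walk.nil)))
    (by simp [h1.ne, h2.ne, h3.ne, hac, hbd, h4.ne.symm]) h4.symm
  simp at this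

section
variable [Fintype V]

theorem IsDual.parity3 (hD : IsDual G L) (hT : TwoConn G A) {v b₁ b₂ b₃ : V} (h1 : G.Adj v b₁)
    (h2 : G.Adj v b₂) (h3 : G.Adj v b₃) (h12 : b₁ ≠ b₂) (h13 : b₁ ≠ b₃) (h23 : b₂ ≠ b₃)
    (hn : ∀ w, G.Adj v w → w = b₁ ∨ w = b₂ ∨ w = b₃) (f : F) :
    Inc L f v b₁ ↔ ¬ (Inc L f v b₂ ↔ Inc L f v b₃) := by
  have := hD.sum_inc hT f v
  have e : ∀ w, (if G.Adj v w ∧ Inc L f v w then (1 : ZMod 2) else 0) =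
      (if w = b₁ then (if Inc L f v b₁ then 1 else 0) else 0) +
      ((if w = b₂ then (if Inc L f v b₂ then 1 else 0) else 0) +
      (if w = b₃ then (if Inc L f v b₃ then 1 else 0) else 0)) := by
    intro w
    by_cases hw : G.Adj v w
    · rcases hn w hw with rfl | rfl | rfl
      · simp [h1, h12, h13]
      · simp [h2, h12.symm, h23]
      · simp [h3, h13.symm, h23.symm]
    · have e1 : w ≠ b₁ := fun h => hw (h ▸ h1)
      have e2 : w ≠ b₂ := fun h => hw (h ▸ h2)
      have e3 : w ≠ b₃ := fun h => hw (h ▸ h3)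
      simp [hw, e1, e2, e3]
  rw [Finset.sum_congr rfl (fun w _ => e w), Finset.sum_add_distrib, Finset.sum_add_distrib] at this
  simp only [Finset.sum_ite_eq', Finset.mem_univ, if_true] at this
  by_cases i1 : Inc L f v b₁ <;> by_cases i2 : Inc L f v b₂ <;> by_cases i3 : Inc L f v b₃ <;>
    simp only [i1, i2, i3, if_true, if_false] at this ⊢ <;> revert this <;> decide

theorem Bad.face_unique (h : Bad G A K c₀) (hD : IsDual G L) {f f' : F} {k : ℕ} {g : ℤ → V}
    (hf : FCyc G L f k g) (hf' : FCyc G L f' k g) : f = f' := by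
  by_contra hne
  have hT := h.twoConn
  obtain ⟨x, hxA, hxK⟩ := h.exists_internal
  have two : ∀ a b, CEdge g a b → ∀ e, Inc L e a b → e = f ∨ e = f' := by
    intro a b hab e he
    have h1 := (hf.edge a b).mp hab
    have h2 := (hf'.edge a b).mp hab
    rcases h1.2 with h1 | h1 <;> rcases h2.2 with h2 | h2 <;> rcases he with he | he
    all_goals first
      | exact absurd (h1.symm.trans h2) hne
      | exact Or.inl (he.symm.trans h1)
      | exact Or.inr (he.symm.trans h2)
  have key := @IsDual.block _ _ _ _ _ _ hD hT (fun a b => if CEdge g a b then 1 else 0)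
    (fun a b => by simp only [CEdge.comm (x := a)]) (fun v e => by
      by_cases he : e = f ∨ e = f'
      · refine (Finset.sum_congr rfl ?_).trans (hf.cyc.sum_cedge v)
        intro b _
        by_cases hc : CEdge g v b
        · have : G.Adj v b ∧ Inc L e v b := by
            rcases he with rfl | rfl
            · exact (hf.edge _ _).mp hc
            · exact (hf'.edge _ _).mp hc
          rw [if_pos this]
        · simp [hc]
      · apply Finset.sum_eq_zero
        intro b _
        split_ifs with h1 h2
        · exact absurd (two v b h2 e h1.2) he
        · rfl
        · rfl)
  have all : ∀ y, G.Adj x y → CEdge g x y := by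
    intro y hy
    have := key hy (hf.cyc.adj 0)
    rw [if_pos (show CEdge g (g 0) (g (0 + 1)) from ⟨0, Or.inl ⟨rfl, rfl⟩⟩)] at this
    by_contra hc
    rw [if_neg hc] at this
    exact absurd this (by decide)
  obtain ⟨w, hw, -⟩ := hT.exists_other hxA x
  obtain ⟨i, rfl⟩ := hf.cyc.cedge_mem (all w hw)
  obtain ⟨y, hy, h1, h2⟩ := h.exists_third hxA hxK (g (i + 1)) (g (i - 1))
  rcases hf.cyc.cedge_iff.mp (all y hy) with e | e
  · exact h1 e
  · exact h2 e

end

namespace FCyc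

variable {f : F} {k : ℕ} {g : ℤ → V}

theorem inc (hf : FCyc G L f k g) (i : ℤ) : Inc L f (g i) (g (i + 1)) :=
  ((hf.edge _ _).mp ⟨i, Or.inl ⟨rfl, rfl⟩⟩).2

theorem shift (hf : FCyc G L f k g) (m : ℤ) : FCyc G L f k (fun i => g (m + i)) :=
  ⟨hf.cyc.shift m, fun x y => (cedge_shift m).trans (hf.edge x y)⟩

theorem rev (hf : FCyc G L f k g) (m : ℤ) : FCyc G L f k (fun i => g (m - i)) :=
  ⟨hf.cyc.rev m, fun x y => (cedge_rev m).trans (hf.edge x y)⟩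

theorem start (hf : FCyc G L f k g) {x y : V} (hxy : G.Adj x y) (hi : Inc L f x y) :
    ∃ g', FCyc G L f k g' ∧ g' 0 = x ∧ g' 1 = y ∧ ∀ v, (∃ i, g' i = v) ↔ ∃ i, g i = v := by
  obtain ⟨i, ⟨rfl, rfl⟩ | ⟨rfl, rfl⟩⟩ := (hf.edge x y).mpr ⟨hxy, hi⟩
  · refine ⟨_, hf.shift i, by simp, rfl, fun v => ⟨fun ⟨j, hj⟩ => ⟨_, hj⟩, fun ⟨j, hj⟩ => ⟨j - i, ?_⟩⟩⟩
    rw [← hj]; congr 1; ring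
  · refine ⟨_, hf.rev (i + 1), by simp, by simp, fun v => ⟨fun ⟨j, hj⟩ => ⟨_, hj⟩, fun ⟨j, hj⟩ => ⟨i + 1 - j, ?_⟩⟩⟩
    rw [← hj]; congr 1; ring

theorem step (hf : FCyc G L f k g) {g' : ℤ → V} {k' : ℕ} (hf' : FCyc G L f k' g') (h0 : g' 0 = g 0)
    (h1 : g' 1 = g 1) : ∀ n : ℕ, g' n = g n := by
  have h3 := hf'.cyc.three_le
  have h3' := hf.cyc.three_le
  have key : ∀ n : ℕ, g' n = g n ∧ g' (n + 1) = g (n + 1) := by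
    intro n
    induction n with
    | zero => simpa using ⟨h0, h1⟩
    | succ n ih =>
      push_cast
      refine ⟨ih.2, ?_⟩
      have hc : CEdge g (g (n + 1)) (g' (n + 1 + 1)) := by
        rw [hf.edge, ← hf'.edge, ← ih.2]
        exact ⟨_, Or.inl ⟨rfl, rfl⟩⟩
      rcases hf.cyc.cedge_iff.mp hc with e | e
      · exact e
      · exfalso
        rw [add_sub_cancel_right, ← ih.1] at e
        exact hf'.cyc.ne_of (by omega) (by omega) e.symm
  exact fun n => (key n).1

theorem len_unique (hf : FCyc G L f k g) {g' : ℤ → V} {k' : ℕ} (hf' : FCyc G L f k' g') : k = k' := by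
  obtain ⟨q, hq, q0, q1, -⟩ := hf'.start (hf.cyc.adj 0) (hf.inc 0)
  have hs := hf.step hq q0 q1
  apply Nat.dvd_antisymm
  · have : g (k' : ℕ) = g (0 : ℕ) := by
      rw [← hs, ← hs]; simpa using hq.cyc.period 0
    rw [hf.cyc.eq_iff] at this
    simpa [Int.natCast_dvd_natCast] using this
  · have : q (k : ℕ) = q (0 : ℕ) := by
      rw [hs, hs]; simpa using hf.cyc.period 0
    rw [hq.cyc.eq_iff] at this
    simpa [Int.natCast_dvd_natCast] using this

end FCyc

end

section
open scoped Classical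

variable {V : Type} {G : SimpleGraph V} {F : Type} {L : V → V → F} {A K : Finset V} {c₀ : V → Bool}

theorem IsCyc.short_arc {k : ℕ} {g : ℤ → V} (hg : IsCyc G k g) (hk : k ≤ 12) (i j : ℤ) :
    ∃ p : G.Walk (g i) (g j), p.IsPath ∧ p.length ≤ 6 ∧ ∀ v ∈ p.support, ∃ m, g m = v := by
  have aux : ∀ i j : ℤ, ∀ m : ℕ, m ≤ 6 → m < k → g j = g (i + m) →
      ∃ p : G.Walk (g i) (g j), p.IsPath ∧ p.length ≤ 6 ∧ ∀ v ∈ p.support, ∃ m, g m = v := by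
    intro i j m hm hmk e
    obtain ⟨p, hp, hl, hs, -⟩ := hg.arc i m hmk
    rw [e]
    refine ⟨p, hp, by omega, fun v hv => ?_⟩
    obtain ⟨l, -, rfl⟩ := (hs v).mp hv
    exact ⟨_, rfl⟩
  obtain ⟨m, hm, e⟩ := hg.exists_lt i j
  by_cases h6 : m ≤ 6
  · exact aux i j m h6 hm e
  · obtain ⟨p, h1, h2, h3⟩ := aux j i (k - m) (by omega) (by omega) (by
      have := hg.eq_add e (k - m : ℕ)
      rw [this, ← hg.period i]; congr 1; omega)
    exact ⟨p.reverse, h1.reverse, by simpa using h2, by simpa using h3⟩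

variable [Fintype V]

/-- The number of neighbours. -/
noncomputable def deg (G : SimpleGraph V) (v : V) : ℕ := (Finset.univ.filter (G.Adj v)).card

theorem deg_third {v a b : V} (hv : deg G v = 3) (ha : G.Adj v a) (hb : G.Adj v b) (hab : a ≠ b) :
    ∃ c, G.Adj v c ∧ c ≠ a ∧ c ≠ b ∧ ∀ w, G.Adj v w → w = a ∨ w = b ∨ w = c := by
  have hm : ∀ w, w ∈ Finset.univ.filter (G.Adj v) ↔ G.Adj v w := fun w => by simp
  have h1 : ((Finset.univ.filter (G.Adj v)).erase a).card = 2 := by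
    rw [Finset.card_erase_of_mem ((hm a).mpr ha)]; unfold deg at hv; omega
  have h2 : (((Finset.univ.filter (G.Adj v)).erase a).erase b).card = 1 := by
    rw [Finset.card_erase_of_mem (Finset.mem_erase.mpr ⟨hab.symm, (hm b).mpr hb⟩), h1]
  obtain ⟨c, hc⟩ := Finset.card_eq_one.mp h2
  have hc' : ∀ w, (w ≠ b ∧ w ≠ a ∧ G.Adj v w) ↔ w = c := by
    intro w
    rw [← Finset.mem_singleton, ← hc, Finset.mem_erase, Finset.mem_erase, hm]
  have hcc := (hc' c).mpr rfl
  refine ⟨c, hcc.2.2, hcc.2.1, hcc.1, fun w hw => ?_⟩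
  by_cases e1 : w = a
  · exact Or.inl e1
  · by_cases e2 : w = b
    · exact Or.inr (Or.inl e2)
    · exact Or.inr (Or.inr ((hc' w).mp ⟨e2, e1, hw⟩))

theorem deg_three {v a b c : V} (hv : deg G v = 3) (ha : G.Adj v a) (hb : G.Adj v b) (hc : G.Adj v c)
    (hab : a ≠ b) (hac : a ≠ c) (hbc : b ≠ c) : ∀ w, G.Adj v w → w = a ∨ w = b ∨ w = c := by
  obtain ⟨d, -, -, -, hd⟩ := deg_third hv ha hb hab
  obtain rfl : c = d := by
    rcases hd c hc with e | e | e
    · exact absurd e.symm hac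
    · exact absurd e.symm hbc
    · exact e
  exact hd

theorem IsDual.other_face (hD : IsDual G L) (hT : TwoConn G A) {a b : V} (hab : G.Adj a b) {f : F}
    (hf : Inc L f a b) : ∃ f', f' ≠ f ∧ Inc L f' a b ∧ (∀ e, Inc L e a b → e = f ∨ e = f') ∧
      ∀ s : F → ZMod 2, s (L a b) + s (L b a) = s f + s f' := by
  have hne := hD.ne hT hab
  rcases hf with rfl | rfl
  · exact ⟨L b a, hne.symm, Or.inr rfl, fun e he => he.imp Eq.symm Eq.symm, fun s => rfl⟩
  · exact ⟨L a b, hne, Or.inl rfl, fun e he => (he.imp Eq.symm Eq.symm).symm, fun s => add_comm _ _⟩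

theorem IsDual.two_shared (hD : IsDual G L) (hT : TwoConn G A) {f f' : F} (hne : f ≠ f') {v b b' : V}
    (hbb : b ≠ b') (hb : G.Adj v b) (hb' : G.Adj v b') (h1 : Inc L f v b) (h2 : Inc L f v b')
    (h3 : Inc L f' v b) (h4 : Inc L f' v b') : ∀ w, G.Adj v w → w = b ∨ w = b' := by
  have two : ∀ x, Inc L f v x → Inc L f' v x → ∀ e, Inc L e v x → e = f ∨ e = f' := by
    intro x h1 h2 e he
    rcases h1 with h1 | h1 <;> rcases h2 with h2 | h2 <;> rcases he with he | he
    all_goals first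
      | exact absurd (h1.symm.trans h2) hne
      | exact Or.inl (he.symm.trans h1)
      | exact Or.inr (he.symm.trans h2)
  intro w hw
  have key := hD.bond' hT v (fun w => if w = b ∨ w = b' then 1 else 0) (fun e => by
    by_cases he : e = f ∨ e = f'
    · have e1 : ∀ w, (if G.Adj v w ∧ Inc L e v w then (if w = b ∨ w = b' then (1 : ZMod 2) else 0) else 0) =
          (if w = b then 1 else 0) + (if w = b' then 1 else 0) := by
        intro w
        by_cases w1 : w = b
        · subst w1
          have : Inc L e v w := by rcases he with rfl | rfl <;> assumption
          simp [hb, this, hbb]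
        · by_cases w2 : w = b'
          · subst w2
            have : Inc L e v w := by rcases he with rfl | rfl <;> assumption
            simp [hb', this, w1]
          · simp [w1, w2]
      rw [Finset.sum_congr rfl (fun w _ => e1 w), Finset.sum_add_distrib]
      simp only [Finset.sum_ite_eq', Finset.mem_univ, if_true]
      decide
    · apply Finset.sum_eq_zero
      intro w _
      split_ifs with i1 i2
      · exfalso
        rcases i2 with rfl | rfl
        · exact he (two _ h1 h3 e i1.2)
        · exact he (two _ h2 h4 e i1.2)
      · rfl
      · rfl) hw hb
  by_contra hc
  rw [if_neg hc, if_pos (Or.inl rfl)] at key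
  exact absurd key (by decide)

namespace Bad

theorem two_shared (h : Bad G A K c₀) (hD : IsDual G L) {f f' : F} (hne : f ≠ f') {v b b' : V}
    (hv : v ∉ K) (hbb : b ≠ b') (hb : G.Adj v b) (hb' : G.Adj v b') (h1 : Inc L f v b)
    (h2 : Inc L f v b') (h3 : Inc L f' v b) (h4 : Inc L f' v b') : False := by
  obtain ⟨w, hw, w1, w2⟩ := h.exists_third (h.mem _ _ hb) hv b b'
  exact (hD.two_shared h.twoConn hne hbb hb hb' h1 h2 h3 h4 w hw).elim w1 w2

/-- Deleting `D` and identifying `p` and `q` in a smallest configuration. -/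
theorem identify (h : Bad G A K c₀) {D T : Finset V} {p q : V} (hDK : ∀ x ∈ D, x ∉ K)
    (hpA : p ∈ A) (hqA : q ∈ A) (hpD : p ∉ D) (hqD : q ∉ D) (hpq : p ≠ q)
    (hT : ∀ x ∈ T, x ∉ D → x = p ∨ x = q) (hpT : p ∈ T) (hqT : q ∈ T)
    (hreach : ∀ x ∈ T, (res G T).Reachable x q)
    (hno : ∀ w : G.Walk p q, w.IsPath → (∀ x ∈ w.support, x ∉ D) →
      w.length ≠ 1 ∧ w.length ≠ 2 ∧ w.length ≠ 4 ∧ w.length ≠ 6 ∧ w.length ≠ 8)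
    (hlong : p ∈ K ∨ q ∈ K → ∀ w : G.Walk p q, w.IsPath → (∀ x ∈ w.support, x ∉ D) → 8 ≤ w.length) :
    ∃ c, (∀ v ∈ K, c v = c₀ v) ∧ Ok G (A \ D) K c ∧ c p = c q ∧
      (c p = false → ¬ Linked G (A \ D) K c p q) := by
  have hKA : K ⊆ A \ D := fun x hx => Finset.mem_sdiff.mpr ⟨h.sub hx, fun hd => hDK x hd hx⟩
  have arc : ∀ a ∈ K, ∀ b ∈ K, ∃ w : G.Walk a b, w.IsPath ∧ w.length ≤ 6 ∧ ∀ v ∈ w.support, v ∈ K := by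
    intro a ha b hb
    rcases h.anch with ⟨z, rfl⟩ | ⟨k, g, hg, hk, hK, -⟩
    · rw [Finset.mem_singleton] at ha hb
      subst ha; subst hb
      exact ⟨Walk.nil, by simp, by simp, by simp⟩
    · obtain ⟨i, rfl⟩ := (hK a).mp ha
      obtain ⟨j, rfl⟩ := (hK b).mp hb
      obtain ⟨w, h1, h2, h3⟩ := hg.short_arc hk i j
      exact ⟨w, h1, h2, fun v hv => (hK v).mpr (h3 v hv)⟩
  have far : ∀ a b, a ∈ K → (∀ w : G.Walk a b, w.IsPath → (∀ x ∈ w.support, x ∉ D) → 8 ≤ w.length) →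
      b ∉ D → b ∉ K ∧ ∀ x ∈ K, ¬ G.Adj b x := by
    intro a b ha hl hbD
    have hb : b ∉ K := fun hb => by
      obtain ⟨w, h1, h2, h3⟩ := arc a ha b hb
      have := hl w h1 (fun x hx hd => hDK x hd (h3 x hx))
      omega
    refine ⟨hb, fun x hx hbx => ?_⟩
    obtain ⟨w, h1, h2, h3⟩ := arc a ha x hx
    have := hl (w.concat hbx.symm) (Walk.concat_isPath_iff _ |>.mpr ⟨h1, fun hm => hb (h3 _ hm)⟩)
      (fun y hy hd => by
        rw [Walk.support_concat, List.mem_append, List.mem_singleton] at hy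
        rcases hy with hy | rfl
        · exact hDK y hd (h3 y hy)
        · exact hbD hd)
    rw [Walk.length_concat] at this
    omega
  have hpA' := Finset.mem_sdiff.mpr ⟨hpA, hpD⟩
  have hqA' := Finset.mem_sdiff.mpr ⟨hqA, hqD⟩
  by_cases hpK : p ∈ K
  · obtain ⟨f1, f2⟩ := far p q hpK (hlong (Or.inl hpK)) hqD
    obtain ⟨c, k1, k2, k3, k4⟩ := exists_identified (p := q) (q := p) h.nice h.ih hKA h.anchor c₀ h.proper
      hqA' hpA' hpq.symm f1 (fun _ => f2) (fun x hx hd => (hT x hx hd).symm) hqT hpT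
      (fun x hx => (hreach x hx).trans (hreach p hpT).symm)
      (fun w hw hs => by
        have := hno w.reverse hw.reverse (by simpa using hs)
        simpa using this)
    exact ⟨c, k1, k2, k3.symm, fun e hl => k4 (k3.trans e) hl.symm⟩
  · refine exists_identified h.nice h.ih hKA h.anchor c₀ h.proper hpA' hqA' hpq hpK (fun hqK => ?_)
      hT hpT hqT hreach hno
    exact (far q p hqK (fun w hw hs => by
      have := hlong (Or.inr hqK) w.reverse hw.reverse (by simpa using hs)
      simpa using this) hpD).2

end Bad

end

section
open scoped Classical

variable {V : Type} {G : SimpleGraph V} {F : Type} {L : V → V → F} {A K : Finset V} {c₀ : V → Bool}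

theorem FCyc.apex {f : F} {g : ℤ → V} (hf : FCyc G L f 3 g) {x y : V} (hxy : G.Adj x y)
    (hi : Inc L f x y) : ∃ t, G.Adj y t ∧ G.Adj t x ∧ Inc L f y t ∧ Inc L f t x := by
  obtain ⟨q, hq, rfl, rfl, -⟩ := hf.start hxy hi
  have e : q (2 + 1) = q 0 := by simpa using hq.cyc.period 0
  have h1 := hq.cyc.adj 1
  have h2 := hq.cyc.adj 2
  have i1 := hq.inc 1
  have i2 := hq.inc 2
  rw [e] at h2 i2
  exact ⟨q 2, h1, h2, i1, i2⟩

/-- An internal vertex of degree three. -/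
def Small [Fintype V] (G : SimpleGraph V) (K : Finset V) (v : V) : Prop := v ∉ K ∧ deg G v = 3

theorem NoCyc.path_close (hN : NoCyc G) {a b : V} (p : G.Walk a b) (hp : p.IsPath) (h : G.Adj b a) :
    p.length ≠ 3 ∧ p.length ≠ 5 ∧ p.length ≠ 7 := hN _ _ p hp h.symm

variable [Fintype V]

namespace Bad

theorem tetrad_path (h : Bad G A K c₀) (hD : IsDual G L) {f : F} {v₀ v₁ v₂ v₃ v₄ t s : V}
    (a01 : G.Adj v₀ v₁) (a12 : G.Adj v₁ v₂) (a23 : G.Adj v₂ v₃) (a34 : G.Adj v₃ v₄)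
    (a1t : G.Adj v₁ t) (a2t : G.Adj v₂ t) (a3s : G.Adj v₃ s) (a4s : G.Adj v₄ s)
    (n13 : v₁ ≠ v₃) (n14 : v₁ ≠ v₄) (n24 : v₂ ≠ v₄)
    (hv₂ : v₂ ∉ K) (m2 : ∀ w, G.Adj v₂ w → w = v₁ ∨ w = v₃ ∨ w = t)
    (f12 : Inc L f v₁ v₂) (f23 : Inc L f v₂ v₃) (f34 : Inc L f v₃ v₄)
    (h0t : v₀ ≠ t) (h1t : v₁ ≠ t) (h3t : v₃ ≠ t) (hts : t ≠ s)
    (w : G.Walk v₀ s) (hw : w.IsPath)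
    (hav : ∀ x ∈ w.support, x ≠ v₁ ∧ x ≠ v₂ ∧ x ≠ v₃ ∧ x ≠ v₄) (hl : w.length ≤ 8) : False := by
  have hT := h.twoConn
  have hN := h.nice.2
  have av1 := fun hm => (hav v₁ hm).1 rfl
  have av2 := fun hm => (hav v₂ hm).2.1 rfl
  have av3 := fun hm => (hav v₃ hm).2.2.1 rfl
  have av4 := fun hm => (hav v₄ hm).2.2.2 rfl
  have htw : t ∉ w.support := by
    intro htw
    have hlen : w.length = (w.takeUntil t htw).length + (w.dropUntil t htw).length := by
      conv_lhs => rw [← Walk.take_spec w htw]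
      rw [Walk.length_append]
    have pa := hw.takeUntil htw
    have pb := hw.dropUntil htw
    have sa := fun x hx => w.support_takeUntil_subset_support htw (a := x) hx
    have sb := fun x hx => w.support_dropUntil_subset_support htw (a := x) hx
    have pa1 : (Walk.cons a01.symm (w.takeUntil t htw)).IsPath := by
      rw [Walk.cons_isPath_iff]; exact ⟨pa, fun hm => av1 (sa _ hm)⟩
    have c1 := hN.path_close _ pa1 a1t.symm
    have pa2 : (Walk.cons a12.symm (Walk.cons a01.symm (w.takeUntil t htw))).IsPath := by
      rw [Walk.cons_isPath_iff]
      refine ⟨pa1, fun hm => ?_⟩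
      rw [Walk.support_cons, List.mem_cons] at hm
      exact hm.elim a12.ne.symm (fun hm => av2 (sa _ hm))
    have c2 := hN.path_close _ pa2 a2t.symm
    have pb1 : ((w.dropUntil t htw).concat a3s.symm).IsPath := by
      rw [Walk.concat_isPath_iff]; exact ⟨pb, fun hm => av3 (sb _ hm)⟩
    have pb2 : (((w.dropUntil t htw).concat a3s.symm).concat a23.symm).IsPath := by
      rw [Walk.concat_isPath_iff]
      refine ⟨pb1, fun hm => ?_⟩
      rw [Walk.support_concat, List.mem_append, List.mem_singleton] at hm
      exact hm.elim (fun hm => av2 (sb _ hm)) a23.ne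
    have c3 := hN.path_close _ pb2 a2t
    have pc1 : ((w.dropUntil t htw).concat a4s.symm).IsPath := by
      rw [Walk.concat_isPath_iff]; exact ⟨pb, fun hm => av4 (sb _ hm)⟩
    have pc2 : (((w.dropUntil t htw).concat a4s.symm).concat a34.symm).IsPath := by
      rw [Walk.concat_isPath_iff]
      refine ⟨pc1, fun hm => ?_⟩
      rw [Walk.support_concat, List.mem_append, List.mem_singleton] at hm
      exact hm.elim (fun hm => av3 (sb _ hm)) a34.ne
    have pc3 : ((((w.dropUntil t htw).concat a4s.symm).concat a34.symm).concat a23.symm).IsPath := by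
      rw [Walk.concat_isPath_iff]
      refine ⟨pc2, fun hm => ?_⟩
      rw [Walk.support_concat, List.mem_append, List.mem_singleton, Walk.support_concat, List.mem_append, List.mem_singleton] at hm
      exact hm.elim (fun hm => hm.elim (fun hm => av2 (sb _ hm)) n24) a23.ne
    have c4 := hN.path_close _ pc3 a2t
    have hb0 : (w.dropUntil t htw).length ≠ 0 := fun h0 => hts (Walk.eq_of_length_eq_zero h0)
    have ha0 : (w.takeUntil t htw).length ≠ 0 := fun h0 => h0t (Walk.eq_of_length_eq_zero h0)
    simp only [Walk.length_cons, Walk.length_concat] at c1 c2 c3 c4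
    omega
  have pq1 : (w.concat a3s.symm).IsPath := by
    rw [Walk.concat_isPath_iff]; exact ⟨hw, av3⟩
  have pq2 : (Walk.cons a01.symm (w.concat a3s.symm)).IsPath := by
    rw [Walk.cons_isPath_iff]
    refine ⟨pq1, fun hm => ?_⟩
    rw [Walk.support_concat, List.mem_append, List.mem_singleton] at hm
    exact hm.elim av1 n13
  have pq3 : (Walk.cons a12.symm (Walk.cons a01.symm (w.concat a3s.symm))).IsPath := by
    rw [Walk.cons_isPath_iff]
    refine ⟨pq2, fun hm => ?_⟩
    rw [Walk.support_cons, List.mem_cons, Walk.support_concat, List.mem_append, List.mem_singleton] at hm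
    exact hm.elim a12.ne.symm (fun hm => hm.elim av2 a23.ne)
  obtain ⟨g, hg, -, hsup, hE⟩ := exists_isCyc_of_path _ pq3 a23.symm (by simp)
  have off : ∀ x, x ∉ w.support → x ≠ v₁ → x ≠ v₂ → x ≠ v₃ → ∀ i, g i ≠ x := by
    intro x h1 h2 h3 h4 i hi
    have := (hsup x).mpr ⟨i, hi⟩
    simp only [Walk.support_cons, Walk.support_concat, List.mem_cons, List.mem_append,
      List.not_mem_nil] at this
    tauto
  have ot := off t htw h1t.symm a2t.ne.symm h3t.symm
  have o4 := off v₄ av4 n14.symm n24.symm a34.ne.symm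
  obtain ⟨σ, hσ⟩ := hD.side hg
  have hlen : (Walk.cons a12.symm (Walk.cons a01.symm (w.concat a3s.symm))).length + 1 ≤ 12 := by
    simp only [Walk.length_cons, Walk.length_concat]; omega
  have e1 := h.one_side hD hg hlen hσ ot o4 a2t.symm a34.symm
  obtain ⟨f₂, hf₂, if₂, -, hs₂⟩ := hD.other_face hT a23 f23
  have hc : CEdge g v₂ v₃ := (hE _ _).mpr (Or.inl Sym2.eq_swap)
  have e2 := hσ _ _ a23
  rw [if_pos hc, hs₂] at e2
  have n2t : Inc L f₂ v₂ t := by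
    have hpar := hD.parity3 hT a23 a12.symm a2t n13.symm h3t h1t
      (fun w hw => by have := m2 w hw; tauto) f₂
    have hn : ¬ Inc L f₂ v₂ v₁ := fun hi =>
      h.two_shared hD hf₂ hv₂ n13 a12.symm a23 hi if₂ f12.symm f23
    by_contra hc2
    exact hpar.mp if₂ ⟨fun h => absurd h hn, fun h => absurd h hc2⟩
  have e3 := hD.off_face hT hσ hg ot a2t.symm a2t.symm n2t.symm
  have e4 := hD.off_face hT hσ hg o4 a34.symm a34.symm f34.symm
  rw [← e3, ← e4, e1, CharTwo.add_self_eq_zero] at e2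
  exact absurd e2 (by decide)

theorem no_tetrad (h : Bad G A K c₀) (hD : IsDual G L) {f T₁ T₂ : F} {k : ℕ} {g q₁ q₂ : ℤ → V}
    (hf : FCyc G L f k g) (hk : 9 ≤ k) (s1 : Small G K (g 1)) (s2 : Small G K (g 2))
    (s3 : Small G K (g 3)) (s4 : Small G K (g 4)) (hT₁ : FCyc G L T₁ 3 q₁) (hT₂ : FCyc G L T₂ 3 q₂)
    (h1 : T₁ ≠ f) (h2 : T₂ ≠ f) (i1 : Inc L T₁ (g 1) (g 2)) (i2 : Inc L T₂ (g 3) (g 4)) : False := by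
  have hT := h.twoConn
  have hN := h.nice.2
  have ad : ∀ i j : ℤ, j = i + 1 → G.Adj (g i) (g j) := fun i j e => e ▸ hf.cyc.adj i
  have ic : ∀ i j : ℤ, j = i + 1 → Inc L f (g i) (g j) := fun i j e => e ▸ hf.inc i
  have ne : ∀ i j : ℤ, i < j → j < i + 9 → g i ≠ g j := fun i j h1 h2 => hf.cyc.ne_of h1 (by omega)
  obtain ⟨t, a2t, at1, i2t, it1⟩ := hT₁.apex (ad 1 2 rfl) i1
  obtain ⟨s, a4s, as3, i4s, is3⟩ := hT₂.apex (ad 3 4 rfl) i2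
  have arc3 : ¬ G.Adj (g 1) (g 4) := fun ha => by
    have := hN.arc hf.cyc (i := 1) (m := 3) (by omega) (by simpa using ha)
    exact this.1 rfl
  have t0 : g 0 ≠ t := by
    rintro rfl
    exact h.two_shared hD h1 s1.1 (ne 0 2 (by norm_num) (by norm_num)) (ad 0 1 rfl).symm (ad 1 2 rfl)
      it1.symm i1 (ic 0 1 rfl).symm (ic 1 2 rfl)
  have t3 : g 3 ≠ t := by
    rintro rfl
    exact h.two_shared hD h1 s2.1 (ne 1 3 (by norm_num) (by norm_num)) (ad 1 2 rfl).symm (ad 2 3 rfl)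
      i1.symm i2t (ic 1 2 rfl).symm (ic 2 3 rfl)
  have s2' : g 2 ≠ s := by
    rintro rfl
    exact h.two_shared hD h2 s3.1 (ne 2 4 (by norm_num) (by norm_num)) (ad 2 3 rfl).symm (ad 3 4 rfl)
      is3.symm i2 (ic 2 3 rfl).symm (ic 3 4 rfl)
  have s5' : g 5 ≠ s := by
    rintro rfl
    exact h.two_shared hD h2 s4.1 (ne 3 5 (by norm_num) (by norm_num)) (ad 3 4 rfl).symm (ad 4 5 rfl)
      i2.symm i4s (ic 3 4 rfl).symm (ic 4 5 rfl)
  have t4 : g 4 ≠ t := by rintro rfl; exact arc3 at1.symm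
  have s1' : g 1 ≠ s := by rintro rfl; exact arc3 a4s.symm
  have hts : t ≠ s := by
    rintro rfl
    exact hN.no4 (ad 1 2 rfl) (ad 2 3 rfl) as3.symm at1 (ne 1 3 (by norm_num) (by norm_num)) a2t.ne
  have h0s : g 0 ≠ s := by
    rintro rfl
    exact hN.no4 (ad 0 1 rfl) (ad 1 2 rfl) (ad 2 3 rfl) as3.symm (ne 0 2 (by norm_num) (by norm_num))
      (ne 1 3 (by norm_num) (by norm_num))
  have m1 := deg_three s1.2 (ad 0 1 rfl).symm (ad 1 2 rfl) at1.symm (ne 0 2 (by norm_num) (by norm_num)) t0 a2t.ne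
  have m2 := deg_three s2.2 (ad 1 2 rfl).symm (ad 2 3 rfl) a2t (ne 1 3 (by norm_num) (by norm_num)) at1.ne.symm t3
  have m3 := deg_three s3.2 (ad 2 3 rfl).symm (ad 3 4 rfl) as3.symm (ne 2 4 (by norm_num) (by norm_num)) s2' a4s.ne
  have m4 := deg_three s4.2 (ad 3 4 rfl).symm (ad 4 5 rfl) a4s (ne 3 5 (by norm_num) (by norm_num)) as3.ne.symm s5'
  let D : Finset V := {g 1, g 2, g 3, g 4}
  have mD : ∀ x, x ∈ D ↔ x = g 1 ∨ x = g 2 ∨ x = g 3 ∨ x = g 4 := fun x => by simp [D]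
  let T : Finset V := {g 0, g 1, g 2, g 3, s}
  have mT : ∀ x, x ∈ T ↔ x = g 0 ∨ x = g 1 ∨ x = g 2 ∨ x = g 3 ∨ x = s := fun x => by simp [T]
  have n01 := ne 0 1 (by norm_num) (by norm_num)
  have n02 := ne 0 2 (by norm_num) (by norm_num)
  have n03 := ne 0 3 (by norm_num) (by norm_num)
  have n04 := ne 0 4 (by norm_num) (by norm_num)
  have n15 := ne 1 5 (by norm_num) (by norm_num)
  have n25 := ne 2 5 (by norm_num) (by norm_num)
  have n35 := ne 3 5 (by norm_num) (by norm_num)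
  have n45 := ne 4 5 (by norm_num) (by norm_num)
  have notD : ∀ x, x ∉ D ↔ x ≠ g 1 ∧ x ≠ g 2 ∧ x ≠ g 3 ∧ x ≠ g 4 := fun x => by rw [mD]; tauto
  have d0 : g 0 ∉ D := (notD _).mpr ⟨n01, n02, n03, n04⟩
  have d5 : g 5 ∉ D := (notD _).mpr ⟨n15.symm, n25.symm, n35.symm, n45.symm⟩
  have ds : s ∉ D := (notD _).mpr ⟨s1'.symm, s2'.symm, as3.ne, a4s.ne.symm⟩
  have dt : t ∉ D := (notD _).mpr ⟨at1.ne, a2t.ne.symm, t3.symm, t4.symm⟩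
  have path : ∀ w : G.Walk (g 0) s, w.IsPath → (∀ x ∈ w.support, x ∉ D) → 9 ≤ w.length := by
    intro w hw hav
    by_contra hl
    exact h.tetrad_path hD (ad 0 1 rfl) (ad 1 2 rfl) (ad 2 3 rfl) (ad 3 4 rfl) at1.symm a2t as3.symm a4s
      (ne 1 3 (by norm_num) (by norm_num)) (ne 1 4 (by norm_num) (by norm_num))
      (ne 2 4 (by norm_num) (by norm_num)) s2.1 m2 (ic 1 2 rfl) (ic 2 3 rfl) (ic 3 4 rfl)
      t0 at1.ne.symm t3 hts w hw (fun x hx => (notD x).mp (hav x hx)) (by omega)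
  have hAm : ∀ i, g i ∈ A := fun i => h.mem _ _ (hf.cyc.adj i)
  have r3 : (res G T).Reachable (g 3) s :=
    SimpleGraph.Adj.reachable ⟨as3.symm, by simp [T], by simp [T]⟩
  have r2 : (res G T).Reachable (g 2) s := (SimpleGraph.Adj.reachable
    (show (res G T).Adj (g 2) (g 3) from ⟨ad 2 3 rfl, by simp [T], by simp [T]⟩)).trans r3
  have r1 : (res G T).Reachable (g 1) s := (SimpleGraph.Adj.reachable
    (show (res G T).Adj (g 1) (g 2) from ⟨ad 1 2 rfl, by simp [T], by simp [T]⟩)).trans r2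
  have r0 : (res G T).Reachable (g 0) s := (SimpleGraph.Adj.reachable
    (show (res G T).Adj (g 0) (g 1) from ⟨ad 0 1 rfl, by simp [T], by simp [T]⟩)).trans r1
  obtain ⟨c₁, k1, k2, k3, k4⟩ := h.identify (D := D) (T := T) (p := g 0) (q := s)
    (fun x hx => by rcases (mD x).mp hx with rfl | rfl | rfl | rfl; exacts [s1.1, s2.1, s3.1, s4.1])
    (hAm 0) (h.mem _ _ as3) d0 ds h0s
    (fun x hx hd => by have := (mT x).mp hx; have := (notD x).mp hd; tauto)
    (by simp [T]) (by simp [T])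
    (fun x hx => by rcases (mT x).mp hx with rfl | rfl | rfl | rfl | rfl
                    exacts [r0, r1, r2, r3, SimpleGraph.Reachable.refl _])
    (fun w hw hav => by have := path w hw hav; omega)
    (fun _ w hw hav => by have := path w hw hav; omega)
  have mS : ∀ x, x ∈ A \ D ↔ x ∈ A ∧ x ∉ D := fun x => Finset.mem_sdiff
  have inD : ∀ x, x ∈ D → x ∉ A \ D := fun x hx hx' => ((mS x).mp hx').2 hx
  have hKS : K ⊆ A \ D := fun x hx => (mS x).mpr ⟨h.sub hx, fun hd => by
    rcases (mD x).mp hd with rfl | rfl | rfl | rfl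
    exacts [s1.1 hx, s2.1 hx, s3.1 hx, s4.1 hx]⟩
  obtain ⟨c, hc, hok⟩ := tetrad_ext (A := A) k2 hKS
    (fun v => by
      rw [mS]
      constructor
      · intro hv; by_cases hd : v ∈ D
        · exact Or.inr ((mD v).mp hd)
        · exact Or.inl ⟨hv, hd⟩
      · rintro (hv | rfl | rfl | rfl | rfl)
        exacts [hv.1, hAm _, hAm _, hAm _, hAm _])
    (inD _ (by simp [D])) (inD _ (by simp [D])) (inD _ (by simp [D]))
    (inD _ (by simp [D])) (ne 1 2 (by norm_num) (by norm_num))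
    (ne 1 3 (by norm_num) (by norm_num)) (ne 1 4 (by norm_num) (by norm_num))
    (ne 2 3 (by norm_num) (by norm_num)) (ne 2 4 (by norm_num) (by norm_num))
    (ne 3 4 (by norm_num) (by norm_num)) ((mS _).mpr ⟨hAm 0, d0⟩) ((mS _).mpr ⟨hAm 5, d5⟩)
    ((mS _).mpr ⟨h.mem _ _ at1, dt⟩) ((mS _).mpr ⟨h.mem _ _ as3, ds⟩) t0 hts
    m1 m2 m3 m4 k3 k4
  exact h.bad ⟨c, fun v hv => by rw [← hc v (hKS hv), k1 v hv], hok⟩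

end Bad

end

section
open scoped Classical

variable {V : Type} {G : SimpleGraph V} {F : Type} {L : V → V → F} {A K : Finset V} {c₀ : V → Bool}
theorem split_path {a b m : V} (w : G.Walk a b) (hw : w.IsPath) (hm : m ∈ w.support) :
    ∃ (X : G.Walk a m) (Y : G.Walk m b), X.IsPath ∧ Y.IsPath ∧ w.length = X.length + Y.length ∧
      (∀ x, x ∈ w.support ↔ x ∈ X.support ∨ x ∈ Y.support) ∧
      ∀ x, x ∈ X.support → x ∈ Y.support → x = m := by
  have ha : w = (w.takeUntil m hm).append (w.dropUntil m hm) := (Walk.take_spec w hm).symm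
  refine ⟨_, _, hw.takeUntil hm, hw.dropUntil hm, ?_, fun x => ?_, fun x hx hy => ?_⟩
  · conv_lhs => rw [ha]
    rw [Walk.length_append]
  · conv_lhs => rw [ha]
    rw [Walk.mem_support_append_iff]
  · rw [ha] at hw
    by_contra hne
    have hnd := hw.support_nodup
    rw [Walk.support_append] at hnd
    refine (List.nodup_append.mp hnd).2.2 x hx x ?_ rfl
    rw [← Walk.cons_tail_support, List.mem_cons] at hy
    exact hy.resolve_left hne

variable [Fintype V]

namespace Bad

/-- If a short cycle through an edge of `f` misses a vertex of `f`, then the face on the other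
side of the edge is spanned by the cycle. -/
theorem face_len (h : Bad G A K c₀) (hD : IsDual G L) {f f' : F} {x y u b : V} (p : G.Walk x y)
    (hp : p.IsPath) (h2 : 2 ≤ p.length) (h11 : p.length ≤ 11) (hyx : G.Adj y x) (hf : Inc L f y x)
    (hne : f' ≠ f) (hf' : Inc L f' y x) (hub : G.Adj u b) (hu : u ∉ p.support) (hfu : Inc L f u b)
    {k : ℕ} {g : ℤ → V} (hg : FCyc G L f' k g) : k ≤ p.length + 1 := by
  have hT := h.twoConn
  obtain ⟨q, hq, -, hsup, hE⟩ := exists_isCyc_of_path p hp hyx h2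
  obtain ⟨σ, hσ⟩ := hD.side hq
  have hoff : ∀ z, z ∉ p.support → ∀ i, q i ≠ z := fun z hz i hi => hz ((hsup z).mpr ⟨i, hi⟩)
  have key : ∀ i, g i ∈ p.support := by
    intro i
    by_contra hi
    have e1 := hD.off_face hT hσ hq (hoff _ hi) (hg.cyc.adj i) (hg.cyc.adj i) (hg.inc i)
    have e2 := hD.off_face hT hσ hq (hoff _ hu) hub hub hfu
    have e3 := h.one_side hD hq (by omega) hσ (hoff _ hi) (hoff _ hu) (hg.cyc.adj i) hub
    obtain ⟨f₂, -, -, ho, hs⟩ := hD.other_face hT hyx hf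
    have e4 := hσ _ _ hyx
    rw [if_pos ((hE _ _).mpr (Or.inl rfl)), hs] at e4
    have : f' = f₂ := (ho f' hf').resolve_left hne
    rw [← this, ← e1, ← e2, e3, CharTwo.add_self_eq_zero] at e4
    exact absurd e4 (by decide)
  have hc : (Finset.univ : Finset (Fin k)).card ≤ p.support.toFinset.card := by
    refine Finset.card_le_card_of_injOn (fun i => g (i : ℕ)) (fun i _ => ?_) ?_
    · simpa using key _
    · intro i _ j _ hij
      have : g ((i : ℕ) : ℤ) = g ((j : ℕ) : ℤ) := hij
      have hi := i.2
      have hj := j.2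
      by_contra hn
      have hn' : (i : ℕ) ≠ j := fun e => hn (Fin.ext e)
      rcases Nat.lt_or_gt_of_ne hn' with hl | hl
      · exact hg.cyc.ne_of (i := ((i : ℕ) : ℤ)) (j := ((j : ℕ) : ℤ)) (by omega) (by omega) this
      · exact hg.cyc.ne_of (i := ((j : ℕ) : ℤ)) (j := ((i : ℕ) : ℤ)) (by omega) (by omega) this.symm
  rw [Finset.card_univ, Fintype.card_fin] at hc
  have := p.support.toFinset_card_le
  rw [Walk.length_support] at this
  omega

theorem configB_path (h : Bad G A K c₀) (hD : IsDual G L) {f : F} {u₁ u u₃ u₄ u₅ s : V}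
    (e1 : G.Adj u₁ u) (e2 : G.Adj u u₃) (e3 : G.Adj u₃ u₄) (e4 : G.Adj u₄ u₅) (e5 : G.Adj u₅ u₁)
    (n13 : u₁ ≠ u₃) (n14 : u₁ ≠ u₄) (nu4 : u ≠ u₄) (nu5 : u ≠ u₅) (n35 : u₃ ≠ u₅)
    (i1 : Inc L f u₁ u) (i2 : Inc L f u u₃) (i3 : Inc L f u₃ u₄) (i4 : Inc L f u₄ u₅)
    (i5 : Inc L f u₅ u₁) (hs : G.Adj u s) (ns1 : s ≠ u₁) (ns3 : s ≠ u₃) (hu : u ∉ K)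
    (mu : ∀ w, G.Adj u w → w = u₁ ∨ w = u₃ ∨ w = s)
    (b3 : ∀ f', f' ≠ f → Inc L f' u₃ u₄ → ∀ k g, FCyc G L f' k g → 9 ≤ k)
    (b4 : ∀ f', f' ≠ f → Inc L f' u₄ u₅ → ∀ k g, FCyc G L f' k g → 9 ≤ k)
    (b5 : ∀ f', f' ≠ f → Inc L f' u₅ u₁ → ∀ k g, FCyc G L f' k g → 9 ≤ k)
    (w : G.Walk u₁ u₃) (hw : w.IsPath) (huw : u ∉ w.support) (hsw : s ∉ w.support) :
    w.length ≠ 1 ∧ w.length ≠ 2 ∧ w.length ≠ 4 ∧ w.length ≠ 6 ∧ w.length ≠ 8 := by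
  have hT := h.twoConn
  have hN := h.nice.2
  have hp : (w.concat e2.symm).IsPath := by rw [Walk.concat_isPath_iff]; exact ⟨hw, huw⟩
  have c1 := hN.path_close _ hp e1.symm
  rw [Walk.length_concat] at c1
  have l1 : w.length ≠ 1 := by
    intro hl
    exact hN.no4 (Walk.adj_of_length_eq_one hl) e3 e4 e5 n14 n35
  refine ⟨l1, by omega, by omega, by omega, fun l8 => ?_⟩
  obtain ⟨g, hg, -, hsup, hE⟩ := exists_isCyc_of_path _ hp e1.symm (by rw [Walk.length_concat]; omega)
  have hlen : (w.concat e2.symm).length + 1 ≤ 12 := by rw [Walk.length_concat]; omega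
  obtain ⟨σ, hσ⟩ := hD.side hg
  have hoff : ∀ z, z ∉ w.support → z ≠ u → ∀ i, g i ≠ z := by
    intro z hz hzu i hi
    have := (hsup z).mpr ⟨i, hi⟩
    rw [Walk.support_concat, List.mem_append, List.mem_singleton] at this
    exact this.elim hz hzu
  have os := hoff s hsw hs.ne.symm
  have on : ∀ z b, G.Adj z b → Inc L f z b → z ≠ u → z ∈ w.support := by
    intro z b hzb hf hzu
    by_contra hz
    obtain ⟨f₂, hf₂, if₂, -, hs₂⟩ := hD.other_face hT e1.symm i1.symm
    have q1 := hσ _ _ e1.symm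
    rw [if_pos ((hE _ _).mpr (Or.inl rfl)), hs₂] at q1
    have hpar := hD.parity3 hT e1.symm e2 hs n13 ns1.symm ns3.symm mu f₂
    have hn : ¬ Inc L f₂ u u₃ := fun hi => h.two_shared hD hf₂ hu n13 e1.symm e2 if₂ hi i1.symm i2
    have ins : Inc L f₂ u s := by
      by_contra hc2
      exact hpar.mp if₂ ⟨fun h => absurd h hn, fun h => absurd h hc2⟩
    have q3 := hD.off_face hT hσ hg os hs.symm hs.symm ins.symm
    have q4 := hD.off_face hT hσ hg (hoff z hz hzu) hzb hzb hf
    have q5 := h.one_side hD hg hlen hσ os (hoff z hz hzu) hs.symm hzb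
    rw [← q3, ← q4, q5, CharTwo.add_self_eq_zero] at q1
    exact absurd q1 (by decide)
  have m4 := on u₄ u₅ e4 i4 nu4.symm
  have m5 := on u₅ u₁ e5 i5 nu5.symm
  obtain ⟨X, Y, pX, pY, len5, mXY, disj⟩ := split_path w hw m5
  have x0 : X.length ≠ 0 := fun h0 => e5.ne (Walk.eq_of_length_eq_zero h0).symm
  have y0 : Y.length ≠ 0 := fun h0 => n35 (Walk.eq_of_length_eq_zero h0).symm
  have u3X : u₃ ∉ X.support := fun hm => n35 (disj _ hm Y.end_mem_support)
  have u1Y : u₁ ∉ Y.support := fun hm => e5.ne (disj _ X.start_mem_support hm).symm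
  have uX : u ∉ X.support := fun hm => huw ((mXY _).mpr (Or.inl hm))
  have uY : u ∉ Y.support := fun hm => huw ((mXY _).mpr (Or.inr hm))
  have cat : ∀ {a b c : V} (p : G.Walk a b) (hp : p.IsPath) (hbc : G.Adj b c) (hc : c ∉ p.support),
      (p.concat hbc).IsPath := fun p hp hbc hc => by
    rw [Walk.concat_isPath_iff]; exact ⟨hp, hc⟩
  have nc : ∀ {a b c x : V} (p : G.Walk a b) (hbc : G.Adj b c), x ∉ p.support → x ≠ c →
      x ∉ (p.concat hbc).support := fun p hbc h1 h2 hm => by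
    rw [Walk.support_concat, List.mem_append, List.mem_singleton] at hm
    exact hm.elim h1 h2
  rcases (mXY u₄).mp m4 with m4 | m4
  · obtain ⟨P, R, pP, pR, len4, mPR, disj'⟩ := split_path X pX m4
    have p0 : P.length ≠ 0 := fun h0 => n14 (Walk.eq_of_length_eq_zero h0)
    have r0 : R.length ≠ 0 := fun h0 => e4.ne (Walk.eq_of_length_eq_zero h0)
    have u5P : u₅ ∉ P.support := fun hm => e4.ne (disj' _ hm R.end_mem_support).symm
    have u3P : u₃ ∉ P.support := fun hm => u3X ((mPR _).mpr (Or.inl hm))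
    have uP : u ∉ P.support := fun hm => uX ((mPR _).mpr (Or.inl hm))
    have t1 := hN.path_close _ (cat P pP e4 u5P) e5
    have t2 := hN.path_close _ (cat _ (cat P pP e3.symm u3P) e2.symm (nc _ _ uP e2.ne)) e1.symm
    simp only [Walk.length_concat] at t1 t2
    omega
  · obtain ⟨M, R, pM, pR, len4, mMR, disj'⟩ := split_path Y pY m4
    have m0 : M.length ≠ 0 := fun h0 => e4.ne (Walk.eq_of_length_eq_zero h0).symm
    have r0 : R.length ≠ 0 := fun h0 => e3.ne (Walk.eq_of_length_eq_zero h0).symm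
    have u4X : u₄ ∉ X.support := fun hm => e4.ne (disj _ hm m4)
    have u3M : u₃ ∉ M.support := fun hm => e3.ne (disj' _ hm R.end_mem_support)
    have u5R : u₅ ∉ R.support := fun hm => e4.ne (disj' _ M.start_mem_support hm).symm
    have u1M : u₁ ∉ M.support := fun hm => u1Y ((mMR _).mpr (Or.inl hm))
    have u1R : u₁ ∉ R.support := fun hm => u1Y ((mMR _).mpr (Or.inr hm))
    have uM : u ∉ M.support := fun hm => uY ((mMR _).mpr (Or.inl hm))
    have uR : u ∉ R.support := fun hm => uY ((mMR _).mpr (Or.inr hm))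
    have t1 := hN.path_close _ (cat _ (cat _ (cat X pX e4.symm u4X) e3.symm (nc _ _ u3X e3.ne)) e2.symm
      (nc _ _ (nc _ _ uX nu4) e2.ne)) e1.symm
    have t2 := hN.path_close _ (cat _ (cat _ (cat M pM e3.symm u3M) e2.symm (nc _ _ uM e2.ne)) e1.symm
      (nc _ _ (nc _ _ u1M n13) e1.ne)) e5.symm
    have t3 := hN.path_close _ (cat _ (cat _ (cat R pR e2.symm uR) e1.symm (nc _ _ u1R e1.ne)) e5.symm
      (nc _ _ (nc _ _ u5R nu5.symm) e5.ne)) e4.symm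
    have t4 := hN.path_close _ pX e5
    have t5 := hN.path_close _ pM e4
    have t6 := hN.path_close _ pR e3
    simp only [Walk.length_concat] at t1 t2 t3
    have tri : X.length = 6 ∨ M.length = 6 ∨ R.length = 6 := by omega
    rcases tri with hl | hl | hl
    · obtain ⟨f', hf', hi', -⟩ := hD.other_face hT e5 i5
      obtain ⟨k, q, hq, -⟩ := hD.exists_fcyc hT e5 hi'
      have := h.face_len hD X pX (by omega) (by omega) e5 i5 hf' hi' e2 uX i2 hq
      have := b5 f' hf' hi' k q hq
      omega
    · obtain ⟨f', hf', hi', -⟩ := hD.other_face hT e4 i4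
      obtain ⟨k, q, hq, -⟩ := hD.exists_fcyc hT e4 hi'
      have := h.face_len hD M pM (by omega) (by omega) e4 i4 hf' hi' e2 uM i2 hq
      have := b4 f' hf' hi' k q hq
      omega
    · obtain ⟨f', hf', hi', -⟩ := hD.other_face hT e3 i3
      obtain ⟨k, q, hq, -⟩ := hD.exists_fcyc hT e3 hi'
      have := h.face_len hD R pR (by omega) (by omega) e3 i3 hf' hi' e2 uR i2 hq
      have := b3 f' hf' hi' k q hq
      omega

theorem no_configB (h : Bad G A K c₀) (hD : IsDual G L) {f : F} {q : ℤ → V} (hf : FCyc G L f 5 q)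
    {s a b : V} (s0 : Small G K (q 0)) (s1 : Small G K (q 1)) (s2 : Small G K (q 2))
    (ss : Small G K s) (sa : Small G K a) (sb : Small G K b) (h1s : G.Adj (q 1) s) (hsa : G.Adj s a)
    (hab : G.Adj a b) (hbs : G.Adj b s) (ns0 : s ≠ q 0) (ns2 : s ≠ q 2) (na1 : a ≠ q 1) (nb1 : b ≠ q 1)
    (hb : ∀ i : ℤ, 2 ≤ i → i ≤ 4 → ∀ f', f' ≠ f → Inc L f' (q i) (q (i + 1)) →
      ∀ k g, FCyc G L f' k g → 9 ≤ k) : False := by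
  have hN := h.nice.2
  have ad : ∀ i j : ℤ, j = i + 1 → G.Adj (q i) (q j) := fun i j e => e ▸ hf.cyc.adj i
  have ic : ∀ i j : ℤ, j = i + 1 → Inc L f (q i) (q j) := fun i j e => e ▸ hf.inc i
  have ne : ∀ i j : ℤ, i < j → j < i + 5 → q i ≠ q j := fun i j h1 h2 => hf.cyc.ne_of h1 (by omega)
  have p5 : q 5 = q 0 := by simpa using hf.cyc.period 0
  have n02 := ne 0 2 (by norm_num) (by norm_num)
  have m1 := deg_three s1.2 (ad 0 1 rfl).symm (ad 1 2 rfl) h1s n02 ns0.symm ns2.symm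
  have ms := deg_three ss.2 h1s.symm hsa hbs.symm na1.symm nb1.symm hab.ne
  obtain ⟨a₁, haa, na_s, na_b, ma⟩ := deg_third sa.2 hsa.symm hab hbs.ne.symm
  obtain ⟨b₁, hbb, nb_s, nb_a, mb⟩ := deg_third sb.2 hbs hab.symm hsa.ne
  have far : ∀ z, G.Adj (q 1) z → z ≠ s → z ≠ a ∧ z ≠ b := by
    intro z hz hzs
    constructor
    · rintro rfl
      exact hN.no4 hz hab hbs h1s.symm nb1.symm hsa.ne.symm
    · rintro rfl
      exact hN.no4 hz hab.symm hsa.symm h1s.symm na1.symm hbs.ne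
  have f0 := far _ (ad 0 1 rfl).symm ns0.symm
  have f2 := far _ (ad 1 2 rfl) ns2.symm
  have n1a : a₁ ≠ q 1 := by
    rintro rfl
    have := m1 _ haa.symm
    rcases this with e | e | e
    exacts [f0.1 e.symm, f2.1 e.symm, hsa.ne e.symm]
  have n1b : b₁ ≠ q 1 := by
    rintro rfl
    have := m1 _ hbb.symm
    rcases this with e | e | e
    exacts [f0.2 e.symm, f2.2 e.symm, hbs.ne e]
  let D : Finset V := {q 1, s, a, b}
  have mD : ∀ x, x ∈ D ↔ x = q 1 ∨ x = s ∨ x = a ∨ x = b := fun x => by simp [D]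
  let T : Finset V := {q 0, q 1, q 2}
  have mT : ∀ x, x ∈ T ↔ x = q 0 ∨ x = q 1 ∨ x = q 2 := fun x => by simp [T]
  have notD : ∀ x, x ∉ D ↔ x ≠ q 1 ∧ x ≠ s ∧ x ≠ a ∧ x ≠ b := fun x => by rw [mD]; tauto
  have d0 : q 0 ∉ D := (notD _).mpr ⟨(ad 0 1 rfl).ne, ns0.symm, f0.1, f0.2⟩
  have d2 : q 2 ∉ D := (notD _).mpr ⟨(ad 1 2 rfl).ne.symm, ns2.symm, f2.1, f2.2⟩
  have da : a₁ ∉ D := (notD _).mpr ⟨n1a, na_s, haa.ne.symm, na_b⟩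
  have db : b₁ ∉ D := (notD _).mpr ⟨n1b, nb_s, nb_a, hbb.ne.symm⟩
  have hAm : ∀ i, q i ∈ A := fun i => h.mem _ _ (hf.cyc.adj i)
  have r1 : (res G T).Reachable (q 1) (q 2) := SimpleGraph.Adj.reachable
    (show (res G T).Adj (q 1) (q 2) from ⟨ad 1 2 rfl, by simp [T], by simp [T]⟩)
  have r0 : (res G T).Reachable (q 0) (q 2) := (SimpleGraph.Adj.reachable
    (show (res G T).Adj (q 0) (q 1) from ⟨ad 0 1 rfl, by simp [T], by simp [T]⟩)).trans r1
  have notK : ∀ x ∈ D, x ∉ K := fun x hx => by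
    rcases (mD x).mp hx with rfl | rfl | rfl | rfl; exacts [s1.1, ss.1, sa.1, sb.1]
  obtain ⟨c₁, k1, k2, k3, k4⟩ := h.identify (D := D) (T := T) (p := q 0) (q := q 2)
    notK (hAm 0) (hAm 2) d0 d2 n02
    (fun x hx hd => by have := (mT x).mp hx; have := (notD x).mp hd; tauto)
    (by simp [T]) (by simp [T])
    (fun x hx => by rcases (mT x).mp hx with rfl | rfl | rfl
                    exacts [r0, r1, SimpleGraph.Reachable.refl _])
    (fun w hw hav => h.configB_path hD (ad 0 1 rfl) (ad 1 2 rfl) (ad 2 3 rfl) (ad 3 4 rfl)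
      (p5 ▸ ad 4 5 rfl) n02 (ne 0 3 (by norm_num) (by norm_num)) (ne 1 3 (by norm_num) (by norm_num))
      (ne 1 4 (by norm_num) (by norm_num)) (ne 2 4 (by norm_num) (by norm_num)) (ic 0 1 rfl) (ic 1 2 rfl)
      (ic 2 3 rfl) (ic 3 4 rfl) (p5 ▸ ic 4 5 rfl) h1s ns0 ns2 s1.1 m1
      (hb 2 le_rfl (by norm_num)) (hb 3 (by norm_num) (by norm_num))
      (fun f' h1 h2 => hb 4 (by norm_num) le_rfl f' h1 (by simpa [p5] using h2)) w hw
      (fun hm => ((notD _).mp (hav _ hm)).1 rfl) (fun hm => ((notD _).mp (hav _ hm)).2.1 rfl))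
    (fun hK => (hK.elim s0.1 s2.1).elim)
  have mS : ∀ x, x ∈ A \ D ↔ x ∈ A ∧ x ∉ D := fun x => Finset.mem_sdiff
  have inD : ∀ x, x ∈ D → x ∉ A \ D := fun x hx hx' => ((mS x).mp hx').2 hx
  have hKS : K ⊆ A \ D := fun x hx => (mS x).mpr ⟨h.sub hx, fun hd => notK x hd hx⟩
  obtain ⟨c, hc, hok⟩ := config_ext (A := A) k2 hKS
    (fun v => by
      rw [mS]
      constructor
      · intro hv; by_cases hd : v ∈ D
        · exact Or.inr ((mD v).mp hd)
        · exact Or.inl ⟨hv, hd⟩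
      · rintro (hv | rfl | rfl | rfl | rfl)
        exacts [hv.1, hAm _, h.mem _ _ hsa, h.mem _ _ hab, h.mem _ _ hbs])
    (inD _ (by simp [D])) (inD _ (by simp [D])) (inD _ (by simp [D]))
    (inD _ (by simp [D])) h1s.ne na1.symm nb1.symm hsa.ne hbs.ne.symm hab.ne
    ((mS _).mpr ⟨hAm 0, d0⟩) ((mS _).mpr ⟨hAm 2, d2⟩)
    ((mS _).mpr ⟨h.mem _ _ haa.symm, da⟩) ((mS _).mpr ⟨h.mem _ _ hbb.symm, db⟩) n02
    m1 ms ma mb k3 k4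
  exact h.bad ⟨c, fun v hv => by rw [← hc v (hKS hv), k1 v hv], hok⟩

end Bad

end

section
open scoped Classical

variable {V : Type} {G : SimpleGraph V} {F : Type} {L : V → V → F} {A K : Finset V} {c₀ : V → Bool}

theorem NoCyc.no6 (hN : NoCyc G) {a b c d e f : V} (h1 : G.Adj a b) (h2 : G.Adj b c) (h3 : G.Adj c d)
    (h4 : G.Adj d e) (h5 : G.Adj e f) (h6 : G.Adj f a) (hnd : [a, b, c, d, e, f].Nodup) : False := by
  refine (hN.path_close (Walk.cons h1 (Walk.cons h2 (Walk.cons h3 (Walk.cons h4 (Walk.cons h5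
    Walk.nil))))) ?_ h6).2.1 (by simp)
  rw [Walk.isPath_def]
  simpa using hnd

theorem NoCyc.no8 (hN : NoCyc G) {a b c d e f i j : V} (h1 : G.Adj a b) (h2 : G.Adj b c)
    (h3 : G.Adj c d) (h4 : G.Adj d e) (h5 : G.Adj e f) (h6 : G.Adj f i) (h7 : G.Adj i j) (h8 : G.Adj j a)
    (hnd : [a, b, c, d, e, f, i, j].Nodup) : False := by
  refine (hN.path_close (Walk.cons h1 (Walk.cons h2 (Walk.cons h3 (Walk.cons h4 (Walk.cons h5
    (Walk.cons h6 (Walk.cons h7 Walk.nil))))))) ?_ h8).2.2 (by simp)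
  rw [Walk.isPath_def]
  simpa using hnd

variable [Fintype V]

namespace Bad

theorem face_eq (h : Bad G A K c₀) (hD : IsDual G L) {f f' : F} {k k' : ℕ} {g g' : ℤ → V}
    (hf : FCyc G L f k g) (hf' : FCyc G L f' k' g') (hs : ∀ i, CEdge g' (g i) (g (i + 1))) : f = f' := by
  have hT := h.twoConn
  have hsub : ∀ x y, CEdge g x y → CEdge g' x y := by
    rintro x y ⟨i, ⟨rfl, rfl⟩ | ⟨rfl, rfl⟩⟩
    exacts [hs i, (hs i).symm]
  have hmin := hD.face_min hT (f := f') (fun x y => if CEdge g x y then 1 else 0)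
    (fun a b => by simp only [CEdge.comm]) (fun a b hab => by
      have : CEdge g a b := by by_contra hc; simp [hc] at hab
      exact (hf'.edge a b).mp (hsub a b this))
    (fun a => hf.cyc.sum_cedge a) (a := g 0) (b := g (0 + 1)) (by
      rw [if_pos ⟨0, Or.inl ⟨rfl, rfl⟩⟩]; exact one_ne_zero)
  have hE : ∀ x y, CEdge g x y ↔ CEdge g' x y := fun x y => ⟨hsub x y, fun hc => by
    have := (hf'.edge x y).mp hc
    have := hmin x y this.1 this.2
    by_contra hc'
    simp [hc'] at this⟩
  have e2 : FCyc G L f k' g' := ⟨hf'.cyc, fun x y => by rw [← hE, hf.edge]⟩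
  exact h.face_unique hD e2 hf'

theorem len_cases (h : Bad G A K c₀) {f : F} {k : ℕ} {g : ℤ → V} (hf : FCyc G L f k g) :
    k = 3 ∨ k = 5 ∨ k = 7 ∨ 9 ≤ k := by
  have h1 := h.nice.2.len hf.cyc
  have h2 := hf.cyc.three_le
  omega

theorem tri_edge (h : Bad G A K c₀) (hD : IsDual G L) {T f : F} {q g : ℤ → V} {k : ℕ}
    (hT : FCyc G L T 3 q) (hf : FCyc G L f k g) (hne : T ≠ f) {x y : V} (hxy : G.Adj x y)
    (i1 : Inc L T x y) (i2 : Inc L f x y) : 9 ≤ k := by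
  have hN := h.nice.2
  obtain ⟨t, ayt, atx, iyt, itx⟩ := hT.apex hxy i1
  by_contra hk
  have hk' : k = 3 ∨ k = 5 ∨ k = 7 ∨ k = 9 := by have := h.len_cases hf; omega
  obtain ⟨g, hf, rfl, rfl, -⟩ := hf.start hxy i2
  have h3 := hf.cyc.three_le
  by_cases ht : ∃ j, g j = t
  · obtain ⟨j, rfl⟩ := ht
    have c1 := hN.chord hf.cyc hk' atx
    have c2 := hN.chord hf.cyc hk' ayt
    refine hne (h.face_eq hD hT hf (fun i => ?_))
    obtain ⟨q', hq', e0, e1, hv⟩ := hT.start hxy i1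
    have := (hT.edge _ _).mpr ⟨hT.cyc.adj i, hT.inc i⟩
    rw [hT.edge, ← hq'.edge] at this
    have e2 : q' 2 = g j := by
      have m1 : CEdge q' (q' 1) (g j) := by rw [hq'.edge, e1]; exact ⟨ayt, iyt⟩
      rw [hq'.cyc.cedge_iff] at m1
      rcases m1 with m1 | m1
      · exact m1.symm
      · rw [show (1 : ℤ) - 1 = 0 by norm_num, e0] at m1; exact absurd m1 atx.ne
    have key : ∀ r, CEdge g (q' r) (q' (r + 1)) := by
      intro r
      have hr : ∃ r' : ℤ, 0 ≤ r' ∧ r' < 3 ∧ q' r = q' r' ∧ q' (r + 1) = q' (r' + 1) := by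
        refine ⟨r % 3, by omega, by omega, ?_, ?_⟩
        · rw [hq'.cyc.eq_iff]; push_cast; omega
        · rw [hq'.cyc.eq_iff]; push_cast; omega
      obtain ⟨r', h1, h2, h3, h4⟩ := hr
      rw [h3, h4]
      interval_cases r'
      · rw [show (0 : ℤ) + 1 = 1 by norm_num, e0, e1]; exact ⟨0, Or.inl ⟨rfl, rfl⟩⟩
      · rw [show (1 : ℤ) + 1 = 2 by norm_num, e1, e2]; exact c2
      · have : q' (2 + 1) = q' 0 := by rw [hq'.cyc.eq_iff]; norm_num
        rw [this, e0, e2]; exact c1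
    obtain ⟨r, ⟨e1, e2⟩ | ⟨e1, e2⟩⟩ := this
    · rw [e1, e2]; exact key r
    · rw [e1, e2]; exact (key r).symm
  · obtain ⟨p, hp, hl, hs, -⟩ := hf.cyc.arc 1 (k - 1) (by omega)
    have e : g (1 + (k - 1 : ℕ)) = g 0 := by rw [hf.cyc.eq_iff]; exact ⟨1, by omega⟩
    have hp2 : (p.concat (e ▸ atx.symm : G.Adj (g (1 + (k - 1 : ℕ))) t)).IsPath := by
      rw [Walk.concat_isPath_iff]
      refine ⟨hp, fun hm => ht ?_⟩
      obtain ⟨j, -, hj⟩ := (hs t).mp hm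
      exact ⟨_, hj.symm⟩
    have := hN.path_close _ hp2 ayt.symm
    rw [Walk.length_concat, hl] at this
    omega

theorem penta_edge (h : Bad G A K c₀) (hD : IsDual G L) {f f' : F} {p q : ℤ → V}
    (hf : FCyc G L f 5 p) (hf' : FCyc G L f' 5 q) (hne : f ≠ f') {x y : V} (hxy : G.Adj x y)
    (i1 : Inc L f x y) (i2 : Inc L f' x y) : False := by
  have hN := h.nice.2
  obtain ⟨p, hp, p0, p1, -⟩ := hf.start hxy i1
  obtain ⟨q, hq, q0, q1, -⟩ := hf'.start hxy i2
  subst p0 p1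
  have ap : ∀ i j : ℤ, j = i + 1 → G.Adj (p i) (p j) := fun i j e => e ▸ hp.cyc.adj i
  have aq : ∀ i j : ℤ, j = i + 1 → G.Adj (q i) (q j) := fun i j e => e ▸ hq.cyc.adj i
  have np : ∀ i j : ℤ, i < j → j < i + 5 → p i ≠ p j := fun i j h1 h2 => hp.cyc.ne_of h1 (by omega)
  have nq : ∀ i j : ℤ, i < j → j < i + 5 → q i ≠ q j := fun i j h1 h2 => hq.cyc.ne_of h1 (by omega)
  have p5 : p 5 = p 0 := by simpa using hp.cyc.period 0
  have q5 : q 5 = q 0 := by simpa using hq.cyc.period 0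
  have a40 := p5 ▸ ap 4 5 rfl
  have b40 := q5 ▸ aq 4 5 rfl
  have b12 := aq 1 2 rfl
  have b23 := aq 2 3 rfl
  have b34 := aq 3 4 rfl
  have a12 := ap 1 2 rfl
  have a23 := ap 2 3 rfl
  have a34 := ap 3 4 rfl
  have n01 := np 0 1 (by norm_num) (by norm_num)
  have n02 := np 0 2 (by norm_num) (by norm_num)
  have n03 := np 0 3 (by norm_num) (by norm_num)
  have n04 := np 0 4 (by norm_num) (by norm_num)
  have n12 := np 1 2 (by norm_num) (by norm_num)
  have n13 := np 1 3 (by norm_num) (by norm_num)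
  have n14 := np 1 4 (by norm_num) (by norm_num)
  have n23 := np 2 3 (by norm_num) (by norm_num)
  have n24 := np 2 4 (by norm_num) (by norm_num)
  have n34 := np 3 4 (by norm_num) (by norm_num)
  have m02 := nq 0 2 (by norm_num) (by norm_num)
  have m03 := nq 0 3 (by norm_num) (by norm_num)
  have m04 := nq 0 4 (by norm_num) (by norm_num)
  have m12 := nq 1 2 (by norm_num) (by norm_num)
  have m13 := nq 1 3 (by norm_num) (by norm_num)
  have m14 := nq 1 4 (by norm_num) (by norm_num)
  have m23 := nq 2 3 (by norm_num) (by norm_num)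
  have m24 := nq 2 4 (by norm_num) (by norm_num)
  have m34 := nq 3 4 (by norm_num) (by norm_num)
  have ch : ∀ i j : ℤ, G.Adj (p i) (p j) → p j = p (i + 1) ∨ p j = p (i - 1) := fun i j ha =>
    (hp.cyc.cedge_iff).mp (hN.chord hp.cyc (by norm_num) ha)
  have red : ∀ z : ℤ → V, IsCyc G 5 z → ∀ r : ℤ, ∃ r' : ℤ, 0 ≤ r' ∧ r' < 5 ∧ z r = z r' ∧
      z (r + 1) = z (r' + 1) := fun z hz r => by
    refine ⟨r % 5, by omega, by omega, ?_, ?_⟩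
    · rw [hz.eq_iff]; push_cast; omega
    · rw [hz.eq_iff]; push_cast; omega
  have inP : ∀ i, p i = p 0 ∨ p i = p 1 ∨ p i = p 2 ∨ p i = p 3 ∨ p i = p 4 := by
    intro i
    obtain ⟨r, h1, h2, h3, -⟩ := red p hp.cyc i
    rw [h3]
    interval_cases r <;> simp
  have ne1 : ∀ z, (∀ j, p j ≠ z) → p 0 ≠ z ∧ p 1 ≠ z ∧ p 2 ≠ z ∧ p 3 ≠ z ∧ p 4 ≠ z :=
    fun z hz => ⟨hz 0, hz 1, hz 2, hz 3, hz 4⟩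
  rw [q0] at b40 m02 m03 m04
  rw [q1] at b12 m12 m13 m14
  have c2 : (∃ j, p j = q 2) → q 2 = p 2 := by
    rintro ⟨j, hj⟩
    rw [← hj] at b12 m02 ⊢
    rcases ch _ _ b12 with e | e
    · exact e
    · exact absurd e.symm m02
  have c4 : (∃ j, p j = q 4) → q 4 = p 4 := by
    rintro ⟨j, hj⟩
    rw [← hj] at b40 m14 ⊢
    rcases ch _ _ b40.symm with e | e
    · exact absurd e.symm m14
    · rw [e, hp.cyc.eq_iff]; norm_num
  by_cases h2 : ∃ j, p j = q 2
  · have e2 := c2 h2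
    by_cases h4 : ∃ j, p j = q 4
    · have e4 := c4 h4
      rw [e2] at b23 m23 m24; rw [e4] at b34 m34
      by_cases h3 : ∃ j, p j = q 3
      · obtain ⟨j, hj⟩ := h3
        have e3 : q 3 = p 3 := by
          rw [← hj] at b23 m13 ⊢
          rcases ch _ _ b23 with e | e
          · exact e
          · exact absurd e.symm m13
        refine hne (h.face_eq hD hp hq fun i => ?_)
        obtain ⟨r, r1, r2, r3, r4⟩ := red p hp.cyc i
        rw [r3, r4]
        have : p r = q r ∧ p (r + 1) = q (r + 1) := by
          interval_cases r
          · exact ⟨q0.symm, q1.symm⟩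
          · exact ⟨q1.symm, e2.symm⟩
          · exact ⟨e2.symm, e3.symm⟩
          · exact ⟨e3.symm, e4.symm⟩
          · exact ⟨e4.symm, p5.trans (q0.symm.trans q5.symm)⟩
        rw [this.1, this.2]
        exact ⟨r, Or.inl ⟨rfl, rfl⟩⟩
      · exact hN.no4 b23 b34 a34.symm a23.symm n24 (fun e => h3 ⟨3, e.symm⟩)
    · have h4' := ne1 _ (not_exists.mp h4)
      rw [e2] at b23 m23 m24
      by_cases h3 : ∃ j, p j = q 3
      · obtain ⟨j, hj⟩ := h3
        have e3 : q 3 = p 3 := by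
          rw [← hj] at b23 m13 ⊢
          rcases ch _ _ b23 with e | e
          · exact e
          · exact absurd e.symm m13
        rw [e3] at b34
        exact hN.no4 b34 b40 a40.symm a34.symm n03.symm h4'.2.2.2.2.symm
      · have h3' := ne1 _ (not_exists.mp h3)
        refine hN.no6 b23 b34 b40 a40.symm a34.symm a23.symm ?_
        simp only [List.nodup_cons, List.mem_cons, List.not_mem_nil, or_false, not_or]
        grind
  · have h2' := ne1 _ (not_exists.mp h2)
    by_cases h4 : ∃ j, p j = q 4
    · have e4 := c4 h4
      rw [e4] at b34 m34 m24
      by_cases h3 : ∃ j, p j = q 3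
      · obtain ⟨j, hj⟩ := h3
        have e3 : q 3 = p 3 := by
          rw [← hj] at b34 m03 ⊢
          rcases ch _ _ b34.symm with e | e
          · rw [e, show (4 : ℤ) + 1 = 5 by norm_num, p5] at m03; exact absurd rfl m03
          · exact e
        rw [e3] at b23
        exact hN.no4 b12 b23 a23.symm a12.symm n13 h2'.2.2.1.symm
      · have h3' := ne1 _ (not_exists.mp h3)
        refine hN.no6 b12 b23 b34 a34.symm a23.symm a12.symm ?_
        simp only [List.nodup_cons, List.mem_cons, List.not_mem_nil, or_false, not_or]
        grind
    · have h4' := ne1 _ (not_exists.mp h4)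
      by_cases h3 : ∃ j, p j = q 3
      · obtain ⟨j, hj⟩ := h3
        rcases inP j with e | e | e | e | e <;> rw [hj] at e
        · exact m03 e.symm
        · exact m13 e.symm
        · rw [e] at b34
          exact hN.no4 b34 b40 (ap 0 1 rfl) a12 n02.symm h4'.2.1.symm
        · rw [e] at b23
          exact hN.no4 b12 b23 a23.symm a12.symm n13 h2'.2.2.1.symm
        · rw [e] at b23
          exact hN.no4 b12 b23 a40 (ap 0 1 rfl) n14 h2'.1.symm
      · have h3' := ne1 _ (not_exists.mp h3)
        refine hN.no8 b12 b23 b34 b40 a40.symm a34.symm a23.symm a12.symm ?_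
        simp only [List.nodup_cons, List.mem_cons, List.not_mem_nil, or_false, not_or]
        grind

/-- Two faces of length three or five do not share an edge. -/
theorem short_edge (h : Bad G A K c₀) (hD : IsDual G L) {f f' : F} {k k' : ℕ} {p q : ℤ → V}
    (hf : FCyc G L f k p) (hf' : FCyc G L f' k' q) (hk : k ≤ 6) (hk' : k' ≤ 6) (hne : f ≠ f') {x y : V}
    (hxy : G.Adj x y) (i1 : Inc L f x y) (i2 : Inc L f' x y) : False := by
  rcases h.len_cases hf with rfl | rfl | rfl | h1
  · have := h.tri_edge hD hf hf' hne hxy i1 i2; omega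
  · rcases h.len_cases hf' with rfl | rfl | rfl | h1
    · have := h.tri_edge hD hf' hf hne.symm hxy i2 i1; omega
    · exact h.penta_edge hD hf hf' hne hxy i1 i2
    · omega
    · omega
  · omega
  · omega

end Bad

end

section
open scoped Classical

variable {V : Type} {G : SimpleGraph V} {F : Type} {L : V → V → F} {A : Finset V} [Fintype V]

theorem FCyc.sum_dts (hD : IsDual G L) (hT : TwoConn G A) {f : F} {k : ℕ} {g : ℤ → V}
    (hf : FCyc G L f k g) (w : V → V → ℤ) (hw : ∀ a b, w a b = w b a) :
    ∑ p ∈ (dts G).filter (fun p => L p.1 p.2 = f), w p.1 p.2 =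
      ∑ i ∈ Finset.range k, w (g i) (g (i + 1)) := by
  have hcyc := hf.cyc
  symm
  refine Finset.sum_bij (fun (i : ℕ) _ => if L (g i) (g (i + 1)) = f then (g i, g (i + 1)) else
    (g (i + 1), g i)) ?_ ?_ ?_ ?_
  · intro i _
    have ha := hcyc.adj i
    have hi := ((hf.edge _ _).mp ⟨(i : ℤ), Or.inl ⟨rfl, rfl⟩⟩).2
    rw [Finset.mem_filter, mem_dts]
    by_cases hc : L (g i) (g (i + 1)) = f
    · rw [if_pos hc]; exact ⟨ha, hc⟩
    · rw [if_neg hc]; exact ⟨ha.symm, hi.resolve_left hc⟩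
  · intro i hi j hj hij
    have key : (g i = g j ∧ g (i + 1) = g (j + 1)) ∨ (g i = g (j + 1) ∧ g (i + 1) = g j) := by
      split_ifs at hij <;> rw [Prod.mk.injEq] at hij <;> tauto
    rw [Finset.mem_range] at hi hj
    rcases key with ⟨h1, -⟩ | ⟨h1, h2⟩
    · rw [hcyc.eq_iff] at h1
      obtain ⟨c, hc⟩ := h1
      have : c = 0 := by
        have : -(k : ℤ) < k * c := by omega
        have : (k : ℤ) * c < k := by omega
        by_contra hne
        rcases lt_or_gt_of_ne hne with h | h <;> nlinarith
      subst this
      omega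
    · exfalso
      rw [hcyc.eq_iff] at h1 h2
      have := dvd_sub h2 h1
      rw [show ((i : ℤ) + 1 - j - (i - (j + 1))) = 2 by ring] at this
      have := Int.le_of_dvd (by norm_num) this
      have := hcyc.three_le
      omega
  · rintro ⟨a, b⟩ hp
    rw [Finset.mem_filter, mem_dts] at hp
    obtain ⟨hab, hp⟩ := hp
    dsimp only at hab hp
    have hc : CEdge g a b := (hf.edge a b).mpr ⟨hab, Or.inl hp⟩
    have hk : (0 : ℤ) < k := by have := hcyc.three_le; omega
    obtain ⟨i, hi⟩ := hc
    have h0 : g i = g ((i % k).toNat : ℕ) ∧ g (i + 1) = g (((i % k).toNat : ℕ) + 1) := by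
      have e : (((i % k).toNat : ℕ) : ℤ) = i % k := Int.toNat_of_nonneg (Int.emod_nonneg _ hk.ne')
      rw [e, hcyc.eq_iff, hcyc.eq_iff]
      have := Int.emod_add_mul_ediv i k
      exact ⟨⟨i / k, by linarith⟩, ⟨i / k, by linarith⟩⟩
    have hl : (i % k).toNat < k := by
      have := Int.emod_lt_of_pos i hk
      omega
    refine ⟨(i % k).toNat, Finset.mem_range.mpr hl, ?_⟩
    rw [← h0.1, ← h0.2]
    rcases hi with ⟨rfl, rfl⟩ | ⟨rfl, rfl⟩
    · rw [if_pos hp]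
    · rw [if_neg (fun h => hD.ne hT hab (hp.trans h.symm))]
  · intro i _
    split_ifs
    · rfl
    · exact hw _ _

theorem sum_dts_swap (w : V × V → ℤ) : ∑ p ∈ dts G, w p.swap = ∑ p ∈ dts G, w p := by
  refine Finset.sum_nbij' Prod.swap Prod.swap ?_ ?_ ?_ ?_ ?_ <;> intro p <;>
    simp [mem_dts, G.adj_comm]

theorem sum_dts_eq (hmem : ∀ a b, G.Adj a b → a ∈ A) (w : V → V → ℤ) :
    ∑ p ∈ dts G, w p.1 p.2 = ∑ v ∈ A, ∑ b ∈ Finset.univ.filter (G.Adj v), w v b := by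
  rw [Finset.sum_sigma']
  refine Finset.sum_nbij' (fun p => ⟨p.1, p.2⟩) (fun p => (p.1, p.2)) ?_ ?_ ?_ ?_ ?_
  · rintro ⟨a, b⟩ hp; rw [mem_dts] at hp; simpa using ⟨hmem _ _ hp, hp⟩
  · rintro ⟨a, b⟩ hp; rw [mem_dts]; simpa using (by simpa using hp : a ∈ A ∧ G.Adj a b).2
  all_goals simp

/-- The amount by which the edge `xy` contributes to the final charge of the face `f`, when a face
gives half of `out` for each of its edges to the face on the other side and the vertex `v` gives
twice `hp v f` to `f`. -/
noncomputable def gain (L : V → V → F) (hp : V → F → ℤ) (out : F → V → V → ℤ) (f : F) (x y : V) : ℤ :=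
  24 + hp x f + hp y f + out (L x y) x y + out (L y x) x y - 2 * out f x y

theorem IsDual.total_charge (hD : IsDual G L) (hT : TwoConn G A) (hp : V → F → ℤ)
    (out : F → V → V → ℤ) (ho : ∀ f a b, out f a b = out f b a) :
    ∑ v ∈ A, (∑ b ∈ Finset.univ.filter (G.Adj v), (48 - hp v (L v b) - hp v (L b v)) - 144) +
      ∑ f ∈ fcs G L, (∑ p ∈ (dts G).filter (fun p => L p.1 p.2 = f), gain L hp out f p.1 p.2 - 144) ≤
      -288 := by
  have he := hD.euler hT
  rw [Finset.sum_sub_distrib, Finset.sum_sub_distrib, Finset.sum_const, Finset.sum_const,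
    ← sum_dts_eq hT.mem (fun v b => 48 - hp v (L v b) - hp v (L b v))]
  have h1 : ∑ f ∈ fcs G L, ∑ p ∈ (dts G).filter (fun p => L p.1 p.2 = f), gain L hp out f p.1 p.2 =
      ∑ p ∈ dts G, gain L hp out (L p.1 p.2) p.1 p.2 := by
    rw [← Finset.sum_fiberwise_of_maps_to (t := fcs G L) (g := fun p => L p.1 p.2)
      (fun p hp => mem_fcs.mpr ⟨_, _, mem_dts.mp hp, rfl⟩)]
    refine Finset.sum_congr rfl fun f _ => Finset.sum_congr rfl fun p hp => ?_
    rw [(Finset.mem_filter.mp hp).2]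
  have h2 : ∑ p ∈ dts G, hp p.2 (L p.1 p.2) = ∑ p ∈ dts G, hp p.1 (L p.2 p.1) :=
    sum_dts_swap (fun p => hp p.1 (L p.2 p.1))
  have h3 : ∑ p ∈ dts G, out (L p.2 p.1) p.1 p.2 = ∑ p ∈ dts G, out (L p.1 p.2) p.1 p.2 := by
    rw [← sum_dts_swap]
    exact Finset.sum_congr rfl fun p _ => ho _ _ _
  rw [h1]
  simp only [gain, Finset.sum_sub_distrib, Finset.sum_add_distrib, ← Finset.mul_sum, Finset.sum_const]
  rw [h2, h3]
  simp only [nsmul_eq_mul]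
  zify at he
  linarith

end

section

/-- The numerical facts about a long face without edges in the anchor: `t` and `p` mark the edges
towards triangles and towards paid pentagons, `b` the vertices that are not small. -/
structure LongFace (k : ℕ) (t p b H : ℤ → ℤ) : Prop where
  pt : ∀ i, t (i + k) = t i
  pp : ∀ i, p (i + k) = p i
  pb : ∀ i, b (i + k) = b i
  pH : ∀ i, H (i + k) = H i
  t01 : ∀ i, t i = 0 ∨ t i = 1
  p01 : ∀ i, p i = 0 ∨ p i = 1
  b01 : ∀ i, b i = 0 ∨ b i = 1
  tp : ∀ i, t i + p i ≤ 1
  small : ∀ i, b i = 0 → t (i - 1) + p (i - 1) + t i + p i ≤ 1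
  tetrad : ∀ i, t i = 1 → t (i + 2) = 1 → b i = 0 → b (i + 1) = 0 → b (i + 2) = 0 → b (i + 3) ≠ 0
  spec : k = 9 → ∀ i, p i = 1 → t (i + 2) = 1 → t (i - 2) = 1 → b (i - 2) = 0 → b (i - 1) = 0 →
    b i = 0 → b (i + 1) = 0 → b (i + 2) = 0 → b (i + 3) ≠ 0
  H0 : ∀ i, 0 ≤ H i
  Ht : ∀ i, b i = 1 → t (i - 1) + t i ≠ 0 → 12 ≤ H i
  Hp : ∀ i, b i = 1 → p (i - 1) + p i ≠ 0 → 4 ≤ H i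

namespace LongFace

variable {k : ℕ} {t p b H : ℤ → ℤ}

theorem shift (h : LongFace k t p b H) (m : ℤ) :
    LongFace k (fun i => t (i + m)) (fun i => p (i + m)) (fun i => b (i + m)) (fun i => H (i + m)) where
  pt i := by rw [← h.pt (i + m)]; ring_nf
  pp i := by rw [← h.pp (i + m)]; ring_nf
  pb i := by rw [← h.pb (i + m)]; ring_nf
  pH i := by rw [← h.pH (i + m)]; ring_nf
  t01 i := h.t01 _
  p01 i := h.p01 _
  b01 i := h.b01 _
  tp i := h.tp _
  small i := by have := h.small (i + m); ring_nf at this ⊢; exact this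
  tetrad i := by have := h.tetrad (i + m); ring_nf at this ⊢; exact this
  spec hk i := by have := h.spec hk (i + m); ring_nf at this ⊢; exact this
  H0 i := h.H0 _
  Ht i := by have := h.Ht (i + m); ring_nf at this ⊢; exact this
  Hp i := by have := h.Hp (i + m); ring_nf at this ⊢; exact this

/-- The final charge that remains at the vertex `i`. -/
def val (t p H : ℤ → ℤ) (i : ℤ) : ℤ :=
  2 * H i - 12 * (t (i - 1) + t i) - 4 * (p (i - 1) + p i)

theorem sum_shift (f : ℤ → ℤ) (hf : ∀ i, f (i + k) = f i) (m : ℤ) :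
    ∑ i ∈ Finset.range k, f (i + m) = ∑ i ∈ Finset.range k, f i := by
  rcases Nat.eq_zero_or_pos k with rfl | hk
  · simp
  have h1 : ∀ m, ∑ i ∈ Finset.range k, f (i + (m + 1)) = ∑ i ∈ Finset.range k, f (i + m) := by
    intro m
    obtain ⟨k, rfl⟩ : ∃ n, k = n + 1 := ⟨k - 1, by omega⟩
    rw [Finset.sum_range_succ, Finset.sum_range_succ']
    congr 1
    · exact Finset.sum_congr rfl fun i _ => by push_cast; ring_nf
    · have := hf m; push_cast at this ⊢; rw [zero_add, ← this]; ring_nf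
  induction m using Int.induction_on with
  | zero => simp
  | succ n ih => rw [h1, ih]
  | pred n ih => rw [← ih, ← h1]; simp

theorem exists_local {t t' p p' b H : ℤ} (ht : t = 0 ∨ t = 1) (ht' : t' = 0 ∨ t' = 1) (hp : p = 0 ∨ p = 1)
    (hp' : p' = 0 ∨ p' = 1) (hb : b = 0 ∨ b = 1) (h1 : t + p ≤ 1) (h2 : t' + p' ≤ 1)
    (h3 : b = 0 → t' + p' + t + p ≤ 1) (h0 : 0 ≤ H) (h4 : b = 1 → t' + t ≠ 0 → 12 ≤ H)
    (h5 : b = 1 → p' + p ≠ 0 → 4 ≤ H) {v : ℤ} (hv : v = 2 * H - 12 * (t' + t) - 4 * (p' + p)) {s : ℤ}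
    (hs : (s = 1 ∧ b = 0 ∧ t' + t = 1) ∨ (s = 0 ∧ ¬ (b = 0 ∧ t' + t = 1))) :
    (s = 0 ∨ s = 1) ∧ -12 ≤ v ∧ (s = 0 → -4 ≤ v) ∧ (s = 1 → b = 0) ∧ (s = 1 → t' + t = 1) ∧
    (s = 0 → b = 0 → t' = 0 ∧ t = 0) ∧ (s = 0 → p' = 0 → p = 0 → 0 ≤ v) ∧
    (s = 0 → t' + t = 1 → 8 ≤ v) ∧ (s = 0 → t' + t = 1 → p' = 0 → p = 0 → 12 ≤ v) ∧
    (b = 1 → p = 1 → p' = 0 → 4 ≤ v) ∧ (b = 1 → p' = 1 → p = 0 → 4 ≤ v) ∧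
    (p = 1 → s = 0) ∧ (p' = 1 → s = 0) ∧ (b = 1 → 0 ≤ v) := by
  rcases ht with rfl | rfl <;> rcases ht' with rfl | rfl <;> rcases hp with rfl | rfl <;>
    rcases hp' with rfl | rfl <;> rcases hb with rfl | rfl <;> norm_num at * <;>
    omega

theorem exists_sigma (h : LongFace k t p b H) : ∃ s : ℤ → ℤ, (∀ i, s (i + k) = s i) ∧
    (∀ i, s i = 0 ∨ s i = 1) ∧ (∀ i, -12 ≤ val t p H i) ∧ (∀ i, s i = 0 → -4 ≤ val t p H i) ∧
    (∀ i, s i = 1 → b i = 0) ∧ (∀ i, s i = 1 → t (i - 1) + t i = 1) ∧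
    (∀ i, s i = 0 → b i = 0 → t (i - 1) = 0 ∧ t i = 0) ∧
    (∀ i, s i = 0 → p (i - 1) = 0 → p i = 0 → 0 ≤ val t p H i) ∧
    (∀ i, s i = 0 → t (i - 1) + t i = 1 → 8 ≤ val t p H i) ∧
    (∀ i, s i = 0 → t (i - 1) + t i = 1 → p (i - 1) = 0 → p i = 0 → 12 ≤ val t p H i) ∧
    (∀ i, b i = 1 → p i = 1 → p (i - 1) = 0 → 4 ≤ val t p H i) ∧
    (∀ i, b i = 1 → p (i - 1) = 1 → p i = 0 → 4 ≤ val t p H i) ∧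
    (∀ i, p i = 1 → s i = 0 ∧ s (i + 1) = 0) ∧ (∀ i, b i = 1 → 0 ≤ val t p H i ) ∧
    ∀ i, s i + s (i + 1) + s (i + 2) + s (i + 3) + s (i + 4) ≤ 4 := by
  classical
  let s : ℤ → ℤ := fun i => if b i = 0 ∧ t (i - 1) + t i = 1 then 1 else 0
  have hs : ∀ i, (s i = 1 ∧ b i = 0 ∧ t (i - 1) + t i = 1) ∨
      (s i = 0 ∧ ¬ (b i = 0 ∧ t (i - 1) + t i = 1)) := by
    intro i
    by_cases hc : b i = 0 ∧ t (i - 1) + t i = 1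
    · exact Or.inl ⟨if_pos hc, hc⟩
    · exact Or.inr ⟨if_neg hc, hc⟩
  have key := fun i => exists_local (h.t01 i) (h.t01 (i - 1)) (h.p01 i) (h.p01 (i - 1)) (h.b01 i) (h.tp i)
    (h.tp (i - 1)) (h.small i) (h.H0 i) (h.Ht i) (h.Hp i) (v := val t p H i) rfl (hs i)
  refine ⟨s, ?_, fun i => (key i).1, fun i => (key i).2.1, fun i => (key i).2.2.1,
    fun i => (key i).2.2.2.1, fun i => (key i).2.2.2.2.1, fun i => (key i).2.2.2.2.2.1,
    fun i => (key i).2.2.2.2.2.2.1, fun i => (key i).2.2.2.2.2.2.2.1,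
    fun i => (key i).2.2.2.2.2.2.2.2.1, fun i => (key i).2.2.2.2.2.2.2.2.2.1,
    fun i => (key i).2.2.2.2.2.2.2.2.2.2.1, fun i hp => ⟨(key i).2.2.2.2.2.2.2.2.2.2.2.1 hp, ?_⟩,
    fun i => (key i).2.2.2.2.2.2.2.2.2.2.2.2.2, ?_⟩
  · intro i
    have e : t (i + k - 1) = t (i - 1) := by rw [← h.pt (i - 1)]; ring_nf
    simp only [s, h.pb, h.pt, e]
  · have := (key (i + 1)).2.2.2.2.2.2.2.2.2.2.2.2.1
    rw [add_sub_cancel_right] at this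
    exact this hp
  · intro i
    by_contra hc
    have hle : ∀ j, s j ≤ 1 := fun j => by rcases hs j with h | h <;> rw [h.1]; norm_num
    have l0 := hle i
    have l1 := hle (i + 1)
    have l2 := hle (i + 2)
    have l3 := hle (i + 3)
    have l4 := hle (i + 4)
    have one : ∀ j, s j = 1 → b j = 0 ∧ t (j - 1) + t j = 1 := fun j hj => by
      rcases hs j with h | h
      · exact h.2
      · rw [h.1] at hj; norm_num at hj
    have h0 := one i (by linarith)
    have h1 := one (i + 1) (by linarith)
    have h2 := one (i + 2) (by linarith)
    have h3 := one (i + 3) (by linarith)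
    have h4 := one (i + 4) (by linarith)
    have z1 := h.tetrad i
    have z2 := h.tetrad (i + 1)
    rw [show i + 1 - 1 = i by ring] at h1
    rw [show i + 2 - 1 = i + 1 by ring] at h2
    rw [show i + 3 - 1 = i + 2 by ring] at h3
    rw [show i + 4 - 1 = i + 3 by ring] at h4
    rw [show i + 1 + 1 = i + 2 by ring, show i + 1 + 2 = i + 3 by ring,
      show i + 1 + 3 = i + 4 by ring] at z2
    rcases h.t01 i with e | e
    · exact z2 (by linarith) (by linarith) h1.1 h2.1 h3.1 h4.1
    · exact z1 e (by linarith) h0.1 h1.1 h2.1 h3.1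

theorem sum_range_const_le {k : ℕ} {f : ℤ → ℤ} {c : ℤ} (h : ∀ i, c ≤ f i) :
    k * c ≤ ∑ i ∈ Finset.range k, f i := by
  have := Finset.card_nsmul_le_sum (Finset.range k) (fun i : ℕ => f i) c (fun i _ => h i)
  simpa using this

theorem sum_add_le {k : ℕ} {lo f : ℤ → ℤ} {c i : ℤ} (h : ∀ i, lo i ≤ f i) (h0 : 0 ≤ i) (hk : i < k)
    (hi : lo i + c ≤ f i) : ∑ i ∈ Finset.range k, lo i + c ≤ ∑ i ∈ Finset.range k, f i := by
  have := Finset.single_le_sum (f := fun j : ℕ => f j - lo j) (s := Finset.range k)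
    (fun j _ => sub_nonneg.mpr (h j)) (Finset.mem_range.mpr (by omega : i.toNat < k))
  rw [Finset.sum_sub_distrib] at this
  rw [Int.toNat_of_nonneg h0] at this
  linarith

theorem exists_odd (h : LongFace k t p b H) {s : ℤ → ℤ} (s01 : ∀ i, s i = 0 ∨ s i = 1)
    (st : ∀ i, s i = 1 → t (i - 1) + t i = 1) (hs : ¬ (2 : ℤ) ∣ ∑ i ∈ Finset.range k, s i) :
    ∃ i : ℤ, 0 ≤ i ∧ i < k ∧ s i = 0 ∧ t (i - 1) + t i = 1 := by
  by_contra hc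
  push Not at hc
  refine hs ?_
  have e : ∀ i ∈ Finset.range k, (2 : ℤ) ∣ (t ((i : ℤ) - 1) + t i) - s i := by
    intro i hi
    have h1 := hc i (by omega) (by have := Finset.mem_range.mp hi; omega)
    have h2 := st i
    have h3 := h.t01 i
    have h4 := h.t01 ((i : ℤ) - 1)
    rcases s01 i with h5 | h5 <;> omega
  have e := Finset.dvd_sum e
  rw [Finset.sum_sub_distrib, Finset.sum_add_distrib] at e
  have := sum_shift t h.pt (-1)
  simp only [← sub_eq_add_neg] at this
  rw [this, ← two_mul] at e
  exact (dvd_sub_right (Dvd.intro _ rfl)).mp e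

theorem final10 (h : LongFace 10 t p b H) : -96 ≤ ∑ i ∈ Finset.range 10, val t p H i := by
  obtain ⟨s, ps, s01, v12, v4, sb, st, s0, v0, v8, v12', -, -, pss, -, w⟩ := h.exists_sigma
  have s1 := s01 0; have s2 := s01 1; have s3 := s01 2; have s4 := s01 3; have s5 := s01 4
  have s6 := s01 5; have s7 := s01 6; have s8 := s01 7; have s9 := s01 8; have s10 := s01 9
  have v12' : ∀ i, -4 - 8 * s i ≤ val t p H i := fun i => by
    have := s01 i; have := v4 i; have := v12 i; omega
  have a1 := v12' 0; have a2 := v12' 1; have a3 := v12' 2; have a4 := v12' 3; have a5 := v12' 4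
  have a6 := v12' 5; have a7 := v12' 6; have a8 := v12' 7; have a9 := v12' 8; have a10 := v12' 9
  have r : ∀ i : ℤ, s (i + 10) = s i := fun i => by simpa using ps i
  have r0 := r 0; have r1 := r 1; have r2 := r 2; have r3 := r 3
  have w0 := w 0; have w1 := w 1; have w2 := w 2; have w3 := w 3; have w4 := w 4; have w5 := w 5
  have w6 := w 6; have w7 := w 7; have w8 := w 8; have w9 := w 9
  norm_num at r0 r1 r2 r3 w0 w1 w2 w3 w4 w5 w6 w7 w8 w9
  simp only [Finset.sum_range_succ, Finset.sum_range_zero]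
  push_cast
  by_cases hm : s 0 + s 1 + s 2 + s 3 + s 4 + s 5 + s 6 + s 7 + s 8 + s 9 ≤ 7
  · omega
  have hp0 : ∀ i, p i = 0 := by
    intro i
    by_contra hc
    have hc := (h.p01 i).resolve_left hc
    obtain ⟨e1, e2⟩ := pss i hc
    have hsum := sum_shift s ps i
    simp only [Finset.sum_range_succ, Finset.sum_range_zero] at hsum
    push_cast at hsum
    have f1 := w (2 + i)
    have f2 := s01 (7 + i)
    have f3 := s01 (8 + i)
    have f4 := s01 (9 + i)
    ring_nf at hsum e1 e2 f1 f2 f3 f4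
    omega
  have v0' : ∀ i, -12 * s i ≤ val t p H i := fun i => by
    have := s01 i; have := v0 i; have := v12 i; have := hp0 i; have := hp0 (i - 1); omega
  have a1 := v0' 0; have a2 := v0' 1; have a3 := v0' 2; have a4 := v0' 3; have a5 := v0' 4
  have a6 := v0' 5; have a7 := v0' 6; have a8 := v0' 7; have a9 := v0' 8; have a10 := v0' 9
  omega

theorem final11 (h : LongFace 11 t p b H) : -108 ≤ ∑ i ∈ Finset.range 11, val t p H i := by
  obtain ⟨s, ps, s01, v12, v4, -, -, -, -, -, -, -, -, -, -, w⟩ := h.exists_sigma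
  have v12' : ∀ i, -4 - 8 * s i ≤ val t p H i := fun i => by
    have := s01 i; have := v4 i; have := v12 i; omega
  have a1 := v12' 0; have a2 := v12' 1; have a3 := v12' 2; have a4 := v12' 3; have a5 := v12' 4
  have a6 := v12' 5; have a7 := v12' 6; have a8 := v12' 7; have a9 := v12' 8; have a10 := v12' 9
  have a11 := v12' 10
  have r : ∀ i : ℤ, s (i + 11) = s i := fun i => by simpa using ps i
  have r0 := r 0; have r1 := r 1; have r2 := r 2; have r3 := r 3
  have w0 := w 0; have w1 := w 1; have w2 := w 2; have w3 := w 3; have w4 := w 4; have w5 := w 5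
  have w6 := w 6; have w7 := w 7; have w8 := w 8; have w9 := w 9; have w10 := w 10
  norm_num at r0 r1 r2 r3 w0 w1 w2 w3 w4 w5 w6 w7 w8 w9 w10
  simp only [Finset.sum_range_succ, Finset.sum_range_zero]
  push_cast
  omega

theorem final9 (h : LongFace 9 t p b H) : -72 ≤ ∑ i ∈ Finset.range 9, val t p H i := by
  by_cases hP : ∃ x, p x = 1
  · obtain ⟨x, hx⟩ := hP
    have hval : ∀ i, val (fun i => t (i + x)) (fun i => p (i + x)) (fun i => H (i + x)) i =
        val t p H (i + x) := fun i => by unfold val; ring_nf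
    have hper : ∀ i, val t p H (i + (9 : ℕ)) = val t p H i := fun i => by
      have e1 : t (i + (9 : ℕ) - 1) = t (i - 1) := by rw [← h.pt (i - 1)]; ring_nf
      have e2 : p (i + (9 : ℕ) - 1) = p (i - 1) := by rw [← h.pp (i - 1)]; ring_nf
      unfold val; rw [h.pH, h.pt, h.pp, e1, e2]
    rw [← sum_shift _ hper x]
    simp only [← hval]
    replace h := h.shift x
    have hx' : (fun i => p (i + x)) 0 = 1 := by simpa using hx
    generalize (fun i => t (i + x)) = t at h ⊢
    generalize (fun i => p (i + x)) = p at h hx' ⊢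
    generalize (fun i => b (i + x)) = b at h
    generalize (fun i => H (i + x)) = H at h ⊢
    obtain ⟨s, ps, s01, v12, v4, sb, st, s0, v0, v8, v12', v4a, v4b, pss, vb, w⟩ := h.exists_sigma
    have vv : ∀ i, -4 - 8 * s i ≤ val t p H i := fun i => by
      have := s01 i; have := v4 i; have := v12 i; omega
    obtain ⟨z0, z1⟩ := pss 0 hx'
    rw [zero_add] at z1
    have hle : ∀ i, s i ≤ 1 := fun i => by rcases s01 i with e | e <;> rw [e]; norm_num
    have q3 := hle 2; have q4 := hle 3; have q5 := hle 4; have q6 := hle 5; have q7 := hle 6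
    have q8 := hle 7; have q9 := hle 8
    have a1 := vv 0; have a2 := vv 1; have a3 := vv 2; have a4 := vv 3; have a5 := vv 4
    have a6 := vv 5; have a7 := vv 6; have a8 := vv 7; have a9 := vv 8
    have w2 := w 2; have w3 := w 3; have w4 := w 4
    norm_num at w2 w3 w4
    simp only [Finset.sum_range_succ, Finset.sum_range_zero]
    push_cast
    by_cases m5 : s 2 + s 3 + s 4 + s 5 + s 6 + s 7 + s 8 ≤ 4
    · linarith
    have rs : ∀ i : ℤ, s (i + 9) = s i := fun i => by simpa using ps i
    have rt : ∀ i : ℤ, t (i + 9) = t i := fun i => by simpa using h.pt i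
    have rp : ∀ i : ℤ, p (i + 9) = p i := fun i => by simpa using h.pp i
    have rb : ∀ i : ℤ, b (i + 9) = b i := fun i => by simpa using h.pb i
    have t8 : t (-1) = t 8 := (rt (-1)).symm
    have p8 : p (-1) = p 8 := (rp (-1)).symm
    have t7 : t (-2) = t 7 := (rt (-2)).symm
    have b7 : b (-2) = b 7 := (rb (-2)).symm
    have b8 : b (-1) = b 8 := (rb (-1)).symm
    have s9 : s 9 = s 0 := rs 0
    by_cases m4 : s 2 + s 3 + s 4 + s 5 + s 6 + s 7 + s 8 = 5
    · have e : ∑ i ∈ Finset.range 9, s i = 5 := by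
        simp only [Finset.sum_range_succ, Finset.sum_range_zero]; push_cast; linarith
      obtain ⟨i, i0, i9, si, ti⟩ := h.exists_odd s01 st (by rw [e]; norm_num)
      have := sum_add_le (c := 12) vv i0 i9 (by have := v8 i si ti; rw [si]; linarith)
      simp only [Finset.sum_range_succ, Finset.sum_range_zero] at this
      push_cast at this
      linarith
    · have m3 : s 2 + s 3 + s 4 + s 5 + s 6 + s 7 + s 8 = 6 := by
        clear a1 a2 a3 a4 a5 a6 a7 a8 a9
        omega
      have e2 : s 2 = 1 := (s01 2).resolve_left (fun hc => by linarith)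
      have e3 : s 3 = 1 := (s01 3).resolve_left (fun hc => by linarith)
      have e7 : s 7 = 1 := (s01 7).resolve_left (fun hc => by linarith)
      have e8 : s 8 = 1 := (s01 8).resolve_left (fun hc => by linarith)
      have pz : ∀ i, s i = 1 → p i = 0 ∧ p (i - 1) = 0 := by
        intro i hi
        constructor
        · by_contra hc
          have := (pss i ((h.p01 i).resolve_left hc)).1
          linarith
        · by_contra hc
          have := (pss (i - 1) ((h.p01 _).resolve_left hc)).2
          rw [sub_add_cancel] at this
          linarith
      have vz : ∀ i, s (i - 1) = 1 → s (i + 1) = 1 → -12 * s i ≤ val t p H i := by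
        intro i h1 h2
        have z1 := (pz _ h1).1
        have z2 := (pz _ h2).2
        rw [add_sub_cancel_right] at z2
        rcases s01 i with e | e
        · have := v0 i e z1 z2
          linarith
        · have := v12 i
          linarith
      have c1 : p 1 = 0 := by simpa using (pz 2 e2).2
      have c8 : p (-1) = 0 := by rw [p8]; exact (pz 8 e8).1
      have c0 : p 0 = 1 := hx'
      have hv01 : 0 ≤ val t p H 0 + val t p H 1 := by
        rcases h.b01 0 with hb0 | hb0
        · rcases h.b01 1 with hb1 | hb1
          · exfalso
            have g0 := s0 0 z0 hb0
            have g1 := s0 1 z1 hb1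
            have k2 := st 2 e2
            have k8 := st 8 e8
            have k3 := sb 3 e3
            have k7 := sb 7 e7
            norm_num at g0 g1 k2 k8
            rw [t8] at g0
            exact h.spec rfl 0 hx' (by norm_num; linarith) (by norm_num; linarith)
              (by norm_num; rw [b7]; exact k7) (by norm_num; rw [b8]; exact sb 8 e8) hb0 (by norm_num; exact hb1)
              (by norm_num; exact sb 2 e2) (by norm_num; exact k3)
          · have := v4b 1 hb1 (by norm_num; exact c0) c1
            linarith
        · have := v4a 0 hb0 c0 (by norm_num; exact c8)
          linarith
      have z4 := vz 4; have z5 := vz 5; have z6 := vz 6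
      norm_num at z4 z5 z6
      have k2 := v12 2; have k3 := v12 3; have k4 := v12 4; have k5 := v12 5; have k6 := v12 6
      have k7 := v12 7; have k8 := v12 8
      rcases s01 4 with f4 | f4
      · have := z4 e3 (by linarith)
        linarith
      · rcases s01 5 with f5 | f5
        · have := z5 f4 (by linarith)
          linarith
        · have := z6 f5 e7
          linarith
  · have hp0 : ∀ i, p i = 0 := fun i => (h.p01 i).resolve_right (fun hc => hP ⟨i, hc⟩)
    obtain ⟨s, ps, s01, v12, v4, sb, st, s0, v0, v8, v12', v4a, v4b, pss, vb, w⟩ := h.exists_sigma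
    have v0' : ∀ i, -12 * s i ≤ val t p H i := fun i => by
      have := s01 i; have := v0 i; have := v12 i; have := hp0 i; have := hp0 (i - 1); omega
    have a1 := v0' 0; have a2 := v0' 1; have a3 := v0' 2; have a4 := v0' 3; have a5 := v0' 4
    have a6 := v0' 5; have a7 := v0' 6; have a8 := v0' 7; have a9 := v0' 8
    have r : ∀ i : ℤ, s (i + 9) = s i := fun i => by simpa using ps i
    have r0 := r 0; have r1 := r 1; have r2 := r 2; have r3 := r 3
    have w0 := w 0; have w1 := w 1; have w2 := w 2; have w3 := w 3; have w4 := w 4; have w5 := w 5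
    have w6 := w 6; have w7 := w 7; have w8 := w 8
    norm_num at r0 r1 r2 r3 w0 w1 w2 w3 w4 w5 w6 w7 w8
    simp only [Finset.sum_range_succ, Finset.sum_range_zero]
    push_cast
    by_cases m3 : s 0 + s 1 + s 2 + s 3 + s 4 + s 5 + s 6 + s 7 + s 8 ≤ 6
    · omega
    have m2 : s 0 + s 1 + s 2 + s 3 + s 4 + s 5 + s 6 + s 7 + s 8 = 7 := by omega
    have e : ∑ i ∈ Finset.range 9, s i = 7 := by
      simp only [Finset.sum_range_succ, Finset.sum_range_zero]; push_cast; linarith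
    obtain ⟨i, i0, i9, si, ti⟩ := h.exists_odd s01 st (by rw [e]; norm_num)
    have := sum_add_le (c := 12) v0' i0 i9 (by have := v12' i si ti (hp0 _) (hp0 _); omega)
    simp only [Finset.sum_range_succ, Finset.sum_range_zero] at this
    push_cast at this
    linarith

theorem final (h : LongFace k t p b H) (hk : 9 ≤ k) :
    144 ≤ ∑ i ∈ Finset.range k, (24 + val t p H i) := by
  rw [Finset.sum_add_distrib]
  simp only [Finset.sum_const, Finset.card_range, nsmul_eq_mul]
  rcases (by omega : k = 9 ∨ k = 10 ∨ k = 11 ∨ 12 ≤ k) with rfl | rfl | rfl | hk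
  · have := h.final9; push_cast; linarith
  · have := h.final10; push_cast; linarith
  · have := h.final11; push_cast; linarith
  · obtain ⟨s, -, -, v12, -⟩ := h.exists_sigma
    have := sum_range_const_le (k := k) v12
    have : (12 : ℤ) ≤ k := by exact_mod_cast hk
    linarith

end LongFace
end

section

/-- The numerical facts about a face: `t` and `p` mark the edges towards triangles and towards paid
pentagons, `b` the vertices that are not small, `c` the vertices of the anchor, `e` the edges of a
pentagon that receive nothing; `H` is the charge from the vertices and `N` the charge through the
edges. -/
structure FaceNum (k : ℕ) (t p b c e H N : ℤ → ℤ) : Prop where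
  len : k = 3 ∨ k = 5 ∨ k = 7 ∨ 9 ≤ k
  pt : ∀ i, t (i + k) = t i
  pp : ∀ i, p (i + k) = p i
  pb : ∀ i, b (i + k) = b i
  pc : ∀ i, c (i + k) = c i
  pe : ∀ i, e (i + k) = e i
  pH : ∀ i, H (i + k) = H i
  t01 : ∀ i, t i = 0 ∨ t i = 1
  p01 : ∀ i, p i = 0 ∨ p i = 1
  b01 : ∀ i, b i = 0 ∨ b i = 1
  c01 : ∀ i, c i = 0 ∨ c i = 1
  e01 : ∀ i, e i = 0 ∨ e i = 1
  tp : ∀ i, t i + p i ≤ 1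
  small : ∀ i, b i = 0 → t (i - 1) + p (i - 1) + t i + p i ≤ 1
  H0 : ∀ i, c i = 0 → 0 ≤ H i
  Ht : ∀ i, c i = 0 → b i = 1 → t (i - 1) + t i ≠ 0 → 12 ≤ H i
  Hp : ∀ i, c i = 0 → b i = 1 → p (i - 1) + p i ≠ 0 → 4 ≤ H i
  cb : ∀ i, c i = 1 → b i = 1
  cH : ∀ i, c i = 1 → -6 ≤ H i
  cH6 : ∀ i, c i = 1 → c (i - 1) = 0 ∨ c (i + 1) = 0 → 6 ≤ H i
  cH9 : k ≠ 3 → ∀ i, c i = 1 → c (i - 1) = 0 ∨ c (i + 1) = 0 → 9 ≤ H i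
  cHt : ∀ i, c i = 1 → t (i - 1) + t i ≠ 0 → 12 ≤ H i
  ct : ∀ i, c i = 1 → c (i + 1) = 1 → t i = 0 ∧ p i = 0
  notall : ∃ i, c i = 0
  tetrad : 9 ≤ k → ∀ i, t i = 1 → t (i + 2) = 1 → b i = 0 → b (i + 1) = 0 → b (i + 2) = 0 → b (i + 3) ≠ 0
  spec : k = 9 → ∀ i, p i = 1 → t (i + 2) = 1 → t (i - 2) = 1 → b (i - 2) = 0 → b (i - 1) = 0 →
    b i = 0 → b (i + 1) = 0 → b (i + 2) = 0 → b (i + 3) ≠ 0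
  N0 : ∀ i, 0 ≤ N i
  N3 : k = 3 → ∀ i, c i = 0 ∨ c (i + 1) = 0 → 24 ≤ N i
  N5 : k = 5 → ∀ i, c i = 0 ∨ c (i + 1) = 0 → e i = 0 → 8 ≤ N i
  eb : ∀ i, e i = 1 → c i = 0 ∧ c (i + 1) = 0
  ee : k = 5 → ∀ i, e i = 1 → e (i + 1) = 1 → e (i + 2) = 0 ∧ e (i + 3) = 0 ∧ e (i + 4) = 0
  t9 : k < 9 → ∀ i, t i = 0
  p6 : k < 6 → ∀ i, p i = 0

namespace FaceNum

open LongFace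

variable {k : ℕ} {t p b c e H N : ℤ → ℤ}

theorem red (h : FaceNum k t p b c e H N) {w : ℤ → ℤ} (hw : ∀ i, w (i + k) = w i) (i : ℤ) :
    ∃ j : ℤ, 0 ≤ j ∧ j < k ∧ w j = w i := by
  have hk : (0 : ℤ) < k := by have := h.len; omega
  have : ∀ m : ℤ, ∀ i, w (i + k * m) = w i := by
    intro m
    induction m using Int.induction_on with
    | zero => intro i; simp
    | succ n ih => intro i; rw [← ih i, ← hw (i + k * n)]; ring_nf
    | pred n ih => intro i; rw [← ih i, ← hw (i + k * (-n - 1))]; ring_nf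
  refine ⟨i % k, Int.emod_nonneg _ hk.ne', Int.emod_lt_of_pos _ hk, ?_⟩
  rw [← this (i / k), Int.emod_add_mul_ediv]

theorem val_ge (h : FaceNum k t p b c e H N) (i : ℤ) : -12 ≤ val t p H i := by
  have h1 := h.t01 i
  have h2 := h.t01 (i - 1)
  have h3 := h.p01 i
  have h4 := h.p01 (i - 1)
  have h5 := h.tp i
  have h6 := h.tp (i - 1)
  unfold val
  rcases h.c01 i with hc | hc
  · have := h.H0 i hc
    rcases h.b01 i with hb | hb
    · have := h.small i hb
      omega
    · have := h.Ht i hc hb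
      have := h.Hp i hc hb
      omega
  · have := h.cH i hc
    have h7 := h.cHt i hc
    have h8 := h.ct i hc
    have h9 := h.ct (i - 1)
    have h11 := h.t9
    have h10 := h.cH6 i hc
    rw [sub_add_cancel] at h9
    have := h.c01 (i - 1)
    have := h.c01 (i + 1)
    by_cases hz : c (i - 1) = 0 ∨ c (i + 1) = 0
    · have := h10 hz
      have := h.len
      by_cases hk : k = 3
      · have := h.p6 (by omega) i
        have := h.p6 (by omega) (i - 1)
        omega
      · have := h.cH9 hk i hc hz
        omega
    · have := h9 (by omega) hc
      have := h8 (by omega)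
      omega

theorem final3 (h : FaceNum 3 t p b c e H N) : 144 ≤ ∑ i ∈ Finset.range 3, (24 + val t p H i + N i) := by
  have vH : ∀ i, val t p H i = 2 * H i := fun i => by
    have := h.t9 (by norm_num); have := h.p6 (by norm_num); unfold val; simp [*]
  simp only [vH]
  simp only [Finset.sum_range_succ, Finset.sum_range_zero]
  push_cast
  have r : ∀ i : ℤ, c (i + 3) = c i := fun i => by simpa using h.pc i
  have r0 : c 3 = c 0 := r 0
  have r1 : c (-1) = c 2 := (r (-1)).symm
  have hex : c 0 = 0 ∨ c 1 = 0 ∨ c 2 = 0 := by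
    obtain ⟨i, hi⟩ := h.notall
    obtain ⟨j, j0, jk, hj⟩ := h.red h.pc i
    rw [hi] at hj
    push_cast at jk
    interval_cases j <;> tauto
  have a0 := h.H0 0; have a1 := h.H0 1; have a2 := h.H0 2
  have b0 := h.cH6 0; have b1 := h.cH6 1; have b2 := h.cH6 2
  have d0 := h.N0 0; have d1 := h.N0 1; have d2 := h.N0 2
  have g0 := h.N3 rfl 0; have g1 := h.N3 rfl 1; have g2 := h.N3 rfl 2
  have c0 := h.c01 0; have c1 := h.c01 1; have c2 := h.c01 2
  norm_num at b0 b1 b2 g0 g1 g2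
  rw [r0] at b2 g2
  rw [r1] at b0
  rcases c0 with c0 | c0 <;> rcases c1 with c1 | c1 <;> rcases c2 with c2 | c2 <;>
    simp only [c0, c1, c2] at * <;> norm_num at * <;> linarith

theorem H_ge (h : FaceNum k t p b c e H N) (hk : k ≠ 3) (i : ℤ) :
    9 * c i - 15 * (c (i - 1) * c i * c (i + 1)) ≤ H i := by
  have h0 := h.H0 i
  have h1 := h.cH i
  have h2 := h.cH9 hk i
  rcases h.c01 i with hc | hc
  · simpa [hc] using h0 hc
  · rcases h.c01 (i - 1) with h3 | h3
    · have := h2 hc (.inl h3); simp [hc, h3, this]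
    rcases h.c01 (i + 1) with h4 | h4
    · have := h2 hc (.inr h4); simp [hc, h4, this]
    · have := h1 hc; simp [hc, h3, h4, this]

theorem N_ge (h : FaceNum k t p b c e H N) (hk : k = 5) (i : ℤ) :
    8 * (c i + c (i + 1) - 2 * (c i * c (i + 1))) ≤ N i := by
  have h1 := h.N5 hk i
  have h2 := h.eb i
  have h3 := h.e01 i
  have h4 := h.N0 i
  rcases h.c01 i with hc | hc <;> rcases h.c01 (i + 1) with hd | hd <;> rw [hc, hd] <;> omega

theorem final5 (h : FaceNum 5 t p b c e H N) : 144 ≤ ∑ i ∈ Finset.range 5, (24 + val t p H i + N i) ∧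
    ((∃ i, c i = 1) → 145 ≤ ∑ i ∈ Finset.range 5, (24 + val t p H i + N i)) := by
  have vH : ∀ i, val t p H i = 2 * H i := fun i => by
    have := h.t9 (by norm_num); have := h.p6 (by norm_num); unfold val; simp [*]
  simp only [vH, Finset.sum_range_succ, Finset.sum_range_zero]
  push_cast
  have r0 : c 5 = c 0 := by simpa using h.pc 0
  have r1 : c (-1) = c 4 := by simpa using (h.pc (-1)).symm
  have r2 : e 5 = e 0 := by simpa using h.pe 0
  have hex : c 0 = 0 ∨ c 1 = 0 ∨ c 2 = 0 ∨ c 3 = 0 ∨ c 4 = 0 := by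
    obtain ⟨i, hi⟩ := h.notall
    obtain ⟨j, j0, jk, hj⟩ := h.red h.pc i
    rw [hi] at hj
    push_cast at jk
    interval_cases j <;> tauto
  by_cases hK : ∃ i, c i = 1
  · suffices 145 ≤ 0 + (24 + 2 * H 0 + N 0) + (24 + 2 * H 1 + N 1) + (24 + 2 * H 2 + N 2) +
        (24 + 2 * H 3 + N 3) + (24 + 2 * H 4 + N 4) from ⟨by linarith, fun _ => this⟩
    have hex1 : c 0 = 1 ∨ c 1 = 1 ∨ c 2 = 1 ∨ c 3 = 1 ∨ c 4 = 1 := by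
      obtain ⟨i, hi⟩ := hK
      obtain ⟨j, j0, jk, hj⟩ := h.red h.pc i
      rw [hi] at hj
      push_cast at jk
      interval_cases j <;> tauto
    have b0 := h.H_ge (by norm_num) 0; have b1 := h.H_ge (by norm_num) 1
    have b2 := h.H_ge (by norm_num) 2; have b3 := h.H_ge (by norm_num) 3
    have b4 := h.H_ge (by norm_num) 4
    have d0 := h.N_ge rfl 0; have d1 := h.N_ge rfl 1; have d2 := h.N_ge rfl 2
    have d3 := h.N_ge rfl 3; have d4 := h.N_ge rfl 4
    have c0 := h.c01 0; have c1 := h.c01 1; have c2 := h.c01 2; have c3 := h.c01 3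
    have c4 := h.c01 4
    simp only [Int.reduceAdd, Int.reduceSub, r0, r1] at b0 b1 b2 b3 b4 d0 d1 d2 d3 d4
    clear h hK vH r0 r1 r2
    generalize c 0 = x0 at *
    generalize c 1 = x1 at *
    generalize c 2 = x2 at *
    generalize c 3 = x3 at *
    generalize c 4 = x4 at *
    rcases c0 with rfl | rfl <;> rcases c1 with rfl | rfl <;> rcases c2 with rfl | rfl <;>
      rcases c3 with rfl | rfl <;> rcases c4 with rfl | rfl <;>
      first | linarith | (exfalso; revert hex; decide) | (exfalso; revert hex1; decide)
  · refine ⟨?_, fun h => absurd h hK⟩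
    have hc : ∀ i, c i = 0 := fun i => (h.c01 i).resolve_right fun hi => hK ⟨i, hi⟩
    have gg : ∀ i, 8 - 8 * e i ≤ N i := fun i => by
      have h1 := h.N5 rfl i (.inl (hc i))
      have h4 := h.N0 i
      rcases h.e01 i with h3 | h3 <;> omega
    have ee := h.ee rfl
    have w0 := ee 0; have w1 := ee 1; have w2 := ee 2; have w3 := ee 3; have w4 := ee 4
    have r3 : e 6 = e 1 := by simpa using h.pe 1
    have r4 : e 7 = e 2 := by simpa using h.pe 2
    have r5 : e 8 = e 3 := by simpa using h.pe 3
    simp only [Int.reduceAdd, zero_add, r2, r3, r4, r5] at w0 w1 w2 w3 w4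
    have w5 : e 0 + e 1 + e 2 + e 3 + e 4 ≤ 2 := by
      have f0 := h.e01 0; have f1 := h.e01 1; have f2 := h.e01 2; have f3 := h.e01 3
      have f4 := h.e01 4
      clear gg hex ee hK vH r0 r1 r2 r3 r4 r5 hc h
      generalize e 0 = x0 at *
      generalize e 1 = x1 at *
      generalize e 2 = x2 at *
      generalize e 3 = x3 at *
      generalize e 4 = x4 at *
      rcases f0 with rfl | rfl <;> rcases f1 with rfl | rfl <;> rcases f2 with rfl | rfl <;>
        rcases f3 with rfl | rfl <;> rcases f4 with rfl | rfl <;> first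
          | decide
          | (exfalso; revert w0; decide)
          | (exfalso; revert w1; decide)
          | (exfalso; revert w2; decide)
          | (exfalso; revert w3; decide)
          | (exfalso; revert w4; decide)
    have := h.H0 0 (hc 0); have := h.H0 1 (hc 1); have := h.H0 2 (hc 2); have := h.H0 3 (hc 3)
    have := h.H0 4 (hc 4)
    have := gg 0; have := gg 1; have := gg 2; have := gg 3; have := gg 4
    clear hex hc gg ee
    linarith

set_option maxHeartbeats 2000000 in
theorem final7 (h : FaceNum 7 t p b c e H N) : 144 ≤ ∑ i ∈ Finset.range 7, (24 + val t p H i + N i) ∧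
    ((∃ i, c i = 1) → 145 ≤ ∑ i ∈ Finset.range 7, (24 + val t p H i + N i)) := by
  suffices hv : 144 ≤ ∑ i ∈ Finset.range 7, (24 + val t p H i) ∧
      ((∃ i, c i = 1) → 145 ≤ ∑ i ∈ Finset.range 7, (24 + val t p H i)) by
    have : 0 ≤ ∑ i ∈ Finset.range 7, N i := Finset.sum_nonneg fun i _ => h.N0 i
    rw [Finset.sum_add_distrib]
    exact ⟨by linarith [hv.1], fun hi => by linarith [hv.2 hi]⟩
  have vH : ∀ i, val t p H i = 2 * H i - 4 * (p (i - 1) + p i) := fun i => by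
    have := h.t9 (by norm_num); unfold val; simp [*]
  simp only [vH, Finset.sum_range_succ, Finset.sum_range_zero]
  push_cast
  have r0 : c 7 = c 0 := by simpa using h.pc 0
  have r1 : c (-1) = c 6 := by simpa using (h.pc (-1)).symm
  have r2 : p (-1) = p 6 := by simpa using (h.pp (-1)).symm
  simp only [Int.reduceNeg, r2]
  have hex : c 0 = 0 ∨ c 1 = 0 ∨ c 2 = 0 ∨ c 3 = 0 ∨ c 4 = 0 ∨ c 5 = 0 ∨ c 6 = 0 := by
    obtain ⟨i, hi⟩ := h.notall
    obtain ⟨j, j0, jk, hj⟩ := h.red h.pc i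
    rw [hi] at hj
    push_cast at jk
    interval_cases j <;> tauto
  have pl : ∀ i, 0 ≤ p i ∧ p i ≤ 1 - c i * c (i + 1) := fun i => by
    have h1 := h.p01 i
    have h2 := h.ct i
    rcases h.c01 i with hc | hc <;> rcases h.c01 (i + 1) with hd | hd <;> rw [hc, hd] <;> omega
  have pH : ∀ i, 4 * (p (i - 1) + p i - 1) - 10 * c i ≤ H i := fun i => by
    have h1 := h.p01 i
    have h2 := h.p01 (i - 1)
    have h3 := h.Hp i
    have h4 := h.H0 i
    have h5 := h.cH i
    have h6 := h.small i
    have h7 := h.t01 i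
    have h8 := h.t01 (i - 1)
    rcases h.c01 i with hc | hc
    · rcases h.b01 i with hb | hb <;> omega
    · omega
  have vg : ∀ i, -4 * (1 - c i) + c i * (10 + 4 * (c (i - 1) + c (i + 1)) - 30 * (c (i - 1) * c (i + 1))) ≤
      2 * H i - 4 * (p (i - 1) + p i) := fun i => by
    have h1 := pH i
    have h2 := h.H_ge (by norm_num) i
    have h3 := (pl i).2
    have h4 := (pl (i - 1)).2
    have h5 := h.H0 i
    rw [sub_add_cancel] at h4
    have h6 := h.p01 i
    have h7 := h.p01 (i - 1)
    clear pl pH hex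
    rcases h.c01 i with hc | hc <;> rcases h.c01 (i + 1) with hd | hd <;>
      rcases h.c01 (i - 1) with he | he <;> simp only [hc, hd, he] at h1 h2 h3 h4 h5 ⊢ <;> omega
  obtain ⟨m0, l0⟩ := pl 0; obtain ⟨m1, l1⟩ := pl 1; obtain ⟨m2, l2⟩ := pl 2; obtain ⟨m3, l3⟩ := pl 3; obtain ⟨m4, l4⟩ := pl 4
  obtain ⟨m5, l5⟩ := pl 5; obtain ⟨m6, l6⟩ := pl 6
  have q0 := pH 0; have q1 := pH 1; have q2 := pH 2; have q3 := pH 3; have q4 := pH 4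
  have q5 := pH 5; have q6 := pH 6
  simp only [Int.reduceAdd, Int.reduceSub, r0, r2]
    at l0 l1 l2 l3 l4 l5 l6 q0 q1 q2 q3 q4 q5 q6
  by_cases hK : ∃ i, c i = 1
  · refine (fun this => ⟨le_trans (by norm_num) this, fun _ => this⟩ : ∀ {z : ℤ}, 145 ≤ z →
      144 ≤ z ∧ ((∃ i, c i = 1) → 145 ≤ z)) ?_
    have hex1 : c 0 = 1 ∨ c 1 = 1 ∨ c 2 = 1 ∨ c 3 = 1 ∨ c 4 = 1 ∨ c 5 = 1 ∨ c 6 = 1 := by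
      obtain ⟨i, hi⟩ := hK
      obtain ⟨j, j0, jk, hj⟩ := h.red h.pc i
      rw [hi] at hj
      push_cast at jk
      interval_cases j <;> tauto
    have b0 := h.H_ge (by norm_num) 0; have b1 := h.H_ge (by norm_num) 1
    have b2 := h.H_ge (by norm_num) 2; have b3 := h.H_ge (by norm_num) 3
    have b4 := h.H_ge (by norm_num) 4; have b5 := h.H_ge (by norm_num) 5
    have b6 := h.H_ge (by norm_num) 6
    have c0 := h.c01 0; have c1 := h.c01 1; have c2 := h.c01 2; have c3 := h.c01 3
    have c4 := h.c01 4; have c5 := h.c01 5; have c6 := h.c01 6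
    have v0 := vg 0; have v1 := vg 1; have v2 := vg 2; have v3 := vg 3; have v4 := vg 4
    have v5 := vg 5; have v6 := vg 6
    simp only [Int.reduceAdd, Int.reduceSub, Int.reduceNeg, r0, r1, r2]
      at b0 b1 b2 b3 b4 b5 b6 v0 v1 v2 v3 v4 v5 v6
    clear h hK vH r0 r1 r2 vg pl pH
    generalize c 0 = x0 at *
    generalize c 1 = x1 at *
    generalize c 2 = x2 at *
    generalize c 3 = x3 at *
    generalize c 4 = x4 at *
    generalize c 5 = x5 at *
    generalize c 6 = x6 at *
    rcases c0 with rfl | rfl <;> rcases c1 with rfl | rfl <;> rcases c2 with rfl | rfl <;>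
      rcases c3 with rfl | rfl <;> rcases c4 with rfl | rfl <;> rcases c5 with rfl | rfl <;>
      rcases c6 with rfl | rfl <;> first
        | linarith only [v0, v1, v2, v3, v4, v5, v6]
        | (exfalso; revert hex; decide)
        | (exfalso; revert hex1; decide)
        | linarith only [q0, q1, q2, q3, q4, q5, q6, b0, b1, b2, b3, b4, b5, b6, l0, l1, l2, l3, l4, l5, l6,
            m0, m1, m2, m3, m4, m5, m6, v0, v1, v2, v3, v4, v5, v6]
  · refine ⟨?_, fun h => absurd h hK⟩
    have hc : ∀ i, c i = 0 := fun i => (h.c01 i).resolve_right fun hi => hK ⟨i, hi⟩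
    have := h.H0 0 (hc 0); have := h.H0 1 (hc 1); have := h.H0 2 (hc 2); have := h.H0 3 (hc 3)
    have := h.H0 4 (hc 4); have := h.H0 5 (hc 5); have := h.H0 6 (hc 6)
    simp only [hc] at q0 q1 q2 q3 q4 q5 q6
    by_cases hP : p 0 + p 1 + p 2 + p 3 + p 4 + p 5 + p 6 ≤ 3
    · linarith
    · linarith [Int.not_le.mp hP |> Int.add_one_le_of_lt]

theorem exists_run_start (h : FaceNum k t p b c e H N) {i : ℤ} (h1 : c i = 1) :
    ∃ m : ℕ, c (i - m) = 1 ∧ c (i - m - 1) = 0 ∧ ∀ n : ℕ, n ≤ m → c (i - n) = 1 := by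
  have hz : ∃ n : ℕ, c (i - n) = 0 := by
    obtain ⟨j, hj⟩ := h.notall
    have hk := h.len
    have hp : ∀ (m : ℕ) (j : ℤ), c (j + k * m) = c j := by
      intro m
      induction m with
      | zero => simp
      | succ m ih => intro j; rw [← ih j, ← h.pc (j + k * m)]; push_cast; ring_nf
    have hp' : ∀ (m : ℕ) (j : ℤ), c (j - k * m) = c j := fun m j => by
      rw [← hp m (j - k * m), sub_add_cancel]
    refine ⟨(i - (j - k * (j - i).toNat)).toNat, ?_⟩
    rw [Int.toNat_of_nonneg, sub_sub_cancel, hp', hj]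
    have h1 := Int.self_le_toNat (j - i)
    have h2 : (1 : ℤ) ≤ k := by omega
    have h3 := mul_le_mul_of_nonneg_right h2 (Int.natCast_nonneg (j - i).toNat)
    linarith
  classical
  have hs := Nat.find_spec hz
  have hm : ∀ n < Nat.find hz, c (i - n) = 1 := fun n hn =>
    (h.c01 _).resolve_left (Nat.find_min hz hn)
  obtain ⟨m, hm'⟩ : ∃ m, Nat.find hz = m + 1 :=
    Nat.exists_eq_succ_of_ne_zero fun h0 => by rw [h0] at hs; simp [h1] at hs
  refine ⟨m, hm _ (by omega), ?_, fun n hn => hm _ (by omega)⟩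
  rw [hm'] at hs
  push_cast at hs
  rwa [sub_sub]

end FaceNum
end

section

namespace FaceNum

open LongFace

variable {k : ℕ} {t p b c e H N : ℤ → ℤ}

theorem pval (h : FaceNum k t p b c e H N) (i : ℤ) : val t p H (i + k) = val t p H i := by
  unfold val
  rw [h.pH, h.pt, h.pp, add_sub_right_comm, h.pt, h.pp]

theorem val_end (h : FaceNum k t p b c e H N) (hk : k ≠ 3) {i : ℤ} (h1 : c i = 1)
    (h2 : (c (i - 1) = 0 ∧ c (i + 1) = 1) ∨ (c (i - 1) = 1 ∧ c (i + 1) = 0)) : 12 ≤ val t p H i := by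
  have ht := h.t01 i
  have ht' := h.t01 (i - 1)
  have hp := h.p01 i
  have hp' := h.p01 (i - 1)
  have h3 := h.cH9 hk i h1
  have h4 := h.cHt i h1
  have h5 := h.ct i h1
  have h6 := h.ct (i - 1)
  have h7 := h.tp i
  have h8 := h.tp (i - 1)
  rw [sub_add_cancel] at h6
  unfold val
  rcases h2 with ⟨h2, h2'⟩ | ⟨h2, h2'⟩
  · have := h3 (.inl h2)
    have := h5 h2'
    omega
  · have := h3 (.inr h2')
    have := h6 h2 h1
    omega

theorem final9 (h : FaceNum k t p b c e H N) (hk : 9 ≤ k) :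
    144 ≤ ∑ i ∈ Finset.range k, (24 + val t p H i + N i) ∧
    ((∃ i, c i = 1 ∧ c (i + 1) = 1) → 145 ≤ ∑ i ∈ Finset.range k, (24 + val t p H i + N i)) := by
  suffices hv : 144 ≤ ∑ i ∈ Finset.range k, (24 + val t p H i) ∧
      ((∃ i, c i = 1 ∧ c (i + 1) = 1) → 145 ≤ ∑ i ∈ Finset.range k, (24 + val t p H i)) by
    have : 0 ≤ ∑ i ∈ Finset.range k, N i := Finset.sum_nonneg fun i _ => h.N0 i
    rw [Finset.sum_add_distrib]
    exact ⟨by linarith [hv.1], fun hi => by linarith [hv.2 hi]⟩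
  by_cases hK : ∃ i, c i = 1 ∧ c (i + 1) = 1
  · suffices 145 ≤ ∑ i ∈ Finset.range k, (24 + val t p H i) from ⟨by linarith, fun _ => this⟩
    obtain ⟨i, hi, hi'⟩ := hK
    obtain ⟨m, hm, hm', hr⟩ := h.exists_run_start hi
    obtain ⟨s, rfl⟩ : ∃ s, i = s + m := ⟨i - m, by ring⟩
    rw [add_sub_cancel_right] at hm hm'
    have hs1 : c (s + 1) = 1 := by
      rcases m with _ | m
      · simpa using hi'
      · have := hr m (by omega)
        exact (congrArg c (by push_cast; ring)).trans this
    have hz : ∃ n : ℕ, c (s + n) = 0 := ⟨k - 1, by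
      rw [Nat.cast_sub (by omega), ← hm', ← h.pc (s - 1)]; congr 1; push_cast; ring⟩
    classical
    have hn := Nat.find_spec hz
    have hlt : Nat.find hz ≤ k - 1 := Nat.find_le (by
      rw [Nat.cast_sub (by omega), ← hm', ← h.pc (s - 1)]; congr 1; push_cast; ring)
    have hmin : ∀ n < Nat.find hz, c (s + n) = 1 := fun n hn =>
      (h.c01 _).resolve_left (Nat.find_min hz hn)
    generalize Nat.find hz = n at hn hlt hmin
    have n0 : n ≠ 0 := by rintro rfl; simp [hm] at hn
    have n1 : n ≠ 1 := by rintro rfl; simp [hs1] at hn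
    obtain ⟨n, rfl⟩ : ∃ l, n = l + 2 := ⟨n - 2, by omega⟩
    have v1 : 12 ≤ val t p H s := h.val_end (by omega) hm (.inl ⟨hm', hs1⟩)
    have v2 : 12 ≤ val t p H (s + (n + 1 : ℕ)) := by
      refine h.val_end (by omega) (hmin _ (by omega)) (.inr ⟨?_, ?_⟩)
      · exact (congrArg c (by push_cast; ring)).trans (hmin n (by omega))
      · exact (congrArg c (by push_cast; ring)).trans hn
    rw [← sum_shift (fun i => 24 + val t p H i) (fun i => by rw [h.pval]) s]
    have hsum : ∑ i ∈ Finset.range k, (12 + if i = 0 ∨ i = n + 1 then 24 else 0 : ℤ) ≤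
        ∑ i ∈ Finset.range k, (24 + val t p H (i + s)) := by
      refine Finset.sum_le_sum fun i _ => ?_
      have := h.val_ge (i + s)
      split_ifs with hi
      · rcases hi with rfl | rfl
        · simp only [Nat.cast_zero, zero_add]; linarith
        · rw [add_comm _ s]; linarith
      · linarith
    refine le_trans ?_ hsum
    rw [Finset.sum_add_distrib, ← Finset.sum_filter, Finset.sum_const, Finset.sum_const]
    have hc : ({0, n + 1} : Finset ℕ).card ≤ ((Finset.range k).filter fun i => i = 0 ∨ i = n + 1).card := by
      refine Finset.card_le_card fun i hi => ?_
      simp only [Finset.mem_insert, Finset.mem_singleton] at hi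
      simp only [Finset.mem_filter, Finset.mem_range]
      omega
    rw [Finset.card_pair (by omega)] at hc
    simp only [Finset.card_range, nsmul_eq_mul]
    have h1 : (2 : ℤ) ≤ ((Finset.range k).filter fun i => i = 0 ∨ i = n + 1).card := by exact_mod_cast hc
    have h2 : (9 : ℤ) ≤ k := by exact_mod_cast hk
    linarith
  · refine ⟨?_, fun h => absurd h hK⟩
    have hc : ∀ i, c i = 1 → 9 ≤ H i := fun i hi => h.cH9 (by omega) i hi (.inr
      ((h.c01 _).resolve_right fun hi' => hK ⟨i, hi, hi'⟩))
    exact LongFace.final (b := b) (p := p) (t := t) (H := H)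
      { pt := h.pt, pp := h.pp, pb := h.pb, pH := h.pH, t01 := h.t01, p01 := h.p01, b01 := h.b01
        tp := h.tp, small := h.small, tetrad := h.tetrad hk, spec := h.spec
        H0 := fun i => (h.c01 i).elim (h.H0 i) fun h1 => by linarith [hc i h1]
        Ht := fun i hb ht => (h.c01 i).elim (fun h1 => h.Ht i h1 hb ht) fun h1 => h.cHt i h1 ht
        Hp := fun i hb ht => (h.c01 i).elim (fun h1 => h.Hp i h1 hb ht) fun h1 => by linarith [hc i h1] } hk

theorem final (h : FaceNum k t p b c e H N) :
    144 ≤ ∑ i ∈ Finset.range k, (24 + val t p H i + N i) := by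
  rcases h.len with rfl | rfl | rfl | hk
  exacts [h.final3, h.final5.1, h.final7.1, (h.final9 hk).1]

theorem final_lt (h : FaceNum k t p b c e H N) (hk : k ≠ 3) (hi : ∃ i, c i = 1 ∧ c (i + 1) = 1) :
    145 ≤ ∑ i ∈ Finset.range k, (24 + val t p H i + N i) := by
  have hi' : ∃ i, c i = 1 := hi.imp fun _ h => h.1
  rcases h.len with rfl | rfl | rfl | hk'
  exacts [absurd rfl hk, h.final5.2 hi', h.final7.2 hi', (h.final9 hk').2 hi]

end FaceNum
end

section
open scoped Classical

variable {V F : Type} [Fintype V] {G : SimpleGraph V} {L : V → V → F} {A K : Finset V} {c₀ : V → Bool}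
  {O : F → Prop}

/-- Across the edge `xy` of the face `f` there is an inner face of length `n`. -/
def Toward (G : SimpleGraph V) (L : V → V → F) (O : F → Prop) (n : ℕ) (f : F) (x y : V) : Prop :=
  ∃ f', f' ≠ f ∧ Inc L f' x y ∧ ¬O f' ∧ ∃ q, FCyc G L f' n q

/-- The edge `xy` is the middle edge of six consecutive small vertices of the 9-face `f`, the two
outer pairs of which lie on triangles. -/
def Spec (G : SimpleGraph V) (L : V → V → F) (O : F → Prop) (K : Finset V) (f : F) (x y : V) : Prop :=
  ∃ g, FCyc G L f 9 g ∧ g 0 = x ∧ g 1 = y ∧ (∀ i, -2 ≤ i → i ≤ 3 → Small G K (g i)) ∧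
    Toward G L O 3 f (g 2) (g 3) ∧ Toward G L O 3 f (g (-2)) (g (-1))

/-- Half of the charge sent by the face `f` through the edge `xy`. -/
noncomputable def pay (G : SimpleGraph V) (L : V → V → F) (O : F → Prop) (K : Finset V) (f : F) (x y : V) : ℤ :=
  if O f then 0 else if Toward G L O 3 f x y then 12 else
    if Toward G L O 5 f x y ∧ ¬Spec G L O K f x y then 4 else 0

def Tri (G : SimpleGraph V) (L : V → V → F) (f : F) : Prop := ∃ q, FCyc G L f 3 q

def At (G : SimpleGraph V) (L : V → V → F) (O : F → Prop) (n : ℕ) (f : F) (v : V) : Prop :=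
  ∃ w, G.Adj v w ∧ Inc L f v w ∧ Toward G L O n f v w

/-- Half of the charge sent by the vertex `v` to the face `f`. -/
noncomputable def give (G : SimpleGraph V) (L : V → V → F) (O : F → Prop) (K : Finset V) (v : V) (f : F) : ℤ :=
  if v ∈ K then
    if ∀ f, ¬O f then 12 else if O f then -18 else if deg G v = 2 then -6 else
      if deg G v = 3 then (if Tri G L f then 6 else if At G L O 3 f v then 12 else 9) else 12
  else if deg G v = 3 ∨ Tri G L f then 0 else if At G L O 3 f v then 12 else
    if At G L O 5 f v then 4 else 0

theorem Toward.symm {n : ℕ} {f : F} {x y : V} (h : Toward G L O n f x y) : Toward G L O n f y x := by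
  obtain ⟨f', h1, h2, h3⟩ := h
  exact ⟨f', h1, h2.symm, h3⟩

theorem Toward.comm {n : ℕ} {f : F} {x y : V} : Toward G L O n f x y ↔ Toward G L O n f y x :=
  ⟨.symm, .symm⟩

theorem Spec.symm {f : F} {x y : V} (h : Spec G L O K f x y) : Spec G L O K f y x := by
  obtain ⟨g, hf, h0, h1, hs, h2, h3⟩ := h
  exact ⟨fun i => g (1 - i), hf.rev 1, h1, h0, fun i i1 i2 => hs _ (by omega) (by omega), h3.symm, h2.symm⟩

theorem pay_comm (f : F) (x y : V) : pay G L O K f x y = pay G L O K f y x := by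
  have : Spec G L O K f x y ↔ Spec G L O K f y x := ⟨.symm, .symm⟩
  simp only [pay, Toward.comm (x := x), this]

theorem pay_nonneg (f : F) (x y : V) : 0 ≤ pay G L O K f x y := by
  unfold pay; split_ifs <;> norm_num

theorem give_le (v : V) (f : F) : give G L O K v f ≤ 12 := by
  unfold give; split_ifs <;> norm_num

/-- A minimal counterexample with its dual and the predicate `O` of being the face of the anchor. -/
structure Chg (G : SimpleGraph V) (L : V → V → F) (A K : Finset V) (c₀ : V → Bool) (O : F → Prop) :
    Prop where
  bad : Bad G A K c₀
  dual : IsDual G L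
  outer : ((∃ x, K = {x}) ∧ ∀ f, ¬O f) ∨ ∃ f₀ k₀ g₀, FCyc G L f₀ k₀ g₀ ∧ k₀ ≤ 12 ∧
    (∀ v, v ∈ K ↔ ∃ i, g₀ i = v) ∧ (∀ a ∈ K, ∀ b ∈ K, G.Adj a b → CEdge g₀ a b) ∧ ∀ f, O f ↔ f = f₀

namespace Chg

theorem other (h : Chg G L A K c₀ O) {a b : V} (hab : G.Adj a b) {f f₁ f₂ : F} (hf : Inc L f a b)
    (h1 : Inc L f₁ a b) (h2 : Inc L f₂ a b) (n1 : f₁ ≠ f) (n2 : f₂ ≠ f) : f₁ = f₂ := by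
  obtain ⟨f', -, -, hu, -⟩ := h.dual.other_face h.bad.twoConn hab hf
  rw [(hu _ h1).resolve_left n1, (hu _ h2).resolve_left n2]

theorem outer_edge (h : Chg G L A K c₀ O) {a b : V} (ha : a ∈ K) (hb : b ∈ K) (hab : G.Adj a b) :
    ∃ f, O f ∧ Inc L f a b := by
  rcases h.outer with ⟨⟨x, rfl⟩, -⟩ | ⟨f₀, k₀, g₀, hf, -, -, hK, hO⟩
  · rw [Finset.mem_singleton] at ha hb
    exact absurd hab (ha ▸ hb ▸ G.loopless.irrefl _)
  · exact ⟨f₀, (hO _).mpr rfl, ((hf.edge _ _).mp (hK a ha b hb hab)).2⟩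

theorem mem_of_outer (h : Chg G L A K c₀ O) {a b : V} {f : F} (hf : O f) (hab : G.Adj a b) (hi : Inc L f a b) :
    a ∈ K ∧ b ∈ K := by
  rcases h.outer with ⟨-, hO⟩ | ⟨f₀, k₀, g₀, hf₀, -, hm, -, hO⟩
  · exact absurd hf (hO f)
  · obtain rfl := (hO f).mp hf
    have := (hf₀.edge a b).mpr ⟨hab, hi⟩
    exact ⟨(hm a).mpr (hf₀.cyc.cedge_mem this), (hm b).mpr (hf₀.cyc.cedge_mem this.symm)⟩

theorem not_toward (h : Chg G L A K c₀ O) {n : ℕ} {a b : V} {f : F} (ha : a ∈ K) (hb : b ∈ K) (hab : G.Adj a b)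
    (hf : ¬O f) (hi : Inc L f a b) : ¬Toward G L O n f a b := by
  rintro ⟨f', hne, hi', hO, -⟩
  obtain ⟨f₀, h0, hi₀⟩ := h.outer_edge ha hb hab
  exact hO (h.other hab hi hi' hi₀ hne (fun e => hf (e ▸ h0)) ▸ h0)

theorem toward_len (h : Chg G L A K c₀ O) {n m : ℕ} {a b : V} {f : F} (hab : G.Adj a b) (hi : Inc L f a b)
    (h1 : Toward G L O n f a b) (h2 : Toward G L O m f a b) : n = m := by
  obtain ⟨f₁, n1, i1, -, q1, hq1⟩ := h1
  obtain ⟨f₂, n2, i2, -, q2, hq2⟩ := h2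
  obtain rfl := h.other hab hi i1 i2 n1 n2
  exact hq1.len_unique hq2

theorem short_toward (h : Chg G L A K c₀ O) {n k : ℕ} {a b : V} {f : F} {g : ℤ → V} (hf : FCyc G L f k g)
    (hk : k ≤ 6) (hn : n ≤ 6) (hab : G.Adj a b) (hi : Inc L f a b) : ¬Toward G L O n f a b := by
  rintro ⟨f', hne, hi', -, q, hq⟩
  exact h.bad.short_edge h.dual hf hq hk hn hne.symm hab hi hi'

theorem tri_toward (h : Chg G L A K c₀ O) {k : ℕ} {a b : V} {f : F} {g : ℤ → V} (hf : FCyc G L f k g)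
    (hab : G.Adj a b) (hi : Inc L f a b) (ht : Toward G L O 3 f a b) : 9 ≤ k := by
  obtain ⟨f', hne, hi', -, q, hq⟩ := ht
  exact h.bad.tri_edge h.dual hq hf hne hab hi' hi

/-- At a small vertex, a face meeting the first edge and not the second one meets the third one. -/
theorem small_third (h : Chg G L A K c₀ O) {v a b w : V} {f f' : F} (hv : Small G K v) (ha : G.Adj v a)
    (hb : G.Adj v b) (hw : G.Adj v w) (hab : a ≠ b) (haw : a ≠ w) (hbw : b ≠ w) (hne : f ≠ f')
    (ia : Inc L f v a) (ib : Inc L f v b) (ia' : Inc L f' v a) : Inc L f' v w ∧ ¬Inc L f' v b := by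
  have hn : ¬Inc L f' v b := fun ib' => h.bad.two_shared h.dual hne hv.1 hab ha hb ia ib ia' ib'
  have := (h.dual.parity3 h.bad.twoConn ha hb hw hab haw hbw (deg_three hv.2 ha hb hw hab haw hbw) f').mp ia'
  exact ⟨by_contra fun hc => this ⟨fun x => absurd x hn, fun x => absurd x hc⟩, hn⟩

theorem toward_small (h : Chg G L A K c₀ O) {v a b : V} {f : F} {n m : ℕ} (hv : Small G K v) (ha : G.Adj v a)
    (hb : G.Adj v b) (hab : a ≠ b) (ia : Inc L f v a) (ib : Inc L f v b) (hn : n ≤ 6) (hm : m ≤ 6)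
    (ta : Toward G L O n f v a) (tb : Toward G L O m f v b) : False := by
  obtain ⟨w, hw, hwa, hwb, -⟩ := deg_third hv.2 ha hb hab
  obtain ⟨f₁, n1, i1, -, q1, hq1⟩ := ta
  obtain ⟨f₂, n2, i2, -, q2, hq2⟩ := tb
  obtain ⟨j1, k1⟩ := h.small_third hv ha hb hw hab hwa.symm hwb.symm n1.symm ia ib i1
  obtain ⟨j2, k2⟩ := h.small_third hv hb ha hw hab.symm hwb.symm hwa.symm n2.symm ib ia i2
  exact h.bad.short_edge h.dual hq1 hq2 hn hm (fun e => k1 (e ▸ i2)) hw j1 j2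

/-- The vertices of the anchor cycle have two neighbours in the anchor. -/
theorem anchor_nbrs (h : Chg G L A K c₀ O) {v : V} (hv : v ∈ K) (hO : ∃ f, O f) :
    ∃ p n, p ∈ K ∧ n ∈ K ∧ p ≠ n ∧ G.Adj v p ∧ G.Adj v n ∧ (∀ f, O f → Inc L f v p ∧ Inc L f v n) ∧
      ∀ w ∈ K, G.Adj v w → w = p ∨ w = n := by
  rcases h.outer with ⟨-, hO'⟩ | ⟨f₀, k₀, g₀, hf₀, -, hm, hE, hO'⟩
  · obtain ⟨f, hf⟩ := hO
    exact absurd hf (hO' f)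
  · obtain ⟨i, rfl⟩ := (hm v).mp hv
    have c1 : CEdge g₀ (g₀ i) (g₀ (i - 1)) := ⟨i - 1, .inr ⟨rfl, by rw [sub_add_cancel]⟩⟩
    have c2 : CEdge g₀ (g₀ i) (g₀ (i + 1)) := ⟨i, .inl ⟨rfl, rfl⟩⟩
    have hk := hf₀.cyc.three_le
    refine ⟨g₀ (i - 1), g₀ (i + 1), (hm _).mpr ⟨_, rfl⟩, (hm _).mpr ⟨_, rfl⟩,
      hf₀.cyc.ne_of (by omega) (by omega), hf₀.cyc.cedge_adj c1, hf₀.cyc.cedge_adj c2, fun f hf => ?_,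
      fun w hw hvw => ((hf₀.cyc.cedge_iff).mp (hE _ hv w hw hvw)).symm⟩
    obtain rfl := (hO' f).mp hf
    exact ⟨((hf₀.edge _ _).mp c1).2, ((hf₀.edge _ _).mp c2).2⟩

theorem mem_of_deg_two (h : Chg G L A K c₀ O) {v w : V} (hv : v ∈ K) (hO : ∃ f, O f) (hd : deg G v = 2)
    (hw : G.Adj v w) : w ∈ K := by
  obtain ⟨p, n, hp, hn, hpn, ap, an, -⟩ := h.anchor_nbrs hv hO
  have : ({p, n} : Finset V) = Finset.univ.filter (G.Adj v) := by
    refine Finset.eq_of_subset_of_card_le (fun x hx => ?_) ?_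
    · simp only [Finset.mem_insert, Finset.mem_singleton] at hx
      rcases hx with rfl | rfl <;> simpa
    · rw [Finset.card_pair hpn]; exact hd.le
  have hw' : w ∈ ({p, n} : Finset V) := by rw [this]; simpa
  simp only [Finset.mem_insert, Finset.mem_singleton] at hw'
  rcases hw' with rfl | rfl <;> assumption

end Chg
end

section
open scoped Classical

variable {V F : Type} [Fintype V] {G : SimpleGraph V} {L : V → V → F} {A K : Finset V} {c₀ : V → Bool}
  {O : F → Prop}

namespace Chg

theorem long_of_spec (h : Chg G L A K c₀ O) {f f₁ f₂ : F} {x y z : V} (n1 : f₁ ≠ f)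
    (s1 : Spec G L O K f₁ x y) (hyx : G.Adj y x) (ix : Inc L f y x) (hyz : G.Adj y z) (hxz : x ≠ z)
    (iz : Inc L f y z) (n2 : f₂ ≠ f) (iz2 : Inc L f₂ y z) {k : ℕ} {p : ℤ → V} (hp : FCyc G L f₂ k p) :
    9 ≤ k := by
  obtain ⟨g, hg, rfl, rfl, hs, ⟨T, nT, iT, -, r, hT⟩, -⟩ := s1
  have e12 : Inc L f₁ (g 1) (g 2) := hg.inc 1
  have e10 : Inc L f₁ (g 1) (g 0) := (hg.inc 0).symm
  have e23 : Inc L f₁ (g 2) (g 3) := hg.inc 2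
  have a12 : G.Adj (g 1) (g 2) := hg.cyc.adj 1
  have a23 : G.Adj (g 2) (g 3) := hg.cyc.adj 2
  have n02 : g 0 ≠ g 2 := hg.cyc.ne_of (by norm_num) (by norm_num)
  have n13 : g 1 ≠ g 3 := hg.cyc.ne_of (by norm_num) (by norm_num)
  have S1 := hs 1 (by norm_num) (by norm_num)
  have S2 := hs 2 (by norm_num) (by norm_num)
  have nz2 : z ≠ g 2 := fun e => h.bad.two_shared h.dual n1.symm S1.1 hxz hyx hyz ix iz e10 (e ▸ e12)
  obtain ⟨j1, j2⟩ := h.small_third S1 hyz hyx a12 hxz.symm nz2 n02 n2.symm iz ix iz2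
  obtain ⟨u, hu, u1, u3, -⟩ := deg_third S2.2 a12.symm a23 n13
  obtain ⟨k1, k2⟩ := h.small_third S2 a23 a12.symm hu n13.symm u3.symm u1.symm nT.symm e23 e12.symm iT
  obtain ⟨l1, -⟩ := h.small_third S2 a12.symm a23 hu n13 u1.symm u3.symm (fun e : f₁ = f₂ => j2 (e ▸ e10)) e12.symm e23
    j1.symm
  exact h.bad.tri_edge h.dual hT hp (fun e => k2 (e ▸ j1.symm)) hu k1 l1

theorem no_three_spec (h : Chg G L A K c₀ O) {f f₁ f₂ f₃ : F} {q : ℤ → V} (hf : FCyc G L f 5 q)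
    (n1 : f₁ ≠ f) (i1 : Inc L f₁ (q 0) (q 1)) (s1 : Spec G L O K f₁ (q 0) (q 1))
    (n2 : f₂ ≠ f) (i2 : Inc L f₂ (q 1) (q 2)) (s2 : Spec G L O K f₂ (q 1) (q 2))
    (n3 : f₃ ≠ f) {j : ℤ} (j2 : 2 ≤ j) (j4 : j ≤ 4) (i3 : Inc L f₃ (q j) (q (j + 1)))
    (s3 : Spec G L O K f₃ (q j) (q (j + 1))) : False := by
  have q5 : q 5 = q 0 := by simpa using hf.cyc.period 0
  have adj : ∀ i, G.Adj (q i) (q (i + 1)) := hf.cyc.adj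
  have inc : ∀ i, Inc L f (q i) (q (i + 1)) := hf.inc
  have a01 : G.Adj (q 0) (q 1) := adj 0
  have a12 : G.Adj (q 1) (q 2) := adj 1
  have a40 : G.Adj (q 4) (q 0) := q5 ▸ adj 4
  have c01 : Inc L f (q 0) (q 1) := inc 0
  have c12 : Inc L f (q 1) (q 2) := inc 1
  have c40 : Inc L f (q 4) (q 0) := q5 ▸ inc 4
  have q02 : q 0 ≠ q 2 := hf.cyc.ne_of (by norm_num) (by norm_num)
  have q14 : q 1 ≠ q 4 := hf.cyc.ne_of (by norm_num) (by norm_num)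
  have q13 : q 1 ≠ q 3 := hf.cyc.ne_of (by norm_num) (by norm_num)
  have q24 : q 2 ≠ q 4 := hf.cyc.ne_of (by norm_num) (by norm_num)
  have q30 : q 3 ≠ q 0 := (hf.cyc.ne_of (by norm_num) (by norm_num)).symm
  have long : ∀ i : ℤ, 2 ≤ i → i ≤ 4 → ∀ f', f' ≠ f → Inc L f' (q i) (q (i + 1)) →
      ∀ k g, FCyc G L f' k g → 9 ≤ k := by
    intro i l2 l4 f' nf' hi k g hg
    by_cases hij : i = j
    · subst hij
      obtain rfl := h.other (adj i) (inc i) hi i3 nf' n3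
      obtain ⟨p, hp, -⟩ := s3
      exact (hp.len_unique hg).le
    obtain rfl | rfl | rfl : i = 2 ∨ i = 3 ∨ i = 4 := by omega
    · exact h.long_of_spec n2 s2 a12.symm c12.symm (adj 2) q13 (inc 2) nf' hi hg
    · obtain rfl | rfl : j = 2 ∨ j = 4 := by omega
      · exact h.long_of_spec n3 s3 (adj 2).symm (inc 2).symm (adj 3) q24 (inc 3) nf' hi hg
      · exact h.long_of_spec n3 (y := q 4) (x := q 5) s3.symm (adj 4) (inc 4) (adj 3).symm
          (by rw [q5]; exact q30.symm) (inc 3).symm nf' hi.symm hg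
    · have hi' : Inc L f' (q 4) (q 0) := q5 ▸ hi
      exact h.long_of_spec n1 s1.symm a01 c01 a40.symm q14 c40.symm nf' hi'.symm hg
  obtain ⟨g, hg, g0, g1, hs, ⟨T, nT, iT, -, r, hT⟩, -⟩ := s1
  obtain ⟨g', hg', g0', g1', hs', -, -⟩ := s2
  have S1 : Small G K (q 1) := g1 ▸ hs 1 (by norm_num) (by norm_num)
  have n12 : f₁ ≠ f₂ := fun e => h.bad.two_shared h.dual n1.symm S1.1 q02 a01.symm a12 c01.symm c12 i1.symm
    (e ▸ i2)
  have z1 : (-1 : ℤ) + 1 = 0 := rfl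
  have z2 : (-2 : ℤ) + 1 = -1 := rfl
  have e1 : G.Adj (q 1) (g 2) := g1 ▸ hg.cyc.adj 1
  have e1' : G.Adj (q 1) (g' (-1)) := g0' ▸ z1 ▸ (hg'.cyc.adj (-1)).symm
  have d1 : Inc L f₁ (q 1) (g 2) := g1 ▸ hg.inc 1
  have d1' : Inc L f₂ (q 1) (g' (-1)) := g0' ▸ z1 ▸ (hg'.inc (-1)).symm
  have m0 : g 2 ≠ q 0 := g0 ▸ (hg.cyc.ne_of (by norm_num) (by norm_num)).symm
  have m2 : g 2 ≠ q 2 := fun e => h.bad.two_shared h.dual n1.symm S1.1 q02 a01.symm a12 c01.symm c12 i1.symm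
    (e ▸ d1)
  have m2' : g' (-1) ≠ q 2 := g1' ▸ (hg'.cyc.ne_of (by norm_num) (by norm_num))
  have m0' : g' (-1) ≠ q 0 := fun e => h.bad.two_shared h.dual n2.symm S1.1 q02 a01.symm a12 c01.symm c12
    (e ▸ d1') i2
  have hss : g' (-1) = g 2 := by
    obtain ⟨c, -, -, -, hc⟩ := deg_third S1.2 a01.symm a12 q02
    rw [((hc _ e1).resolve_left m0).resolve_left m2, ((hc _ e1').resolve_left m0').resolve_left m2']
  have S2 := hs 2 (by norm_num) (by norm_num)
  have a23 : G.Adj (g 2) (g 3) := hg.cyc.adj 2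
  have a23' : G.Adj (g 2) (g' (-2)) := hss ▸ z2 ▸ (hg'.cyc.adj (-2)).symm
  have d23 : Inc L f₁ (g 2) (g 3) := hg.inc 2
  have d23' : Inc L f₂ (g 2) (g' (-2)) := hss ▸ z2 ▸ (hg'.inc (-2)).symm
  have k1 : g 3 ≠ q 1 := g1 ▸ (hg.cyc.ne_of (by norm_num) (by norm_num)).symm
  have k1' : g' (-2) ≠ q 1 := g0' ▸ hg'.cyc.ne_of (by norm_num) (by norm_num)
  have nab : g 3 ≠ g' (-2) := fun e => h.bad.two_shared h.dual n12 S2.1 k1.symm e1.symm a23 d1.symm d23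
    (hss ▸ d1').symm (e ▸ d23')
  obtain ⟨l1, l2⟩ := h.small_third S2 a23 e1.symm a23' k1 nab k1'.symm nT.symm d23 d1.symm iT
  obtain ⟨t, hat, hts, -, its⟩ := hT.apex a23 iT
  obtain ⟨c, -, -, -, hc⟩ := deg_third S2.2 a23 e1.symm k1
  have ht : t = g' (-2) := by
    rw [((hc t hts.symm).resolve_left hat.ne').resolve_left (fun e => l2 (e ▸ its.symm)),
      ((hc _ a23').resolve_left nab.symm).resolve_left k1']
  subst ht
  exact h.bad.no_configB h.dual hf (g0 ▸ hs 0 (by norm_num) (by norm_num)) S1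
    (g1' ▸ hs' 1 (by norm_num) (by norm_num)) S2 (hs 3 (by norm_num) (by norm_num))
    (hs' (-2) (by norm_num) (by norm_num)) e1 a23 hat hts m0 m2 k1 k1' long

end Chg
end

section
open scoped Classical

variable {V F : Type} [Fintype V] {G : SimpleGraph V} {L : V → V → F} {A K : Finset V} {c₀ : V → Bool}
  {O : F → Prop}

theorem ind_eq_one {P : Prop} [Decidable P] : (if P then (1 : ℤ) else 0) = 1 ↔ P := by split_ifs <;> simp_all

theorem ind_eq_zero {P : Prop} [Decidable P] : (if P then (1 : ℤ) else 0) = 0 ↔ ¬P := by split_ifs <;> simp_all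

theorem ind_add_ne_zero {P Q : Prop} [Decidable P] [Decidable Q] :
    (if P then (1 : ℤ) else 0) + (if Q then (1 : ℤ) else 0) ≠ 0 ↔ P ∨ Q := by split_ifs <;> simp_all

theorem ind_zero_or_one {P : Prop} [Decidable P] : (if P then (1 : ℤ) else 0) = 0 ∨ (if P then (1 : ℤ) else 0) = 1 := by
  split_ifs <;> simp

theorem ind_sum_le_one {P Q R S : Prop} [Decidable P] [Decidable Q] [Decidable R] [Decidable S]
    (h1 : P → ¬Q) (h2 : P → ¬R) (h3 : P → ¬S) (h4 : Q → ¬R) (h5 : Q → ¬S) (h6 : R → ¬S) :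
    (if P then (1 : ℤ) else 0) + (if Q then 1 else 0) + (if R then 1 else 0) + (if S then 1 else 0) ≤ 1 := by
  by_cases hP : P
  · simp [hP, h1 hP, h2 hP, h3 hP]
  by_cases hQ : Q
  · simp [hP, hQ, h4 hQ, h5 hQ]
  by_cases hR : R
  · simp [hP, hQ, hR, h6 hR]
  rw [if_neg hP, if_neg hQ, if_neg hR]
  split_ifs <;> norm_num

/-- The charge received by the face `f` through the edge `xy`. -/
noncomputable def recv (G : SimpleGraph V) (L : V → V → F) (O : F → Prop) (K : Finset V) (f : F) (x y : V) : ℤ :=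
  2 * pay G L O K (L x y) x y + 2 * pay G L O K (L y x) x y - 2 * pay G L O K f x y

namespace Chg

theorem recv_eq (h : Chg G L A K c₀ O) {f f' : F} {a b : V} (hab : G.Adj a b) (hi : Inc L f a b)
    (hi' : Inc L f' a b) (hne : f' ≠ f) : recv G L O K f a b = 2 * pay G L O K f' a b := by
  have hLL := h.dual.ne h.bad.twoConn hab
  unfold recv
  rcases hi with rfl | rfl <;> rcases hi' with rfl | rfl
  · exact absurd rfl hne
  · ring
  · ring
  · exact absurd rfl hne

theorem recv_nonneg (h : Chg G L A K c₀ O) {f : F} {a b : V} (hab : G.Adj a b) (hi : Inc L f a b) :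
    0 ≤ recv G L O K f a b := by
  obtain ⟨f', hne, hi', -⟩ := h.dual.other_face h.bad.twoConn hab hi
  rw [h.recv_eq hab hi hi' hne]
  exact mul_nonneg (by norm_num) (pay_nonneg _ _ _)

theorem inner_nbr (h : Chg G L A K c₀ O) {f : F} {a b : V} (hab : G.Adj a b) (hf : ¬O f)
    (hK : a ∉ K ∨ b ∉ K) {n : ℕ} {q : ℤ → V} (hq : FCyc G L f n q) (hi : Inc L f a b) :
    ∃ f', f' ≠ f ∧ Inc L f' a b ∧ ¬O f' ∧ Toward G L O n f' a b := by
  obtain ⟨f', hne, hi', -⟩ := h.dual.other_face h.bad.twoConn hab hi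
  refine ⟨f', hne, hi', fun hO => ?_, f, hne.symm, hi, hf, q, hq⟩
  have := h.mem_of_outer hO hab hi'
  tauto

theorem give_nonneg {v : V} (f : F) (hv : v ∉ K) : 0 ≤ give G L O K v f := by
  unfold give; rw [if_neg hv]; split_ifs <;> norm_num

theorem give_at (h : Chg G L A K c₀ O) {f : F} {v w : V} (hv : v ∉ K) (hd : ¬Small G K v) {n : ℕ} (hn : n = 3 ∨ n = 5) (hvw : G.Adj v w) (hi : Inc L f v w)
    (ht : Toward G L O n f v w) : 4 ≤ give G L O K v f ∧ (n = 3 → 12 ≤ give G L O K v f) := by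
  have h1 : ¬(deg G v = 3 ∨ Tri G L f) := by
    rintro (h3 | ⟨q, hq⟩)
    · exact hd ⟨hv, h3⟩
    · exact h.short_toward hq (by norm_num) (by omega) hvw hi ht
  unfold give
  rw [if_neg hv, if_neg h1]
  rcases hn with rfl | rfl
  · rw [if_pos ⟨w, hvw, hi, ht⟩]; simp
  · have : At G L O 5 f v := ⟨w, hvw, hi, ht⟩
    rw [if_pos this]
    split_ifs <;> norm_num

theorem give_anchor (h : Chg G L A K c₀ O) {f : F} (hO : ¬O f) {v : V} (hv : v ∈ K) :
    -6 ≤ give G L O K v f ∧ (∀ w, G.Adj v w → w ∉ K → 6 ≤ give G L O K v f ∧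
      (¬Tri G L f → 9 ≤ give G L O K v f) ∧ (Inc L f v w → Toward G L O 3 f v w → 12 ≤ give G L O K v f)) := by
  unfold give
  rw [if_pos hv, if_neg hO]
  by_cases hall : ∀ f, ¬O f
  · rw [if_pos hall]; norm_num
  rw [if_neg hall]
  push Not at hall
  refine ⟨by split_ifs <;> norm_num, fun w hvw hw => ?_⟩
  rw [if_neg (fun hd => hw (h.mem_of_deg_two hv hall hd hvw))]
  refine ⟨by split_ifs <;> norm_num, fun hT => by rw [if_neg hT]; split_ifs <;> norm_num, fun hi ht => ?_⟩
  have hT : ¬Tri G L f := fun ⟨q, hq⟩ => h.short_toward hq (by norm_num) (by norm_num) hvw hi ht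
  have : At G L O 3 f v := ⟨w, hvw, hi, ht⟩
  rw [if_neg hT, if_pos this]; split_ifs <;> norm_num

theorem exists_not_mem (h : Chg G L A K c₀ O) {f : F} (hO : ¬O f) {k : ℕ} {g : ℤ → V} (hf : FCyc G L f k g) :
    ∃ i, g i ∉ K := by
  by_contra hc
  push Not at hc
  rcases h.outer with ⟨⟨x, rfl⟩, -⟩ | ⟨f₀, k₀, g₀, hf₀, -, -, hE, hO'⟩
  · have := hf.cyc.adj 0
    rw [Finset.mem_singleton.mp (hc 0), Finset.mem_singleton.mp (hc (0 + 1))] at this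
    exact G.loopless.irrefl _ this
  · exact hO ((hO' f).mpr (h.bad.face_eq h.dual hf hf₀ fun i => hE _ (hc _) _ (hc _) (hf.cyc.adj i)))

theorem faceNum (h : Chg G L A K c₀ O) {f : F} (hO : ¬O f) {k : ℕ} {g : ℤ → V} (hf : FCyc G L f k g) :
    FaceNum k (fun i => if Toward G L O 3 f (g i) (g (i + 1)) then 1 else 0)
      (fun i => if Toward G L O 5 f (g i) (g (i + 1)) ∧ ¬Spec G L O K f (g i) (g (i + 1)) then 1 else 0)
      (fun i => if ¬Small G K (g i) then 1 else 0) (fun i => if g i ∈ K then 1 else 0)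
      (fun i => if ∃ f', f' ≠ f ∧ Inc L f' (g i) (g (i + 1)) ∧ Spec G L O K f' (g i) (g (i + 1)) then 1 else 0)
      (fun i => give G L O K (g i) f) (fun i => recv G L O K f (g i) (g (i + 1))) := by
  have per : ∀ i, g (i + k) = g i := hf.cyc.period
  have per1 : ∀ i, g (i + k + 1) = g (i + 1) := fun i => hf.cyc.eq_add (per i) 1
  have adj : ∀ i, G.Adj (g i) (g (i + 1)) := hf.cyc.adj
  have inc : ∀ i, Inc L f (g i) (g (i + 1)) := hf.inc
  have adj' : ∀ i, G.Adj (g i) (g (i - 1)) := fun i => by simpa using (adj (i - 1)).symm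
  have inc' : ∀ i, Inc L f (g i) (g (i - 1)) := fun i => by simpa using (inc (i - 1)).symm
  have hk3 := hf.cyc.three_le
  have ne' : ∀ i, g (i - 1) ≠ g (i + 1) := fun i => hf.cyc.ne_of (by omega) (by omega)
  have len : ∀ {k' : ℕ} {g' : ℤ → V}, FCyc G L f k' g' → k' = k := fun hf' => hf'.len_unique hf
  refine
    { len := h.bad.len_cases hf
      pt := fun i => by simp only [per, per1]
      pp := fun i => by simp only [per, per1]
      pb := fun i => by simp only [per]
      pc := fun i => by simp only [per]
      pe := fun i => by simp only [per, per1]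
      pH := fun i => by simp only [per]
      t01 := fun i => ind_zero_or_one
      p01 := fun i => ind_zero_or_one
      b01 := fun i => ind_zero_or_one
      c01 := fun i => ind_zero_or_one
      e01 := fun i => ind_zero_or_one
      tp := fun i => ?_, small := fun i hb => ?_, H0 := fun i hc => ?_, Ht := fun i hc hb ht => ?_
      Hp := fun i hc hb ht => ?_, cb := fun i hc => ?_, cH := fun i hc => ?_, cH6 := fun i hc hn => ?_
      cH9 := fun hk i hc hn => ?_, cHt := fun i hc ht => ?_, ct := fun i hc hc' => ?_, notall := ?_
      tetrad := fun hk i t0 t2 b0 b1 b2 b3 => ?_, spec := fun hk i pi t2 t2' c1 c2 c3 c4 c5 c6 => ?_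
      N0 := fun i => ?_, N3 := fun hk i hc => ?_, N5 := fun hk i hc he => ?_, eb := fun i he => ?_
      ee := fun hk i e0 e1 => ?_, t9 := fun hk i => ?_, p6 := fun hk i => ?_ }
  · by_cases h1 : Toward G L O 3 f (g i) (g (i + 1))
    · have h2 : ¬Toward G L O 5 f (g i) (g (i + 1)) := fun h2 => by
        have := h.toward_len (adj i) (inc i) h1 h2
        omega
      simp [h1, h2]
    · rw [if_neg h1]; split_ifs <;> norm_num
  · rw [ind_eq_zero, not_not] at hb
    have key : ∀ n m, n ≤ 6 → m ≤ 6 → Toward G L O n f (g (i - 1)) (g (i - 1 + 1)) →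
        ¬Toward G L O m f (g i) (g (i + 1)) := fun n m hn hm h1 h2 => by
      rw [sub_add_cancel] at h1
      exact h.toward_small hb (adj' i) (adj i) (ne' i) (inc' i) (inc i) hn hm h1.symm h2
    have l : ∀ j, Toward G L O 3 f (g j) (g (j + 1)) → ¬Toward G L O 5 f (g j) (g (j + 1)) := fun j h1 h2 => by
      have := h.toward_len (adj j) (inc j) h1 h2
      omega
    exact ind_sum_le_one (fun a b => l (i - 1) a b.1) (key 3 3 (by norm_num) (by norm_num))
      (fun a b => key 3 5 (by norm_num) (by norm_num) a b.1)
      (fun a => key 5 3 (by norm_num) (by norm_num) a.1)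
      (fun a b => key 5 5 (by norm_num) (by norm_num) a.1 b.1) (fun a b => l i a b.1)
  · exact give_nonneg _ (ind_eq_zero.mp hc)
  · rw [ind_eq_zero] at hc
    rw [ind_eq_one] at hb
    rw [ind_add_ne_zero, sub_add_cancel] at ht
    rcases ht with ht | ht
    · exact (h.give_at hc hb (.inl rfl) (adj' i) (inc' i) ht.symm).2 rfl
    · exact (h.give_at hc hb (.inl rfl) (adj i) (inc i) ht).2 rfl
  · rw [ind_eq_zero] at hc
    rw [ind_eq_one] at hb
    rw [ind_add_ne_zero, sub_add_cancel] at ht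
    rcases ht with ⟨ht, -⟩ | ⟨ht, -⟩
    · exact (h.give_at hc hb (.inr rfl) (adj' i) (inc' i) ht.symm).1
    · exact (h.give_at hc hb (.inr rfl) (adj i) (inc i) ht).1
  · rw [ind_eq_one] at hc ⊢
    exact fun hs => hs.1 hc
  · exact (h.give_anchor hO (ind_eq_one.mp hc)).1
  · rw [ind_eq_one] at hc
    rw [ind_eq_zero, ind_eq_zero] at hn
    rcases hn with hn | hn
    exacts [((h.give_anchor hO hc).2 _ (adj' i) hn).1, ((h.give_anchor hO hc).2 _ (adj i) hn).1]
  · rw [ind_eq_one] at hc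
    rw [ind_eq_zero, ind_eq_zero] at hn
    have hT : ¬Tri G L f := fun ⟨q, hq⟩ => hk (len hq).symm
    rcases hn with hn | hn
    exacts [((h.give_anchor hO hc).2 _ (adj' i) hn).2.1 hT, ((h.give_anchor hO hc).2 _ (adj i) hn).2.1 hT]
  · rw [ind_eq_one] at hc
    rw [ind_add_ne_zero, sub_add_cancel] at ht
    rcases ht with ht | ht
    · exact ((h.give_anchor hO hc).2 _ (adj' i) fun hn => h.not_toward hc hn (adj' i) hO (inc' i) ht.symm).2.2
        (inc' i) ht.symm
    · exact ((h.give_anchor hO hc).2 _ (adj i) fun hn => h.not_toward hc hn (adj i) hO (inc i) ht).2.2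
        (inc i) ht
  · rw [ind_eq_one] at hc hc'
    rw [ind_eq_zero, ind_eq_zero]
    exact ⟨h.not_toward hc hc' (adj i) hO (inc i), fun hp => h.not_toward hc hc' (adj i) hO (inc i) hp.1⟩
  · exact (h.exists_not_mem hO hf).imp fun i hi => ind_eq_zero.mpr hi
  · rw [ind_eq_one] at t0 t2
    simp only [ind_eq_zero, not_not] at b0 b1 b2 b3
    obtain ⟨T₁, n1, i1, -, q1, hq1⟩ := t0
    obtain ⟨T₂, n2, i2, -, q2, hq2⟩ := t2
    have e1 : i - 1 + 1 = i := by ring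
    have e2 : i - 1 + 2 = i + 1 := by ring
    have e3 : i - 1 + 3 = i + 2 := by ring
    have e4 : i - 1 + 4 = i + 3 := by ring
    have e5 : i + 2 + 1 = i + 3 := by ring
    refine h.bad.no_tetrad h.dual (hf.shift (i - 1)) hk ?_ ?_ ?_ ?_ hq1 hq2 n1 n2 ?_ ?_
    · rwa [e1]
    · rwa [e2]
    · rwa [e3]
    · rwa [e4]
    · rwa [e1, e2]
    · rw [e5] at i2
      rwa [e3, e4]
  · subst hk
    rw [ind_eq_one] at t2 t2' pi
    simp only [ind_eq_zero, not_not] at c1 c2 c3 c4 c5 c6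
    refine pi.2 ⟨fun j => g (i + j), hf.shift i, by simp, rfl, fun j j1 j2 => ?_, ?_, ?_⟩
    · obtain rfl | rfl | rfl | rfl | rfl | rfl : j = -2 ∨ j = -1 ∨ j = 0 ∨ j = 1 ∨ j = 2 ∨ j = 3 := by omega
      exacts [c1, c2, by simpa using c3, c4, c5, c6]
    · rwa [add_assoc] at t2
    · have e : i - 2 + 1 = i + -1 := by ring
      rwa [e] at t2'
  · exact h.recv_nonneg (adj i) (inc i)
  · subst hk
    rw [ind_eq_zero, ind_eq_zero] at hc
    obtain ⟨f', hne, hi, hO', ht⟩ := h.inner_nbr (adj i) hO hc hf (inc i)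
    rw [h.recv_eq (adj i) (inc i) hi hne]
    simp [pay, hO', ht]
  · subst hk
    rw [ind_eq_zero, ind_eq_zero] at hc
    rw [ind_eq_zero] at he
    obtain ⟨f', hne, hi, hO', ht⟩ := h.inner_nbr (adj i) hO hc hf (inc i)
    have hs : ¬Spec G L O K f' (g i) (g (i + 1)) := fun hs => he ⟨f', hne, hi, hs⟩
    rw [h.recv_eq (adj i) (inc i) hi hne]
    have hts : Toward G L O 5 f' (g i) (g (i + 1)) ∧ ¬Spec G L O K f' (g i) (g (i + 1)) := ⟨ht, hs⟩
    simp only [pay, if_neg hO', if_pos hts]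
    split_ifs <;> norm_num
  · rw [ind_eq_one] at he
    rw [ind_eq_zero, ind_eq_zero]
    obtain ⟨f', -, -, g', -, h0, h1, hs, -⟩ := he
    exact ⟨h0 ▸ (hs 0 (by norm_num) (by norm_num)).1, h1 ▸ (hs 1 (by norm_num) (by norm_num)).1⟩
  · subst hk
    rw [ind_eq_one] at e0 e1
    rw [ind_eq_zero, ind_eq_zero, ind_eq_zero]
    obtain ⟨f₁, n1, i1, s1⟩ := e0
    obtain ⟨f₂, n2, i2, s2⟩ := e1
    have key : ∀ j : ℤ, 2 ≤ j → j ≤ 4 →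
        ¬∃ f', f' ≠ f ∧ Inc L f' (g (i + j)) (g (i + j + 1)) ∧ Spec G L O K f' (g (i + j)) (g (i + j + 1)) := by
      rintro j j2 j4 ⟨f₃, n3, i3, s3⟩
      have e1 : i + 1 + 1 = i + 2 := by ring
      rw [add_assoc] at i3 s3
      rw [e1] at i2 s2
      exact h.no_three_spec (hf.shift i) (f₁ := f₁) n1 (by simpa using i1) (by simpa using s1) n2 i2 s2 n3 j2 j4
        i3 s3
    exact ⟨key 2 (by norm_num) (by norm_num), key 3 (by norm_num) (by norm_num), key 4 (by norm_num) le_rfl⟩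
  · rw [ind_eq_zero]
    intro ht
    have := h.tri_toward hf (adj i) (inc i) ht
    omega
  · rw [ind_eq_zero]
    exact fun ht => h.short_toward hf (by omega) (by norm_num) (adj i) (inc i) ht.1

end Chg
end

section
open scoped Classical

variable {V F : Type} [Fintype V] {G : SimpleGraph V} {L : V → V → F} {A K : Finset V} {c₀ : V → Bool}
  {O : F → Prop}

theorem sum_two_ge {N : Finset V} {w : V → ℤ} {a b : V} (ha : a ∈ N) (hb : b ∈ N) (hab : a ≠ b) {x y : ℤ}
    (h1 : x ≤ w a) (h2 : x ≤ w b) (h3 : ∀ c ∈ N, c ≠ a → c ≠ b → y ≤ w c) :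
    2 * x + (N.card - 2) * y ≤ ∑ c ∈ N, w c := by
  have hb' : b ∈ N.erase a := Finset.mem_erase.mpr ⟨hab.symm, hb⟩
  rw [← Finset.add_sum_erase N w ha, ← Finset.add_sum_erase _ w hb']
  have h4 := Finset.card_nsmul_le_sum ((N.erase a).erase b) w y fun c hc => by
    simp only [Finset.mem_erase] at hc
    exact h3 c hc.2.2 hc.2.1 hc.1
  have h5 := Finset.card_erase_add_one hb'
  have h6 := Finset.card_erase_add_one ha
  have h7 : (((N.erase a).erase b).card : ℤ) = N.card - 2 := by omega
  rw [nsmul_eq_mul, h7] at h4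
  linarith

theorem deg_fourth {v a b c : V} (hv : deg G v = 4) (ha : G.Adj v a) (hb : G.Adj v b) (hc : G.Adj v c)
    (hab : a ≠ b) (hac : a ≠ c) (hbc : b ≠ c) : ∃ d, G.Adj v d ∧ d ≠ a ∧ d ≠ b ∧ d ≠ c ∧
      ∀ w, G.Adj v w → w = a ∨ w = b ∨ w = c ∨ w = d := by
  have hsub : ({a, b, c} : Finset V) ⊆ Finset.univ.filter (G.Adj v) := by
    intro x hx
    simp only [Finset.mem_insert, Finset.mem_singleton] at hx
    rcases hx with rfl | rfl | rfl <;> simpa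
  have h3 : ({a, b, c} : Finset V).card = 3 := by simp [hab, hac, hbc]
  have hcard := Finset.card_sdiff_add_card_eq_card hsub
  have hv' : (Finset.univ.filter (G.Adj v)).card = 4 := hv
  obtain ⟨d, hd⟩ := Finset.card_eq_one.mp (show (Finset.univ.filter (G.Adj v) \ {a, b, c}).card = 1 by omega)
  have hmem : ∀ w, w = d ↔ G.Adj v w ∧ ¬(w = a ∨ w = b ∨ w = c) := fun w => by
    rw [← Finset.mem_singleton, ← hd]; simp
  have := (hmem d).mp rfl
  refine ⟨d, this.1, fun e => this.2 (.inl e), fun e => this.2 (.inr (.inl e)), fun e => this.2 (.inr (.inr e)),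
    fun w hw => ?_⟩
  have := hmem w
  tauto

/-- The final charge of a vertex, up to the constant `-144`. -/
noncomputable def vsum (G : SimpleGraph V) (L : V → V → F) (O : F → Prop) (K : Finset V) (v : V) : ℤ :=
  ∑ b ∈ Finset.univ.filter (G.Adj v), (48 - give G L O K v (L v b) - give G L O K v (L b v))

namespace Chg

theorem mate (h : Chg G L A K c₀ O) {v a : V} {f : F} (ha : G.Adj v a) (hi : Inc L f v a) :
    ∃ b, b ≠ a ∧ G.Adj v b ∧ Inc L f v b ∧ ∀ w, G.Adj v w → Inc L f v w → w = a ∨ w = b := by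
  obtain ⟨k, g, hf, rfl, rfl⟩ := h.dual.exists_fcyc h.bad.twoConn ha hi
  have hk := hf.cyc.three_le
  have hc : CEdge g (g 0) (g (0 - 1)) := hf.cyc.cedge_iff.mpr (.inr rfl)
  have := (hf.edge _ _).mp hc
  refine ⟨g (0 - 1), hf.cyc.ne_of (by omega) (by omega), this.1, this.2, fun w hw iw => ?_⟩
  exact hf.cyc.cedge_iff.mp ((hf.edge _ _).mpr ⟨hw, iw⟩)

theorem term_eq {f f' : F} {v b : V} (hi : Inc L f v b)
    (hi' : Inc L f' v b) (hne : f' ≠ f) : 48 - give G L O K v (L v b) - give G L O K v (L b v) =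
      48 - give G L O K v f - give G L O K v f' := by
  rcases hi with rfl | rfl <;> rcases hi' with rfl | rfl
  · exact absurd rfl hne
  · ring
  · ring
  · exact absurd rfl hne

theorem term_ge (v b : V) : 24 ≤ 48 - give G L O K v (L v b) - give G L O K v (L b v) := by
  have := give_le (G := G) (L := L) (O := O) (K := K) v (L v b)
  have := give_le (G := G) (L := L) (O := O) (K := K) v (L b v)
  linarith

theorem term_ge_of (h : Chg G L A K c₀ O) {f : F} {v b : V} (hb : G.Adj v b) (hi : Inc L f v b) :
    36 - give G L O K v f ≤ 48 - give G L O K v (L v b) - give G L O K v (L b v) := by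
  obtain ⟨f', hne, hi', -⟩ := h.dual.other_face h.bad.twoConn hb hi
  rw [term_eq (G := G) (O := O) (K := K) hi hi' hne]
  linarith [give_le (G := G) (L := L) (O := O) (K := K) v f']

theorem give_tri {v : V} (hv : v ∉ K) {T : F} (hT : Tri G L T) : give G L O K v T = 0 := by
  unfold give; rw [if_neg hv, if_pos (.inr hT)]

theorem vsum_four (h : Chg G L A K c₀ O) {v a b : V} {T : F} (hv : v ∉ K) (hd : deg G v = 4) (hT : Tri G L T)
    (ha : G.Adj v a) (hb : G.Adj v b) (hab : a ≠ b) (ia : Inc L T v a) (ib : Inc L T v b)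
    (hT' : ∀ w, G.Adj v w → Inc L T v w → w = a ∨ w = b) : 144 ≤ vsum G L O K v := by
  have hB := h.bad
  obtain ⟨f₂, n2, i2, -⟩ := h.dual.other_face hB.twoConn ha ia
  obtain ⟨x, hxa, hx, ix, h2⟩ := h.mate ha i2
  have hxb : x ≠ b := fun e => hB.two_shared h.dual n2 hv hab ha hb i2 (e ▸ ix) ia ib
  obtain ⟨y, hy, hya, hyb, hyx, hN⟩ := deg_fourth hd ha hb hx hab hxa.symm hxb.symm
  obtain ⟨f₄, n4, i4, -⟩ := h.dual.other_face hB.twoConn hx ix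
  have nT4 : f₄ ≠ T := fun e => (hT' x hx (e ▸ i4)).elim hxa hxb
  have onea : ∀ e, Inc L e v a → e = T ∨ e = f₂ := fun e he => by
    by_contra hc
    push Not at hc
    exact hc.2 (h.other ha ia he i2 hc.1 n2)
  have onex : ∀ e, Inc L e v x → e = f₂ ∨ e = f₄ := fun e he => by
    by_contra hc
    push Not at hc
    exact hc.2 (h.other hx ix he i4 hc.1 n4)
  have n4a : ¬Inc L f₄ v a := fun hc => (onea _ hc).elim nT4 n4
  have n2y : ¬Inc L f₂ v y := fun hc => (h2 y hy hc).elim hya hyx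
  have nTy : ¬Inc L T v y := fun hc => (hT' y hy hc).elim hya hyb
  have ey : ∀ e, Inc L e v y → e = f₄ ∨ Inc L e v b := fun e he => by
    obtain ⟨z, hzy, hz, iz, -⟩ := h.mate hy he
    rcases hN z hz with rfl | rfl | rfl | rfl
    · rcases onea _ iz with rfl | rfl
      exacts [absurd he nTy, absurd he n2y]
    · exact .inr iz
    · rcases onex _ iz with rfl | rfl
      exacts [absurd he n2y, .inl rfl]
    · exact absurd rfl hzy
  have i4y : Inc L f₄ v y := by
    obtain ⟨z, hzx, hz, iz, h4⟩ := h.mate hx i4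
    rcases hN z hz with rfl | rfl | rfl | rfl
    · exact absurd iz n4a
    · obtain ⟨e, hne, he, -⟩ := h.dual.other_face hB.twoConn hy (f := L v y) (.inl rfl)
      have n4y : ¬Inc L f₄ v y := fun hc => (h4 y hy hc).elim hyx hyb
      have key : ∀ e, Inc L e v y → e = f₄ := fun e he =>
        (ey e he).elim id fun hb' => h.other hb ib hb' iz (fun e' => nTy (e' ▸ he)) nT4
      exact absurd (key e he ▸ he) n4y
    · exact absurd rfl hzx
    · exact iz
  have h4 : ∀ w, G.Adj v w → Inc L f₄ v w → w = x ∨ w = y := fun w hw iw => by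
    obtain ⟨z, hzx, hz, iz, h4⟩ := h.mate hx i4
    obtain rfl := (h4 y hy i4y).resolve_left hyx
    exact h4 w hw iw
  obtain ⟨q, hq⟩ := hT
  have noAt : ∀ n, n ≤ 6 → ¬At G L O n f₄ v := by
    rintro n hn ⟨w, hw, iw, f', hne, hi', -, q', hq'⟩
    rcases h4 w hw iw with rfl | rfl
    · obtain rfl := (onex _ hi').resolve_right hne
      exact hB.short_edge h.dual hq hq' (by norm_num) hn n2.symm ha ia i2
    · exact hB.short_edge h.dual hq hq' (by norm_num) hn (fun e => nTy (e ▸ hi')) hb ib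
        ((ey _ hi').resolve_left hne)
  have g4 : give G L O K v f₄ = 0 := by
    unfold give
    rw [if_neg hv, if_neg (noAt 3 (by norm_num)), if_neg (noAt 5 (by norm_num)), ite_self]
  have gT : give G L O K v T = 0 := give_tri hv ⟨q, hq⟩
  have := Finset.card_nsmul_le_sum (Finset.univ.filter (G.Adj v))
    (fun b => 48 - give G L O K v (L v b) - give G L O K v (L b v)) 36 fun w hw => by
      rcases hN w (by simpa using hw) with rfl | rfl | rfl | rfl
      · simpa [gT] using h.term_ge_of ha ia
      · simpa [gT] using h.term_ge_of hb ib
      · simpa [g4] using h.term_ge_of hx i4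
      · simpa [g4] using h.term_ge_of hy i4y
  rw [show (Finset.univ.filter (G.Adj v)).card = 4 from hd] at this
  exact this

theorem vsum_inner (h : Chg G L A K c₀ O) {v : V} (hA : v ∈ A) (hv : v ∉ K) : 144 ≤ vsum G L O K v := by
  have hB := h.bad
  obtain ⟨a, ha, -, -⟩ := hB.exists_third hA hv v v
  obtain ⟨b, hb, hba, -⟩ := hB.exists_third hA hv a a
  obtain ⟨c, hc, hca, hcb⟩ := hB.exists_third hA hv a b
  have hd3 : 3 ≤ deg G v := by
    rw [← show ({a, b, c} : Finset V).card = 3 by simp [hba.symm, hca.symm, hcb.symm]]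
    refine Finset.card_le_card fun x hx => ?_
    simp only [Finset.mem_insert, Finset.mem_singleton] at hx
    rcases hx with rfl | rfl | rfl <;> simpa
  by_cases h3 : deg G v = 3
  · have hz : ∀ f, give G L O K v f = 0 := fun f => by unfold give; rw [if_neg hv, if_pos (.inl h3)]
    have h3' : (Finset.univ.filter (G.Adj v)).card = 3 := h3
    unfold vsum
    simp [hz, h3']
  by_cases hT : ∃ T a, Tri G L T ∧ G.Adj v a ∧ Inc L T v a
  · obtain ⟨T, a, hT, ha, ia⟩ := hT
    obtain ⟨b, hba, hb, ib, hab⟩ := h.mate ha ia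
    by_cases h4 : deg G v = 4
    · exact h.vsum_four hv h4 hT ha hb hba.symm ia ib hab
    · have t1 := h.term_ge_of (O := O) ha ia
      have t2 := h.term_ge_of (O := O) hb ib
      rw [give_tri hv hT, sub_zero] at t1 t2
      have := sum_two_ge (N := Finset.univ.filter (G.Adj v)) (by simpa) (by simpa) hba.symm t1 t2
        fun c _ _ _ => term_ge v c
      have h5 : (5 : ℤ) ≤ (Finset.univ.filter (G.Adj v)).card := by
        have : 5 ≤ deg G v := by omega
        exact_mod_cast this
      unfold vsum
      linarith
  · push Not at hT
    have g4 : ∀ w f, G.Adj v w → Inc L f v w → give G L O K v f ≤ 4 := fun w f hw iw => by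
      have : ¬At G L O 3 f v := by
        rintro ⟨w, hw, -, f', -, hi', -, q⟩
        exact hT f' w q hw hi'
      unfold give
      rw [if_neg hv, if_neg this]
      split_ifs <;> norm_num
    have := Finset.card_nsmul_le_sum (Finset.univ.filter (G.Adj v))
      (fun b => 48 - give G L O K v (L v b) - give G L O K v (L b v)) 40 fun w hw => by
        have hw' : G.Adj v w := by simpa using hw
        linarith [g4 w (L v w) hw' (.inl rfl), g4 w (L w v) hw' (.inr rfl)]
    rw [nsmul_eq_mul] at this
    have h5 : (4 : ℤ) ≤ (Finset.univ.filter (G.Adj v)).card := by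
      have : 4 ≤ deg G v := by omega
      exact_mod_cast this
    unfold vsum
    linarith

theorem give_outer {v : V} {f : F} (hv : v ∈ K) (hf : O f) : give G L O K v f = -18 := by
  unfold give
  rw [if_pos hv, if_neg (fun hc => hc f hf), if_pos hf]

theorem vsum_anchor (h : Chg G L A K c₀ O) (hO : ∃ f, O f) {v : V} (hv : v ∈ K) : 144 ≤ vsum G L O K v ∧
    (deg G v ≠ 2 → 145 ≤ vsum G L O K v ∨ ∃ f w, G.Adj v w ∧ Inc L f v w ∧ w ∈ K ∧ ¬O f ∧ ¬Tri G L f) := by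
  have hB := h.bad
  obtain ⟨f₀, hf₀⟩ := hO
  obtain ⟨p, n, hp, hn, hpn, ap, an, h0, hK⟩ := h.anchor_nbrs hv ⟨f₀, hf₀⟩
  obtain ⟨ip, in'⟩ := h0 f₀ hf₀
  have huniq : ∀ f, O f → f = f₀ := by
    rcases h.outer with ⟨-, hc⟩ | ⟨f₁, -, -, -, -, -, -, hc⟩
    · exact absurd hf₀ (hc f₀)
    · intro f hf; rw [(hc f).mp hf, (hc f₀).mp hf₀]
  have g0 : give G L O K v f₀ = -18 := give_outer hv hf₀
  have hpN : p ∈ Finset.univ.filter (G.Adj v) := by simpa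
  have hnN : n ∈ Finset.univ.filter (G.Adj v) := by simpa
  have hall : ¬∀ f, ¬O f := fun hc => hc f₀ hf₀
  obtain ⟨f₁, n1, i1, -⟩ := h.dual.other_face hB.twoConn ap ip
  obtain ⟨f₂, n2, i2, -⟩ := h.dual.other_face hB.twoConn an in'
  have o1 : ¬O f₁ := fun hc => n1 (huniq _ hc)
  have o2 : ¬O f₂ := fun hc => n2 (huniq _ hc)
  have tp := term_eq (G := G) (O := O) (K := K) ip i1 n1
  have tn := term_eq (G := G) (O := O) (K := K) in' i2 n2
  rw [g0] at tp tn
  have hd2 : 2 ≤ deg G v := by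
    rw [← Finset.card_pair hpn]
    refine Finset.card_le_card fun x hx => ?_
    simp only [Finset.mem_insert, Finset.mem_singleton] at hx
    rcases hx with rfl | rfl <;> assumption
  by_cases h2 : deg G v = 2
  · refine ⟨?_, fun hc => absurd h2 hc⟩
    have g6 : ∀ f, ¬O f → give G L O K v f = -6 := fun f hf => by
      unfold give; rw [if_pos hv, if_neg hall, if_neg hf, if_pos h2]
    rw [g6 _ o1] at tp
    rw [g6 _ o2] at tn
    have := sum_two_ge hpN hnN hpn tp.ge tn.ge fun c _ _ _ => term_ge v c
    rw [show (Finset.univ.filter (G.Adj v)).card = 2 from h2] at this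
    push_cast at this
    unfold vsum
    linarith
  by_cases h3 : deg G v = 3
  · obtain ⟨w, hw, hwp, hwn, hN⟩ := deg_third h3 ap an hpn
    have hwK : w ∉ K := fun hc => (hK w hc hw).elim hwp hwn
    have no2 : ∀ f, f ≠ f₀ → Inc L f v p → ¬Inc L f v n := fun f hf jp jn =>
      (h.dual.two_shared hB.twoConn hf hpn ap an jp jn ip in' w hw).elim hwp hwn
    have third : ∀ f, f ≠ f₀ → Inc L f v p ∨ Inc L f v n → Inc L f v w := by
      rintro f hf (jp | jn)
      · obtain ⟨z, hz, az, iz, -⟩ := h.mate ap jp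
        rcases hN z az with rfl | rfl | rfl
        exacts [absurd rfl hz, absurd iz (no2 f hf jp), iz]
      · obtain ⟨z, hz, az, iz, -⟩ := h.mate an jn
        rcases hN z az with rfl | rfl | rfl
        exacts [absurd jn (no2 f hf iz), absurd rfl hz, iz]
    have j1 := third f₁ n1 (.inl i1)
    have j2 := third f₂ n2 (.inr i2)
    have n12 : f₂ ≠ f₁ := fun e => no2 f₁ n1 i1 (e ▸ i2)
    have tw := term_eq (G := G) (O := O) (K := K) j1 j2 n12
    have gv : ∀ f, ¬O f → give G L O K v f = if Tri G L f then 6 else if At G L O 3 f v then 12 else 9 :=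
      fun f hf => by unfold give; rw [if_pos hv, if_neg hall, if_neg hf, if_neg h2, if_pos h3]
    have one : ∀ e, Inc L e v w → e = f₁ ∨ e = f₂ := fun e he => by
      by_contra hc
      push Not at hc
      exact hc.2 (h.other hw j1 he j2 hc.1 n12)
    have noAt : ¬Tri G L f₁ → ¬Tri G L f₂ → ∀ f, ¬O f → (f = f₁ ∨ f = f₂) → ¬At G L O 3 f v := by
      rintro t1 t2 f hf - ⟨z, hz, iz, ht⟩
      by_cases hzK : z ∈ K
      · exact h.not_toward hv hzK hz hf iz ht
      · obtain ⟨f', -, hi', -, q⟩ := ht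
        rcases hN z hz with rfl | rfl | rfl
        · exact hzK hp
        · exact hzK hn
        · rcases one _ hi' with rfl | rfl
          exacts [t1 q, t2 q]
    have g18 : give G L O K v f₁ + give G L O K v f₂ ≤ 18 := by
      by_cases t1 : Tri G L f₁
      · rw [gv f₁ o1, if_pos t1]; linarith [give_le (G := G) (L := L) (O := O) (K := K) v f₂]
      by_cases t2 : Tri G L f₂
      · rw [gv f₂ o2, if_pos t2]; linarith [give_le (G := G) (L := L) (O := O) (K := K) v f₁]
      · rw [gv f₁ o1, gv f₂ o2, if_neg t1, if_neg t2, if_neg (noAt t1 t2 _ o1 (.inl rfl)),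
          if_neg (noAt t1 t2 _ o2 (.inr rfl))]
        norm_num
    refine ⟨?_, fun _ => .inr ?_⟩
    · have hNe : Finset.univ.filter (G.Adj v) = {p, n, w} := by
        ext z
        simp only [Finset.mem_filter, Finset.mem_univ, true_and, Finset.mem_insert, Finset.mem_singleton]
        exact ⟨hN z, by rintro (rfl | rfl | rfl) <;> assumption⟩
      unfold vsum
      rw [hNe, Finset.sum_insert (by simp [hpn, hwp.symm]), Finset.sum_insert (by simp [hwn.symm]),
        Finset.sum_singleton, tp, tn, tw]
      linarith
    · by_cases t1 : Tri G L f₁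
      · refine ⟨f₂, n, an, i2, hn, o2, fun t2 => ?_⟩
        obtain ⟨q, hq⟩ := t1
        obtain ⟨q', hq'⟩ := t2
        exact hB.short_edge h.dual hq hq' (by norm_num) (by norm_num) n12.symm hw j1 j2
      · exact ⟨f₁, p, ap, i1, hp, o1, t1⟩
  · suffices 145 ≤ vsum G L O K v from ⟨by linarith, fun _ => .inl this⟩
    have b1 : (54 : ℤ) ≤ 48 - give G L O K v (L v p) - give G L O K v (L p v) := by
      rw [tp]; linarith [give_le (G := G) (L := L) (O := O) (K := K) v f₁]
    have b2 : (54 : ℤ) ≤ 48 - give G L O K v (L v n) - give G L O K v (L n v) := by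
      rw [tn]; linarith [give_le (G := G) (L := L) (O := O) (K := K) v f₂]
    have := sum_two_ge hpN hnN hpn b1 b2 fun c _ _ _ => term_ge v c
    have h5 : (4 : ℤ) ≤ (Finset.univ.filter (G.Adj v)).card := by
      have : 4 ≤ deg G v := by omega
      exact_mod_cast this
    unfold vsum
    linarith

end Chg
end

section
open scoped Classical

variable {V F : Type} [Fintype V] {G : SimpleGraph V} {L : V → V → F} {A K : Finset V} {c₀ : V → Bool}
  {O : F → Prop}

theorem FaceNum.sum_val {k : ℕ} {t p b c e H N : ℤ → ℤ} (h : FaceNum k t p b c e H N) :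
    ∑ i ∈ Finset.range k, (24 + LongFace.val t p H i + N i) =
      ∑ i ∈ Finset.range k, (24 + H i + H (i + 1) + N i - (24 * t i + 8 * p i)) := by
  have s1 := LongFace.sum_shift t h.pt (-1)
  have s2 := LongFace.sum_shift p h.pp (-1)
  have s3 := LongFace.sum_shift H h.pH 1
  simp only [LongFace.val, Finset.sum_add_distrib, ← Finset.mul_sum,
    sub_eq_add_neg, Finset.sum_neg_distrib] at *
  linarith

/-- The final charge of the face `f`, plus 144. -/
noncomputable def fsum (G : SimpleGraph V) (L : V → V → F) (O : F → Prop) (K : Finset V) (f : F) : ℤ :=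
  ∑ p ∈ (dts G).filter (fun p => L p.1 p.2 = f),
    gain L (give G L O K) (fun f x y => 2 * pay G L O K f x y) f p.1 p.2

namespace Chg

theorem fsum_eq (h : Chg G L A K c₀ O) {f : F} {k : ℕ} {g : ℤ → V} (hf : FCyc G L f k g) :
    fsum G L O K f = ∑ i ∈ Finset.range k, (24 + give G L O K (g i) f + give G L O K (g (i + 1)) f +
      recv G L O K f (g i) (g (i + 1)) - 2 * pay G L O K f (g i) (g (i + 1))) := by
  unfold fsum
  rw [hf.sum_dts h.dual h.bad.twoConn]
  · refine Finset.sum_congr rfl fun i _ => ?_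
    unfold gain recv
    ring
  · intro a b
    simp only [gain, pay_comm _ a b]
    ring

theorem fsum_val (h : Chg G L A K c₀ O) {f : F} (hO : ¬O f) {k : ℕ} {g : ℤ → V} (hf : FCyc G L f k g) :
    fsum G L O K f = ∑ i ∈ Finset.range k, (24 + LongFace.val
      (fun i => if Toward G L O 3 f (g i) (g (i + 1)) then 1 else 0)
      (fun i => if Toward G L O 5 f (g i) (g (i + 1)) ∧ ¬Spec G L O K f (g i) (g (i + 1)) then 1 else 0)
      (fun i => give G L O K (g i) f) i + recv G L O K f (g i) (g (i + 1))) := by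
  have hN := h.faceNum hO hf
  have e : ∀ i, 2 * pay G L O K f (g i) (g (i + 1)) =
      24 * (if Toward G L O 3 f (g i) (g (i + 1)) then 1 else 0) +
      8 * (if Toward G L O 5 f (g i) (g (i + 1)) ∧ ¬Spec G L O K f (g i) (g (i + 1)) then 1 else 0) := by
    intro i
    have := hN.tp i
    unfold pay
    rw [if_neg hO]
    by_cases h3 : Toward G L O 3 f (g i) (g (i + 1))
    · rw [if_pos h3] at this ⊢
      split_ifs at this ⊢
      all_goals first | (exfalso; omega) | norm_num
    · rw [if_neg h3]
      split_ifs <;> norm_num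
  rw [h.fsum_eq hf, hN.sum_val]
  exact Finset.sum_congr rfl fun i _ => by rw [e]

theorem fsum_inner (h : Chg G L A K c₀ O) {f : F} (hf : f ∈ fcs G L) (hO : ¬O f) : 144 ≤ fsum G L O K f := by
  obtain ⟨a, b, hab, hl⟩ := mem_fcs.mp hf
  obtain ⟨k, g, hg, -⟩ := h.dual.exists_fcyc h.bad.twoConn hab (.inl hl)
  rw [h.fsum_val hO hg]
  exact (h.faceNum hO hg).final

theorem fsum_inner_lt (h : Chg G L A K c₀ O) {f : F} {v w : V} (hv : v ∈ K) (hw : w ∈ K) (ha : G.Adj v w)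
    (hi : Inc L f v w) (hO : ¬O f) (ht : ¬Tri G L f) : 145 ≤ fsum G L O K f := by
  obtain ⟨k, g, hg, g0, g1⟩ := h.dual.exists_fcyc h.bad.twoConn ha hi
  rw [h.fsum_val hO hg]
  refine (h.faceNum hO hg).final_lt (fun e => ht ⟨g, e ▸ hg⟩) ⟨0, ?_, ?_⟩
  · rw [ind_eq_one, g0]; exact hv
  · rw [ind_eq_one, zero_add, g1]; exact hw

theorem fsum_outer (h : Chg G L A K c₀ O) {f : F} (hO : O f) {k : ℕ} {g : ℤ → V} (hf : FCyc G L f k g) :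
    -12 * k ≤ fsum G L O K f := by
  rw [h.fsum_eq hf]
  have : ∀ i ∈ Finset.range k, (-12 : ℤ) ≤ 24 + give G L O K (g i) f + give G L O K (g (i + 1)) f +
      recv G L O K f (g i) (g (i + 1)) - 2 * pay G L O K f (g i) (g (i + 1)) := fun i _ => by
    have ha := hf.cyc.adj i
    obtain ⟨h1, h2⟩ := h.mem_of_outer hO ha (hf.inc i)
    rw [give_outer h1 hO, give_outer h2 hO]
    have := h.recv_nonneg ha (hf.inc i)
    unfold pay
    rw [if_pos hO]
    linarith
  have := Finset.card_nsmul_le_sum _ _ _ this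
  rw [Finset.card_range, nsmul_eq_mul] at this
  linarith

theorem total (h : Chg G L A K c₀ O) :
    ∑ v ∈ A, (vsum G L O K v - 144) + ∑ f ∈ fcs G L, (fsum G L O K f - 144) ≤ -288 :=
  h.dual.total_charge h.bad.twoConn (give G L O K) (fun f x y => 2 * pay G L O K f x y)
    fun f a b => by rw [pay_comm]

theorem exists_anchor_deg (h : Chg G L A K c₀ O) (hO : ∃ f, O f) : ∃ v ∈ K, deg G v ≠ 2 := by
  by_contra hcon
  push Not at hcon
  obtain ⟨v, hv, hvK⟩ := h.bad.exists_internal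
  obtain ⟨u, hu⟩ : ∃ u, u ∈ K := by
    rcases h.outer with ⟨⟨x, rfl⟩, -⟩ | ⟨f₀, k₀, g₀, -, -, hm, -⟩
    exacts [⟨x, by simp⟩, ⟨g₀ 0, (hm _).mpr ⟨0, rfl⟩⟩]
  obtain ⟨w⟩ := h.bad.twoConn.walk (h.bad.sub hu) hv
  refine hvK ?_
  clear hv hvK
  induction w with
  | nil => exact hu
  | cons ha _ ih => exact ih (h.mem_of_deg_two hu hO (hcon _ hu) ha)

theorem false (h : Chg G L A K c₀ O) : False := by
  have ht := h.total
  rcases h.outer with ⟨⟨x, rfl⟩, hO⟩ | ⟨f₀, k₀, g₀, hf₀, hk, hm, hE, hO⟩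
  · have hx : x ∈ A := h.bad.sub (by simp)
    have h1 : 0 ≤ ∑ f ∈ fcs G L, (fsum G L O {x} f - 144) :=
      Finset.sum_nonneg fun f hf => by linarith [h.fsum_inner hf (hO f)]
    have h2 : 0 ≤ ∑ v ∈ A.erase x, (vsum G L O {x} v - 144) := Finset.sum_nonneg fun v hv => by
      rw [Finset.mem_erase] at hv
      linarith [h.vsum_inner hv.2 (by simpa using hv.1)]
    have h3 : 0 ≤ vsum G L O {x} x :=
      Finset.sum_nonneg fun b _ => by linarith [term_ge (G := G) (L := L) (O := O) (K := {x}) x b]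
    rw [← Finset.add_sum_erase _ _ hx] at ht
    linarith
  · have hO₀ : O f₀ := (hO _).mpr rfl
    have hex : ∃ f, O f := ⟨f₀, hO₀⟩
    have hmem : f₀ ∈ fcs G L := mem_fcs_of_inc (hf₀.cyc.adj 0) (hf₀.inc 0)
    have hv : ∀ v ∈ A, 0 ≤ vsum G L O K v - 144 := fun v hv => by
      by_cases hK : v ∈ K
      · linarith [(h.vsum_anchor hex hK).1]
      · linarith [h.vsum_inner hv hK]
    have hfa : ∀ f ∈ (fcs G L).erase f₀, 0 ≤ fsum G L O K f - 144 := fun f hf => by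
      rw [Finset.mem_erase] at hf
      linarith [h.fsum_inner hf.2 (fun hc => hf.1 ((hO _).mp hc))]
    have s1 := Finset.sum_nonneg hv
    have s2 := Finset.sum_nonneg hfa
    have s0 := h.fsum_outer hO₀ hf₀
    rw [← Finset.add_sum_erase _ _ hmem] at ht
    have hk' : (k₀ : ℤ) ≤ 12 := by exact_mod_cast hk
    obtain ⟨v, hvK, hd⟩ := h.exists_anchor_deg hex
    rcases (h.vsum_anchor hex hvK).2 hd with h5 | ⟨f, w, ha, hi, hw, hof, htr⟩
    · have := Finset.single_le_sum hv (h.bad.sub hvK)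
      linarith
    · have := Finset.single_le_sum hfa (Finset.mem_erase.mpr
        ⟨fun e => hof ((hO f).mpr e), mem_fcs_of_inc ha hi⟩)
      linarith [h.fsum_inner_lt hvK hw ha hi hof htr]

end Chg

theorem not_bad (h : Bad G A K c₀) : False := by
  obtain ⟨F, L, hD⟩ := h.nice.1
  rcases h.anch_face hD with hx | ⟨f, k, g, hf, hk, hm, hE⟩
  · exact Chg.false (O := fun _ : F => False) ⟨h, hD, .inl ⟨hx, fun _ => id⟩⟩
  · exact Chg.false (O := fun f' => f' = f) ⟨h, hD, .inr ⟨f, k, g, hf, hk, hm, hE, fun _ => Iff.rfl⟩⟩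

end

section
open scoped Classical

theorem Solvable.of_ih {V : Type} [Fintype V] {G : SimpleGraph V} {A : Finset V} (hG : Nice G)
    (ih : ∀ G' (A' : Finset V), Nice G' → A'.card < A.card → Solvable G' A') : Solvable G A := by
  intro K hKA hK c₀ hc
  suffices main : ∀ K ⊆ A, ((∃ x, K = {x}) ∨ ∃ k g, IsCyc G k g ∧ k ≤ 12 ∧ ∀ v, v ∈ K ↔ ∃ i, g i = v) →
      ∀ c₀ : V → Bool, (∀ a ∈ K, ∀ b ∈ K, G.Adj a b → c₀ a = true → c₀ b = false) →
      ∃ c, (∀ v ∈ K, c v = c₀ v) ∧ Ok G A K c by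
    rcases hK with hK | hK
    · rcases Nat.le_one_iff_eq_zero_or_eq_one.mp hK with h0 | h1
      · rw [Finset.card_eq_zero] at h0
        subst h0
        rcases A.eq_empty_or_nonempty with rfl | ⟨x, hx⟩
        · exact ⟨c₀, by simp, by simp, fun Y hY _ _ hne => absurd (Finset.subset_empty.mp hY) hne.ne_empty⟩
        · obtain ⟨c, h1, h2⟩ := main {x} (by simpa using hx) (.inl ⟨x, rfl⟩) (fun _ => true)
            (fun a ha b hb hab => by
              rw [Finset.mem_singleton] at ha hb
              exact absurd hab (ha ▸ hb ▸ G.loopless.irrefl _))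
          refine ⟨c, by simp, h2.indep, fun Y hY _ hF hne => ?_⟩
          have hxY : x ∉ Y := fun hc => by simpa [h1 x (by simp)] using hF x hc
          obtain ⟨y, hy, hy'⟩ := h2.super Y hY (by simpa using hxY) hF hne
          exact ⟨y, hy, le_trans (Finset.card_le_card (fnb_mono (by simp) y)) hy'⟩
      · exact main K hKA (.inl (Finset.card_eq_one.mp h1)) c₀ hc
    · exact main K hKA (.inr hK) c₀ hc
  clear hc c₀ hK hKA K
  intro K hKA hK c₀ hc
  obtain ⟨H, hHG, hHA, hH, hHK⟩ : ∃ H : SimpleGraph V, H ≤ G ∧ (∀ a b, H.Adj a b → a ∈ A) ∧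
      (∀ a ∈ A, ∀ b ∈ A, G.Adj a b → (a ∈ K ∧ b ∈ K) ∨ H.Adj a b) ∧ ((∃ x, K = {x}) ∨ ∃ k g, IsCyc H k g ∧
        k ≤ 12 ∧ (∀ v, v ∈ K ↔ ∃ i, g i = v) ∧ ∀ a ∈ K, ∀ b ∈ K, H.Adj a b → CEdge g a b) := by
    rcases hK with hx | ⟨k, g, hg, hk, hm⟩
    · exact ⟨res G A, res_le A, fun a b h => h.2.1, fun a ha b hb hab => .inr ⟨hab, ha, hb⟩, .inl hx⟩
    · refine ⟨{ Adj := fun a b => (res G A).Adj a b ∧ (a ∈ K → b ∈ K → CEdge g a b)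
                symm := ⟨fun _ _ h => ⟨h.1.symm, fun h1 h2 => (h.2 h2 h1).symm⟩⟩
                loopless := ⟨fun _ h => (res G A).loopless.irrefl _ h.1⟩ },
        fun a b h => h.1.1, fun a b h => h.1.2.1, fun a ha b hb hab => ?_, .inr ⟨k, g, ⟨hg.three_le,
          fun i => ⟨⟨hg.adj i, hKA ((hm _).mpr ⟨_, rfl⟩), hKA ((hm _).mpr ⟨_, rfl⟩)⟩,
            fun _ _ => ⟨i, .inl ⟨rfl, rfl⟩⟩⟩, hg.eq_iff⟩, hk, hm, fun a ha b hb h => h.2 ha hb⟩⟩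
      by_cases hab' : a ∈ K ∧ b ∈ K
      · exact .inl hab'
      · exact .inr ⟨⟨hab, ha, hb⟩, fun h1 h2 => absurd ⟨h1, h2⟩ hab'⟩
  by_contra hbad
  refine not_bad ⟨hG.mono hHG, ih, hKA, hHA, fun a ha b hb hab => hc a ha b hb (hHG hab), hHK, ?_⟩
  rintro ⟨c, h1, h2⟩
  refine hbad ⟨c, h1, h2.congr_graph (fun a ha b hb hab => ?_) hKA hH⟩
  rw [h1 a ha, h1 b hb]
  exact hc a ha b hb hab

theorem Nice.solvable {V : Type} [Fintype V] {G : SimpleGraph V} (hG : Nice G) (A : Finset V) :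
    Solvable G A := by
  induction h : A.card using Nat.strong_induction_on generalizing G A with
  | _ n ih => exact .of_ih hG fun G' A' h1 h2 => ih _ (h ▸ h2) h1 A' rfl

variable {V : Type} {G : SimpleGraph V}

theorem IsPlanarGraph.comap {W : Type} {f : W → V} (hf : f.Injective) (h : IsPlanarGraph G) :
    IsPlanarGraph (G.comap f) := by
  obtain ⟨vtx, arc, h⟩ := h
  refine ⟨vtx ∘ f, fun a b => arc (f a) (f b), h.vtx_inj.comp hf, fun _ _ h' => h.arc_cont h',
    fun _ _ h' => h.arc_injOn h', fun _ _ h' => h.arc_start h', fun _ _ h' => h.arc_end h',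
    fun _ _ h' => h.arc_symm h', fun _ _ h' w => h.arc_avoids_vtx h' (f w), fun _ _ _ _ h1 h2 hne => ?_⟩
  exact h.arc_disjoint h1 h2 fun e => hne (Sym2.map.injective hf (by simpa using e))

theorem NoCyc.comap {W : Type} {f : W → V} (hf : f.Injective) (h : NoCyc G) : NoCyc (G.comap f) := by
  intro u v p hp huv
  have := h _ _ (p.map (Hom.comap f G)) (hp.map hf) huv
  simpa using this

theorem exists_coloringOn (hp : IsPlanarGraph G) (hc : NoCyc G) (S : Finset V) :
    ∃ c, IFColoringOn G S c := by
  have hi : Function.Injective (Subtype.val : S → V) := Subtype.val_injective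
  have hN : Nice (G.comap (Subtype.val : S → V)) := ⟨hasDual_of_isPlanarGraph (hp.comap hi), hc.comap hi⟩
  obtain ⟨c, -, hok⟩ := hN.solvable Finset.univ ∅ (by simp) (.inl (by simp)) (fun _ => true) (by simp)
  refine ⟨fun v => if h : v ∈ S then c ⟨v, h⟩ else false, fun u v hu hv huv h1 => ?_, fun v w hw hS hF => ?_⟩
  · rw [Finset.mem_coe] at hu hv
    simp only [dif_pos hu] at h1
    simp only [dif_pos hv]
    exact hok.indep ⟨u, hu⟩ (Finset.mem_univ _) ⟨v, hv⟩ (Finset.mem_univ _) huv h1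
  · obtain ⟨y, hy, hy'⟩ := hok.super (Finset.univ.filter fun y => y.1 ∈ w.support) (Finset.subset_univ _)
      (by simp) (fun y hy => by simpa using hF y.1 (by simpa using hy))
      ⟨⟨v, hS v w.start_mem_support⟩, by simp⟩
    have hy : y.1 ∈ w.support := by simpa using hy
    have hr := hw.rotate hy
    have hmem : ∀ x, x ∈ (w.rotate y.1 hy).support → x ∈ w.support ∧ ∃ h : x ∈ S, c ⟨x, h⟩ = false := by
      intro x hx
      rw [Walk.mem_support_rotate_iff] at hx
      have hxS : x ∈ S := hS x hx
      have := hF x hx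
      simp only [dif_pos hxS] at this
      exact ⟨hx, hxS, this⟩
    obtain ⟨s1, h1, m1⟩ := hmem _ (Walk.getVert_mem_support _ 1)
    obtain ⟨s2, h2, m2⟩ := hmem _ (Walk.getVert_mem_support _ _)
    have a1 := Walk.adj_snd hr.not_nil
    have a2 := (Walk.adj_penultimate hr.not_nil).symm
    exact hr.snd_ne_penultimate (Subtype.mk_eq_mk.mp (Finset.card_le_one.mp hy' ⟨_, h1⟩
      (mem_fnb.mpr ⟨by simpa using s1, m1, a1⟩) ⟨_, h2⟩ (mem_fnb.mpr ⟨by simpa using s2, m2, a2⟩)))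

theorem isClosed_coloringOn (S : Set V) : IsClosed {c | IFColoringOn G S c} := by
  have hcl : ∀ (v : V) (b : Bool), IsClosed {c : V → Bool | c v = b} := fun v b =>
    isClosed_eq (continuous_apply v) continuous_const
  have e : {c | IFColoringOn G S c} =
      (⋂ (u) (v) (_ : u ∈ S) (_ : v ∈ S) (_ : G.Adj u v), {c | c u = false} ∪ {c | c v = false}) ∩
      ⋂ (v) (w : G.Walk v v) (_ : w.IsCycle) (_ : ∀ x ∈ w.support, x ∈ S),
        ⋃ x ∈ {x | x ∈ w.support}, {c : V → Bool | c x = true} := by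
    ext c
    simp only [IFColoringOn, Set.mem_ofPred_eq, Set.mem_inter_iff, Set.mem_iInter, Set.mem_union, Set.mem_iUnion,
      not_forall, Bool.not_eq_false, exists_prop, or_iff_not_imp_left]
  rw [e]
  refine .inter ?_ ?_
  · exact isClosed_iInter fun u => isClosed_iInter fun v => isClosed_iInter fun _ => isClosed_iInter fun _ =>
      isClosed_iInter fun _ => (hcl _ _).union (hcl _ _)
  · exact isClosed_iInter fun v => isClosed_iInter fun w => isClosed_iInter fun _ => isClosed_iInter fun _ =>
      (List.finite_toSet w.support).isClosed_biUnion fun x _ => hcl _ _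

theorem ifColorable_of_finite (h : ∀ S : Finset V, ∃ c, IFColoringOn G S c) : IFColorable G := by
  have hmono : ∀ {S T : Finset V}, S ⊆ T → {c | IFColoringOn G T c} ⊆ {c | IFColoringOn G S c} :=
    fun hST c hc => ⟨fun u v hu hv => hc.1 (hST hu) (hST hv), fun v w hw hS => hc.2 v w hw fun x hx => hST (hS x hx)⟩
  obtain ⟨c, hc⟩ := IsCompact.nonempty_iInter_of_directed_nonempty_isCompact_isClosed
    (fun S : Finset V => {c | IFColoringOn G S c})
    (fun S T => ⟨S ∪ T, hmono Finset.subset_union_left, hmono Finset.subset_union_right⟩)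
    h (fun S => (isClosed_coloringOn _).isCompact) fun S => isClosed_coloringOn _
  rw [Set.mem_iInter] at hc
  refine ⟨c, fun u v huv => (hc {u, v}).1 (by simp) (by simp) huv, fun v w hw => ?_⟩
  exact (hc w.support.toFinset).2 v w hw (by simp)

end

/-- Every planar graph without `4`-cycles, without
`6`-cycles, and without `8`-cycles is `(I,F)`-colorable. -/
theorem planar_no_4_6_8_IFColorable {V : Type}
    (G : SimpleGraph V) (hplanar : IsPlanarGraph G)
    (h4 : ∀ (v : V) (w : G.Walk v v), w.IsCycle → w.length ≠ 4)
    (h6 : ∀ (v : V) (w : G.Walk v v), w.IsCycle → w.length ≠ 6)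
    (h8 : ∀ (v : V) (w : G.Walk v v), w.IsCycle → w.length ≠ 8) :
    IFColorable G :=
  ifColorable_of_finite (exists_coloringOn hplanar (noCyc_of_isCycle h4 h6 h8))

end IFPaper
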